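/- Let g ≥ 0 and n ≥ 1 be integers. For an integer m ≥ 1 and a real number Q > 1 define U_m(Q) := m · Σ (−1)^{M−1} · (M−1)! / (∏_λ m_λ!) · ∏_λ ( Q^{−(g−1)⟨λ,λ⟩} · ∏_{boxes of d(λ)} (1 − Q^{h})^{2g−2} )^{m_λ}, where the sum is over all finitely supported functions λ ↦ m_λ ∈ ℤ_{≥0} on the set of nonzero partitions satisfying Σ_λ m_λ·|λ| = m, M := Σ_λ m_λ, and h denotes the hook length of a box. Then for every finite field F_q and every element ζ ∈ F_q^× of multiplicative order exactly n, the number N_n(q) of 2g-tuples (A_1,B_1,…,A_g,B_g) ∈ GL(n,F_q)^{2g} with [A_1,B_1]⋯[A_g,B_g] = ζ·I_n satisfies N_n(q) = (q−1) · |GL(n,F_q)| · q^{(g−1)n²} · (1/n) · Σ_{d | n} μ(d) · U_{n/d}(q^d), where μ is the Möbius function (an identity of rational numbers, with q^{(g−1)n²} interpreted as q raised to the possibly negative integer (g−1)n²). -/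

import Mathlib

open scoped MatrixGroups

namespace Statement11

/-- `colLen p j` is the number of parts of the partition `p` that are `> j`, i.e. the
`(j+1)`-st entry `λ'_{j+1}` of the conjugate partition (the length of column `j` of the
Ferrers diagram, columns indexed from `0`). -/
def colLen {k : ℕ} (p : Nat.Partition k) (j : ℕ) : ℕ :=
  Multiset.card (p.parts.filter (fun a => j < a))

/-- `rowLen p i` is the `(i+1)`-st largest part of `p` (the length of row `i` of the
Ferrers diagram, rows indexed from `0`). -/
def rowLen {k : ℕ} (p : Nat.Partition k) (i : ℕ) : ℕ :=
  ((Finset.range k).filter (fun j => i < colLen p j)).card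

/-- The boxes `(i,j)` (row, column, both `0`-indexed) of the Ferrers diagram of `p`. -/
def boxes {k : ℕ} (p : Nat.Partition k) : Finset (ℕ × ℕ) :=
  (Finset.range k ×ˢ Finset.range k).filter (fun b => b.2 < rowLen p b.1)

/-- Arm length of a box: the number of boxes strictly to its right in its row. -/
def armLength {k : ℕ} (p : Nat.Partition k) (b : ℕ × ℕ) : ℕ :=
  rowLen p b.1 - (b.2 + 1)

/-- Leg length of a box: the number of boxes strictly below it in its column. -/
def legLength {k : ℕ} (p : Nat.Partition k) (b : ℕ × ℕ) : ℕ :=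
  colLen p b.2 - (b.1 + 1)

/-- Hook length `h = a + l + 1` of a box. -/
def hookLength {k : ℕ} (p : Nat.Partition k) (b : ℕ × ℕ) : ℕ :=
  armLength p b + legLength p b + 1

/-- The pairing `⟨λ,λ⟩ = Σ_j (λ'_j)²`. -/
def pairing {k : ℕ} (p : Nat.Partition k) : ℕ :=
  ∑ j ∈ Finset.range k, (colLen p j) ^ 2

open scoped Classical in
/-- The quantity
`U_m(Q) = m · Σ (−1)^{M−1} (M−1)!/(∏_λ m_λ!) · ∏_λ (Q^{−(g−1)⟨λ,λ⟩} ∏_{boxes}(1−Q^h)^{2g−2})^{m_λ}`,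
the sum being over all finitely supported `ℤ_{≥0}`-valued functions `λ ↦ m_λ` on the set
of nonzero partitions with `Σ_λ m_λ·|λ| = m` (encoded as multisets `S` of nonzero
partitions whose sizes sum to `m`, with `m_λ` the multiplicity of `λ` in `S` and
`M = Σ m_λ` the cardinality of `S`). -/
noncomputable def Upoly (g m : ℕ) (Q : ℝ) : ℝ :=
  m * ∑ᶠ (S : Multiset (Σ k : ℕ, Nat.Partition k))
        (_ : (∀ p ∈ S, p.1 ≠ 0) ∧ (S.map Sigma.fst).sum = m),
      (-1 : ℝ) ^ (Multiset.card S - 1) * ((Multiset.card S - 1).factorial : ℝ) /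
          (∏ p ∈ S.toFinset, ((S.count p).factorial : ℝ)) *
        (S.map (fun p =>
            Q ^ (-(((g : ℤ) - 1) * (pairing p.2 : ℤ))) *
              ∏ b ∈ boxes p.2, (1 - Q ^ hookLength p.2 b) ^ (2 * (g : ℤ) - 2))).prod

section P1
/-- Irreducible matrix representations of a finite group over `ℂ`. -/
structure IrrData (G : Type) [Group G] [Fintype G] where
  num : ℕ
  d : Fin num → ℕ
  dpos : ∀ i, 0 < d i
  rep : ∀ i, G →* Matrix (Fin (d i)) (Fin (d i)) ℂ
  surj : ∀ M : ∀ i, Matrix (Fin (d i)) (Fin (d i)) ℂ,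
    ∃ a : G → ℂ, ∀ i, ∑ x, a x • rep i x = M i
  reg : ∀ [DecidableEq G] (x : G), ∑ i, (d i : ℂ) * (rep i x).trace =
    if x = 1 then (Fintype.card G : ℂ) else 0

section irr
open Matrix

lemma trace_lmul_pi {n : ℕ} (d : Fin n → ℕ) (M : ∀ i, Matrix (Fin (d i)) (Fin (d i)) ℂ) :
    LinearMap.trace ℂ (∀ i, Matrix (Fin (d i)) (Fin (d i)) ℂ)
      (LinearMap.mulLeft ℂ M) = ∑ i, (d i : ℂ) * (M i).trace := by
  classical
  rw [LinearMap.trace_eq_matrix_trace ℂ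
    (Pi.basis fun i => Matrix.stdBasis ℂ (Fin (d i)) (Fin (d i)))]
  simp only [Matrix.trace, Matrix.diag_apply, LinearMap.toMatrix_apply]
  rw [Fintype.sum_sigma]
  refine Finset.sum_congr rfl fun i _ => ?_
  rw [Fintype.sum_prod_type, Finset.mul_sum]
  refine Finset.sum_congr rfl fun a _ => ?_
  have h : ∀ b : Fin (d i), (((Pi.basis fun i => Matrix.stdBasis ℂ (Fin (d i)) (Fin (d i))).repr
      ((LinearMap.mulLeft ℂ M) ((Pi.basis fun i => Matrix.stdBasis ℂ (Fin (d i)) (Fin (d i)))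
        ⟨i, (a, b)⟩))) ⟨i, (a, b)⟩) = M i a a := by
    intro b
    rw [Pi.basis_repr, Pi.basis_apply, Matrix.stdBasis_eq_single]
    simp only [LinearMap.mulLeft_apply, Pi.mul_apply, Pi.single_eq_same]
    have h2 := (Matrix.stdBasis ℂ (Fin (d i)) (Fin (d i))).repr_self
    have : ∀ N : Matrix (Fin (d i)) (Fin (d i)) ℂ,
      (Matrix.stdBasis ℂ (Fin (d i)) (Fin (d i))).repr N (a, b) = N a b := by
      intro N
      simp [Matrix.stdBasis]
    rw [this]
    simp
  rw [Finset.sum_congr rfl fun b _ => h b]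
  simp

lemma trace_lmul_group {G : Type} [Group G] [Fintype G] [DecidableEq G] (x : G) :
    LinearMap.trace ℂ (MonoidAlgebra ℂ G)
      (LinearMap.mulLeft ℂ (MonoidAlgebra.of ℂ G x)) =
        if x = 1 then (Fintype.card G : ℂ) else 0 := by
  rw [LinearMap.trace_eq_matrix_trace ℂ (MonoidAlgebra.basis G ℂ)]
  simp only [Matrix.trace, Matrix.diag_apply, LinearMap.toMatrix_apply]
  have : ∀ g : G, ((MonoidAlgebra.basis G ℂ).repr
      ((LinearMap.mulLeft ℂ (MonoidAlgebra.of ℂ G x)) (MonoidAlgebra.basis G ℂ g))) g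
      = if x = 1 then 1 else 0 := by
    intro g
    have h1 : (MonoidAlgebra.basis G ℂ g) = MonoidAlgebra.of ℂ G g := by simp
    rw [LinearMap.mulLeft_apply, h1, ← map_mul]
    have h2 : MonoidAlgebra.of ℂ G (x*g) = MonoidAlgebra.basis G ℂ (x * g) := by simp
    rw [h2, Module.Basis.repr_self, Finsupp.single_apply]
    simp
  simp only [this]
  split_ifs <;> simp

theorem exists_irrData (G : Type) [Group G] [Fintype G] : Nonempty (IrrData G) := by
  classical
  obtain ⟨n, d, hd, ⟨φ⟩⟩ := IsSemisimpleRing.exists_algEquiv_pi_matrix_of_isAlgClosed (F := ℂ)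
    (R := MonoidAlgebra ℂ G)
  refine ⟨⟨n, d, fun i => Nat.pos_of_ne_zero (hd i).out,
    fun i => (Pi.evalMonoidHom (fun i => Matrix (Fin (d i)) (Fin (d i)) ℂ) i).comp
      ((φ.toAlgHom.toRingHom.toMonoidHom).comp (MonoidAlgebra.of ℂ G)), ?_, ?_⟩⟩
  · intro M
    refine ⟨fun x => (φ.symm M).coeff x, fun i => ?_⟩
    have h : φ.symm M = ∑ x, (φ.symm M).coeff x • MonoidAlgebra.of ℂ G x := by
      have := (MonoidAlgebra.basis G ℂ).sum_repr (φ.symm M)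
      conv_lhs => rw [← this]
      refine Finset.sum_congr rfl fun x _ => ?_
      simp [MonoidAlgebra.basis]
    have h3 := congrArg φ h
    rw [φ.apply_symm_apply, map_sum] at h3
    have h4 := congrFun h3 i
    rw [h4, Finset.sum_apply]
    refine Finset.sum_congr rfl fun x _ => ?_
    rw [map_smul]
    rfl
  · intro _ x
    have h1 := trace_lmul_pi d (φ (MonoidAlgebra.of ℂ G x))
    have h2 : LinearMap.mulLeft ℂ (φ (MonoidAlgebra.of ℂ G x)) =
      φ.toLinearEquiv.conj (LinearMap.mulLeft ℂ (MonoidAlgebra.of ℂ G x)) := by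
      refine LinearMap.ext fun y => ?_
      rw [LinearEquiv.conj_apply_apply, LinearMap.mulLeft_apply, LinearMap.mulLeft_apply]
      change _ = φ (_ * φ.symm y)
      rw [map_mul, φ.apply_symm_apply]
    rw [h2, LinearMap.trace_conj', trace_lmul_group] at h1
    rw [h1]
    rfl

variable {G : Type} [Group G] [Fintype G]

namespace IrrData
variable (D : IrrData G)

noncomputable def chi (i : Fin D.num) (x : G) : ℂ := (D.rep i x).trace

lemma chi_one (i : Fin D.num) : D.chi i 1 = D.d i := by simp [chi]

lemma chi_conj (i : Fin D.num) (x y : G) : D.chi i (y * x * y⁻¹) = D.chi i x := by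
  rw [chi, map_mul, Matrix.trace_mul_comm, ← map_mul]; simp [chi]

lemma cardG_ne : (Fintype.card G : ℂ) ≠ 0 := by
  exact_mod_cast Fintype.card_ne_zero

/-- scalars: a matrix commuting with all `rep i x` is scalar -/
lemma scalar_of_comm (i : Fin D.num) (M : Matrix (Fin (D.d i)) (Fin (D.d i)) ℂ)
    (h : ∀ x, D.rep i x * M = M * D.rep i x) : M = (M.trace / D.d i) • 1 := by
  classical
  have hc : ∀ N : Matrix (Fin (D.d i)) (Fin (D.d i)) ℂ, N * M = M * N := by
    intro N
    obtain ⟨a, ha⟩ := D.surj (Function.update 0 i N)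
    have := ha i
    rw [Function.update_self] at this
    rw [← this, Finset.sum_mul, Finset.mul_sum]
    refine Finset.sum_congr rfl fun x _ => ?_
    rw [smul_mul_assoc, mul_smul_comm, h]
  have : M ∈ Set.range (Matrix.scalar (Fin (D.d i))) := by
    apply Matrix.mem_range_scalar_of_commute_single
    intro a b _
    exact hc _
  obtain ⟨c, hc⟩ := this
  have hd : (D.d i : ℂ) ≠ 0 := by exact_mod_cast (D.dpos i).ne'
  have hM : M = c • 1 := by rw [← hc]; ext a b; simp [Matrix.diagonal, Matrix.one_apply]
  have ht : M.trace = c * D.d i := by rw [hM]; simp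
  rw [ht, mul_div_cancel_right₀ _ hd, hM]

/-- Fourier inversion -/
lemma inversion (a : G → ℂ) (y : G) :
    (Fintype.card G : ℂ) * a y =
      ∑ i, (D.d i : ℂ) * ((D.rep i y⁻¹) * ∑ x, a x • D.rep i x).trace := by
  classical
  have : ∀ i, (D.d i : ℂ) * ((D.rep i y⁻¹) * ∑ x, a x • D.rep i x).trace =
      ∑ x, a x * ((D.d i : ℂ) * (D.rep i (y⁻¹ * x)).trace) := by
    intro i
    rw [Finset.mul_sum, Matrix.trace_sum, Finset.mul_sum]
    refine Finset.sum_congr rfl fun x _ => ?_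
    rw [mul_smul_comm, ← map_mul, Matrix.trace_smul, smul_eq_mul]; ring
  simp only [this]
  rw [Finset.sum_comm]
  simp only [← Finset.mul_sum, D.reg]
  rw [Finset.sum_eq_single y]
  · simp [mul_comm]
  · intro b _ hb
    rw [if_neg, mul_zero]
    intro h; apply hb
    rw [inv_mul_eq_one] at h; exact h.symm
  · simp

/-- class function elements act by scalars -/
lemma class_scalar (f : G → ℂ) (hf : ∀ x y, f (y * x * y⁻¹) = f x) (i : Fin D.num) :
    ∑ x, f x • D.rep i x = ((∑ x, f x * D.chi i x) / D.d i) • 1 := by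
  have h := D.scalar_of_comm i (∑ x, f x • D.rep i x) ?_
  · rw [h]
    congr 2
    rw [Matrix.trace_sum]
    refine Finset.sum_congr rfl fun x _ => ?_
    rw [Matrix.trace_smul, smul_eq_mul]; rfl
  · intro y
    rw [Finset.mul_sum, Finset.sum_mul]
    refine Fintype.sum_equiv (MulAut.conj y).toEquiv _ _ fun x => ?_
    simp only [MulEquiv.toEquiv_eq_coe, EquivLike.coe_coe, MulAut.conj_apply, hf]
    rw [mul_smul_comm, smul_mul_assoc, ← map_mul, ← map_mul]
    congr 2
    group

lemma expand (f : G → ℂ) (hf : ∀ x y, f (y * x * y⁻¹) = f x) (y : G) :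
    f y = ∑ i, ((Fintype.card G : ℂ)⁻¹ * ∑ x, f x * D.chi i x⁻¹) * D.chi i y := by
  have h := D.inversion (fun x => f x⁻¹) y⁻¹
  have h2 := fun i => D.class_scalar (fun x => f x⁻¹) (fun x y => by
    rw [← hf x⁻¹ y]; congr 1; group) i
  simp only [h2, inv_inv] at h
  have hG := cardG_ne (G := G)
  rw [← mul_right_inj' hG, h, Finset.mul_sum]
  refine Finset.sum_congr rfl fun i _ => ?_
  have hd : (D.d i : ℂ) ≠ 0 := by exact_mod_cast (D.dpos i).ne'
  have h3 : ∑ x, f x⁻¹ * D.chi i x = ∑ x, f x * D.chi i x⁻¹ :=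
    Fintype.sum_equiv (Equiv.inv G) _ _ (fun x => by simp)
  rw [mul_smul_comm, Matrix.trace_smul, smul_eq_mul, mul_one, h3]
  simp only [chi]
  field_simp

lemma ortho (j k : Fin D.num) :
    (Fintype.card G : ℂ)⁻¹ * ∑ x, D.chi j x * D.chi k x⁻¹ = if j = k then 1 else 0 := by
  classical
  obtain ⟨a, ha⟩ := D.surj (Function.update 0 k ((D.d k : ℂ)⁻¹ • 1))
  have key : ∀ i, ∑ x, a x * D.chi i x = if i = k then 1 else 0 := by
    intro i
    have h := congrArg Matrix.trace (ha i)
    rw [Matrix.trace_sum] at h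
    simp only [Matrix.trace_smul, smul_eq_mul] at h
    rw [show ∑ x, a x * D.chi i x = _ from h]
    split_ifs with hik
    · subst hik
      have hd : (D.d i : ℂ) ≠ 0 := by exact_mod_cast (D.dpos i).ne'
      simp [hd]
    · rw [Function.update_of_ne hik]; simp
  have h := fun y => D.expand (D.chi j) (fun x y => D.chi_conj j x y) y
  have h2 := key j
  rw [← h2]
  conv_rhs => enter [2, x]; rw [h x]
  simp only [Finset.mul_sum]
  conv_rhs => rw [Finset.sum_comm]
  have : ∀ i, ∑ x, a x * ((∑ x', (Fintype.card G : ℂ)⁻¹ * (D.chi j x' * D.chi i x'⁻¹))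
      * D.chi i x) = (∑ x', (Fintype.card G : ℂ)⁻¹ * (D.chi j x' * D.chi i x'⁻¹)) *
        if i = k then 1 else 0 := by
    intro i
    rw [← key i, Finset.mul_sum]
    refine Finset.sum_congr rfl fun x _ => by ring
  simp only [← Finset.mul_sum] at this ⊢
  simp only [this]
  simp

/-- central character -/
noncomputable def omega (i : Fin D.num) (z : G) : ℂ := D.chi i z / D.d i

lemma rep_central (i : Fin D.num) (z : G) (hz : ∀ x, x * z = z * x) :
    D.rep i z = D.omega i z • 1 := by
  exact D.scalar_of_comm i _ fun x => by rw [← map_mul, hz, map_mul]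

lemma chi_central_mul (i : Fin D.num) (z : G) (hz : ∀ x, x * z = z * x) (x : G) :
    D.chi i (z * x) = D.omega i z * D.chi i x := by
  rw [chi, map_mul, D.rep_central i z hz]; simp [chi]

lemma omega_mul (i : Fin D.num) (z z' : G) (hz : ∀ x, x * z = z * x) :
    D.omega i (z * z') = D.omega i z * D.omega i z' := by
  rw [omega, D.chi_central_mul i z hz, omega, omega]; ring

lemma omega_one (i : Fin D.num) : D.omega i 1 = 1 := by
  have hd : (D.d i : ℂ) ≠ 0 := by exact_mod_cast (D.dpos i).ne'
  rw [omega, chi_one, div_self hd]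

/-- Number of solutions of `∏ [a,b] = z`. -/
lemma commutator_elt (i : Fin D.num) :
    ∑ p : G × G, D.rep i (p.1 * p.2 * p.1⁻¹ * p.2⁻¹) =
      (((Fintype.card G : ℂ) / D.d i) ^ 2) • (1 : Matrix (Fin (D.d i)) (Fin (D.d i)) ℂ) := by
  have hd : (D.d i : ℂ) ≠ 0 := by exact_mod_cast (D.dpos i).ne'
  have hG := cardG_ne (G := G)
  -- ∑_a  ρ(a x a⁻¹) = |G| χ(x)/d
  have h1 : ∀ x, ∑ a, D.rep i (a * x * a⁻¹) =
      ((Fintype.card G : ℂ) * D.chi i x / D.d i) • (1 : Matrix (Fin (D.d i)) (Fin (D.d i)) ℂ) := by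
    intro x
    have h := D.scalar_of_comm i (∑ a, D.rep i (a * x * a⁻¹)) ?_
    · rw [h]; congr 2
      rw [Matrix.trace_sum]
      have h3 : ∀ a, (D.rep i (a * x * a⁻¹)).trace = D.chi i x := fun a => D.chi_conj i x a
      simp only [h3]
      simp
    · intro y
      rw [Finset.mul_sum, Finset.sum_mul]
      refine Fintype.sum_equiv (Equiv.mulLeft y) _ _ fun x => ?_
      rw [← map_mul, ← map_mul]
      simp only [Equiv.coe_mulLeft]
      congr 1; group
  rw [Fintype.sum_prod_type, Finset.sum_comm]
  have h2 : ∀ b, ∑ a, D.rep i (a * b * a⁻¹ * b⁻¹) =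
      ((Fintype.card G : ℂ) / D.d i) • (D.chi i b • D.rep i b⁻¹) := by
    intro b
    simp only [fun a => map_mul (D.rep i) (a * b * a⁻¹) b⁻¹]
    rw [← Finset.sum_mul, h1, smul_mul_assoc, one_mul, smul_smul]
    congr 1; ring
  simp only [h2, ← Finset.smul_sum]
  have h3 : ∑ b, D.chi i b • D.rep i b⁻¹ = ∑ b, D.chi i b⁻¹ • D.rep i b :=
    Fintype.sum_equiv (Equiv.inv G) _ _ (fun x => by simp)
  rw [h3, D.class_scalar (fun b => D.chi i b⁻¹) (fun x y => by
    rw [← D.chi_conj i x⁻¹ y]; congr 1; group), smul_smul]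
  have h4 := D.ortho i i
  have h5 : ∑ x, D.chi i x⁻¹ * D.chi i x = Fintype.card G := by
    rw [if_pos rfl, inv_mul_eq_one₀ hG] at h4
    rw [h4]
    exact Finset.sum_congr rfl fun x _ => mul_comm _ _
  rw [h5]; congr 1; ring

lemma commutator_prod (i : Fin D.num) (g : ℕ) :
    ∑ p : (Fin g → G) × (Fin g → G),
      D.rep i ((List.ofFn fun j => p.1 j * p.2 j * (p.1 j)⁻¹ * (p.2 j)⁻¹).prod) =
      (((Fintype.card G : ℂ) / D.d i) ^ (2 * g)) • (1 : Matrix (Fin (D.d i)) (Fin (D.d i)) ℂ) := by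
  induction g with
  | zero => simp
  | succ g ih =>
    have : ∑ p : (Fin (g+1) → G) × (Fin (g+1) → G),
      D.rep i ((List.ofFn fun j => p.1 j * p.2 j * (p.1 j)⁻¹ * (p.2 j)⁻¹).prod) =
      ∑ r : (G × G) × ((Fin g → G) × (Fin g → G)),
        D.rep i (r.1.1 * r.1.2 * r.1.1⁻¹ * r.1.2⁻¹) *
        D.rep i ((List.ofFn fun j => r.2.1 j * r.2.2 j * (r.2.1 j)⁻¹ * (r.2.2 j)⁻¹).prod) := by
      symm
      refine Fintype.sum_equiv ((Equiv.prodProdProdComm G G (Fin g → G) (Fin g → G)).trans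
        (Equiv.prodCongr (Fin.consEquiv fun _ => G) (Fin.consEquiv fun _ => G))) _ _ fun r => ?_
      rw [← map_mul, List.ofFn_succ]
      simp [Fin.consEquiv]
    rw [this, Fintype.sum_prod_type]
    simp only [← Finset.mul_sum, ih]
    rw [← Finset.sum_mul, D.commutator_elt i, smul_mul_smul_comm, one_mul, ← pow_add]
    congr 2; ring

theorem frobenius (g : ℕ) (z : G) :
    (Nat.card {p : (Fin g → G) × (Fin g → G) //
      (List.ofFn fun j => p.1 j * p.2 j * (p.1 j)⁻¹ * (p.2 j)⁻¹).prod = z} : ℂ) =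
    (Fintype.card G : ℂ) * ∑ i, ((Fintype.card G : ℂ) / D.d i) ^ (2 * (g : ℤ) - 2)
      * D.omega i z⁻¹ := by
  classical
  have hG := cardG_ne (G := G)
  have h : (Fintype.card G : ℂ) * (Nat.card {p : (Fin g → G) × (Fin g → G) //
      (List.ofFn fun j => p.1 j * p.2 j * (p.1 j)⁻¹ * (p.2 j)⁻¹).prod = z} : ℂ) =
      ∑ p : (Fin g → G) × (Fin g → G), ∑ i, (D.d i : ℂ) *
        (D.rep i (z⁻¹ * (List.ofFn fun j => p.1 j * p.2 j * (p.1 j)⁻¹ * (p.2 j)⁻¹).prod)).trace := by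
    simp only [D.reg, inv_mul_eq_one]
    rw [Nat.card_eq_fintype_card, Fintype.card_subtype, ← Finset.sum_filter]
    conv_rhs => enter [1, 1, p]; rw [eq_comm]
    simp [mul_comm]
  rw [← mul_right_inj' hG, h, Finset.sum_comm, Finset.mul_sum, Finset.mul_sum]
  refine Finset.sum_congr rfl fun i _ => ?_
  have hd : (D.d i : ℂ) ≠ 0 := by exact_mod_cast (D.dpos i).ne'
  rw [← Finset.mul_sum]
  simp only [map_mul]
  rw [← Matrix.trace_sum, ← Finset.mul_sum, D.commutator_prod i g, mul_smul_comm, mul_one,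
    Matrix.trace_smul, smul_eq_mul]
  rw [zpow_sub₀ (div_ne_zero hG hd)]
  rw [show (2 * (g:ℤ)) = ((2 * g : ℕ) : ℤ) by push_cast; ring, zpow_natCast, omega, chi]
  rw [show ((2 : ℤ)) = ((2 : ℕ) : ℤ) by norm_num, zpow_natCast]
  field_simp

end IrrData

/-- Integrality of the multiplicity of the trivial representation. -/
lemma avg_trace_nat {m : Type} [Fintype m] [DecidableEq m] (σ : G →* Matrix m m ℂ) :
    ∃ k : ℕ, (Fintype.card G : ℂ)⁻¹ * ∑ x, (σ x).trace = k := by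
  set E : Matrix m m ℂ := (Fintype.card G : ℂ)⁻¹ • ∑ x, σ x with hE
  have hG := IrrData.cardG_ne (G := G)
  have h1 : ∀ y, σ y * ∑ x, σ x = ∑ x, σ x := by
    intro y
    rw [Finset.mul_sum]
    exact Fintype.sum_equiv (Equiv.mulLeft y) _ _ fun x => by simp
  have h2 : IsIdempotentElem E := by
    rw [IsIdempotentElem, hE, smul_mul_smul_comm, Finset.sum_mul]
    simp only [h1]
    rw [Finset.sum_const, Finset.card_univ, ← Nat.cast_smul_eq_nsmul ℂ, smul_smul]
    congr 1; field_simp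
  have h3 : IsIdempotentElem (Matrix.toLin' E) := by
    rw [IsIdempotentElem, Module.End.mul_eq_comp, ← Matrix.toLin'_mul, h2]
  have h4 := (LinearMap.IsIdempotentElem.isProj_range _ h3).trace
  rw [Matrix.trace_toLin'_eq] at h4
  refine ⟨_, Eq.trans ?_ h4⟩
  rw [hE, Matrix.trace_smul, Matrix.trace_sum, smul_eq_mul]

end irr
end P1

section P3a
open scoped Classical in
/-- Data abstracting the Zelevinsky Hopf algebra of the groups `GL n`. -/
structure PSH (q : ℝ) (Z : Type) [CommGroup Z] where
  B : Type
  deg : B → ℕ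
  lev : ℕ → Finset B
  mem_lev : ∀ n b, b ∈ lev n ↔ deg b = n
  o : B
  deg_eq_zero : ∀ b, deg b = 0 ↔ b = o
  N : B → B → B → ℕ
  N_deg : ∀ a b c, N a b c ≠ 0 → deg a + deg b = deg c
  N_o_left : ∀ a b, N o a b = if a = b then 1 else 0
  N_o_right : ∀ a b, N a o b = if a = b then 1 else 0
  assoc : ∀ a b c d D, deg d ≤ D →
    ∑ e ∈ (Finset.range (D + 1)).biUnion lev, N a b e * N e c d =
    ∑ e ∈ (Finset.range (D + 1)).biUnion lev, N b c e * N a e d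
  hopf : ∀ a b c d D, deg a + deg b ≤ D →
    ∑ e ∈ (Finset.range (D + 1)).biUnion lev, N a b e * N c d e =
    ∑ i ∈ (Finset.range (D + 1)).biUnion lev, ∑ j ∈ (Finset.range (D + 1)).biUnion lev,
    ∑ k ∈ (Finset.range (D + 1)).biUnion lev, ∑ l ∈ (Finset.range (D + 1)).biUnion lev,
      N i j a * N k l b * (N i k c * N j l d)
  delta : B → ℝ
  delta_pos : ∀ b, 0 < delta b
  delta_o : delta o = 1
  delta_mul : ∀ a b D, deg a + deg b ≤ D →
    ∑ e ∈ (Finset.range (D + 1)).biUnion lev, N a b e * delta e = delta a * delta b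
  c : B → ℕ
  c_le : ∀ b, c b ≤ 1
  c_o : c o = 1
  P5 : ∀ a D, deg a ≤ D → q ^ deg a * delta a =
    ∑ i ∈ (Finset.range (D + 1)).biUnion lev, ∑ j ∈ (Finset.range (D + 1)).biUnion lev,
      N i j a * (c i * delta j)
  om : B → Z →* ℂ
  om_o : ∀ z, om o z = 1
  om_mul : ∀ a b d, N a b d ≠ 0 → ∀ z, om d z = om a z * om b z
  GG_one : ∀ n, 1 ≤ n → ∑ b ∈ lev n, (c b : ℂ) * om b 1 * delta b = 1
  GG : ∀ n, 1 ≤ n → ∀ z, z ≠ 1 → ∑ b ∈ lev n, (c b : ℂ) * om b z * delta b = 0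
  hq : 1 < q

namespace PSH
variable {q : ℝ} {Z : Type} [CommGroup Z] (P : PSH q Z)

open scoped Classical in
/-- Basis elements of degree at most `D`. -/
noncomputable def upto (D : ℕ) : Finset P.B := (Finset.range (D + 1)).biUnion P.lev

lemma mem_upto {D : ℕ} {b : P.B} : b ∈ P.upto D ↔ P.deg b ≤ D := by
  simp [upto, P.mem_lev]

lemma upto_mono {D D' : ℕ} (h : D ≤ D') : P.upto D ⊆ P.upto D' := by
  intro b; rw [mem_upto, mem_upto]; omega

lemma deg_o : P.deg P.o = 0 := (P.deg_eq_zero _).2 rfl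

lemma deg_pos {b : P.B} (h : b ≠ P.o) : 0 < P.deg b :=
  Nat.pos_of_ne_zero fun h' => h ((P.deg_eq_zero b).1 h')

lemma N_eq_zero {a b c : P.B} (h : P.deg a + P.deg b ≠ P.deg c) : P.N a b c = 0 := by
  by_contra h'; exact h (P.N_deg _ _ _ h')

lemma assoc' (a b c d : P.B) (D : ℕ) (h : P.deg d ≤ D) :
    ∑ e ∈ P.upto D, P.N a b e * P.N e c d = ∑ e ∈ P.upto D, P.N b c e * P.N a e d :=
  P.assoc a b c d D h

lemma hopf' (a b c d : P.B) (D : ℕ) (h : P.deg a + P.deg b ≤ D) :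
    ∑ e ∈ P.upto D, P.N a b e * P.N c d e =
    ∑ i ∈ P.upto D, ∑ j ∈ P.upto D, ∑ k ∈ P.upto D, ∑ l ∈ P.upto D,
      P.N i j a * P.N k l b * (P.N i k c * P.N j l d) :=
  P.hopf a b c d D h

/-- Commutativity. -/
theorem N_comm (a b e : P.B) : P.N a b e = P.N b a e := by
  suffices H : ∀ n, ∀ a b, P.deg a + P.deg b = n → ∀ e, P.N a b e = P.N b a e from
    H _ a b rfl e
  intro n
  induction n using Nat.strong_induction_on with
  | _ n ih =>
  intro a b hn e
  by_cases ha : a = P.o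
  · subst ha; rw [P.N_o_left, P.N_o_right]
  by_cases hb : b = P.o
  · subst hb; rw [P.N_o_left, P.N_o_right]
  have ha' := P.deg_pos ha
  have hb' := P.deg_pos hb
  have key : ∀ {i j k l a b : P.B}, P.deg a + P.deg b = n → a ≠ P.o → b ≠ P.o →
      ∀ c d, P.deg c + P.deg d = n → c ≠ P.o → d ≠ P.o →
      P.N i j a * P.N k l b * (P.N i k c * P.N j l d) =
      P.N i j a * P.N k l b * (P.N k i c * P.N l j d) := by
    intro i j k l a b hab ha hb c d hcd hc hd
    by_cases h0 : P.N i j a * P.N k l b = 0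
    · rw [h0]; simp
    have h1 := P.N_deg _ _ _ (left_ne_zero_of_mul h0)
    have h2 := P.N_deg _ _ _ (right_ne_zero_of_mul h0)
    by_cases h3 : P.deg i + P.deg k = P.deg c
    · by_cases h4 : P.deg j + P.deg l = P.deg d
      · rw [ih _ _ i k rfl, ih _ _ j l rfl]
        · have := P.deg_pos hc; omega
        · have := P.deg_pos hd; omega
      · rw [P.N_eq_zero h4, P.N_eq_zero (a := l) (b := j) (by omega)]
        simp
    · rw [P.N_eq_zero h3, P.N_eq_zero (a := k) (b := i) (by omega)]
      simp
  set D := n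
  have A1 := P.hopf' a b a b D (by omega)
  have A2 := P.hopf' a b b a D (by omega)
  have A3 := P.hopf' b a b a D (by omega)
  -- ⟨ab,ba⟩ = ⟨ba,ba⟩ and ⟨ba, ab⟩ = ⟨ab,ab⟩
  have E1 : ∑ e ∈ P.upto D, P.N a b e * P.N b a e = ∑ e ∈ P.upto D, P.N b a e * P.N b a e := by
    rw [A2, A3]
    rw [Finset.sum_congr rfl fun i _ => Finset.sum_comm]
    rw [Finset.sum_comm]
    refine Finset.sum_congr rfl fun i _ => ?_
    rw [Finset.sum_congr rfl fun i _ => Finset.sum_comm]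
    rw [Finset.sum_comm]
    refine Finset.sum_congr rfl fun j _ => ?_
    refine Finset.sum_congr rfl fun k _ => ?_
    refine Finset.sum_congr rfl fun l _ => ?_
    rw [key hn ha hb b a (by omega) hb ha]
    ring
  have A4 := P.hopf' b a a b D (by omega)
  have E2 : ∑ e ∈ P.upto D, P.N b a e * P.N a b e = ∑ e ∈ P.upto D, P.N a b e * P.N a b e := by
    rw [A4, A1]
    rw [Finset.sum_congr rfl fun i _ => Finset.sum_comm]
    rw [Finset.sum_comm]
    refine Finset.sum_congr rfl fun i _ => ?_
    rw [Finset.sum_congr rfl fun i _ => Finset.sum_comm]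
    rw [Finset.sum_comm]
    refine Finset.sum_congr rfl fun j _ => ?_
    refine Finset.sum_congr rfl fun k _ => ?_
    refine Finset.sum_congr rfl fun l _ => ?_
    rw [key (by omega) hb ha a b (by omega) ha hb]
    ring
  have S : ∑ e ∈ P.upto D, ((P.N a b e : ℤ) - P.N b a e) ^ 2 = 0 := by
    have E1' : ∑ e ∈ P.upto D, (P.N a b e : ℤ) * P.N b a e =
      ∑ e ∈ P.upto D, (P.N b a e : ℤ) * P.N b a e := by exact_mod_cast E1
    have E2' : ∑ e ∈ P.upto D, (P.N b a e : ℤ) * P.N a b e =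
      ∑ e ∈ P.upto D, (P.N a b e : ℤ) * P.N a b e := by exact_mod_cast E2
    have : ∀ e, ((P.N a b e : ℤ) - P.N b a e) ^ 2 =
      ((P.N a b e : ℤ) * P.N a b e - P.N b a e * P.N a b e) +
      ((P.N b a e : ℤ) * P.N b a e - P.N a b e * P.N b a e) := by intro e; ring
    simp only [this, Finset.sum_add_distrib, Finset.sum_sub_distrib]
    rw [E1', E2']; ring
  rw [Finset.sum_eq_zero_iff_of_nonneg (fun _ _ => sq_nonneg _)] at S
  by_cases he : P.deg e = n
  · have := S e (P.mem_upto.2 he.le)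
    have h2 : (P.N a b e : ℤ) - P.N b a e = 0 := by simpa using this
    omega
  · rw [P.N_eq_zero (by omega), P.N_eq_zero (by omega)]

/-- The convolution algebra. -/
def Conv (A : Type) : Type := P.B → A

section conv
variable {A : Type} [CommRing A]

instance : AddCommGroup (P.Conv A) := inferInstanceAs (AddCommGroup (P.B → A))

@[ext] lemma Conv.ext {f g : P.Conv A} (h : ∀ b, f b = g b) : f = g := funext h

@[simp] lemma conv_add (f g : P.Conv A) (b : P.B) : (f + g) b = f b + g b := rfl
@[simp] lemma conv_zero (b : P.B) : (0 : P.Conv A) b = 0 := rfl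
@[simp] lemma conv_neg (f : P.Conv A) (b : P.B) : (-f) b = - f b := rfl

noncomputable def convMul (f g : P.Conv A) : P.Conv A := fun d =>
  ∑ a ∈ P.upto (P.deg d), ∑ b ∈ P.upto (P.deg d), (P.N a b d : A) * (f a * g b)

open scoped Classical in
noncomputable def convOne : P.Conv A := fun d => if d = P.o then 1 else 0

lemma convMul_apply (f g : P.Conv A) (d : P.B) (D : ℕ) (h : P.deg d ≤ D) :
    P.convMul f g d = ∑ a ∈ P.upto D, ∑ b ∈ P.upto D, (P.N a b d : A) * (f a * g b) := by
  rw [convMul]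
  have h1 : ∀ a, ∑ b ∈ P.upto (P.deg d), (P.N a b d : A) * (f a * g b) =
      ∑ b ∈ P.upto D, (P.N a b d : A) * (f a * g b) := by
    intro a
    refine Finset.sum_subset (P.upto_mono h) fun b _ hb => ?_
    rw [P.mem_upto] at hb
    rw [P.N_eq_zero (by omega)]; simp
  rw [Finset.sum_congr rfl fun a _ => h1 a]
  refine Finset.sum_subset (P.upto_mono h) fun a _ ha => ?_
  rw [P.mem_upto] at ha
  refine Finset.sum_eq_zero fun b _ => ?_
  rw [P.N_eq_zero (by omega)]; simp

lemma convMul_comm (f g : P.Conv A) : P.convMul f g = P.convMul g f := by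
  funext d
  rw [convMul, convMul, Finset.sum_comm]
  refine Finset.sum_congr rfl fun a _ => Finset.sum_congr rfl fun b _ => ?_
  rw [P.N_comm]; ring

lemma convMul_assoc (f g h : P.Conv A) :
    P.convMul (P.convMul f g) h = P.convMul f (P.convMul g h) := by
  funext d
  set D := P.deg d
  rw [P.convMul_apply _ _ d D le_rfl, P.convMul_apply _ _ d D le_rfl]
  have e1 : ∀ e ∈ P.upto D, ∀ c, (P.N e c d : A) * (P.convMul f g e * h c) =
     ∑ a ∈ P.upto D, ∑ b ∈ P.upto D, ((P.N a b e * P.N e c d : ℕ) : A) * (f a * g b * h c) := by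
    intro e he c
    rw [P.convMul_apply _ _ e D (P.mem_upto.1 he), Finset.sum_mul, Finset.mul_sum]
    refine Finset.sum_congr rfl fun a _ => ?_
    rw [Finset.sum_mul, Finset.mul_sum]
    refine Finset.sum_congr rfl fun b _ => ?_
    push_cast; ring
  have e2 : ∀ e ∈ P.upto D, ∀ a, (P.N a e d : A) * (f a * P.convMul g h e) =
     ∑ b ∈ P.upto D, ∑ c ∈ P.upto D, ((P.N b c e * P.N a e d : ℕ) : A) * (f a * g b * h c) := by
    intro e he a
    rw [P.convMul_apply _ _ e D (P.mem_upto.1 he), Finset.mul_sum, Finset.mul_sum]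
    refine Finset.sum_congr rfl fun b _ => ?_
    rw [Finset.mul_sum, Finset.mul_sum]
    refine Finset.sum_congr rfl fun c _ => ?_
    push_cast; ring
  rw [Finset.sum_congr rfl fun e he => Finset.sum_congr rfl fun c _ => e1 e he c]
  rw [Finset.sum_congr rfl fun a _ => Finset.sum_congr rfl fun e he => e2 e he a]
  -- LHS: ∑e ∑c ∑a ∑b ; RHS : ∑a ∑e ∑b ∑c
  have L : ∑ e ∈ P.upto D, ∑ c ∈ P.upto D, ∑ a ∈ P.upto D, ∑ b ∈ P.upto D,
      ((P.N a b e * P.N e c d : ℕ) : A) * (f a * g b * h c) =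
      ∑ a ∈ P.upto D, ∑ b ∈ P.upto D, ∑ c ∈ P.upto D,
        ((∑ e ∈ P.upto D, P.N a b e * P.N e c d : ℕ) : A) * (f a * g b * h c) := by
    simp only [Nat.cast_sum, Finset.sum_mul]
    rw [Finset.sum_congr rfl fun e _ => Finset.sum_comm]
    rw [Finset.sum_comm]
    refine Finset.sum_congr rfl fun a _ => ?_
    rw [Finset.sum_congr rfl fun e _ => Finset.sum_comm]
    rw [Finset.sum_comm]
    refine Finset.sum_congr rfl fun b _ => ?_
    rw [Finset.sum_comm]
  have Rr : ∑ a ∈ P.upto D, ∑ e ∈ P.upto D, ∑ b ∈ P.upto D, ∑ c ∈ P.upto D,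
      ((P.N b c e * P.N a e d : ℕ) : A) * (f a * g b * h c) =
      ∑ a ∈ P.upto D, ∑ b ∈ P.upto D, ∑ c ∈ P.upto D,
        ((∑ e ∈ P.upto D, P.N b c e * P.N a e d : ℕ) : A) * (f a * g b * h c) := by
    simp only [Nat.cast_sum, Finset.sum_mul]
    refine Finset.sum_congr rfl fun a _ => ?_
    rw [Finset.sum_comm]
    refine Finset.sum_congr rfl fun b _ => ?_
    rw [Finset.sum_comm]
  rw [L, Rr]
  refine Finset.sum_congr rfl fun a _ => Finset.sum_congr rfl fun b _ =>
    Finset.sum_congr rfl fun c _ => ?_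
  rw [P.assoc' a b c d D le_rfl]

lemma convOne_mul (f : P.Conv A) : P.convMul P.convOne f = f := by
  classical
  funext d
  rw [convMul, Finset.sum_eq_single P.o]
  · rw [Finset.sum_eq_single d]
    · simp [convOne, P.N_o_left]
    · intro b _ hb; simp [P.N_o_left, hb]
    · intro h; exact absurd (P.mem_upto.2 le_rfl) h
  · intro a _ ha; simp [convOne, ha]
  · intro h; exact absurd (P.mem_upto.2 (by rw [P.deg_o]; omega)) h

noncomputable instance : CommRing (P.Conv A) :=
  { (inferInstance : AddCommGroup (P.Conv A)) with
    mul := P.convMul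
    one := P.convOne
    mul_assoc := P.convMul_assoc
    mul_comm := P.convMul_comm
    one_mul := P.convOne_mul
    mul_one := fun f => by
      change P.convMul f P.convOne = f
      rw [P.convMul_comm, P.convOne_mul]
    left_distrib := fun f g h => by
      funext d
      change P.convMul f (g + h) d = P.convMul f g d + P.convMul f h d
      simp [convMul, mul_add, Finset.sum_add_distrib]
    right_distrib := fun f g h => by
      funext d
      change P.convMul (f + g) h d = P.convMul f h d + P.convMul g h d
      simp [convMul, mul_add, add_mul, Finset.sum_add_distrib]
    zero_mul := fun f => by
      funext d
      change P.convMul 0 f d = 0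
      simp [convMul]
    mul_zero := fun f => by
      funext d
      change P.convMul f 0 d = 0
      simp [convMul] }

lemma mul_apply (f g : P.Conv A) (d : P.B) (D : ℕ) (h : P.deg d ≤ D) :
    (f * g) d = ∑ a ∈ P.upto D, ∑ b ∈ P.upto D, (P.N a b d : A) * (f a * g b) :=
  P.convMul_apply f g d D h

open scoped Classical in
lemma one_apply (d : P.B) : (1 : P.Conv A) d = if d = P.o then 1 else 0 := rfl

/-- Multiplicative elements. -/
def IsMult (X : P.Conv A) : Prop :=
  X P.o = 1 ∧ ∀ a b D, P.deg a + P.deg b ≤ D →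
    ∑ e ∈ P.upto D, (P.N a b e : A) * X e = X a * X b

lemma IsMult.one : P.IsMult (1 : P.Conv A) := by
  classical
  refine ⟨by simp [one_apply], fun a b D h => ?_⟩
  simp only [one_apply, mul_ite, mul_one, mul_zero]
  rw [Finset.sum_ite_eq' , if_pos (P.mem_upto.2 (by rw [P.deg_o]; omega))]
  by_cases ha : a = P.o
  · subst ha; simp [P.N_o_left]
  · rw [P.N_eq_zero (by have := P.deg_pos ha; rw [P.deg_o]; omega)]; simp [ha]

lemma conv_hopf (X Y : P.Conv A) (a b : P.B) (D : ℕ) (h : P.deg a + P.deg b ≤ D) :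
    ∑ e ∈ P.upto D, (P.N a b e : A) * (X * Y) e =
      ∑ i ∈ P.upto D, ∑ j ∈ P.upto D, ∑ k ∈ P.upto D, ∑ l ∈ P.upto D,
        ((P.N i j a : A) * P.N k l b) * ((∑ c ∈ P.upto D, (P.N i k c : A) * X c) *
          (∑ d ∈ P.upto D, (P.N j l d : A) * Y d)) := by
  have e1 : ∀ e ∈ P.upto D, (P.N a b e : A) * (X * Y) e =
      ∑ c ∈ P.upto D, ∑ d ∈ P.upto D, ((P.N a b e * P.N c d e : ℕ) : A) * (X c * Y d) := by
    intro e he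
    rw [P.mul_apply X Y e D (P.mem_upto.1 he), Finset.mul_sum]
    refine Finset.sum_congr rfl fun c _ => ?_
    rw [Finset.mul_sum]
    refine Finset.sum_congr rfl fun d _ => ?_
    push_cast; ring
  rw [Finset.sum_congr rfl e1, Finset.sum_comm,
    Finset.sum_congr rfl fun c _ => Finset.sum_comm]
  simp only [← Finset.sum_mul, ← Nat.cast_sum]
  simp only [P.hopf' a b _ _ D h]
  simp only [Nat.cast_sum, Finset.sum_mul]
  -- ∑c ∑d ∑i ∑j ∑k ∑l
  rw [Finset.sum_congr rfl fun c _ => Finset.sum_comm]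
  rw [Finset.sum_comm]
  refine Finset.sum_congr rfl fun i _ => ?_
  rw [Finset.sum_congr rfl fun c _ => Finset.sum_congr rfl fun d _ => rfl]
  rw [Finset.sum_congr rfl fun c _ => Finset.sum_comm]
  rw [Finset.sum_comm]
  refine Finset.sum_congr rfl fun j _ => ?_
  rw [Finset.sum_congr rfl fun c _ => Finset.sum_comm]
  rw [Finset.sum_comm]
  refine Finset.sum_congr rfl fun k _ => ?_
  rw [Finset.sum_congr rfl fun c _ => Finset.sum_comm]
  rw [Finset.sum_comm]
  refine Finset.sum_congr rfl fun l _ => ?_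
  rw [Finset.mul_sum]
  refine Finset.sum_congr rfl fun c _ => ?_
  rw [Finset.mul_sum, Finset.mul_sum]
  refine Finset.sum_congr rfl fun d _ => ?_
  push_cast; ring

lemma IsMult.mul {X Y : P.Conv A} (hX : P.IsMult X) (hY : P.IsMult Y) : P.IsMult (X * Y) := by
  classical
  constructor
  · rw [P.mul_apply X Y P.o 0 P.deg_o.le, Finset.sum_eq_single P.o, Finset.sum_eq_single P.o]
    · simp [P.N_o_left, hX.1, hY.1]
    · intro b hb hb'
      simp [P.N_o_left, hb']
    · intro h; exact absurd (P.mem_upto.2 P.deg_o.le) h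
    · intro b hb hb'
      refine absurd ?_ hb'
      rw [P.mem_upto] at hb
      exact (P.deg_eq_zero b).1 (by omega)
    · intro h; exact absurd (P.mem_upto.2 P.deg_o.le) h
  intro a b D h
  rw [P.conv_hopf X Y a b D h, P.mul_apply X Y a D (by omega), P.mul_apply X Y b D (by omega), Finset.sum_mul]
  refine Finset.sum_congr rfl fun i _ => ?_
  rw [Finset.sum_mul]
  refine Finset.sum_congr rfl fun j _ => ?_
  rw [Finset.mul_sum]
  refine Finset.sum_congr rfl fun k _ => ?_
  rw [Finset.mul_sum]
  refine Finset.sum_congr rfl fun l _ => ?_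
  by_cases h1 : P.N i j a = 0
  · simp [h1]
  by_cases h2 : P.N k l b = 0
  · simp [h2]
  have h3 := P.N_deg _ _ _ h1
  have h4 := P.N_deg _ _ _ h2
  rw [hX.2 i k D (by omega), hY.2 j l D (by omega)]
  ring

end conv
end PSH
end P3a

section P3b
namespace PSH
variable {q : ℝ} {Z : Type} [CommGroup Z] (P : PSH q Z)

/-- `delta` as an element of the convolution ring -/
def dR : P.Conv ℝ := fun b => P.delta b

/-- `q ^ deg * delta` as an element of the convolution ring -/
def qdR : P.Conv ℝ := fun b => q ^ P.deg b * P.delta b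

lemma dR_apply (b : P.B) : P.dR b = P.delta b := rfl
lemma qdR_apply (b : P.B) : P.qdR b = q ^ P.deg b * P.delta b := rfl

lemma delta_isMult : P.IsMult P.dR :=
  ⟨P.delta_o, fun a b D h => P.delta_mul a b D h⟩

lemma qdelta_isMult : P.IsMult P.qdR := by
  refine ⟨by simp [qdR_apply, P.deg_o, P.delta_o], fun a b D h => ?_⟩
  simp only [qdR_apply]
  have := P.delta_mul a b D h
  have h2 : ∀ e, (P.N a b e : ℝ) * (q ^ P.deg e * P.delta e) =
      q ^ (P.deg a + P.deg b) * (P.N a b e * P.delta e) := by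
    intro e
    by_cases h0 : P.N a b e = 0
    · simp [h0]
    · rw [P.N_deg _ _ _ h0]; ring
  simp only [h2, ← Finset.mul_sum]
  rw [show ∑ e ∈ P.upto D, (P.N a b e : ℝ) * P.delta e = _ from this, pow_add]; ring

/-- the Whittaker functional as real valued -/
def cR : P.Conv ℝ := fun b => (P.c b : ℝ)

lemma cR_mul_delta : P.cR * P.dR = P.qdR := by
  funext b
  rw [P.mul_apply _ _ b _ le_rfl, qdR_apply, P.P5 b _ le_rfl]
  rfl

lemma cR_isMult : P.IsMult P.cR := by
  classical
  refine ⟨by simp [cR, P.c_o], ?_⟩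
  suffices H : ∀ n, ∀ a b, P.deg a + P.deg b = n → ∀ D, n ≤ D →
      ∑ e ∈ P.upto D, (P.N a b e : ℝ) * P.cR e = P.cR a * P.cR b from
    fun a b D h => H _ a b rfl D h
  intro n
  induction n using Nat.strong_induction_on with
  | _ n ih =>
  intro a b hab D hD
  have h1 := (P.qdelta_isMult).2 a b D (by omega)
  rw [← P.cR_mul_delta, P.conv_hopf _ _ a b D (by omega), P.mul_apply _ _ a D (by omega),
    P.mul_apply _ _ b D (by omega)] at h1
  have h2 : (∑ a_1 ∈ P.upto D, ∑ b ∈ P.upto D, (P.N a_1 b a : ℝ) * (P.cR a_1 * P.dR b)) *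
      ∑ a ∈ P.upto D, ∑ b_1 ∈ P.upto D, (P.N a b_1 b : ℝ) * (P.cR a * P.dR b_1) =
      ∑ i ∈ P.upto D, ∑ j ∈ P.upto D, ∑ k ∈ P.upto D, ∑ l ∈ P.upto D,
        ((P.N i j a : ℝ) * P.N k l b) * ((P.cR i * P.cR k) * (P.dR j * P.dR l)) := by
    rw [Finset.sum_mul]
    refine Finset.sum_congr rfl fun i _ => ?_
    rw [Finset.sum_mul]
    refine Finset.sum_congr rfl fun j _ => ?_
    rw [Finset.mul_sum]
    refine Finset.sum_congr rfl fun k _ => ?_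
    rw [Finset.mul_sum]
    refine Finset.sum_congr rfl fun l _ => ?_
    ring
  rw [h2, ← sub_eq_zero] at h1
  simp only [← Finset.sum_sub_distrib] at h1
  have hz : ∀ i j k l, ((P.N i j a : ℝ) * P.N k l b) * ((∑ c ∈ P.upto D, (P.N i k c : ℝ) * P.cR c) *
          (∑ d ∈ P.upto D, (P.N j l d : ℝ) * P.dR d)) -
        ((P.N i j a : ℝ) * P.N k l b) * ((P.cR i * P.cR k) * (P.dR j * P.dR l)) =
      if i = a ∧ j = P.o ∧ k = b ∧ l = P.o then
        (∑ c ∈ P.upto D, (P.N a b c : ℝ) * P.cR c) - P.cR a * P.cR b else 0 := by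
    intro i j k l
    by_cases h0 : P.N i j a = 0
    · rw [h0]
      rw [if_neg]
      · simp
      · rintro ⟨rfl, rfl, -⟩
        rw [P.N_o_right] at h0; simp at h0
    by_cases h0' : P.N k l b = 0
    · rw [h0']
      rw [if_neg]
      · simp
      · rintro ⟨-, -, rfl, rfl⟩
        rw [P.N_o_right] at h0'; simp at h0'
    have d1 := P.N_deg _ _ _ h0
    have d2 := P.N_deg _ _ _ h0'
    rw [P.delta_isMult.2 j l D (by omega)]
    by_cases hj : j = P.o
    · by_cases hl : l = P.o
      · subst hj; subst hl
        rw [P.N_o_right] at h0 h0'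
        have h0 : i = a := by by_contra h; simp [h] at h0
        have h0' : k = b := by by_contra h; simp [h] at h0'
        subst h0; subst h0'
        simp [P.N_o_right, dR_apply, P.delta_o]
      · rw [if_neg (by tauto), ih _ _ i k rfl D (by omega), sub_self]
        have := P.deg_pos hl; omega
    · rw [if_neg (by tauto), ih _ _ i k rfl D (by omega), sub_self]
      have := P.deg_pos hj; omega
  simp only [hz] at h1
  have ho : P.o ∈ P.upto D := P.mem_upto.2 (by rw [P.deg_o]; omega)
  rw [Finset.sum_eq_single_of_mem a (P.mem_upto.2 (by omega)),
    Finset.sum_eq_single_of_mem P.o ho,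
    Finset.sum_eq_single_of_mem b (P.mem_upto.2 (by omega)),
    Finset.sum_eq_single_of_mem P.o ho, if_pos ⟨rfl, rfl, rfl, rfl⟩] at h1
  · linarith
  · intro x _ hx; rw [if_neg (by tauto)]
  · intro x _ hx; refine Finset.sum_eq_zero fun y _ => ?_; rw [if_neg (by tauto)]
  · intro x _ hx; refine Finset.sum_eq_zero fun y _ => Finset.sum_eq_zero fun y' _ => ?_
    rw [if_neg (by tauto)]
  · intro x _ hx
    refine Finset.sum_eq_zero fun y _ => Finset.sum_eq_zero fun y' _ =>
      Finset.sum_eq_zero fun y'' _ => ?_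
    rw [if_neg (by tauto)]

lemma c_mul (a b : P.B) (D : ℕ) (h : P.deg a + P.deg b ≤ D) :
    ∑ e ∈ P.upto D, P.N a b e * P.c e = P.c a * P.c b := by
  have := P.cR_isMult.2 a b D h
  simp only [cR] at this
  exact_mod_cast this

/-- The subring of elements of bounded degree. -/
noncomputable def Rb : Subring (P.Conv ℤ) where
  carrier := {x | ∃ D, ∀ b, D < P.deg b → x b = 0}
  mul_mem' := by
    rintro x y ⟨D, hx⟩ ⟨E, hy⟩
    refine ⟨D + E, fun b hb => ?_⟩
    rw [P.mul_apply x y b _ le_rfl]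
    refine Finset.sum_eq_zero fun i _ => Finset.sum_eq_zero fun j _ => ?_
    by_cases h0 : P.N i j b = 0
    · simp [h0]
    have := P.N_deg _ _ _ h0
    by_cases hi : D < P.deg i
    · simp [hx i hi]
    · rw [hy j (by omega)]; simp
  one_mem' := ⟨0, fun b hb => by
    classical
    rw [P.one_apply, if_neg]
    rintro rfl
    rw [P.deg_o] at hb; omega⟩
  add_mem' := by
    rintro x y ⟨D, hx⟩ ⟨E, hy⟩
    exact ⟨max D E, fun b hb => by
      rw [P.conv_add, hx b (by omega), hy b (by omega), add_zero]⟩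
  zero_mem' := ⟨0, fun _ _ => rfl⟩
  neg_mem' := by
    rintro x ⟨D, hx⟩
    exact ⟨D, fun b hb => by rw [P.conv_neg, hx b hb, neg_zero]⟩

/-- a degree bound -/
noncomputable def bd (x : P.Rb) : ℕ := x.2.choose

lemma bd_spec (x : P.Rb) (b : P.B) (h : P.bd x < P.deg b) : x.1 b = 0 := x.2.choose_spec b h

section ev
variable {A : Type} [CommRing A]

noncomputable def evFun (X : P.Conv A) (x : P.Rb) : A := ∑ b ∈ P.upto (P.bd x), (x.1 b : A) * X b

lemma evFun_eq (X : P.Conv A) (x : P.Rb) (D : ℕ) (h : ∀ b, D < P.deg b → x.1 b = 0) :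
    P.evFun X x = ∑ b ∈ P.upto D, (x.1 b : A) * X b := by
  have key : ∀ D D', (∀ b, D < P.deg b → x.1 b = 0) → (∀ b, D' < P.deg b → x.1 b = 0) → D ≤ D' →
    ∑ b ∈ P.upto D, (x.1 b : A) * X b = ∑ b ∈ P.upto D', (x.1 b : A) * X b := by
    intro D D' h h' hD
    refine Finset.sum_subset (P.upto_mono hD) fun b _ hb => ?_
    rw [P.mem_upto] at hb
    rw [h b (by omega)]; simp
  rcases le_total D (P.bd x) with hD | hD
  · exact (key _ _ h (P.bd_spec x) hD).symm
  · exact key _ _ (P.bd_spec x) h hD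

/-- Evaluation of a multiplicative functional. -/
noncomputable def ev (X : P.Conv A) (hX : P.IsMult X) : P.Rb →+* A where
  toFun := P.evFun X
  map_one' := by
    classical
    rw [P.evFun_eq X 1 0 (fun b hb => ?_)]
    · rw [Finset.sum_eq_single_of_mem P.o (P.mem_upto.2 P.deg_o.le)]
      · rw [hX.1]; simp [P.one_apply]
      · intro b _ hb; simp [P.one_apply, hb]
    · change (1 : P.Conv ℤ) b = 0
      rw [P.one_apply, if_neg]
      rintro rfl
      rw [P.deg_o] at hb; omega
  map_mul' := by
    intro x y
    set D := P.bd x + P.bd y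
    have hx : ∀ b, D < P.deg b → x.1 b = 0 := fun b hb => P.bd_spec x b (by omega)
    have hy : ∀ b, D < P.deg b → y.1 b = 0 := fun b hb => P.bd_spec y b (by omega)
    have hxy : ∀ b, D < P.deg b → (x * y).1 b = 0 := by
      intro b hb
      change (x.1 * y.1) b = 0
      rw [P.mul_apply _ _ b _ le_rfl]
      refine Finset.sum_eq_zero fun i _ => Finset.sum_eq_zero fun j _ => ?_
      by_cases h0 : P.N i j b = 0
      · simp [h0]
      have := P.N_deg _ _ _ h0
      by_cases hi : P.bd x < P.deg i
      · simp [P.bd_spec x i hi]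
      · rw [P.bd_spec y j (by omega)]; simp
    rw [P.evFun_eq X _ D hxy, P.evFun_eq X _ D hx, P.evFun_eq X _ D hy, Finset.sum_mul_sum]
    have e1 : ∀ e ∈ P.upto D, (((x * y).1 e : ℤ) : A) * X e =
        ∑ a ∈ P.upto D, ∑ b ∈ P.upto D, ((x.1 a : A) * y.1 b) * ((P.N a b e : A) * X e) := by
      intro e he
      rw [show (x * y).1 e = (x.1 * y.1) e from rfl, P.mul_apply _ _ e D (P.mem_upto.1 he)]
      push_cast
      rw [Finset.sum_mul]
      refine Finset.sum_congr rfl fun a _ => ?_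
      rw [Finset.sum_mul]
      refine Finset.sum_congr rfl fun b _ => ?_
      ring
    rw [Finset.sum_congr rfl e1, Finset.sum_comm]
    refine Finset.sum_congr rfl fun a _ => ?_
    rw [Finset.sum_comm]
    refine Finset.sum_congr rfl fun b _ => ?_
    rw [← Finset.mul_sum]
    by_cases ha : P.bd x < P.deg a
    · rw [P.bd_spec x a ha]; simp
    by_cases hb : P.bd y < P.deg b
    · rw [P.bd_spec y b hb]; simp
    rw [hX.2 a b D (by omega)]
    ring
  map_zero' := by simp [evFun]
  map_add' := by
    intro x y
    set D := P.bd x + P.bd y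
    have hx : ∀ b, D < P.deg b → x.1 b = 0 := fun b hb => P.bd_spec x b (by omega)
    have hy : ∀ b, D < P.deg b → y.1 b = 0 := fun b hb => P.bd_spec y b (by omega)
    have hxy : ∀ b, D < P.deg b → (x + y).1 b = 0 := fun b hb => by
      change x.1 b + y.1 b = 0
      rw [hx b hb, hy b hb, add_zero]
    rw [P.evFun_eq X _ D hxy, P.evFun_eq X _ D hx, P.evFun_eq X _ D hy, ← Finset.sum_add_distrib]
    refine Finset.sum_congr rfl fun a _ => ?_
    rw [show (x + y).1 a = x.1 a + y.1 a from rfl]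
    push_cast; ring

lemma ev_eq (X : P.Conv A) (hX : P.IsMult X) (x : P.Rb) (D : ℕ)
    (h : ∀ b, D < P.deg b → x.1 b = 0) :
    P.ev X hX x = ∑ b ∈ P.upto D, (x.1 b : A) * X b := P.evFun_eq X x D h

end ev

open scoped Classical in
/-- basis element -/
noncomputable def sg (a : P.B) : P.Rb :=
  ⟨fun b => if b = a then 1 else 0, P.deg a, fun b hb => by
    change (if b = a then (1:ℤ) else 0) = 0
    rw [if_neg]; rintro rfl; omega⟩

open scoped Classical in
lemma sg_apply (a b : P.B) : (P.sg a).1 b = if b = a then 1 else 0 := rfl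

lemma ev_sg {A : Type} [CommRing A] (X : P.Conv A) (hX : P.IsMult X) (a : P.B) :
    P.ev X hX (P.sg a) = X a := by
  classical
  rw [P.ev_eq X hX _ (P.deg a) (fun b hb => by rw [sg_apply, if_neg]; rintro rfl; omega)]
  simp only [sg_apply]
  rw [Finset.sum_eq_single_of_mem a (P.mem_upto.2 le_rfl)]
  · simp
  · intro b _ hb; simp [hb]

lemma sg_o : P.sg P.o = 1 := by
  classical
  apply Subtype.ext; funext b
  rw [sg_apply]; exact (P.one_apply b).symm

lemma sg_mul_apply (a b d : P.B) : (P.sg a * P.sg b).1 d = P.N a b d := by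
  classical
  rw [show (P.sg a * P.sg b).1 = (P.sg a).1 * (P.sg b).1 from rfl,
    P.mul_apply _ _ d (P.deg d + P.deg a + P.deg b) (by omega),
    Finset.sum_eq_single_of_mem a (P.mem_upto.2 (by omega)),
    Finset.sum_eq_single_of_mem b (P.mem_upto.2 (by omega))]
  · simp [sg_apply]
  · intro y _ hy; simp [sg_apply, hy]
  · intro y _ hy; simp [sg_apply, hy]

lemma sg_mul_apply' (a : P.B) (x : P.Rb) (d : P.B) (D : ℕ) (hD : P.deg d ≤ D) :
    (P.sg a * x).1 d = ∑ b ∈ P.upto D, P.N a b d * x.1 b := by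
  classical
  rw [show (P.sg a * x).1 = (P.sg a).1 * x.1 from rfl,
    P.mul_apply _ _ d (D + P.deg a) (by omega),
    Finset.sum_eq_single_of_mem a (P.mem_upto.2 (by omega))]
  · simp only [sg_apply, if_true, one_mul]
    symm
    refine Finset.sum_subset (P.upto_mono (by omega)) fun b _ hb => ?_
    rw [P.mem_upto] at hb
    rw [P.N_eq_zero (by omega)]; simp
  · intro y _ hy; simp [sg_apply, hy]

/-- cuspidal elements -/
def Cusp (ρ : P.B) : Prop := ρ ≠ P.o ∧ ∀ i j, P.N i j ρ ≠ 0 → i = P.o ∨ j = P.o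

/-- the skewing operator -/
noncomputable def perp (ρ : P.B) (x : P.Conv ℤ) : P.Conv ℤ := fun j =>
  ∑ b ∈ P.upto (P.deg ρ + P.deg j), P.N ρ j b * x b

set_option maxHeartbeats 1000000 in
lemma perp_mul {ρ : P.B} (h : P.Cusp ρ) (x y : P.Conv ℤ) :
    P.perp ρ (x * y) = P.perp ρ x * y + x * P.perp ρ y := by
  classical
  funext j
  set D := P.deg ρ + P.deg j with hD
  rw [P.conv_add, P.mul_apply _ _ j D (by omega), P.mul_apply _ _ j D (by omega), perp,
    P.conv_hopf x y ρ j D le_rfl]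
  have hp : ∀ (z : P.Conv ℤ) k, k ∈ P.upto (P.deg j) →
      ∑ c ∈ P.upto D, (P.N ρ k c : ℤ) * z c = P.perp ρ z k := by
    intro z k hk
    rw [P.mem_upto] at hk
    rw [perp]
    symm
    refine Finset.sum_subset (P.upto_mono (by omega)) fun b _ hb => ?_
    rw [P.mem_upto] at hb
    rw [P.N_eq_zero (by omega)]; simp
  have ho : ∀ (z : P.Conv ℤ) k, k ∈ P.upto D →
      ∑ c ∈ P.upto D, (P.N P.o k c : ℤ) * z c = z k := by
    intro z k hk
    rw [Finset.sum_eq_single_of_mem k hk]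
    · simp [P.N_o_left]
    · intro b _ hb; rw [P.N_o_left, if_neg (Ne.symm hb)]; simp
  have hoD : P.o ∈ P.upto D := P.mem_upto.2 (by rw [P.deg_o]; omega)
  have hρD : ρ ∈ P.upto D := P.mem_upto.2 (by omega)
  have hne : P.o ≠ ρ := fun h' => h.1 h'.symm
  -- reduce the (i,j) sum to (ρ,o), (o,ρ)
  have red : ∀ F : P.B → P.B → ℤ, ∑ i ∈ P.upto D, ∑ j' ∈ P.upto D, (P.N i j' ρ : ℤ) * F i j' =
      F ρ P.o + F P.o ρ := by
    intro F
    rw [← Finset.sum_subset (s₁ := {ρ, P.o}), Finset.sum_pair hne.symm]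
    · congr 1
      · rw [Finset.sum_eq_single_of_mem P.o hoD]
        · simp [P.N_o_right]
        · intro b _ hb
          have : P.N ρ b ρ = 0 := P.N_eq_zero (by have := P.deg_pos hb; omega)
          simp [this]
      · rw [Finset.sum_eq_single_of_mem ρ hρD]
        · simp [P.N_o_left]
        · intro b _ hb
          rw [P.N_o_left, if_neg hb]; simp
    · intro b hb
      simp only [Finset.mem_insert, Finset.mem_singleton] at hb
      rcases hb with rfl | rfl <;> assumption
    · intro i _ hi
      simp only [Finset.mem_insert, Finset.mem_singleton, not_or] at hi
      refine Finset.sum_eq_zero fun j' _ => ?_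
      by_cases h0 : P.N i j' ρ = 0
      · simp [h0]
      rcases h.2 _ _ h0 with h1 | h1
      · exact absurd h1 hi.2
      · subst h1; rw [P.N_o_right, if_neg hi.1]; simp
  have e : ∀ i j', ∑ k ∈ P.upto D, ∑ l ∈ P.upto D,
        ((P.N i j' ρ : ℤ) * P.N k l j) * ((∑ c ∈ P.upto D, (P.N i k c : ℤ) * x c) *
          (∑ d ∈ P.upto D, (P.N j' l d : ℤ) * y d)) = (P.N i j' ρ : ℤ) *
      ∑ k ∈ P.upto D, ∑ l ∈ P.upto D,
        (P.N k l j : ℤ) * ((∑ c ∈ P.upto D, (P.N i k c : ℤ) * x c) *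
          (∑ d ∈ P.upto D, (P.N j' l d : ℤ) * y d)) := by
    intro i j'
    rw [Finset.mul_sum]
    refine Finset.sum_congr rfl fun k _ => ?_
    rw [Finset.mul_sum]
    refine Finset.sum_congr rfl fun l _ => ?_
    ring
  simp only [e]
  rw [red]
  congr 1
  · refine Finset.sum_congr rfl fun k _ => Finset.sum_congr rfl fun l hl => ?_
    rw [ho y l hl]
    by_cases h0 : P.N k l j = 0
    · simp [h0]
    · rw [hp x k (P.mem_upto.2 (by have := P.N_deg _ _ _ h0; omega))]
  · refine Finset.sum_congr rfl fun k hk => Finset.sum_congr rfl fun l _ => ?_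
    rw [ho x k hk]
    by_cases h0 : P.N k l j = 0
    · simp [h0]
    · rw [hp y l (P.mem_upto.2 (by have := P.N_deg _ _ _ h0; omega))]

open scoped Classical in
lemma perp_sg {ρ σ : P.B} (h : P.Cusp ρ) (h' : P.Cusp σ) :
    P.perp ρ (P.sg σ).1 = if ρ = σ then 1 else 0 := by
  funext j
  have e : P.perp ρ (P.sg σ).1 j = P.N ρ j σ := by
    rw [perp]
    by_cases h0 : P.N ρ j σ = 0
    · rw [h0]
      refine Finset.sum_eq_zero fun b _ => ?_
      rw [sg_apply]; split_ifs with hb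
      · subst hb; simp [h0]
      · simp
    · rw [Finset.sum_eq_single_of_mem σ (P.mem_upto.2 (P.N_deg _ _ _ h0).ge)]
      · simp [sg_apply]
      · intro b _ hb; simp [sg_apply, hb]
  rw [e]
  by_cases hj : j = P.o
  · subst hj; rw [P.N_o_right]; split_ifs
    · simp [P.one_apply]
    · simp
  · have : P.N ρ j σ = 0 := by
      by_contra h0
      rcases h'.2 _ _ h0 with h1 | h1
      · exact h.1 h1
      · exact hj h1
    rw [this]; split_ifs
    · simp [P.one_apply, hj]
    · simp

/-- product of cuspidals -/
noncomputable def cp (S : Multiset P.B) : P.Rb := (S.map P.sg).prod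

lemma cp_cons (ρ : P.B) (S : Multiset P.B) : P.cp (ρ ::ₘ S) = P.sg ρ * P.cp S := by simp [cp]

lemma cp_zero : P.cp 0 = 1 := by simp [cp]

lemma cp_add (S T : Multiset P.B) : P.cp (S + T) = P.cp S * P.cp T := by simp [cp]

lemma cp_nonneg (S : Multiset P.B) (b : P.B) : 0 ≤ (P.cp S).1 b := by
  classical
  induction S using Multiset.induction_on generalizing b with
  | empty =>
    rw [cp_zero, show (1 : P.Rb).1 = 1 from rfl, P.one_apply]; split_ifs <;> simp
  | cons ρ S ih =>
    rw [cp_cons, P.sg_mul_apply' ρ _ b _ le_rfl]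
    exact Finset.sum_nonneg fun j _ => mul_nonneg (by positivity) (ih j)

open scoped Classical in
lemma perp_cp {ρ : P.B} (h : P.Cusp ρ) (T : Multiset P.B) (hT : ∀ σ ∈ T, P.Cusp σ) :
    P.perp ρ (P.cp T).1 = (T.count ρ : ℤ) • (P.cp (T.erase ρ)).1 := by
  induction T using Multiset.induction_on with
  | empty =>
    funext j
    have : P.perp ρ (P.cp 0).1 j = 0 := by
      rw [perp]
      refine Finset.sum_eq_zero fun b _ => ?_
      rw [cp_zero, show (1 : P.Rb).1 = 1 from rfl, P.one_apply]
      split_ifs with hb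
      · rw [P.N_eq_zero (by have := P.deg_pos h.1; rw [hb, P.deg_o]; omega)]; simp
      · simp
    rw [this]; simp
  | cons σ T ih =>
    have ih := ih (fun τ hτ => hT τ (Multiset.mem_cons_of_mem hτ))
    rw [cp_cons, show (P.sg σ * P.cp T).1 = (P.sg σ).1 * (P.cp T).1 from rfl, P.perp_mul h,
      P.perp_sg h (hT σ (Multiset.mem_cons_self _ _)), ih]
    by_cases hs : ρ = σ
    · subst hs
      rw [if_pos rfl, one_mul, Multiset.count_cons_self, Multiset.erase_cons_head, mul_smul_comm]
      by_cases hm : ρ ∈ T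
      · conv_rhs => rw [← Multiset.cons_erase hm, cp_cons]
        rw [show (P.sg ρ * P.cp (T.erase ρ)).1 = (P.sg ρ).1 * (P.cp (T.erase ρ)).1 from rfl]
        conv_lhs => rw [← Multiset.cons_erase hm, cp_cons]
        rw [show (P.sg ρ * P.cp (T.erase ρ)).1 = (P.sg ρ).1 * (P.cp (T.erase ρ)).1 from rfl]
        rw [Multiset.cons_erase hm]
        push_cast
        rw [add_smul, one_smul, add_comm]
      · rw [Multiset.count_eq_zero_of_notMem hm]; simp
    · rw [if_neg hs, zero_mul, zero_add, Multiset.count_cons_of_ne hs, mul_smul_comm,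
        Multiset.erase_cons_tail _ (by simpa using Ne.symm hs), cp_cons]
      rfl

lemma exists_of_sg_mul {ρ : P.B} {x : P.Rb} {b : P.B} (h : (P.sg ρ * x).1 b ≠ 0) :
    ∃ j, P.N ρ j b ≠ 0 ∧ x.1 j ≠ 0 := by
  rw [P.sg_mul_apply' ρ x b _ le_rfl] at h
  obtain ⟨j, -, hj⟩ := Finset.exists_ne_zero_of_sum_ne_zero h
  exact ⟨j, by exact_mod_cast left_ne_zero_of_mul hj, right_ne_zero_of_mul hj⟩

/-- `b` occurs in the product of the cuspidals of `S` -/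
def Occ (b : P.B) (S : Multiset P.B) : Prop := (∀ σ ∈ S, P.Cusp σ) ∧ (P.cp S).1 b ≠ 0

lemma Occ.unique {b : P.B} {S T : Multiset P.B} (hS : P.Occ b S) (hT : P.Occ b T) : S = T := by
  classical
  induction S using Multiset.induction_on generalizing b T with
  | empty =>
    have h1 := hS.2
    rw [cp_zero, show (1 : P.Rb).1 = 1 from rfl, P.one_apply] at h1
    have hb : b = P.o := by by_contra h; simp [h] at h1
    subst hb
    by_contra hne
    obtain ⟨ρ, hρ⟩ := Multiset.exists_mem_of_ne_zero (Ne.symm hne)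
    have h2 := hT.2
    rw [← Multiset.cons_erase hρ, cp_cons] at h2
    obtain ⟨j, hj, -⟩ := P.exists_of_sg_mul h2
    have := P.N_deg _ _ _ hj
    have h3 := P.deg_pos (hT.1 ρ hρ).1
    rw [P.deg_o] at this; omega
  | cons ρ S ih =>
    have hρ := hS.1 ρ (Multiset.mem_cons_self _ _)
    have h2 := hS.2
    rw [cp_cons] at h2
    obtain ⟨j, hj, hj2⟩ := P.exists_of_sg_mul h2
    have h3 : P.perp ρ (P.cp T).1 j ≠ 0 := by
      have : 0 < P.perp ρ (P.cp T).1 j := by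
        rw [perp]
        refine Finset.sum_pos' (fun b _ => mul_nonneg (by positivity) (P.cp_nonneg T b))
          ⟨b, P.mem_upto.2 (P.N_deg _ _ _ hj).ge, ?_⟩
        exact mul_pos (by positivity) (lt_of_le_of_ne (P.cp_nonneg T b) hT.2.symm)
      exact this.ne'
    rw [P.perp_cp hρ T hT.1] at h3
    have h4 : (((T.count ρ : ℤ) • (P.cp (T.erase ρ)).1 : P.Conv ℤ)) j =
      (T.count ρ : ℤ) * (P.cp (T.erase ρ)).1 j := rfl
    rw [h4] at h3
    have hm : ρ ∈ T := by
      by_contra hm; rw [Multiset.count_eq_zero_of_notMem hm] at h3; simp at h3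
    have := ih (b := j) (T := T.erase ρ) ⟨fun σ hσ => hS.1 σ (Multiset.mem_cons_of_mem hσ), hj2⟩
      ⟨fun σ hσ => hT.1 σ (Multiset.mem_of_mem_erase hσ), right_ne_zero_of_mul h3⟩
    rw [this, Multiset.cons_erase hm]

lemma Occ.mul {a b d : P.B} {S T : Multiset P.B} (hS : P.Occ a S) (hT : P.Occ b T)
    (h : P.N a b d ≠ 0) : P.Occ d (S + T) := by
  refine ⟨fun σ hσ => ?_, ?_⟩
  · rcases Multiset.mem_add.1 hσ with h | h
    · exact hS.1 σ h
    · exact hT.1 σ h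
  · rw [cp_add]
    apply ne_of_gt
    rw [show (P.cp S * P.cp T).1 = (P.cp S).1 * (P.cp T).1 from rfl, P.mul_apply _ _ d _ le_rfl]
    have hd := P.N_deg _ _ _ h
    have nn : ∀ i j, 0 ≤ (P.N i j d : ℤ) * ((P.cp S).1 i * (P.cp T).1 j) := fun i j =>
      mul_nonneg (by positivity) (mul_nonneg (P.cp_nonneg S i) (P.cp_nonneg T j))
    refine Finset.sum_pos' (fun i _ => Finset.sum_nonneg fun j _ => nn i j)
      ⟨a, P.mem_upto.2 (by omega), Finset.sum_pos' (fun j _ => nn a j)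
        ⟨b, P.mem_upto.2 (by omega), ?_⟩⟩
    exact mul_pos (by positivity) (mul_pos (lt_of_le_of_ne (P.cp_nonneg S a) hS.2.symm)
      (lt_of_le_of_ne (P.cp_nonneg T b) hT.2.symm))

lemma occ_exists (b : P.B) : ∃ S, P.Occ b S := by
  suffices H : ∀ n b, P.deg b = n → ∃ S, P.Occ b S from H _ b rfl
  intro n
  induction n using Nat.strong_induction_on with
  | _ n ih =>
  intro b hb
  by_cases ho : b = P.o
  · refine ⟨0, by simp, ?_⟩
    subst ho
    classical
    rw [cp_zero, show (1 : P.Rb).1 = 1 from rfl, P.one_apply]; simp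
  by_cases hc : P.Cusp b
  · refine ⟨{b}, by simpa using hc, ?_⟩
    classical
    simp [cp, sg_apply]
  · simp only [Cusp, not_and, not_forall, not_or] at hc
    obtain ⟨i, j, h0, hi, hj⟩ := hc ho
    have := P.N_deg _ _ _ h0
    have hi' := P.deg_pos hi
    have hj' := P.deg_pos hj
    obtain ⟨S, hS⟩ := ih _ (by omega) i rfl
    obtain ⟨T, hT⟩ := ih _ (by omega) j rfl
    exact ⟨_, Occ.mul P hS hT h0⟩

/-- cuspidal support -/
noncomputable def supp (b : P.B) : Multiset P.B := (P.occ_exists b).choose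

lemma supp_occ (b : P.B) : P.Occ b (P.supp b) := (P.occ_exists b).choose_spec

lemma supp_eq {b : P.B} {S : Multiset P.B} (h : P.Occ b S) : P.supp b = S :=
  Occ.unique P (P.supp_occ b) h

lemma supp_mul {a b d : P.B} (h : P.N a b d ≠ 0) : P.supp d = P.supp a + P.supp b :=
  P.supp_eq (Occ.mul P (P.supp_occ a) (P.supp_occ b) h)

lemma supp_cusp {b σ : P.B} (h : σ ∈ P.supp b) : P.Cusp σ := (P.supp_occ b).1 σ h

lemma supp_of_cusp {ρ : P.B} (h : P.Cusp ρ) : P.supp ρ = {ρ} := by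
  classical
  refine P.supp_eq ⟨by simpa using h, ?_⟩
  simp [cp, sg_apply]

lemma supp_o : P.supp P.o = 0 := by
  classical
  refine P.supp_eq ⟨by simp, ?_⟩
  rw [cp_zero, show (1 : P.Rb).1 = 1 from rfl, P.one_apply]; simp

lemma occ_deg_om {b : P.B} {S : Multiset P.B} (h : P.Occ b S) :
    P.deg b = (S.map P.deg).sum ∧ ∀ z, P.om b z = (S.map fun ρ => P.om ρ z).prod := by
  classical
  induction S using Multiset.induction_on generalizing b with
  | empty =>
    have h1 := h.2
    rw [cp_zero, show (1 : P.Rb).1 = 1 from rfl, P.one_apply] at h1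
    have hb : b = P.o := by by_contra h; simp [h] at h1
    subst hb
    exact ⟨by simp [P.deg_o], fun z => by simp [P.om_o]⟩
  | cons ρ S ih =>
    have h2 := h.2
    rw [cp_cons] at h2
    obtain ⟨j, hj, hj2⟩ := P.exists_of_sg_mul h2
    obtain ⟨i1, i2⟩ := ih (b := j) ⟨fun σ hσ => h.1 σ (Multiset.mem_cons_of_mem hσ), hj2⟩
    refine ⟨?_, fun z => ?_⟩
    · rw [Multiset.map_cons, Multiset.sum_cons, ← i1, P.N_deg _ _ _ hj]
    · rw [Multiset.map_cons, Multiset.prod_cons, ← i2, P.om_mul _ _ _ hj]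

lemma deg_supp (b : P.B) : P.deg b = ((P.supp b).map P.deg).sum := (P.occ_deg_om (P.supp_occ b)).1

lemma om_supp (b : P.B) (z : Z) : P.om b z = ((P.supp b).map fun ρ => P.om ρ z).prod :=
  (P.occ_deg_om (P.supp_occ b)).2 z

lemma cusp_c_delta {ρ : P.B} (h : P.Cusp ρ) :
    P.c ρ = 1 ∧ (q ^ P.deg ρ - 1) * P.delta ρ = 1 := by
  classical
  have h5 := P.P5 ρ (P.deg ρ) le_rfl
  change _ = ∑ i ∈ P.upto (P.deg ρ), ∑ j ∈ P.upto (P.deg ρ), _ at h5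
  have hne : P.o ≠ ρ := fun h' => h.1 h'.symm
  have hoD : P.o ∈ P.upto (P.deg ρ) := P.mem_upto.2 (by rw [P.deg_o]; omega)
  have hρD : ρ ∈ P.upto (P.deg ρ) := P.mem_upto.2 (by omega)
  rw [← Finset.sum_subset (s₁ := {ρ, P.o}), Finset.sum_pair hne.symm,
    Finset.sum_eq_single_of_mem P.o hoD, Finset.sum_eq_single_of_mem ρ hρD] at h5
  · simp only [P.N_o_right, P.N_o_left, if_true, P.delta_o, P.c_o] at h5
    have h6 : (q ^ P.deg ρ - 1) * P.delta ρ = P.c ρ := by push_cast at h5; linarith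
    have hq := P.hq
    have : 0 < (q ^ P.deg ρ - 1) * P.delta ρ :=
      mul_pos (by linarith [one_lt_pow₀ hq (P.deg_pos h.1).ne']) (P.delta_pos ρ)
    have h7 : P.c ρ = 1 := by
      have := P.c_le ρ
      have h8 : 0 < (P.c ρ : ℝ) := by linarith
      have h9 : 0 < P.c ρ := by exact_mod_cast h8
      omega
    exact ⟨h7, by rw [h6, h7]; simp⟩
  · intro b _ hb; rw [P.N_o_left, if_neg hb]; simp
  · intro b _ hb
    have : P.N ρ b ρ = 0 := P.N_eq_zero (by have := P.deg_pos hb; omega)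
    simp [this]
  · intro b hb
    simp only [Finset.mem_insert, Finset.mem_singleton] at hb
    rcases hb with rfl | rfl <;> assumption
  · intro i _ hi
    simp only [Finset.mem_insert, Finset.mem_singleton, not_or] at hi
    refine Finset.sum_eq_zero fun j' _ => ?_
    by_cases h0 : P.N i j' ρ = 0
    · simp [h0]
    rcases h.2 _ _ h0 with h1 | h1
    · exact absurd h1 hi.2
    · subst h1; rw [P.N_o_right, if_neg hi.1]; simp

/-- the Whittaker functional as integer valued -/
def cZ : P.Conv ℤ := fun b => (P.c b : ℤ)

lemma cZ_apply (b : P.B) : P.cZ b = P.c b := rfl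

lemma c_isMult : P.IsMult P.cZ :=
  ⟨by simp [cZ_apply, P.c_o], fun a b D h => by
    simp only [cZ_apply]; exact_mod_cast P.c_mul a b D h⟩

/-- existence and uniqueness of the generic element of a given support -/
lemma exists_generic {S : Multiset P.B} (hS : ∀ σ ∈ S, P.Cusp σ) :
    ∃ b, (P.supp b = S ∧ P.c b = 1) ∧ ∀ b', P.supp b' = S → P.c b' = 1 → b' = b := by
  classical
  have h1 : P.ev _ P.c_isMult (P.cp S) = 1 := by
    rw [cp, map_multiset_prod, Multiset.map_map]
    apply Multiset.prod_eq_one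
    intro x hx
    obtain ⟨ρ, hρ, rfl⟩ := Multiset.mem_map.1 hx
    simp only [Function.comp]
    rw [P.ev_sg]
    simp [cZ_apply, (P.cusp_c_delta (hS ρ hρ)).1]
  have key : ∀ D, (∀ b, D < P.deg b → (P.cp S).1 b = 0) →
      ∑ b ∈ P.upto D, (P.cp S).1 b * (P.c b : ℤ) = 1 := by
    intro D hD
    rw [P.ev_eq _ _ _ D hD] at h1
    simpa [cZ_apply] using h1
  have K := key _ (P.bd_spec (P.cp S))
  have nn : ∀ b, 0 ≤ (P.cp S).1 b * (P.c b : ℤ) := fun b =>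
    mul_nonneg (P.cp_nonneg S b) (by positivity)
  obtain ⟨b, hb, hb0⟩ := Finset.exists_ne_zero_of_sum_ne_zero (by rw [K]; norm_num)
  have hcb : P.c b ≠ 0 := by exact_mod_cast right_ne_zero_of_mul hb0
  have hc1 : P.c b = 1 := by have := P.c_le b; omega
  refine ⟨b, ⟨P.supp_eq ⟨hS, left_ne_zero_of_mul hb0⟩, hc1⟩, fun b' hb' hc' => ?_⟩
  by_contra hne
  have h2 := (P.supp_occ b').2
  rw [hb'] at h2
  have hb'm : b' ∈ P.upto (P.bd (P.cp S)) := by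
    rw [P.mem_upto]; by_contra h; exact h2 (P.bd_spec _ _ (by omega))
  have h3 : ∑ x ∈ {b, b'}, (P.cp S).1 x * (P.c x : ℤ) ≤ 1 := by
    rw [← K]
    refine Finset.sum_le_sum_of_subset_of_nonneg ?_ fun x _ _ => nn x
    intro x hx
    simp only [Finset.mem_insert, Finset.mem_singleton] at hx
    rcases hx with rfl | rfl <;> assumption
  rw [Finset.sum_pair (Ne.symm hne), hc1, hc'] at h3
  have h4 := P.cp_nonneg S b
  have h5 := P.cp_nonneg S b'
  have h6 := left_ne_zero_of_mul hb0
  push_cast at h3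
  omega

/-- The generic element with cuspidal support `S`. -/
noncomputable def gen (S : Multiset P.B) : P.B :=
  open scoped Classical in
  if h : ∀ σ ∈ S, P.Cusp σ then (P.exists_generic h).choose else P.o

lemma gen_supp {S : Multiset P.B} (hS : ∀ σ ∈ S, P.Cusp σ) : P.supp (P.gen S) = S := by
  rw [gen, dif_pos hS]; exact (P.exists_generic hS).choose_spec.1.1

lemma gen_c {S : Multiset P.B} (hS : ∀ σ ∈ S, P.Cusp σ) : P.c (P.gen S) = 1 := by
  rw [gen, dif_pos hS]; exact (P.exists_generic hS).choose_spec.1.2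

lemma eq_gen {b : P.B} (h : P.c b = 1) : b = P.gen (P.supp b) := by
  have hS : ∀ σ ∈ P.supp b, P.Cusp σ := fun σ hσ => P.supp_cusp hσ
  rw [gen, dif_pos hS]
  exact (P.exists_generic hS).choose_spec.2 b rfl h

lemma gen_zero : P.gen 0 = P.o := by
  rw [← P.supp_o, ← P.eq_gen P.c_o]

open scoped Classical in
lemma N_gen {S : Multiset P.B} (hS : ∀ σ ∈ S, P.Cusp σ) (a b : P.B) :
    P.N a b (P.gen S) = if P.supp a + P.supp b = S then P.c a * P.c b else 0 := by
  split_ifs with h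
  · rw [← P.c_mul a b (P.deg a + P.deg b) le_rfl]
    by_cases h0 : P.N a b (P.gen S) = 0
    · rw [h0]; symm
      refine Finset.sum_eq_zero fun e _ => ?_
      by_contra h1
      have h2 := P.supp_mul (left_ne_zero_of_mul h1)
      have h3 := right_ne_zero_of_mul h1
      have h4 := P.eq_gen (b := e) (by have := P.c_le e; omega)
      rw [h2, h] at h4
      rw [← h4] at h0
      exact left_ne_zero_of_mul h1 h0
    · rw [Finset.sum_eq_single_of_mem (P.gen S) (P.mem_upto.2 (P.N_deg _ _ _ h0).ge)]
      · rw [P.gen_c hS, mul_one]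
      · intro e _ he
        by_contra h1
        have h2 := P.supp_mul (left_ne_zero_of_mul h1)
        have h3 := right_ne_zero_of_mul h1
        have h4 := P.eq_gen (b := e) (by have := P.c_le e; omega)
        rw [h2, h] at h4
        exact he h4
  · by_contra h0
    have := P.supp_mul h0
    rw [P.gen_supp hS] at this
    exact h this.symm

end PSH
end P3b

section P3c
namespace PSH
variable {q : ℝ} {Z : Type} [CommGroup Z] (P : PSH q Z)

/-- one column elements -/
noncomputable def e (ρ : P.B) (r : ℕ) : P.B := P.gen (Multiset.replicate r ρ)

variable {P}

lemma rep_cusp {ρ : P.B} (h : P.Cusp ρ) (r : ℕ) : ∀ σ ∈ Multiset.replicate r ρ, P.Cusp σ := by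
  intro σ hσ; rw [Multiset.eq_of_mem_replicate hσ]; exact h

lemma e_supp {ρ : P.B} (h : P.Cusp ρ) (r : ℕ) : P.supp (P.e ρ r) = Multiset.replicate r ρ :=
  P.gen_supp (rep_cusp h r)

lemma e_c {ρ : P.B} (h : P.Cusp ρ) (r : ℕ) : P.c (P.e ρ r) = 1 := P.gen_c (rep_cusp h r)

lemma e_deg {ρ : P.B} (h : P.Cusp ρ) (r : ℕ) : P.deg (P.e ρ r) = r * P.deg ρ := by
  rw [P.deg_supp, e_supp h]; simp

lemma e_zero (ρ : P.B) : P.e ρ 0 = P.o := by simp [e, P.gen_zero]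

lemma e_inj {ρ : P.B} (h : P.Cusp ρ) {r s : ℕ} (hh : P.e ρ r = P.e ρ s) : r = s := by
  have := congrArg P.supp hh
  rw [e_supp h, e_supp h] at this
  simpa using congrArg Multiset.card this

lemma eq_e {ρ : P.B} {b : P.B} (hc : P.c b = 1) {r : ℕ}
    (hs : P.supp b = Multiset.replicate r ρ) : b = P.e ρ r := by
  rw [P.eq_gen hc, hs]; rfl

variable {A : Type} [CommRing A]

lemma mul_e {ρ : P.B} (h : P.Cusp ρ) (X Y : P.Conv A) (r : ℕ) :
    (X * Y) (P.e ρ r) = ∑ p ∈ Finset.HasAntidiagonal.antidiagonal r, X (P.e ρ p.1) * Y (P.e ρ p.2) := by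
  classical
  rw [P.mul_apply X Y _ _ le_rfl, ← Finset.sum_product']
  symm
  refine Finset.sum_of_injOn (fun p => (P.e ρ p.1, P.e ρ p.2)) ?_ ?_ ?_ ?_
  · intro p _ p' _ hh
    simp only [Prod.mk.injEq] at hh
    exact Prod.ext (e_inj h hh.1) (e_inj h hh.2)
  · intro p hp
    simp only [Finset.coe_product, Set.mem_prod, Finset.mem_coe, P.mem_upto, e_deg h]
    have := Finset.HasAntidiagonal.mem_antidiagonal.1 (Finset.mem_coe.1 hp)
    constructor <;> exact Nat.mul_le_mul_right _ (by omega)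
  · rintro ⟨a, b⟩ _ hab
    have : P.N a b (P.e ρ r) = 0 := by
      rw [e, P.N_gen (rep_cusp h r)]
      split_ifs with hs
      · by_contra h0
        have h1 := left_ne_zero_of_mul h0
        have h2 := right_ne_zero_of_mul h0
        have h1' : P.c a = 1 := by have := P.c_le a; omega
        have h2' : P.c b = 1 := by have := P.c_le b; omega
        have ha := Multiset.eq_replicate_card.2
          (fun x hx => Multiset.eq_of_mem_replicate (n := r) (a := ρ) (hs ▸ Multiset.mem_add.2 (Or.inl hx)))
        have hb := Multiset.eq_replicate_card.2
          (fun x hx => Multiset.eq_of_mem_replicate (n := r) (a := ρ) (hs ▸ Multiset.mem_add.2 (Or.inr hx)))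
        apply hab
        refine ⟨(_, _), ?_, Prod.ext (eq_e h1' ha).symm (eq_e h2' hb).symm⟩
        rw [Finset.mem_coe, Finset.HasAntidiagonal.mem_antidiagonal]
        have := congrArg Multiset.card hs
        rw [Multiset.card_add, Multiset.card_replicate] at this
        exact this
      · rfl
    simp [this]
  · rintro ⟨i, j⟩ hp
    have hp := Finset.HasAntidiagonal.mem_antidiagonal.1 hp
    have : P.N (P.e ρ i) (P.e ρ j) (P.e ρ r) = 1 := by
      rw [show P.e ρ r = P.gen (Multiset.replicate r ρ) from rfl, P.N_gen (rep_cusp h r), if_pos]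
      · rw [e_c h, e_c h]
      · rw [e_supp h, e_supp h, ← Multiset.replicate_add, ← hp]
    simp [this]

variable (P) in
/-- The generating series along one cuspidal. -/
noncomputable def Hs (ρ : P.B) (X : P.Conv A) : PowerSeries A := PowerSeries.mk fun r => X (P.e ρ r)

lemma Hs_mul {ρ : P.B} (h : P.Cusp ρ) (X Y : P.Conv A) : P.Hs ρ (X * Y) = P.Hs ρ X * P.Hs ρ Y := by
  ext r
  rw [PowerSeries.coeff_mul]
  simp only [Hs, PowerSeries.coeff_mk, mul_e h]

lemma Hs_one {ρ : P.B} (h : P.Cusp ρ) : P.Hs ρ (1 : P.Conv A) = 1 := by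
  classical
  ext r
  simp only [Hs, PowerSeries.coeff_mk, P.one_apply, PowerSeries.coeff_one]
  congr 1
  apply propext
  constructor
  · intro hh; exact e_inj h (hh.trans (e_zero ρ).symm)
  · rintro rfl; exact e_zero ρ

lemma Hs_prod {ρ : P.B} (h : P.Cusp ρ) {ι : Type} (s : Finset ι) (X : ι → P.Conv A) :
    P.Hs ρ (∏ i ∈ s, X i) = ∏ i ∈ s, P.Hs ρ (X i) := by
  classical
  induction s using Finset.induction_on with
  | empty => simp [Hs_one h]
  | insert i s hi ih => rw [Finset.prod_insert hi, Finset.prod_insert hi, Hs_mul h, ih]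

/-- dimension recursion -/
lemma delta_e_rec {ρ : P.B} (h : P.Cusp ρ) (r : ℕ) :
    (q ^ P.deg ρ) ^ (r + 1) * P.delta (P.e ρ (r + 1)) - (q ^ P.deg ρ) ^ r * P.delta (P.e ρ r) =
      P.delta (P.e ρ (r + 1)) := by
  have key : ∀ r, (q ^ P.deg ρ) ^ r * P.delta (P.e ρ r) =
      ∑ j ∈ Finset.range (r + 1), P.delta (P.e ρ j) := by
    intro r
    have h1 := congrFun P.cR_mul_delta (P.e ρ r)
    have h2 : ∀ i, P.cR (P.e ρ i) = 1 := fun i => by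
      change ((P.c (P.e ρ i) : ℕ) : ℝ) = 1
      rw [e_c h]; simp
    rw [mul_e h, qdR_apply, e_deg h] at h1
    simp only [h2, one_mul] at h1
    rw [← pow_mul, mul_comm (P.deg ρ), ← h1, Finset.Nat.sum_antidiagonal_eq_sum_range_succ_mk,
      ← Finset.sum_range_reflect]
    refine Finset.sum_congr rfl fun j hj => ?_
    rw [Finset.mem_range] at hj
    simp only [dR_apply]
    congr 2; omega
  rw [key, key, Finset.sum_range_succ _ (r + 1)]; ring

lemma delta_e {ρ : P.B} (h : P.Cusp ρ) (r : ℕ) :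
    P.delta (P.e ρ r) * ∏ i ∈ Finset.range r, ((q ^ P.deg ρ) ^ (i + 1) - 1) =
      (q ^ P.deg ρ) ^ (r.choose 2) := by
  induction r with
  | zero => simp [e_zero, P.delta_o]
  | succ r ih =>
    have h1 := delta_e_rec h r
    rw [Finset.prod_range_succ, Nat.choose_succ_succ' r 1, Nat.choose_one_right,
      pow_add _ r (r.choose (1 + 1)), ← ih]
    have h2 : ((q ^ P.deg ρ) ^ (r + 1) - 1) * P.delta (P.e ρ (r + 1)) =
      (q ^ P.deg ρ) ^ r * P.delta (P.e ρ r) := by linarith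
    linear_combination (∏ i ∈ Finset.range r, ((q ^ P.deg ρ) ^ (i + 1) - 1)) * h2

variable (P) in
/-- multiplicative functions built from `c` -/
noncomputable def cf (f : P.B → A) : P.Conv A := fun b => (P.c b : A) * ((P.supp b).map f).prod

lemma cf_apply (f : P.B → A) (b : P.B) : P.cf f b = (P.c b : A) * ((P.supp b).map f).prod := rfl

lemma cf_isMult (f : P.B → A) : P.IsMult (P.cf f) := by
  refine ⟨by simp [cf_apply, P.c_o, P.supp_o], fun a b D h => ?_⟩
  have h1 : ∀ x ∈ P.upto D, (P.N a b x : A) * P.cf f x =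
      ((P.N a b x * P.c x : ℕ) : A) * (((P.supp a).map f).prod * ((P.supp b).map f).prod) := by
    intro x _
    by_cases h0 : P.N a b x = 0
    · simp [h0]
    · rw [cf_apply, P.supp_mul h0]; push_cast; simp; ring
  rw [Finset.sum_congr rfl h1, ← Finset.sum_mul, ← Nat.cast_sum, P.c_mul a b D h]
  simp only [cf_apply]; push_cast; ring

lemma cf_e (f : P.B → A) {ρ : P.B} (h : P.Cusp ρ) (r : ℕ) : P.cf f (P.e ρ r) = f ρ ^ r := by
  rw [cf_apply, e_c h, e_supp h]; simp

lemma Hs_cf (f : P.B → A) {ρ : P.B} (h : P.Cusp ρ) :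
    (1 - PowerSeries.C (f ρ) * PowerSeries.X) * P.Hs ρ (P.cf f) = 1 := by
  ext r
  rw [sub_mul, one_mul, map_sub, mul_assoc, PowerSeries.coeff_C_mul, PowerSeries.coeff_one]
  cases r with
  | zero => simp [Hs, cf_e f h]
  | succ r =>
    rw [PowerSeries.coeff_succ_X_mul]
    simp [Hs, cf_e f h]; ring

/-- number of generic elements weighted by central characters: generating function identity. -/
lemma generic_sum (z : Z) (n : ℕ) :
    (q : ℂ) ^ n * ∑ b ∈ P.lev n, (P.c b : ℂ) * P.om b z * P.delta b =
    ∑ p ∈ Finset.HasAntidiagonal.antidiagonal n, (∑ b ∈ P.lev p.1, (P.c b : ℂ) * P.om b z) *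
      ∑ b ∈ P.lev p.2, (P.c b : ℂ) * P.om b z * P.delta b := by
  classical
  have hP : ∀ b ∈ P.lev n, (q : ℂ) ^ n * ((P.c b : ℂ) * P.om b z * P.delta b) =
      ∑ i ∈ P.upto n, ∑ j ∈ P.upto n, ((P.N i j b * P.c b : ℕ) : ℂ) *
        ((P.c i : ℂ) * P.om i z * (P.om j z * P.delta j)) := by
    intro b hb
    have hb := (P.mem_lev _ _).1 hb
    have h5 := congrArg (fun x : ℝ => (x : ℂ)) (P.P5 b n hb.le)
    change _ = ((∑ i ∈ P.upto n, ∑ j ∈ P.upto n, _ : ℝ) : ℂ) at h5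
    push_cast at h5
    rw [hb] at h5
    calc _ = (P.c b : ℂ) * P.om b z * ((q : ℂ) ^ n * P.delta b) := by ring
      _ = _ := by
        rw [h5, Finset.mul_sum]
        refine Finset.sum_congr rfl fun i _ => ?_
        rw [Finset.mul_sum]
        refine Finset.sum_congr rfl fun j _ => ?_
        by_cases h0 : P.N i j b = 0
        · simp [h0]
        · rw [P.om_mul _ _ _ h0]; push_cast; ring
  rw [Finset.mul_sum, Finset.sum_congr rfl hP, Finset.sum_comm]
  rw [Finset.sum_congr rfl fun i _ => Finset.sum_comm]
  have h2 : ∀ i ∈ P.upto n, ∀ j ∈ P.upto n, ∑ b ∈ P.lev n, ((P.N i j b * P.c b : ℕ) : ℂ) *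
        ((P.c i : ℂ) * P.om i z * (P.om j z * P.delta j)) =
      if P.deg i + P.deg j = n then ((P.c i : ℂ) * P.om i z) * ((P.c j : ℂ) * P.om j z * P.delta j)
        else 0 := by
    intro i hi j hj
    rw [← Finset.sum_mul, ← Nat.cast_sum]
    split_ifs with hd
    · have hcc : (P.c i : ℂ) * P.c i = P.c i := by
        have := P.c_le i
        interval_cases P.c i <;> simp
      have : ∑ b ∈ P.lev n, P.N i j b * P.c b = P.c i * P.c j := by
        rw [← P.c_mul i j n hd.le]
        refine Finset.sum_subset (fun b hb => P.mem_upto.2 ((P.mem_lev _ _).1 hb).le) ?_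
        intro b _ hb
        rw [P.N_eq_zero, zero_mul]
        rw [P.mem_lev] at hb; omega
      rw [this]; push_cast
      linear_combination ((P.c j : ℂ) * P.om i z * (P.om j z * P.delta j)) * hcc
    · rw [Finset.sum_eq_zero, Nat.cast_zero, zero_mul]
      intro b hb
      rw [P.N_eq_zero, zero_mul]
      rw [P.mem_lev] at hb; omega
  rw [Finset.sum_congr rfl fun i hi => Finset.sum_congr rfl fun j hj => h2 i hi j hj]
  simp only [Finset.sum_mul_sum]
  rw [← Finset.sum_product', ← Finset.sum_filter]
  simp only [← Finset.sum_product']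
  rw [Finset.sum_sigma']
  symm
  refine Finset.sum_bij' (fun x _ => x.2) (fun x _ => ⟨(P.deg x.1, P.deg x.2), x⟩) ?_ ?_ ?_ ?_ ?_
  · rintro ⟨⟨a, b⟩, x, y⟩ h
    simp only [Finset.mem_sigma, Finset.HasAntidiagonal.mem_antidiagonal, Finset.mem_product, P.mem_lev] at h
    simp only [Finset.mem_filter, Finset.mem_product, P.mem_upto]
    omega
  · rintro ⟨x, y⟩ h
    simp only [Finset.mem_filter, Finset.mem_product, P.mem_upto] at h
    simp [P.mem_lev, h.2]
  · rintro ⟨⟨a, b⟩, x, y⟩ h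
    simp only [Finset.mem_sigma, Finset.HasAntidiagonal.mem_antidiagonal, Finset.mem_product, P.mem_lev] at h
    obtain ⟨-, rfl, rfl⟩ := h
    rfl
  · rintro ⟨x, y⟩ h; rfl
  · rintro ⟨⟨a, b⟩, x, y⟩ h; rfl

variable (P) in
/-- weighted number of generic elements -/
noncomputable def genSum (z : Z) (n : ℕ) : ℂ := ∑ b ∈ P.lev n, (P.c b : ℂ) * P.om b z

lemma lev_zero : P.lev 0 = {P.o} := by
  ext b; simp [P.mem_lev, P.deg_eq_zero]

lemma genSum_zero (z : Z) : P.genSum z 0 = 1 := by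
  rw [genSum, lev_zero]; simp [P.c_o, P.om_o]

lemma genSum_of_ne {z : Z} (hz : z ≠ 1) (n : ℕ) (hn : 1 ≤ n) : P.genSum z n = 0 := by
  have h := generic_sum (P := P) z n
  rw [P.GG n hn z hz, mul_zero, Finset.sum_eq_single (n, 0)] at h
  · rw [lev_zero] at h
    simp only [Finset.sum_singleton, P.c_o, P.om_o, P.delta_o] at h
    rw [genSum, h]; simp
  · rintro ⟨a, b⟩ hab hne
    rw [Finset.HasAntidiagonal.mem_antidiagonal] at hab
    simp only at hab
    rw [P.GG b _ z hz, mul_zero]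
    rcases Nat.eq_zero_or_pos b with rfl | h1
    · simp at hab; subst hab; exact absurd rfl hne
    · exact h1
  · intro h'; simp at h'

lemma genSum_one_one : P.genSum 1 1 = q - 1 := by
  have h := generic_sum (P := P) 1 1
  have h0 : ∑ b ∈ P.lev 0, (P.c b : ℂ) * P.om b 1 * P.delta b = 1 := by
    rw [lev_zero]; simp [P.c_o, P.om_o, P.delta_o]
  rw [Finset.Nat.sum_antidiagonal_eq_sum_range_succ_mk, Finset.sum_range_succ,
    Finset.sum_range_one] at h
  simp only [Nat.sub_zero, Nat.sub_self, P.GG_one 1 le_rfl, h0] at h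
  change _ = P.genSum 1 0 * 1 + P.genSum 1 1 * 1 at h
  rw [genSum_zero] at h
  linear_combination -h

end PSH
end P3c

section P6a
section JT
variable {A : Type} [CommRing A]

lemma coeff_prod_lin {ι : Type} (s : Finset ι) (y : ι → A) (b : ℕ) (hb : s.card < b) :
    PowerSeries.coeff b (∏ l ∈ s, (1 - PowerSeries.C (y l) * PowerSeries.X)) = 0 := by
  classical
  induction s using Finset.induction_on generalizing b with
  | empty => simp at hb; simp [PowerSeries.coeff_one]; omega
  | insert i s hi ih =>
    rw [Finset.card_insert_of_notMem hi] at hb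
    rw [Finset.prod_insert hi, sub_mul, one_mul, map_sub, mul_assoc, PowerSeries.coeff_C_mul]
    obtain ⟨b, rfl⟩ : ∃ b', b = b' + 1 := ⟨b - 1, by omega⟩
    rw [PowerSeries.coeff_succ_X_mul, ih _ (by omega), ih _ (by omega)]; simp

/-- the matrix of complete symmetric functions -/
def hmat {N : ℕ} (h : ℕ → A) (β : Fin N → ℕ) : Matrix (Fin N) (Fin N) A :=
  Matrix.of fun i m => if (m : ℕ) ≤ β i then h (β i - m) else 0

lemma jt {N : ℕ} (y : Fin N → A) (h : ℕ → A)
    (hH : (∏ l, (1 - PowerSeries.C (y l) * PowerSeries.X)) * PowerSeries.mk h = 1)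
    (β : Fin N → ℕ) :
    (Matrix.of fun i j : Fin N => y j ^ (i : ℕ)).det * (hmat h β).det =
      (Matrix.of fun i j : Fin N => y j ^ β i).det := by
  classical
  set R : Fin N → PowerSeries A := fun j =>
    ∏ l ∈ Finset.univ.erase j, (1 - PowerSeries.C (y l) * PowerSeries.X) with hR
  set M : Matrix (Fin N) (Fin N) A := Matrix.of fun m j => PowerSeries.coeff (m : ℕ) (R j)
  have h0 : h 0 = 1 := by
    have := congrArg (PowerSeries.coeff 0) hH
    simpa [map_prod] using this
  have key : ∀ β : Fin N → ℕ, (Matrix.of fun i j : Fin N => y j ^ β i) = hmat h β * M := by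
    intro β
    ext i j
    have hRj : (1 - PowerSeries.C (y j) * PowerSeries.X) * R j =
        ∏ l, (1 - PowerSeries.C (y l) * PowerSeries.X) :=
      Finset.mul_prod_erase Finset.univ (fun l => (1 - PowerSeries.C (y l) * PowerSeries.X))
        (Finset.mem_univ j)
    have e1 : R j * PowerSeries.mk h = PowerSeries.mk fun a => y j ^ a := by
      have e2 : (1 - PowerSeries.C (y j) * PowerSeries.X) * (R j * PowerSeries.mk h) = 1 := by
        rw [← mul_assoc, hRj, hH]
      have e3 : (1 - PowerSeries.C (y j) * PowerSeries.X) * PowerSeries.mk (fun a => y j ^ a) = 1 := by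
        ext r
        rw [sub_mul, one_mul, map_sub, mul_assoc, PowerSeries.coeff_C_mul, PowerSeries.coeff_one]
        cases r with
        | zero => simp
        | succ r => rw [PowerSeries.coeff_succ_X_mul]; simp; ring
      calc R j * PowerSeries.mk h = (1 - PowerSeries.C (y j) * PowerSeries.X) *
            PowerSeries.mk (fun a => y j ^ a) * (R j * PowerSeries.mk h) := by rw [e3, one_mul]
        _ = PowerSeries.mk (fun a => y j ^ a) * ((1 - PowerSeries.C (y j) * PowerSeries.X) *
            (R j * PowerSeries.mk h)) := by ring
        _ = _ := by rw [e2, mul_one]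
    have e4 := congrArg (PowerSeries.coeff (β i)) e1
    rw [PowerSeries.coeff_mul, PowerSeries.coeff_mk,
      Finset.Nat.sum_antidiagonal_eq_sum_range_succ_mk] at e4
    rw [Matrix.of_apply, ← e4, Matrix.mul_apply]
    simp only [hmat, Matrix.of_apply, M, PowerSeries.coeff_mk]
    rw [← Fin.sum_univ_eq_sum_range (fun m => PowerSeries.coeff m (R j) * h (β i - m))] 
    rw [Fin.sum_univ_eq_sum_range (fun m => PowerSeries.coeff m (R j) * h (β i - m)),
      Fin.sum_univ_eq_sum_range (fun m => (if m ≤ β i then h (β i - m) else 0) *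
        PowerSeries.coeff m (R j)) N]
    have z1 : ∀ m, N ≤ m → PowerSeries.coeff m (R j) = 0 := fun m hm => by
      apply coeff_prod_lin
      rw [Finset.card_erase_of_mem (Finset.mem_univ j), Finset.card_univ, Fintype.card_fin]
      have := j.2
      omega
    have L : ∑ m ∈ Finset.range (β i + 1), PowerSeries.coeff m (R j) * h (β i - m) =
      ∑ m ∈ Finset.range (β i + 1 + N), (if m ≤ β i then h (β i - m) else 0) *
        PowerSeries.coeff m (R j) := by
      have : ∀ m ∈ Finset.range (β i + 1), PowerSeries.coeff m (R j) * h (β i - m) =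
        (if m ≤ β i then h (β i - m) else 0) * PowerSeries.coeff m (R j) := by
        intro m hm; rw [Finset.mem_range] at hm; rw [if_pos (by omega), mul_comm]
      rw [Finset.sum_congr rfl this]
      refine Finset.sum_subset (Finset.range_mono (by omega)) fun m _ hm => ?_
      rw [Finset.mem_range] at hm; rw [if_neg (by omega), zero_mul]
    rw [L]; symm
    refine Finset.sum_subset (Finset.range_mono (by omega)) fun m _ hm => ?_
    rw [Finset.mem_range] at hm; rw [z1 _ (by omega), mul_zero]
  have d1 : (hmat h (fun i : Fin N => (i : ℕ))).det = 1 := by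
    rw [Matrix.det_of_lowerTriangular]
    · simp [hmat, h0]
    · intro i j hij
      have : (i : ℕ) < j := hij
      simp only [hmat, Matrix.of_apply]
      rw [if_neg (by omega)]
  have d2 := congrArg Matrix.det (key fun i => i)
  rw [Matrix.det_mul, d1, one_mul] at d2
  rw [key β, Matrix.det_mul, ← d2]
  ring

end JT

/-- numeric determinant -/
noncomputable def Dnum {N : ℕ} (Q : ℝ) (β : Fin N → ℕ) : ℝ :=
  Q ^ (∑ m : Fin N, ((m : ℕ) + 1).choose 2) *
    (∏ i, (Q ^ (β i).choose 2 / ∏ k ∈ Finset.range (β i), (Q ^ (k + 1) - 1))) *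
    ∏ i : Fin N, ∏ j ∈ Finset.Ioi i, ((Q ^ β i)⁻¹ - (Q ^ β j)⁻¹)

lemma phi_formula (Q : ℝ) (hQ : 1 < Q) (φ : ℕ → ℝ)
    (hφ : ∀ r, φ r * ∏ k ∈ Finset.range r, (Q ^ (k + 1) - 1) = Q ^ r.choose 2) (b m : ℕ) :
    (if m ≤ b then φ (b - m) else 0) =
      Q ^ b.choose 2 / (∏ k ∈ Finset.range b, (Q ^ (k + 1) - 1)) *
      ((-1) ^ m * Q ^ (m + 1).choose 2 * ∏ t ∈ Finset.range m, ((Q ^ b)⁻¹ - (Q ^ t)⁻¹)) := by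
  have hQ0 : Q ≠ 0 := by positivity
  have pos : ∀ r, (∏ k ∈ Finset.range r, (Q ^ (k + 1) - 1)) ≠ 0 := fun r =>
    Finset.prod_ne_zero_iff.2 fun k _ => by
      have := one_lt_pow₀ hQ (Nat.add_one_ne_zero k); linarith
  induction m with
  | zero => simp [eq_div_iff (pos b), hφ]
  | succ m ih =>
    by_cases hm : m + 1 ≤ b
    · rw [if_pos hm]
      rw [if_pos (by omega)] at ih
      rw [Finset.prod_range_succ, pow_succ, Nat.choose_succ_succ' (m+1) 1, Nat.choose_one_right,
        pow_add _ (m + 1) ((m + 1).choose (1 + 1))]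
      obtain ⟨r, rfl⟩ : ∃ r, b = r + (m + 1) := ⟨b - (m + 1), by omega⟩
      rw [show r + (m + 1) - (m + 1) = r by omega]
      rw [show r + (m + 1) - m = r + 1 by omega] at ih
      have h1 := hφ r
      have h2 := hφ (r + 1)
      rw [Finset.prod_range_succ, Nat.choose_succ_succ' r 1, Nat.choose_one_right,
        pow_add _ r (r.choose (1 + 1)), ← h1] at h2
      have h3 : φ (r + 1) * (Q ^ (r + 1) - 1) = Q ^ r * φ r := by
        apply mul_left_cancel₀ (pos r); linear_combination h2
      have h4 : (Q ^ (r + (m + 1)))⁻¹ - (Q ^ m)⁻¹ = - (Q ^ (r+1) - 1) * (Q ^ (r + 1 + m))⁻¹ := by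
        rw [show r + (m + 1) = r + 1 + m by ring]
        field_simp
        rw [pow_add, pow_add]; ring
      rw [h4]
      have h5 : φ r = φ (r + 1) * (Q ^ (r + 1) - 1) * (Q ^ r)⁻¹ := by
        rw [h3]; field_simp
      rw [h5, ih]
      have h6 : (Q ^ (r + 1 + m))⁻¹ * Q ^ (m + 1) = (Q ^ r)⁻¹ := by
        rw [show r + 1 + m = r + (m + 1) by ring, pow_add]; field_simp
      rw [← h6]
      ring
    · rw [if_neg hm, Finset.prod_eq_zero (i := b) (s := Finset.range (m + 1))]
      · simp
      · rw [Finset.mem_range]; omega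
      · simp

lemma det_num {N : ℕ} (Q : ℝ) (hQ : 1 < Q) (φ : ℕ → ℝ)
    (hφ : ∀ r, φ r * ∏ k ∈ Finset.range r, (Q ^ (k + 1) - 1) = Q ^ r.choose 2) (β : Fin N → ℕ) :
    (hmat φ β).det = Dnum Q β := by
  set p : Fin N → Polynomial ℝ := fun m =>
    ∏ t ∈ Finset.range (m : ℕ), (Polynomial.X - Polynomial.C (Q ^ t)⁻¹) with hp
  set w : Fin N → ℝ := fun i => (Q ^ β i)⁻¹ with hw
  have e : hmat φ β = Matrix.of fun i m => (Q ^ (β i).choose 2 / ∏ k ∈ Finset.range (β i), (Q ^ (k + 1) - 1)) *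
      (Matrix.of fun i m : Fin N => ((-1) ^ (m : ℕ) * Q ^ ((m : ℕ) + 1).choose 2) *
        (Matrix.of fun i j => (p j).eval (w i)) i m) i m := by
    ext i m
    simp only [hmat, Matrix.of_apply]
    rw [phi_formula Q hQ φ hφ]
    simp only [hp, hw, Polynomial.eval_prod, Polynomial.eval_sub, Polynomial.eval_X,
      Polynomial.eval_C]
  rw [e, Matrix.det_mul_column, Matrix.det_mul_row,
    ← Matrix.det_eval_matrixOfPolynomials_eq_det_vandermonde w p, Matrix.det_vandermonde,
    Finset.prod_mul_distrib, Dnum, ← Finset.prod_pow_eq_pow_sum]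
  · have sgn : (∏ x : Fin N, (-1 : ℝ) ^ (x : ℕ)) * ∏ i : Fin N, ∏ j ∈ Finset.Ioi i, (w j - w i) =
        ∏ i : Fin N, ∏ j ∈ Finset.Ioi i, (w i - w j) := by
      have h1 : (∏ x : Fin N, (-1 : ℝ) ^ (x : ℕ)) = ∏ x : Fin N, (-1 : ℝ) ^ (Finset.Ioi x).card := by
        rw [← Equiv.prod_comp Fin.revPerm]
        refine Finset.prod_congr rfl fun i _ => ?_
        rw [Fin.card_Ioi, Fin.revPerm_apply, Fin.val_rev]
        congr 1; omega
      rw [h1, ← Finset.prod_mul_distrib]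
      refine Finset.prod_congr rfl fun i _ => ?_
      rw [← Finset.prod_const, ← Finset.prod_mul_distrib]
      refine Finset.prod_congr rfl fun j _ => ?_
      ring
    linear_combination (∏ i, (Q ^ (β i).choose 2 / ∏ k ∈ Finset.range (β i), (Q ^ (k + 1) - 1))) *
      (∏ m : Fin N, Q ^ ((m : ℕ) + 1).choose 2) * sgn
  · intro i
    rw [hp]; simp only
    rw [Polynomial.natDegree_prod_of_monic]
    · simp
    · intro t _; exact Polynomial.monic_X_sub_C _
  · intro i
    exact Polynomial.monic_prod_of_monic _ _ fun t _ => Polynomial.monic_X_sub_C _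

lemma Dnum_pos {N : ℕ} (Q : ℝ) (hQ : 1 < Q) (β : Fin N → ℕ) (hβ : StrictMono β) : 0 < Dnum Q β := by
  have hQ0 : 0 < Q := by linarith
  have pos : ∀ r, 0 < (∏ k ∈ Finset.range r, (Q ^ (k + 1) - 1)) := fun r =>
    Finset.prod_pos fun k _ => by
      have := one_lt_pow₀ hQ (Nat.add_one_ne_zero k); linarith
  rw [Dnum]
  refine mul_pos (mul_pos (by positivity) (Finset.prod_pos fun i _ => div_pos (by positivity) (pos _)))
    (Finset.prod_pos fun i _ => Finset.prod_pos fun j hj => ?_)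
  rw [sub_pos]
  apply inv_strictAnti₀ (by positivity)
  exact pow_lt_pow_right₀ hQ (hβ (Finset.mem_Ioi.1 hj))
end P6a

section P6b
namespace PSH
variable {q : ℝ} {Z : Type} [CommGroup Z] {P : PSH q Z}

lemma e_one {ρ : P.B} (h : P.Cusp ρ) : P.e ρ 1 = ρ :=
  (eq_e (P.cusp_c_delta h).1 (by rw [P.supp_of_cusp h]; rfl)).symm

variable (P) in
/-- coefficient functional -/
def cb (b : P.B) : P.Rb →+ ℤ where
  toFun x := x.1 b
  map_zero' := rfl
  map_add' _ _ := rfl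

lemma cb_apply (b : P.B) (x : P.Rb) : P.cb b x = x.1 b := rfl

lemma prod_sg_supp {ι : Type} (s : Finset ι) (a : ι → P.B) {b : P.B}
    (h : P.cb b (∏ i ∈ s, P.sg (a i)) ≠ 0) : P.supp b = ∑ i ∈ s, P.supp (a i) := by
  classical
  induction s using Finset.induction_on generalizing b with
  | empty =>
    rw [Finset.prod_empty, ← P.sg_o, cb_apply, P.sg_apply] at h
    have : b = P.o := by by_contra h'; simp [h'] at h
    rw [this, P.supp_o]; simp
  | insert i s hi ih =>
    rw [Finset.prod_insert hi, cb_apply] at h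
    obtain ⟨j, h1, h2⟩ := P.exists_of_sg_mul h
    rw [P.supp_mul h1, Finset.sum_insert hi, ih h2]

section Setup
variable {C : Type} [Fintype C] [DecidableEq C] (κ : C → P.B) (N : ℕ)

open scoped Classical in
/-- one variable character -/
noncomputable def fi (i : Fin N × C) : P.B → MvPolynomial (Fin N × C) ℤ :=
  fun σ => if σ = κ i.2 then MvPolynomial.X i else 0

lemma fi_self (i : Fin N × C) : fi κ N i (κ i.2) = MvPolynomial.X i := by simp [fi]

/-- the big multiplicative function -/
noncomputable def EE : P.Conv (MvPolynomial (Fin N × C) ℤ) := ∏ i, P.cf (fi κ N i)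

lemma EE_isMult : P.IsMult (EE κ N) :=
  Finset.prod_induction _ P.IsMult (fun _ _ h1 h2 => IsMult.mul P h1 h2) (IsMult.one P)
    fun i _ => cf_isMult _

lemma cf_fi_ne (i : Fin N × C) {a : P.B} (h : P.cf (fi κ N i) a ≠ 0) :
    ∃ r, a = P.e (κ i.2) r := by
  rw [cf_apply] at h
  have h1 := left_ne_zero_of_mul h
  have h2 := right_ne_zero_of_mul h
  have h3 : P.c a = 1 := by
    have := P.c_le a
    have : P.c a ≠ 0 := fun h' => h1 (by rw [h']; simp)
    omega
  refine ⟨_, eq_e h3 (Multiset.eq_replicate_card.2 fun σ hσ => ?_)⟩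
  by_contra hne
  apply h2
  apply Multiset.prod_eq_zero
  rw [Multiset.mem_map]
  exact ⟨σ, hσ, by simp [fi, hne]⟩

variable {κ}

lemma coeff_EE_aux (hκ : ∀ c, P.Cusp (κ c)) (s : Finset (Fin N × C)) (γ : Fin N × C →₀ ℕ) (b : P.B) :
    MvPolynomial.coeff γ ((∏ i ∈ s, P.cf (fi κ N i)) b) =
      if ∀ i, i ∉ s → γ i = 0 then P.cb b (∏ i ∈ s, P.sg (P.e (κ i.2) (γ i))) else 0 := by
  classical
  induction s using Finset.induction_on generalizing b γ with
  | empty =>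
    rw [Finset.prod_empty, Finset.prod_empty, P.one_apply, cb_apply, ← P.sg_o, P.sg_apply]
    by_cases hb : b = P.o
    · simp only [hb, if_true, MvPolynomial.coeff_one]
      congr 1
      apply propext
      constructor
      · rintro rfl; simp
      · intro h; ext i; simp [h i]
    · simp [hb]
  | insert i₀ s hi ih =>
    rw [Finset.prod_insert hi, Finset.prod_insert hi]
    have hc : P.Cusp (κ i₀.2) := hκ _
    set a₀ := P.e (κ i₀.2) (γ i₀) with ha₀
    have claim : ∀ a b', MvPolynomial.coeff γ (P.cf (fi κ N i₀) a * (∏ i ∈ s, P.cf (fi κ N i)) b') =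
        if a = a₀ then (if ∀ i, i ∉ insert i₀ s → γ i = 0 then
          P.cb b' (∏ i ∈ s, P.sg (P.e (κ i.2) (γ i))) else 0) else 0 := by
      intro a b'
      by_cases h0 : P.cf (fi κ N i₀) a = 0
      · rw [if_neg, h0]
        · simp
        · rintro rfl
          rw [ha₀, cf_e _ hc, fi_self] at h0
          exact pow_ne_zero _ (MvPolynomial.X_ne_zero _) h0
      · obtain ⟨r, rfl⟩ := cf_fi_ne κ N i₀ h0
        rw [cf_e _ hc, fi_self, MvPolynomial.X_pow_eq_monomial, MvPolynomial.coeff_monomial_mul',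
          one_mul, ih]
        by_cases hr : r = γ i₀
        · subst hr
          rw [if_pos rfl, if_pos (by simp)]
          have e1 : (∀ i ∉ s, (γ - Finsupp.single i₀ (γ i₀)) i = 0) ↔ ∀ i ∉ insert i₀ s, γ i = 0 := by
            constructor
            · intro h i hi'
              rw [Finset.mem_insert, not_or] at hi'
              have := h i hi'.2
              simpa [Finsupp.single_apply, Ne.symm hi'.1] using this
            · intro h i hi'
              by_cases hii : i = i₀
              · subst hii; simp
              · have := h i (by rw [Finset.mem_insert, not_or]; exact ⟨hii, hi'⟩)
                simp [this]
          have e2 : ∏ i ∈ s, P.sg (P.e (κ i.2) ((γ - Finsupp.single i₀ (γ i₀)) i)) =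
              ∏ i ∈ s, P.sg (P.e (κ i.2) (γ i)) := by
            refine Finset.prod_congr rfl fun i his => ?_
            have : i₀ ≠ i := by rintro rfl; exact hi his
            simp [Finsupp.single_apply, this]
          rw [e2]
          simp only [e1]
        · rw [if_neg (c := P.e (κ i₀.2) r = a₀) (fun h => hr (e_inj hc h))]
          split_ifs with h1 h2
          · exfalso
            have := h2 i₀ hi
            rw [Finsupp.single_le_iff] at h1
            simp at this
            omega
          · rfl
          · rfl
    rw [P.mul_apply _ _ b (P.deg b + P.deg a₀) (by omega), MvPolynomial.coeff_sum]
    simp only [MvPolynomial.coeff_sum, ← map_natCast (MvPolynomial.C : ℤ →+* MvPolynomial (Fin N × C) ℤ),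
      MvPolynomial.coeff_C_mul, claim]
    rw [Finset.sum_eq_single_of_mem a₀ (P.mem_upto.2 (by omega))]
    · simp only [if_true]
      rw [cb_apply, P.sg_mul_apply' _ _ _ (P.deg b + P.deg a₀) (by omega)]
      split_ifs
      · rfl
      · simp
    · intro a _ ha; simp [ha]

lemma coeff_EE (hκ : ∀ c, P.Cusp (κ c)) (γ : Fin N × C →₀ ℕ) (b : P.B) :
    MvPolynomial.coeff γ (EE κ N b) = P.cb b (∏ i, P.sg (P.e (κ i.2) (γ i))) := by
  rw [EE, coeff_EE_aux N hκ, if_pos (by simp)]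

lemma EE_H (hκ : ∀ c, P.Cusp (κ c)) (hinj : Function.Injective κ) (c : C) :
    (∏ l : Fin N, (1 - PowerSeries.C (MvPolynomial.X (l, c) : MvPolynomial (Fin N × C) ℤ) *
      PowerSeries.X)) * PowerSeries.mk (fun r => EE κ N (P.e (κ c) r)) = 1 := by
  have h1 : PowerSeries.mk (fun r => EE κ N (P.e (κ c) r)) = P.Hs (κ c) (EE κ N) := rfl
  have h2 : ∏ l : Fin N, (1 - PowerSeries.C (MvPolynomial.X (l, c) : MvPolynomial (Fin N × C) ℤ) *
      PowerSeries.X) = ∏ i : Fin N × C, (1 - PowerSeries.C (fi κ N i (κ c)) * PowerSeries.X) := by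
    rw [Fintype.prod_prod_type]
    refine Finset.prod_congr rfl fun l _ => ?_
    rw [Finset.prod_eq_single c]
    · rw [show fi κ N (l, c) (κ c) = _ from fi_self κ N (l, c)]
    · intro c' _ hc'
      have : κ c ≠ κ c' := fun h => hc' (hinj h).symm
      simp [fi, this]
    · simp
  rw [h1, EE, Hs_prod (hκ c), h2, ← Finset.prod_mul_distrib]
  exact Finset.prod_eq_one fun i _ => Hs_cf _ (hκ c)

/-- exponent vector -/
noncomputable def toF (γ : C → Fin N → ℕ) : Fin N × C →₀ ℕ :=
  Finsupp.equivFunOnFinite.symm fun i => γ i.2 i.1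

lemma toF_apply (γ : C → Fin N → ℕ) (i : Fin N × C) : toF N γ i = γ i.2 i.1 := rfl

lemma toF_inj {γ γ' : C → Fin N → ℕ} (h : toF N γ = toF N γ') : γ = γ' := by
  funext c j
  exact DFunLike.congr_fun h (j, c)

lemma detX_expand (β : C → Fin N → ℕ) :
    ∏ c, (Matrix.of fun i j : Fin N =>
      (MvPolynomial.X (j, c) : MvPolynomial (Fin N × C) ℤ) ^ β c i).det =
    ∑ σ : C → Equiv.Perm (Fin N), MvPolynomial.monomial (toF N fun c j => β c (σ c j))
      (∏ c, ((Equiv.Perm.sign (σ c) : ℤˣ) : ℤ)) := by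
  simp only [Matrix.det_apply']
  rw [Finset.prod_univ_sum, Fintype.piFinset_univ]
  refine Finset.sum_congr rfl fun σ _ => ?_
  rw [Finset.prod_mul_distrib, MvPolynomial.monomial_eq, Finsupp.prod_fintype]
  · rw [Fintype.prod_prod_type_right]
    congr 1
    rw [map_prod]; simp
  · simp

variable (κ) in
/-- Schur elements -/
noncomputable def sch (β : C → Fin N → ℕ) : P.Rb :=
  ∏ c, (hmat (fun r => P.sg (P.e (κ c) r)) (β c)).det

/-- product of Vandermonde determinants -/
noncomputable def aT (C : Type) [Fintype C] (N : ℕ) : MvPolynomial (Fin N × C) ℤ :=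
  ∏ c, (Matrix.of fun i j : Fin N =>
      (MvPolynomial.X (j, c) : MvPolynomial (Fin N × C) ℤ) ^ (i : ℕ)).det

lemma ev_sch {A : Type} [CommRing A] (X : P.Conv A) (hX : P.IsMult X) (β : C → Fin N → ℕ) :
    P.ev X hX (sch κ N β) = ∏ c, (hmat (fun r => X (P.e (κ c) r)) (β c)).det := by
  rw [sch, map_prod]
  refine Finset.prod_congr rfl fun c _ => ?_
  rw [RingHom.map_det]
  congr 1
  ext i m
  simp only [RingHom.mapMatrix_apply, Matrix.map_apply, hmat, Matrix.of_apply]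
  split_ifs
  · rw [P.ev_sg]
  · simp

lemma aT_mul (hκ : ∀ c, P.Cusp (κ c)) (hinj : Function.Injective κ) (β : C → Fin N → ℕ) :
    aT C N * P.ev (EE κ N) (EE_isMult κ N) (sch κ N β) =
     ∏ c, (Matrix.of fun i j : Fin N =>
      (MvPolynomial.X (j, c) : MvPolynomial (Fin N × C) ℤ) ^ β c i).det := by
  rw [ev_sch, aT, ← Finset.prod_mul_distrib]
  refine Finset.prod_congr rfl fun c _ => ?_
  exact jt _ _ (EE_H N hκ hinj c) (β c)

lemma sch_expand (γ : C → Fin N → ℕ) :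
    sch κ N γ = ∑ σ : C → Equiv.Perm (Fin N), (∏ c, ((Equiv.Perm.sign (σ c) : ℤˣ) : ℤ)) •
      if ∀ c j, (σ c j : ℕ) ≤ γ c j then
        ∏ i : Fin N × C, P.sg (P.e (κ i.2) (γ i.2 i.1 - (σ i.2 i.1 : ℕ))) else 0 := by
  classical
  rw [sch]
  have : ∀ c, (hmat (fun r => P.sg (P.e (κ c) r)) (γ c)).det =
    ∑ τ : Equiv.Perm (Fin N), (((Equiv.Perm.sign τ : ℤˣ) : ℤ) : P.Rb) *
      ∏ j, hmat (fun r => P.sg (P.e (κ c) r)) (γ c) j (τ j) := by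
    intro c
    rw [← Matrix.det_transpose, Matrix.det_apply']
    rfl
  simp only [this]
  rw [Finset.prod_univ_sum, Fintype.piFinset_univ]
  refine Finset.sum_congr rfl fun σ _ => ?_
  rw [Finset.prod_mul_distrib, zsmul_eq_mul, Int.cast_prod]
  congr 1
  split_ifs with h
  · rw [Fintype.prod_prod_type_right]
    refine Finset.prod_congr rfl fun c _ => Finset.prod_congr rfl fun j _ => ?_
    simp only [hmat, Matrix.of_apply]
    rw [if_pos (h c j)]
  · push Not at h
    obtain ⟨c, j, hcj⟩ := h
    refine Finset.prod_eq_zero (Finset.mem_univ c) (Finset.prod_eq_zero (Finset.mem_univ j) ?_)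
    simp only [hmat, Matrix.of_apply]
    rw [if_neg (by omega)]

lemma coeff_ev (hκ : ∀ c, P.Cusp (κ c)) (u : P.Rb) (D : ℕ) (hD : ∀ b, D < P.deg b → u.1 b = 0)
    (γ : Fin N × C →₀ ℕ) :
    MvPolynomial.coeff γ (P.ev (EE κ N) (EE_isMult κ N) u) =
      ∑ b ∈ P.upto D, u.1 b * P.cb b (∏ i, P.sg (P.e (κ i.2) (γ i))) := by
  rw [P.ev_eq _ _ u D hD, MvPolynomial.coeff_sum]
  refine Finset.sum_congr rfl fun b _ => ?_
  rw [← map_intCast (MvPolynomial.C : ℤ →+* MvPolynomial (Fin N × C) ℤ),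
      MvPolynomial.coeff_C_mul, coeff_EE N hκ]
  rfl

lemma coeff_aT (hκ : ∀ c, P.Cusp (κ c)) (u : P.Rb) (D : ℕ) (hD : ∀ b, D < P.deg b → u.1 b = 0)
    (γ : C → Fin N → ℕ) :
    MvPolynomial.coeff (toF N γ) (aT C N * P.ev (EE κ N) (EE_isMult κ N) u) =
      ∑ b ∈ P.upto D, u.1 b * P.cb b (sch κ N γ) := by
  classical
  have h1 := detX_expand (C := C) N (fun _ i => i)
  rw [aT, h1, Finset.sum_mul, MvPolynomial.coeff_sum]
  simp only [MvPolynomial.coeff_monomial_mul', coeff_ev N hκ u D hD]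
  rw [sch_expand]
  simp only [map_sum, map_zsmul, Finset.mul_sum]
  rw [Finset.sum_comm]
  refine Finset.sum_congr rfl fun σ _ => ?_
  have h2 : (toF N (fun c j => (σ c j : ℕ)) ≤ toF N γ) ↔ ∀ c j, (σ c j : ℕ) ≤ γ c j := by
    constructor
    · intro h c j; exact h (j, c)
    · intro h i; exact h i.2 i.1
  simp only [h2]
  split_ifs with h
  · refine Finset.sum_congr rfl fun b _ => ?_
    rw [smul_eq_mul]
    simp only [Finsupp.tsub_apply, toF_apply]
    ring
  · simp

lemma coeff_detX {β γ : C → Fin N → ℕ} (hβ : ∀ c, StrictMono (β c)) (hγ : ∀ c, StrictMono (γ c)) :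
    MvPolynomial.coeff (toF N γ) (∏ c, (Matrix.of fun i j : Fin N =>
      (MvPolynomial.X (j, c) : MvPolynomial (Fin N × C) ℤ) ^ β c i).det) =
    if γ = β then 1 else 0 := by
  classical
  rw [detX_expand, MvPolynomial.coeff_sum]
  simp only [MvPolynomial.coeff_monomial]
  have key : ∀ σ : C → Equiv.Perm (Fin N), (toF N fun c j => β c (σ c j)) = toF N γ →
      γ = β ∧ σ = fun _ => 1 := by
    intro σ h
    have h := toF_inj N h
    have h3 : ∀ c, σ c = 1 := by
      intro c
      have h4 : StrictMono (σ c) := by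
        intro i j hij
        have := hγ c hij
        rw [← h] at this
        exact (hβ c).lt_iff_lt.1 this
      have h5 : (σ c : Fin N → Fin N) = id := by
        refine (StrictMono.range_inj h4 strictMono_id).1 ?_
        rw [(σ c).surjective.range_eq, Set.range_id]
      ext j; rw [h5]; rfl
    refine ⟨?_, funext h3⟩
    rw [← h]; funext c j; rw [h3]; rfl
  split_ifs with h
  · subst h
    rw [Finset.sum_eq_single (fun _ => 1)]
    · simp
    · intro σ _ hσ
      rw [if_neg]
      intro h'
      exact hσ (key σ h').2
    · simp
  · refine Finset.sum_eq_zero fun σ _ => ?_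
    rw [if_neg]
    intro h'
    exact h (key σ h').1

lemma aT_ne_zero : aT C N ≠ 0 := by
  intro h
  have h2 := coeff_detX (C := C) N (β := fun _ i => i) (γ := fun _ i => i)
    (fun _ => Fin.val_strictMono) (fun _ => Fin.val_strictMono)
  rw [if_pos rfl] at h2
  rw [aT] at h
  rw [h] at h2
  simp at h2

end Setup
end PSH
end P6b

section P6c
namespace PSH
variable {q : ℝ} {Z : Type} [CommGroup Z] {P : PSH q Z}

section Setup
variable {C : Type} [Fintype C] [DecidableEq C] {κ : C → P.B} (N : ℕ)

lemma sch_ip (hκ : ∀ c, P.Cusp (κ c)) (hinj : Function.Injective κ)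
    {β γ : C → Fin N → ℕ} (hβ : ∀ c, StrictMono (β c)) (hγ : ∀ c, StrictMono (γ c)) :
    ∑ b ∈ P.upto (P.bd (sch κ N β)), (sch κ N β).1 b * (sch κ N γ).1 b = if γ = β then 1 else 0 := by
  have := coeff_aT N hκ (sch κ N β) _ (P.bd_spec _) γ
  rw [aT_mul N hκ hinj, coeff_detX N hβ hγ] at this
  exact this.symm

lemma ev_dR_sch (hκ : ∀ c, P.Cusp (κ c)) (β : C → Fin N → ℕ) :
    P.ev P.dR P.delta_isMult (sch κ N β) = ∏ c, Dnum (q ^ P.deg (κ c)) (β c) := by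
  rw [ev_sch]
  refine Finset.prod_congr rfl fun c _ => ?_
  refine det_num _ (one_lt_pow₀ P.hq (P.deg_pos (hκ c).1).ne') _ (fun r => ?_) _
  rw [P.dR_apply]; exact delta_e (hκ c) r

lemma sch_eq_sg (hκ : ∀ c, P.Cusp (κ c)) (hinj : Function.Injective κ)
    {γ : C → Fin N → ℕ} (hγ : ∀ c, StrictMono (γ c)) : ∃ b, sch κ N γ = P.sg b := by
  classical
  have h1 := sch_ip N hκ hinj hγ hγ
  rw [if_pos rfl] at h1
  set x := sch κ N γ with hx
  obtain ⟨b, hb, hb0⟩ := Finset.exists_ne_zero_of_sum_ne_zero (h1.trans_ne one_ne_zero)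
  have hxb : x.1 b ≠ 0 := left_ne_zero_of_mul hb0
  have h2 := Finset.add_sum_erase _ (fun b => x.1 b * x.1 b) hb
  rw [h1] at h2
  have h3 : 0 ≤ ∑ b ∈ (P.upto (P.bd x)).erase b, x.1 b * x.1 b :=
    Finset.sum_nonneg fun i _ => mul_self_nonneg _
  have h4 : 0 < x.1 b * x.1 b := mul_self_pos.2 hxb
  have h5 : x.1 b * x.1 b = 1 := by omega
  have h6 : ∑ b ∈ (P.upto (P.bd x)).erase b, x.1 b * x.1 b = 0 := by omega
  have h7 : ∀ b', b' ≠ b → x.1 b' = 0 := by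
    intro b' hb'
    by_cases hm : b' ∈ P.upto (P.bd x)
    · exact mul_self_eq_zero.1 ((Finset.sum_eq_zero_iff_of_nonneg fun i _ => mul_self_nonneg _).1 h6 b'
        (Finset.mem_erase.2 ⟨hb', hm⟩))
    · exact P.bd_spec _ _ (by rw [P.mem_upto] at hm; omega)
  have h8 := ev_dR_sch N hκ γ
  rw [P.ev_eq _ _ _ _ (P.bd_spec _), ← hx, Finset.sum_eq_single_of_mem b hb
    (fun b' _ hb' => by rw [h7 b' hb']; simp)] at h8
  have h9 : 0 < ((x.1 b : ℤ) : ℝ) * P.dR b := by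
    rw [h8]
    exact Finset.prod_pos fun c _ => Dnum_pos _ (one_lt_pow₀ P.hq (P.deg_pos (hκ c).1).ne') _ (hγ c)
  have h10 : 0 < ((x.1 b : ℤ) : ℝ) := by
    by_contra h
    have := mul_nonpos_of_nonpos_of_nonneg (not_lt.1 h) (P.delta_pos b).le
    rw [P.dR_apply] at h9; linarith
  have h11 : 0 < x.1 b := by exact_mod_cast h10
  have h12 : x.1 b = 1 := by nlinarith
  refine ⟨b, Subtype.ext (funext fun b' => ?_)⟩
  rw [P.sg_apply]
  split_ifs with h
  · rw [h, h12]
  · exact h7 b' h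

/-- the irreducible attached to a tuple of strictly increasing sequences -/
noncomputable def irr (hκ : ∀ c, P.Cusp (κ c)) (hinj : Function.Injective κ)
    (γ : C → Fin N → ℕ) (hγ : ∀ c, StrictMono (γ c)) : P.B := (sch_eq_sg N hκ hinj hγ).choose

lemma irr_spec (hκ : ∀ c, P.Cusp (κ c)) (hinj : Function.Injective κ)
    (γ : C → Fin N → ℕ) (hγ : ∀ c, StrictMono (γ c)) : sch κ N γ = P.sg (irr N hκ hinj γ hγ) :=
  (sch_eq_sg N hκ hinj hγ).choose_spec

lemma irr_delta (hκ : ∀ c, P.Cusp (κ c)) (hinj : Function.Injective κ)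
    (γ : C → Fin N → ℕ) (hγ : ∀ c, StrictMono (γ c)) :
    P.delta (irr N hκ hinj γ hγ) = ∏ c, Dnum (q ^ P.deg (κ c)) (γ c) := by
  rw [← ev_dR_sch N hκ, irr_spec N hκ hinj γ hγ, P.ev_sg, P.dR_apply]

lemma irr_inj (hκ : ∀ c, P.Cusp (κ c)) (hinj : Function.Injective κ)
    (γ : C → Fin N → ℕ) (hγ : ∀ c, StrictMono (γ c)) (β : C → Fin N → ℕ) (hβ : ∀ c, StrictMono (β c))
    (h : irr N hκ hinj γ hγ = irr N hκ hinj β hβ) : γ = β := by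
  classical
  by_contra hne
  have h1 := sch_ip N hκ hinj hβ hγ
  have h2 := sch_ip N hκ hinj hβ hβ
  rw [if_neg hne, irr_spec N hκ hinj γ hγ, h, ← irr_spec N hκ hinj β hβ, h2] at h1
  simp at h1

lemma irr_supp (hκ : ∀ c, P.Cusp (κ c)) (hinj : Function.Injective κ)
    (γ : C → Fin N → ℕ) (hγ : ∀ c, StrictMono (γ c)) :
    P.supp (irr N hκ hinj γ hγ) =
      ∑ c, Multiset.replicate (∑ j, γ c j - ∑ j : Fin N, (j : ℕ)) (κ c) := by
  classical
  set b := irr N hκ hinj γ hγ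
  have h1 : P.cb b (sch κ N γ) ≠ 0 := by
    rw [irr_spec N hκ hinj γ hγ, cb_apply, P.sg_apply, if_pos rfl]; simp
  rw [sch_expand, map_sum] at h1
  obtain ⟨σ, -, hσ⟩ := Finset.exists_ne_zero_of_sum_ne_zero h1
  rw [map_zsmul] at hσ
  have hσ := right_ne_zero_of_smul hσ
  split_ifs at hσ with h
  · rw [prod_sg_supp _ _ hσ]
    simp only [fun i : Fin N × C => e_supp (hκ i.2)]
    rw [Fintype.sum_prod_type_right]
    refine Finset.sum_congr rfl fun c _ => ?_
    rw [show ∑ j : Fin N, Multiset.replicate (γ c j - (σ c j : ℕ)) (κ c) =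
      Multiset.replicate (∑ j : Fin N, (γ c j - (σ c j : ℕ))) (κ c) from
      (map_sum (Multiset.replicateAddMonoidHom (κ c)) _ _).symm]
    congr 1
    rw [← Equiv.sum_comp (σ c) (fun j => (j : ℕ)), eq_tsub_iff_add_eq_of_le
      (Finset.sum_le_sum fun j _ => h c j), ← Finset.sum_add_distrib]
    exact Finset.sum_congr rfl fun j _ => by have := h c j; omega
  · simp at hσ

lemma hmat_perm {A : Type} [CommRing A] (h : ℕ → A) (β : Fin N → ℕ) (σ : Equiv.Perm (Fin N)) :
    (hmat h (β ∘ σ)).det = (Equiv.Perm.sign σ : ℤ) * (hmat h β).det := by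
  rw [← Matrix.det_permute]; rfl

lemma irr_surj (hκ : ∀ c, P.Cusp (κ c)) (hinj : Function.Injective κ) (b : P.B)
    (hb : ∀ σ ∈ P.supp b, ∃ c, κ c = σ) (hN : Multiset.card (P.supp b) ≤ N) :
    ∃ γ, ∃ hγ : ∀ c, StrictMono (γ c), irr N hκ hinj γ hγ = b := by
  classical
  by_contra hne
  push Not at hne
  have h1 : ∀ γ : C → Fin N → ℕ, (∀ c, StrictMono (γ c)) → (sch κ N γ).1 b = 0 := by
    intro γ hγ
    rw [irr_spec N hκ hinj γ hγ, P.sg_apply, if_neg]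
    exact fun h => hne γ hγ h.symm
  have h2 : ∀ γ : C → Fin N → ℕ, P.cb b (sch κ N γ) = 0 := by
    intro γ
    by_cases hγ : ∀ c, Function.Injective (γ c)
    · have h3 : sch κ N (fun c => γ c ∘ Tuple.sort (γ c)) =
          (∏ c, (Equiv.Perm.sign (Tuple.sort (γ c)) : ℤ)) • sch κ N γ := by
        rw [sch, sch, zsmul_eq_mul, Int.cast_prod, ← Finset.prod_mul_distrib]
        exact Finset.prod_congr rfl fun c _ => hmat_perm N _ _ _
      have h4 := h1 (fun c => γ c ∘ Tuple.sort (γ c)) (fun c =>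
        (Tuple.monotone_sort (γ c)).strictMono_of_injective ((hγ c).comp (Equiv.injective _)))
      rw [h3, ← cb_apply, map_zsmul, smul_eq_zero] at h4
      refine h4.resolve_left ?_
      exact Finset.prod_ne_zero_iff.2 fun c _ => Units.ne_zero _
    · push Not at hγ
      obtain ⟨c, hc⟩ := hγ
      rw [Function.Injective] at hc
      push Not at hc
      obtain ⟨i, j, hij, hne⟩ := hc
      have : sch κ N γ = 0 := by
        rw [sch]
        refine Finset.prod_eq_zero (Finset.mem_univ c) ?_
        refine Matrix.det_zero_of_row_eq hne ?_
        funext m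
        simp [hmat, hij]
      rw [this, map_zero]
  have h3 : aT C N * EE κ N b = 0 := by
    rw [← P.ev_sg (EE κ N) (EE_isMult κ N) b]
    ext m
    have hm : m = toF N (fun c j => m (j, c)) := by ext i; rfl
    rw [hm, coeff_aT N hκ (P.sg b) (P.deg b)
      (fun b' hb' => by rw [P.sg_apply, if_neg]; rintro rfl; omega), MvPolynomial.coeff_zero]
    refine Finset.sum_eq_zero fun b' _ => ?_
    rw [P.sg_apply]
    split_ifs with h
    · rw [h, h2]; simp
    · simp
  have h4 := (mul_eq_zero.1 h3).resolve_left (aT_ne_zero N)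
  have h5 := coeff_EE N hκ (toF N fun c j => if (j : ℕ) < (P.supp b).count (κ c) then 1 else 0) b
  rw [h4, MvPolynomial.coeff_zero] at h5
  have h6 : ∏ i : Fin N × C, P.sg (P.e (κ i.2) ((toF N fun c j =>
      if (j : ℕ) < (P.supp b).count (κ c) then 1 else 0) i)) = P.cp (P.supp b) := by
    have h7 : P.supp b = ∑ c, Multiset.replicate ((P.supp b).count (κ c)) (κ c) := by
      ext σ
      rw [Multiset.count_sum']
      simp only [Multiset.count_replicate]
      by_cases hσ : σ ∈ P.supp b
      · obtain ⟨c, rfl⟩ := hb σ hσ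
        rw [Finset.sum_eq_single c]
        · simp
        · intro c' _ hc'
          rw [if_neg (fun h => hc' (hinj h))]
        · simp
      · rw [Multiset.count_eq_zero_of_notMem hσ]
        symm
        refine Finset.sum_eq_zero fun c _ => ?_
        split_ifs with h
        · rw [h, Multiset.count_eq_zero_of_notMem hσ]
        · rfl
    have h8 : ∀ s : Finset C, ∀ f : C → Multiset P.B, P.cp (∑ c ∈ s, f c) = ∏ c ∈ s, P.cp (f c) := by
      intro s f
      induction s using Finset.induction_on with
      | empty => simp [P.cp_zero]
      | insert c s hc ih => rw [Finset.sum_insert hc, Finset.prod_insert hc, P.cp_add, ih]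
    conv_rhs => rw [h7, h8]
    rw [Fintype.prod_prod_type_right]
    refine Finset.prod_congr rfl fun c _ => ?_
    simp only [toF_apply]
    have h9 : ∀ j : Fin N, P.sg (P.e (κ c) (if (j : ℕ) < (P.supp b).count (κ c) then 1 else 0)) =
        if (j : ℕ) < (P.supp b).count (κ c) then P.sg (κ c) else 1 := by
      intro j
      split_ifs
      · rw [e_one (hκ c)]
      · rw [e_zero, P.sg_o]
    simp only [h9]
    rw [cp, Multiset.map_replicate, Multiset.prod_replicate, Finset.prod_ite, Finset.prod_const,
      Finset.prod_const_one, mul_one]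
    congr 1
    have hle : (P.supp b).count (κ c) ≤ N := (Multiset.count_le_card _ _).trans hN
    rw [Fin.card_filter_val_lt]
    omega
  rw [h6] at h5
  exact (P.supp_occ b).2 h5.symm

end Setup
end PSH
end P6c

section P7
lemma card_filter_antitone_aux (K : ℕ) (f : ℕ → ℕ) (hf : Antitone f) (hK : ∀ j, K ≤ j → f j = 0)
    (i j : ℕ) : j < ((Finset.range K).filter (fun j => i < f j)).card ↔ i < f j := by
  constructor
  · intro h
    by_contra h2
    have : (Finset.range K).filter (fun j => i < f j) ⊆ Finset.range j := by
      intro x hx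
      simp only [Finset.mem_filter, Finset.mem_range] at hx ⊢
      by_contra h3
      have := hf (not_lt.1 h3)
      omega
    have := Finset.card_le_card this
    simp at this; omega
  · intro h
    have : Finset.range (j + 1) ⊆ (Finset.range K).filter (fun j => i < f j) := by
      intro x hx
      simp only [Finset.mem_filter, Finset.mem_range] at hx ⊢
      have h1 := hf (show x ≤ j by omega)
      refine ⟨?_, by omega⟩
      by_contra h3
      have := hK x (by omega)
      omega
    have := Finset.card_le_card this
    simp at this; omega

section parts
variable {k : ℕ} (p : Nat.Partition k)

lemma colLen_anti : Antitone (colLen p) := by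
  intro i j hij
  refine Multiset.card_le_card (Multiset.monotone_filter_right _ fun a ha => ?_)
  omega

lemma part_le {a : ℕ} (ha : a ∈ p.parts) : a ≤ k := by
  have := Multiset.single_le_sum (fun x _ => Nat.zero_le x) a ha
  rwa [p.parts_sum] at this

lemma colLen_zero {j : ℕ} (h : k ≤ j) : colLen p j = 0 := by
  rw [colLen, Multiset.card_eq_zero, Multiset.filter_eq_nil]
  intro a ha
  have := part_le p ha
  omega

lemma sum_colLen {N : ℕ} (h : k ≤ N) : ∑ j ∈ Finset.range N, colLen p j = k := by
  have key : ∀ s : Multiset ℕ, (∀ a ∈ s, a ≤ N) →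
      ∑ j ∈ Finset.range N, Multiset.card (s.filter (fun a => j < a)) = s.sum := by
    intro s
    induction s using Multiset.induction_on with
    | empty => simp
    | cons a s ih =>
      intro hs
      simp only [Multiset.filter_cons, Multiset.card_add, Finset.sum_add_distrib, Multiset.sum_cons]
      rw [ih fun x hx => hs x (Multiset.mem_cons_of_mem hx)]
      congr 1
      have h1 : ∀ j, Multiset.card (if j < a then ({a} : Multiset ℕ) else 0) = if j < a then 1 else 0 := by
        intro j; split_ifs <;> simp
      simp only [h1]
      rw [← Finset.sum_filter, Finset.sum_const, smul_eq_mul, mul_one]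
      have : (Finset.range N).filter (fun j => j < a) = Finset.range a := by
        ext x
        have := hs a (Multiset.mem_cons_self _ _)
        simp; omega
      rw [this, Finset.card_range]
  exact (key _ fun a ha => (part_le p ha).trans h).trans p.parts_sum

lemma colLen_le (j : ℕ) : colLen p j ≤ k := by
  by_cases h : j < k
  · have := Finset.single_le_sum (f := colLen p) (fun i _ => Nat.zero_le _) (Finset.mem_range.2 h)
    rwa [sum_colLen p le_rfl] at this
  · rw [colLen_zero p (not_lt.1 h)]; omega

lemma lt_rowLen (i j : ℕ) : j < rowLen p i ↔ i < colLen p j :=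
  card_filter_antitone_aux k _ (colLen_anti p) (fun _ h => colLen_zero p h) i j

lemma rowLen_anti : Antitone (rowLen p) := by
  intro i j hij
  by_contra h
  have h1 := (lt_rowLen p j (rowLen p i)).1 (not_le.1 h)
  have h2 := (lt_rowLen p i (rowLen p i)).2 (by omega)
  omega

lemma prod_boxes {N : ℕ} (h : k ≤ N) (f : ℕ × ℕ → ℝ) :
    ∏ b ∈ boxes p, f b = ∏ j ∈ Finset.range N, ∏ i ∈ Finset.range (colLen p j), f (i, j) := by
  rw [Finset.prod_sigma']
  refine Finset.prod_bij' (fun b _ => ⟨b.2, b.1⟩) (fun s _ => (s.2, s.1)) ?_ ?_ ?_ ?_ ?_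
  · rintro ⟨i, j⟩ hb
    simp only [boxes, Finset.mem_filter, Finset.mem_product, Finset.mem_range, lt_rowLen,
      Finset.mem_sigma] at hb ⊢
    exact ⟨by omega, hb.2⟩
  · rintro ⟨j, i⟩ hb
    simp only [boxes, Finset.mem_filter, Finset.mem_product, Finset.mem_range, lt_rowLen,
      Finset.mem_sigma] at hb ⊢
    have := colLen_le p j
    refine ⟨⟨by omega, ?_⟩, hb.2⟩
    by_contra h3
    have := colLen_zero p (not_lt.1 h3)
    omega
  · intro _ _; rfl
  · intro _ _; rfl
  · intro _ _; rfl

/-- beta numbers -/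
def bet (N : ℕ) (i : ℕ) : ℕ := colLen p (N - 1 - i) + i

lemma bet_strictMono (N : ℕ) : StrictMono (bet p N) := by
  intro i j hij
  have := colLen_anti p (show N - 1 - j ≤ N - 1 - i by omega)
  rw [bet, bet]; omega

/-- The hooks in a column together with the differences of beta numbers. -/
lemma hook_col {N : ℕ} (hkN : k ≤ N) (i : ℕ) (hi : i < N) (f : ℕ → ℝ) :
    ∏ t ∈ Finset.range (bet p N i), f (t + 1) =
      (∏ r ∈ Finset.range (colLen p (N - 1 - i)), f (hookLength p (r, N - 1 - i))) *
      ∏ i' ∈ Finset.range i, f (bet p N i - bet p N i') := by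
  set j := N - 1 - i with hj
  set A := (Finset.range (colLen p j)).image (fun r => hookLength p (r, j) - 1)
  set B := (Finset.range i).image (fun i' => bet p N i - bet p N i' - 1)
  have hk : ∀ r, r < colLen p j → hookLength p (r, j) + r + j + 1 = rowLen p r + colLen p j ∧
      j < rowLen p r := by
    intro r hr
    have := (lt_rowLen p r j).2 hr
    rw [hookLength, armLength, legLength]
    dsimp only
    omega
  have hinjA : Set.InjOn (fun r => hookLength p (r, j) - 1) (Finset.range (colLen p j)) := by
    intro r hr s hs hrs
    simp only [Finset.coe_range, Set.mem_Iio] at hr hs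
    have h1 := hk r hr
    have h2 := hk s hs
    have h5 : hookLength p (r, j) = hookLength p (s, j) := by
      have h3 : 0 < hookLength p (r, j) := by rw [hookLength]; omega
      have h4 : 0 < hookLength p (s, j) := by rw [hookLength]; omega
      dsimp only at hrs; omega
    rcases lt_trichotomy r s with h | h | h
    · have := rowLen_anti p h.le; omega
    · exact h
    · have := rowLen_anti p h.le; omega
  have hinjB : Set.InjOn (fun i' => bet p N i - bet p N i' - 1) (Finset.range i) := by
    intro r hr s hs hrs
    simp only [Finset.coe_range, Set.mem_Iio] at hr hs
    have h1 := bet_strictMono p N hr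
    have h2 := bet_strictMono p N hs
    dsimp only at hrs
    exact (bet_strictMono p N).injective (by omega)
  have hdisj : Disjoint A B := by
    rw [Finset.disjoint_left]
    intro x hA hB
    simp only [A, B, Finset.mem_image, Finset.mem_range] at hA hB
    obtain ⟨r, hr, rfl⟩ := hA
    obtain ⟨s, hs, h⟩ := hB
    have h1 := hk r hr
    have h2 := bet_strictMono p N hs
    have h3 : 0 < hookLength p (r, j) := by rw [hookLength]; omega
    have h4 : bet p N i = colLen p j + i := rfl
    have h5 : bet p N s = colLen p (N - 1 - s) + s := rfl
    have h6 := lt_rowLen p r (N - 1 - s)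
    by_cases h7 : r < colLen p (N - 1 - s)
    · have := h6.2 h7; omega
    · have := fun h => h7 (h6.1 h); omega
  have hsub : A ∪ B ⊆ Finset.range (bet p N i) := by
    intro x hx
    simp only [A, B, Finset.mem_union, Finset.mem_image, Finset.mem_range] at hx ⊢
    rcases hx with ⟨r, hr, rfl⟩ | ⟨s, hs, rfl⟩
    · have h1 := hk r hr
      have h4 : bet p N i = colLen p j + i := rfl
      have h6 : rowLen p r ≤ N := by
        refine le_trans ?_ hkN
        rw [rowLen]
        exact (Finset.card_filter_le _ _).trans (by simp)
      omega
    · have := bet_strictMono p N hs; omega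
  have hcard : (A ∪ B).card = (Finset.range (bet p N i)).card := by
    rw [Finset.card_union_of_disjoint hdisj, Finset.card_image_of_injOn hinjA,
      Finset.card_image_of_injOn hinjB]
    simp [bet, hj]
  have heq := Finset.eq_of_subset_of_card_le hsub hcard.ge
  rw [← heq, Finset.prod_union hdisj, Finset.prod_image hinjA, Finset.prod_image hinjB]
  congr 1
  refine Finset.prod_congr rfl fun s hs => ?_
  congr 1
  have := bet_strictMono p N (Finset.mem_range.1 hs); omega

lemma prod_Ioi_eq (N : ℕ) (g : ℕ → ℕ → ℝ) :
    ∏ i : Fin N, ∏ j ∈ Finset.Ioi i, g i j = ∏ j ∈ Finset.range N, ∏ i ∈ Finset.range j, g i j := by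
  rw [Finset.prod_comm' (t' := Finset.univ) (s' := fun j => Finset.Iio j) (by simp)]
  rw [← Fin.prod_univ_eq_prod_range]
  refine Finset.prod_congr rfl fun j _ => ?_
  have h : Finset.range (j : ℕ) = (Finset.Iio j).map Fin.valEmbedding := by
    rw [Fin.map_valEmbedding_Iio]; ext; simp
  rw [h, Finset.prod_map]; rfl

lemma choose_two_aux (l i : ℕ) : (i + 1).choose 2 + (l + i).choose 2 = l.choose 2 + (l + i) * i := by
  have h1 : ∀ n : ℕ, (n.choose 2 : ℚ) = n * (n - 1) / 2 := fun n => Nat.cast_choose_two ℚ n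
  have : (((i + 1).choose 2 + (l + i).choose 2 : ℕ) : ℚ) = (l.choose 2 + (l + i) * i : ℕ) := by
    push_cast [h1]; ring
  exact_mod_cast this

lemma Dnum_bet {N : ℕ} (hkN : k ≤ N) (Q : ℝ) (hQ : 1 < Q) :
    Dnum Q (fun i : Fin N => bet p N i) * ∏ b ∈ boxes p, (Q ^ hookLength p b - 1) =
      Q ^ ∑ j ∈ Finset.range N, (colLen p j).choose 2 := by
  have hQ0 : Q ≠ 0 := by linarith
  have hne : ∀ t : ℕ, 0 < t → Q ^ t - 1 ≠ 0 := fun t ht => by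
    have := one_lt_pow₀ hQ ht.ne'; linarith
  rw [Dnum, prod_boxes p hkN, prod_Ioi_eq N (fun i j => (Q ^ bet p N i)⁻¹ - (Q ^ bet p N j)⁻¹),
    Fin.prod_univ_eq_prod_range (fun i => Q ^ (bet p N i).choose 2 /
      ∏ k ∈ Finset.range (bet p N i), (Q ^ (k + 1) - 1)) N,
    Fin.sum_univ_eq_sum_range (fun m => (m + 1).choose 2) N,
    ← Finset.prod_pow_eq_pow_sum, ← Finset.prod_pow_eq_pow_sum, ← Finset.prod_mul_distrib,
    ← Finset.prod_mul_distrib, ← Finset.prod_range_reflect (fun j => Q ^ (colLen p j).choose 2),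
    ← Finset.prod_range_reflect (fun j => ∏ i ∈ Finset.range (colLen p j), _),
    ← Finset.prod_mul_distrib]
  refine Finset.prod_congr rfl fun i hi => ?_
  have hi := Finset.mem_range.1 hi
  have h1 := hook_col p hkN i hi (fun t => Q ^ t - 1)
  have h2 : ∏ i' ∈ Finset.range i, ((Q ^ bet p N i')⁻¹ - (Q ^ bet p N i)⁻¹) =
      ((Q ^ bet p N i)⁻¹) ^ i * ∏ i' ∈ Finset.range i, (Q ^ (bet p N i - bet p N i') - 1) := by
    have h0 : ((Q ^ bet p N i)⁻¹) ^ i = ∏ _x ∈ Finset.range i, (Q ^ bet p N i)⁻¹ := by simp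
    rw [h0, ← Finset.prod_mul_distrib]
    refine Finset.prod_congr rfl fun s hs => ?_
    have h3 := bet_strictMono p N (Finset.mem_range.1 hs)
    rw [pow_sub₀ _ hQ0 h3.le]
    field_simp
  have hH : ∏ r ∈ Finset.range (colLen p (N - 1 - i)), (Q ^ hookLength p (r, N - 1 - i) - 1) ≠ 0 :=
    Finset.prod_ne_zero_iff.2 fun r _ => hne _ (by rw [hookLength]; omega)
  have hZ : ∏ i' ∈ Finset.range i, (Q ^ (bet p N i - bet p N i') - 1) ≠ 0 :=
    Finset.prod_ne_zero_iff.2 fun s hs => hne _ (by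
      have h3 := bet_strictMono p N (Finset.mem_range.1 hs); omega)
  rw [h1, h2]
  have h4 := choose_two_aux (colLen p (N - 1 - i)) i
  have h5 : Q ^ (i + 1).choose 2 * Q ^ (bet p N i).choose 2 =
    Q ^ (colLen p (N - 1 - i)).choose 2 * (Q ^ bet p N i) ^ i := by
    rw [← pow_add, ← pow_mul, ← pow_add, bet, h4]
  have h6 : (Q ^ bet p N i) ^ i ≠ 0 := pow_ne_zero _ (pow_ne_zero _ hQ0)
  rw [inv_pow]
  generalize (Q ^ bet p N i) ^ i = B at *
  generalize (∏ r ∈ Finset.range (colLen p (N - 1 - i)), (Q ^ hookLength p (r, N - 1 - i) - 1)) = H at *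
  generalize (∏ i' ∈ Finset.range i, (Q ^ (bet p N i - bet p N i') - 1)) = Z at *
  generalize Q ^ (i + 1).choose 2 = a at *
  generalize Q ^ (bet p N i).choose 2 = b at *
  generalize Q ^ (colLen p (N - 1 - i)).choose 2 = c at *
  field_simp
  linear_combination h5

/-- the local factor in the statement -/
noncomputable def Hp (g : ℕ) (Q : ℝ) {k : ℕ} (p : Nat.Partition k) : ℝ :=
  Q ^ (-(((g : ℤ) - 1) * (pairing p : ℤ))) *
    ∏ b ∈ boxes p, (1 - Q ^ hookLength p b) ^ (2 * (g : ℤ) - 2)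

lemma Hp_eq (g : ℕ) {N : ℕ} (hkN : k ≤ N) (Q : ℝ) (hQ : 1 < Q) :
    Hp g Q p = Q ^ (-(((g : ℤ) - 1) * k)) *
      (Dnum Q (fun i : Fin N => bet p N i)) ^ (-(2 * (g : ℤ) - 2)) := by
  have hQ0 : Q ≠ 0 := by linarith
  have hne : ∀ b ∈ boxes p, Q ^ hookLength p b - 1 ≠ 0 := fun b _ => by
    have := one_lt_pow₀ hQ (show hookLength p b ≠ 0 by rw [hookLength]; omega); linarith
  have hX : ∏ b ∈ boxes p, (Q ^ hookLength p b - 1) ≠ 0 := Finset.prod_ne_zero_iff.2 hne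
  have h1 := Dnum_bet p hkN Q hQ
  have h2 : Dnum Q (fun i : Fin N => bet p N i) = Q ^ (∑ j ∈ Finset.range N, (colLen p j).choose 2) *
      (∏ b ∈ boxes p, (Q ^ hookLength p b - 1))⁻¹ := by
    rw [← h1]; field_simp
  have h3 : ∏ b ∈ boxes p, (1 - Q ^ hookLength p b) ^ (2 * (g : ℤ) - 2) =
      (∏ b ∈ boxes p, (Q ^ hookLength p b - 1)) ^ (2 * (g : ℤ) - 2) := by
    rw [← Finset.prod_zpow]
    refine Finset.prod_congr rfl fun b _ => ?_
    rw [← neg_sub, Even.neg_zpow]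
    exact ⟨(g : ℤ) - 1, by ring⟩
  have h4 : (pairing p : ℤ) = 2 * (∑ j ∈ Finset.range N, (colLen p j).choose 2 : ℕ) + k := by
    have h5 : pairing p = ∑ j ∈ Finset.range N, (colLen p j) ^ 2 := by
      rw [pairing]
      refine Finset.sum_subset (by simpa using hkN) fun x _ hx => ?_
      rw [colLen_zero p (by simpa using hx)]; rfl
    have h6 : pairing p = 2 * (∑ j ∈ Finset.range N, (colLen p j).choose 2 : ℕ) + k := by
      rw [h5]
      refine Eq.trans ?_ (congrArg (2 * (∑ j ∈ Finset.range N, (colLen p j).choose 2 : ℕ) + ·)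
        (sum_colLen p hkN))
      rw [Finset.mul_sum, ← Finset.sum_add_distrib]
      refine Finset.sum_congr rfl fun j _ => ?_
      rw [Nat.choose_two_right, Nat.mul_div_cancel' (Nat.even_mul_pred_self _).two_dvd]
      cases colLen p j <;> simp <;> ring
    exact_mod_cast h6
  rw [Hp, h3, h2, mul_zpow, inv_zpow', neg_neg, ← mul_assoc, ← zpow_natCast, ← zpow_mul,
    ← zpow_add₀ hQ0, h4]
  congr 2
  push_cast; ring

lemma bet_sum {N : ℕ} (hkN : k ≤ N) : ∑ i : Fin N, bet p N i = k + ∑ j : Fin N, (j : ℕ) := by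
  rw [Fin.sum_univ_eq_sum_range (fun i => bet p N i) N, Fin.sum_univ_eq_sum_range (fun i => i) N]
  simp only [bet]
  rw [Finset.sum_add_distrib, Finset.sum_range_reflect (colLen p) N, sum_colLen p hkN]

lemma colLen_count (a : ℕ) : colLen p a = p.parts.count (a + 1) + colLen p (a + 1) := by
  have key : ∀ s : Multiset ℕ, Multiset.card (s.filter (fun x => a < x)) =
      s.count (a + 1) + Multiset.card (s.filter (fun x => a + 1 < x)) := by
    intro s
    induction s using Multiset.induction_on with
    | empty => simp
    | cons x s ih =>
      rw [Multiset.filter_cons, Multiset.filter_cons, Multiset.count_cons, Multiset.card_add,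
        Multiset.card_add, ih]
      split_ifs <;> first | omega | (simp; try omega)
  exact key _

lemma colLen_inj {k : ℕ} {p p' : Nat.Partition k} (h : ∀ j, colLen p j = colLen p' j) : p = p' := by
  apply Nat.Partition.ext
  ext a
  cases a with
  | zero =>
    rw [Multiset.count_eq_zero_of_notMem fun h => (p.parts_pos h).ne' rfl,
      Multiset.count_eq_zero_of_notMem fun h => (p'.parts_pos h).ne' rfl]
  | succ a =>
    have h1 := colLen_count p a
    have h2 := colLen_count p' a
    rw [h a, h (a + 1)] at h1
    omega

lemma bet_inj {k : ℕ} {p p' : Nat.Partition k} {N : ℕ} (hkN : k ≤ N)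
    (h : (fun i : Fin N => bet p N i) = fun i : Fin N => bet p' N i) : p = p' := by
  refine colLen_inj fun j => ?_
  by_cases hj : j < N
  · have := congrFun h ⟨N - 1 - j, by omega⟩
    dsimp only at this
    rw [bet, bet, show N - 1 - (N - 1 - j) = j by omega] at this
    omega
  · rw [colLen_zero p (by omega), colLen_zero p' (by omega)]

lemma exists_colLen (l : ℕ → ℕ) (hl : Antitone l) (N : ℕ) (h0 : ∀ j, N ≤ j → l j = 0) (k : ℕ)
    (hk : ∑ j ∈ Finset.range N, l j = k) : ∃ p : Nat.Partition k, ∀ j, colLen p j = l j := by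
  have hlk : ∀ j, l j ≤ k := by
    intro j
    by_cases h : j < N
    · rw [← hk]; exact Finset.single_le_sum (f := l) (fun i _ => Nat.zero_le _) (Finset.mem_range.2 h)
    · rw [h0 j (by omega)]; omega
  set r : ℕ → ℕ := fun i => ((Finset.range N).filter (fun j => i < l j)).card with hr
  have hr' : ∀ i j, j < r i ↔ i < l j := fun i j => card_filter_antitone_aux N l hl h0 i j
  refine ⟨Nat.Partition.ofSums k ((Multiset.range k).map r) ?_, fun j => ?_⟩
  · change ∑ i ∈ Finset.range k, r i = k
    simp only [hr, Finset.card_filter]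
    rw [Finset.sum_comm, ← hk]
    refine Finset.sum_congr rfl fun j _ => ?_
    rw [← Finset.card_filter]
    have : (Finset.range (∑ j ∈ Finset.range N, l j)).filter (fun i => i < l j) = Finset.range (l j) := by
      ext x
      have := hlk j
      simp only [Finset.mem_filter, Finset.mem_range, hk]; omega
    rw [this, Finset.card_range]
  · rw [colLen, Nat.Partition.ofSums]
    dsimp only
    rw [Multiset.filter_filter, Multiset.filter_map, Multiset.card_map]
    have : ((Multiset.range k).filter ((fun a => j < a ∧ a ≠ 0) ∘ r)) =
      ((Finset.range k).filter (fun i => i < l j)).val := by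
      rw [Finset.filter_val, Finset.range_val]
      refine Multiset.filter_congr fun i _ => ?_
      rw [← hr' i j]
      simp only [Function.comp]
      omega
    rw [this, Finset.card_val]
    have : (Finset.range k).filter (fun i => i < l j) = Finset.range (l j) := by
      ext x
      have := hlk j
      simp only [Finset.mem_filter, Finset.mem_range]; omega
    rw [this, Finset.card_range]

lemma bet_surj {k N : ℕ} (γ : Fin N → ℕ) (hγ : StrictMono γ)
    (hs : ∑ i, γ i = k + ∑ j : Fin N, (j : ℕ)) :
    ∃ p : Nat.Partition k, γ = fun i : Fin N => bet p N i := by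
  have hge : ∀ n : ℕ, ∀ (i j : Fin N), (i : ℕ) + n = j → γ i + n ≤ γ j := by
    intro n
    induction n with
    | zero => intro i j h; rw [show i = j from Fin.ext (by omega)]; omega
    | succ n ih =>
      intro i j h
      have h1 := ih i ⟨i + n, by omega⟩ rfl
      have h2 : γ ⟨i + n, by omega⟩ < γ j := hγ (by rw [Fin.lt_def]; dsimp only; omega)
      omega
  have hge0 : ∀ i : Fin N, (i : ℕ) ≤ γ i := by
    intro i
    have hi := i.2
    have := hge i ⟨0, by omega⟩ i (by simp)
    omega
  set l : ℕ → ℕ := fun j => if h : j < N then γ ⟨N - 1 - j, by omega⟩ - (N - 1 - j) else 0 with hldef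
  have hlanti : Antitone l := by
    intro i j hij
    simp only [hldef]
    split_ifs with h1 h2 h2
    · have := hge (j - i) ⟨N - 1 - j, by omega⟩ ⟨N - 1 - i, by omega⟩ (by dsimp only; omega)
      omega
    · omega
    · omega
    · omega
  have hl : ∀ i : Fin N, l (N - 1 - i) + i = γ i := by
    intro i
    have h1 : N - 1 - (i : ℕ) < N := by omega
    simp only [hldef]
    rw [dif_pos h1]
    have h2 : (⟨N - 1 - (N - 1 - (i : ℕ)), by omega⟩ : Fin N) = i := Fin.ext (by dsimp only; omega)
    rw [h2]
    have := hge0 i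
    omega
  obtain ⟨p, hp⟩ := exists_colLen l hlanti N (fun j hj => by simp [hldef, Nat.not_lt.2 hj]) k (by
    rw [← Finset.sum_range_reflect l N, ← Fin.sum_univ_eq_sum_range (fun j => l (N - 1 - j)) N]
    have : ∑ i, γ i = ∑ i : Fin N, l (N - 1 - i) + ∑ i : Fin N, (i : ℕ) := by
      rw [← Finset.sum_add_distrib]
      exact Finset.sum_congr rfl fun i _ => (hl i).symm
    omega)
  refine ⟨p, ?_⟩
  funext i
  rw [bet, hp, hl]

end parts
end P7

section P8a
open PowerSeries

/-- Euler operator -/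
noncomputable def th (P : PowerSeries ℂ) : PowerSeries ℂ := X * derivative ℂ P

lemma coeff_th (P : PowerSeries ℂ) (k : ℕ) : coeff k (th P) = k * coeff k P := by
  cases k with
  | zero => simp [th]
  | succ k => rw [th, coeff_succ_X_mul, coeff_derivative]; push_cast; ring

/-- logarithmic derivative relation -/
def LD (P U : PowerSeries ℂ) : Prop := th P = P * U

lemma LD.mul {P U P' U' : PowerSeries ℂ} (h : LD P U) (h' : LD P' U') : LD (P * P') (U + U') := by
  rw [LD, th] at *
  rw [Derivation.leibniz, smul_eq_mul, smul_eq_mul]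
  linear_combination P' * h + P * h'

lemma LD.prod {ι : Type} (s : Finset ι) (P U : ι → PowerSeries ℂ) (h : ∀ i ∈ s, LD (P i) (U i)) :
    LD (∏ i ∈ s, P i) (∑ i ∈ s, U i) := by
  classical
  induction s using Finset.induction_on with
  | empty => simp [LD, th]
  | insert a s ha ih =>
    rw [Finset.prod_insert ha, Finset.sum_insert ha]
    exact (h a (by simp)).mul (ih fun i hi => h i (by simp [hi]))

/-- substitution `X ↦ w X^d` -/
noncomputable def sb (d : ℕ) (hd : d ≠ 0) (w : ℂ) (P : PowerSeries ℂ) : PowerSeries ℂ :=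
  expand d hd (rescale w P)

lemma coeff_sb (d : ℕ) (hd : d ≠ 0) (w : ℂ) (P : PowerSeries ℂ) (k : ℕ) :
    coeff k (sb d hd w P) = if d ∣ k then w ^ (k / d) * coeff (k / d) P else 0 := by
  rw [sb]
  split_ifs with h
  · obtain ⟨m, rfl⟩ := h
    rw [coeff_expand_mul, coeff_rescale, Nat.mul_div_cancel_left _ (Nat.pos_of_ne_zero hd)]
  · exact coeff_expand_of_not_dvd _ _ _ h

lemma LD.sb {P U : PowerSeries ℂ} (h : LD P U) (d : ℕ) (hd : d ≠ 0) (w : ℂ) :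
    LD (sb d hd w P) (C (d : ℂ) * Statement11.sb d hd w U) := by
  have h1 : th (Statement11.sb d hd w P) = C (d : ℂ) * Statement11.sb d hd w (th P) := by
    ext k
    rw [coeff_th, coeff_C_mul, coeff_sb, coeff_sb]
    split_ifs with hk
    · obtain ⟨m, rfl⟩ := hk
      rw [Nat.mul_div_cancel_left _ (Nat.pos_of_ne_zero hd), coeff_th]
      push_cast; ring
    · simp
  rw [LD] at *
  rw [h1, h]
  simp only [Statement11.sb, map_mul]
  ring

lemma coeff_prod_sb {ι : Type} [Fintype ι] [DecidableEq ι] (d : ι → ℕ) (hd : ∀ i, d i ≠ 0)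
    (w : ι → ℂ) (P : ι → PowerSeries ℂ) (n : ℕ) :
    coeff n (∏ i, sb (d i) (hd i) (w i) (P i)) =
      ∑ k ∈ (Fintype.piFinset fun _ : ι => Finset.range (n + 1)).filter (fun k => ∑ i, k i * d i = n),
        ∏ i, (w i ^ k i * coeff (k i) (P i)) := by
  rw [PowerSeries.coeff_prod]
  symm
  have hle : ∀ k : ι → ℕ, ∑ i, k i * d i = n → ∀ i, k i < n + 1 := by
    intro k hk i
    have h1 := Finset.single_le_sum (f := fun i => k i * d i) (fun i _ => Nat.zero_le _)
      (Finset.mem_univ i)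
    have h2 : k i * 1 ≤ k i * d i := Nat.mul_le_mul_left _ (Nat.pos_of_ne_zero (hd i))
    omega
  refine Finset.sum_of_injOn (fun k => Finsupp.equivFunOnFinite.symm fun i => k i * d i) ?_ ?_ ?_ ?_
  · intro k _ k' _ h
    funext i
    have := DFunLike.congr_fun h i
    simp only [Finsupp.equivFunOnFinite_symm_apply_apply] at this
    exact Nat.eq_of_mul_eq_mul_right (Nat.pos_of_ne_zero (hd i)) this
  · intro k hk
    simp only [Finset.coe_filter, Set.mem_setOf_eq] at hk
    simp [Finset.mem_finsuppAntidiag, hk.2]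
  · intro l hl hl2
    by_cases h : ∀ i, d i ∣ l i
    · exfalso
      apply hl2
      have hs : ∑ i, l i / d i * d i = n := by
        rw [Finset.mem_finsuppAntidiag] at hl
        rw [← hl.1]
        exact Finset.sum_congr rfl fun i _ => Nat.div_mul_cancel (h i)
      refine ⟨fun i => l i / d i, ?_, ?_⟩
      · simp only [Finset.coe_filter, Set.mem_setOf_eq, Fintype.mem_piFinset, Finset.mem_range]
        exact ⟨hle _ hs, hs⟩
      · ext i
        simp [Nat.div_mul_cancel (h i)]
    · push Not at h
      obtain ⟨i, hi⟩ := h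
      refine Finset.prod_eq_zero (Finset.mem_univ i) ?_
      rw [coeff_sb, if_neg hi]
  · intro k _
    refine Finset.prod_congr rfl fun i _ => ?_
    rw [coeff_sb, Finsupp.equivFunOnFinite_symm_apply_apply, if_pos (Dvd.intro_left _ rfl),
      Nat.mul_div_cancel _ (Nat.pos_of_ne_zero (hd i))]
end P8a

section P8b
open PowerSeries

/-- partitions of size between 1 and `K` -/
def sK (K : ℕ) : Finset (Σ k : ℕ, Nat.Partition k) := (Finset.Icc 1 K).sigma fun _ => Finset.univ

lemma mem_sK {K : ℕ} {p : Σ k : ℕ, Nat.Partition k} : p ∈ sK K ↔ 1 ≤ p.1 ∧ p.1 ≤ K := by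
  simp [sK]

noncomputable def mon (g : ℕ) (Q : ℝ) (p : Σ k : ℕ, Nat.Partition k) : PowerSeries ℂ :=
  monomial p.1 ((Hp g Q p.2 : ℝ) : ℂ)

noncomputable def AA (g : ℕ) (Q : ℝ) (K : ℕ) : PowerSeries ℂ := ∑ p ∈ sK K, mon g Q p

lemma prod_mon (g : ℕ) (Q : ℝ) (S : Multiset (Σ k : ℕ, Nat.Partition k)) :
    (S.map (mon g Q)).prod = monomial (S.map Sigma.fst).sum
      (((S.map fun p => Hp g Q p.2).prod : ℝ) : ℂ) := by
  induction S using Multiset.induction_on with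
  | empty => simp
  | cons a S ih =>
    rw [Multiset.map_cons, Multiset.prod_cons, ih, mon, monomial_mul_monomial]
    simp

lemma countPerms_spec {α : Type} [DecidableEq α] (S : Multiset α) :
    (S.countPerms : ℝ) * (∏ p ∈ S.toFinset, ((S.count p).factorial : ℝ)) = (Multiset.card S).factorial := by
  have h := Nat.multinomial_spec S.toFinset S.count
  rw [Multiset.toFinset_sum_count_eq] at h
  have h2 : S.countPerms = Nat.multinomial S.toFinset S.count := by
    rw [Multiset.countPerms, Finsupp.multinomial_eq]
    simp only [Multiset.toFinsupp_support]
    rfl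
  rw [h2, ← h]; push_cast; ring

lemma coeff_AA_pow (g : ℕ) (Q : ℝ) (K M m : ℕ) :
    coeff m (AA g Q K ^ M) = ∑ S ∈ ((sK K).sym M).filter (fun S => (S.toMultiset.map Sigma.fst).sum = m),
      ((S.toMultiset.countPerms * (S.toMultiset.map fun p => Hp g Q p.2).prod : ℝ) : ℂ) := by
  rw [AA, Finset.sum_pow, map_sum, Finset.sum_filter]
  refine Finset.sum_congr rfl fun S _ => ?_
  have key : ∀ T : Multiset (Σ k : ℕ, Nat.Partition k),
      coeff m ((T.countPerms : PowerSeries ℂ) * (T.map (mon g Q)).prod) =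
        if (T.map Sigma.fst).sum = m then
          ((T.countPerms * (T.map fun p => Hp g Q p.2).prod : ℝ) : ℂ) else 0 := by
    intro T
    rw [prod_mon, ← nsmul_eq_mul, map_nsmul, coeff_monomial]
    by_cases h : (T.map Sigma.fst).sum = m
    · rw [if_pos h.symm, if_pos h, nsmul_eq_mul]; push_cast; rfl
    · rw [if_neg (Ne.symm h), if_neg h, nsmul_zero]
  exact key S.toMultiset

lemma Upoly_eq (g : ℕ) (Q : ℝ) (K m : ℕ) (hm : 1 ≤ m) (hK : m ≤ K) :
    ((Upoly g m Q : ℝ) : ℂ) =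
      m * ∑ M ∈ Finset.Icc 1 m, (-1 : ℂ) ^ (M - 1) / M * coeff m (AA g Q K ^ M) := by
  classical
  set E : Finset (Multiset (Σ k : ℕ, Nat.Partition k)) := (Finset.Icc 1 m).biUnion fun M =>
    (((sK K).sym M).filter (fun S => (S.toMultiset.map Sigma.fst).sum = m)).image Sym.toMultiset with hE
  have hmem : ∀ S : Multiset (Σ k : ℕ, Nat.Partition k),
      ((∀ p ∈ S, p.1 ≠ 0) ∧ (S.map Sigma.fst).sum = m) ↔ S ∈ (E : Set _) := by
    intro S
    simp only [hE, Finset.mem_coe, Finset.mem_biUnion, Finset.mem_image, Finset.mem_filter,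
      Finset.mem_Icc, Finset.mem_sym_iff]
    constructor
    · rintro ⟨h1, h2⟩
      have hc : Multiset.card S ≤ m := by
        have h3 : Multiset.card (S.map Sigma.fst) • 1 ≤ (S.map Sigma.fst).sum :=
          Multiset.card_nsmul_le_sum fun x hx => by
            obtain ⟨p, hp, rfl⟩ := Multiset.mem_map.1 hx
            have := h1 p hp
            omega
        rw [Multiset.card_map, h2] at h3
        simpa using h3
      refine ⟨Multiset.card S, ⟨?_, hc⟩, ⟨S, rfl⟩, ⟨fun p hp => ?_, h2⟩, rfl⟩
      · by_contra h0
        have : S = 0 := by rw [← Multiset.card_eq_zero]; omega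
        subst this
        simp at h2; omega
      · have hp : p ∈ S := hp
        rw [mem_sK]
        have h3 := Multiset.single_le_sum (fun x _ => Nat.zero_le x) p.1
          (Multiset.mem_map_of_mem Sigma.fst hp)
        have := h1 p hp
        omega
    · rintro ⟨M, -, S', ⟨h1, h2⟩, rfl⟩
      refine ⟨fun p hp => ?_, h2⟩
      have := mem_sK.1 (h1 p hp)
      omega
  rw [Upoly]
  simp only [hmem]
  rw [finsum_mem_coe_finset, hE, Finset.sum_biUnion]
  · push_cast
    congr 1
    refine Finset.sum_congr rfl fun M hM => ?_
    rw [Finset.sum_image Sym.coe_injective.injOn, coeff_AA_pow, Finset.mul_sum]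
    refine Finset.sum_congr rfl fun S _ => ?_
    have hM1 := (Finset.mem_Icc.1 hM).1
    have hS : Multiset.card S.toMultiset = M := S.2
    have h1 := countPerms_spec S.toMultiset
    rw [hS] at h1 ⊢
    have h2 : (∏ p ∈ S.toMultiset.toFinset, ((S.toMultiset.count p).factorial : ℝ)) ≠ 0 :=
      Finset.prod_ne_zero_iff.2 fun p _ => by positivity
    have h3 : (M.factorial : ℝ) = M * (M - 1).factorial := by
      exact_mod_cast (Nat.mul_factorial_pred (by omega)).symm
    have hM0 : (M : ℝ) ≠ 0 := by positivity
    have h4 : ((M - 1).factorial : ℝ) / (∏ p ∈ S.toMultiset.toFinset, ((S.toMultiset.count p).factorial : ℝ)) =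
        S.toMultiset.countPerms / M := by
      rw [div_eq_div_iff h2 hM0, h1, h3]; ring
    have h5 : ((-1 : ℝ) ^ (M - 1) * (M - 1).factorial /
        (∏ p ∈ S.toMultiset.toFinset, ((S.toMultiset.count p).factorial : ℝ)) * (S.toMultiset.map fun p => Hp g Q p.2).prod) =
      (-1) ^ (M - 1) / M * (S.toMultiset.countPerms * (S.toMultiset.map fun p => Hp g Q p.2).prod) := by
      rw [mul_div_assoc, h4]; ring
    have h6 := congrArg (fun x : ℝ => (x : ℂ)) h5
    push_cast at h6 ⊢
    exact h6
  · intro M _ M' _ hne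
    rw [Function.onFun, Finset.disjoint_left]
    intro S h1 h2
    simp only [Finset.mem_image] at h1 h2
    obtain ⟨S1, -, rfl⟩ := h1
    obtain ⟨S2, -, h⟩ := h2
    exact hne (S1.2.symm.trans ((congrArg Multiset.card h).symm.trans S2.2))

lemma X_dvd_AA (g : ℕ) (Q : ℝ) (K : ℕ) : X ∣ AA g Q K := by
  refine Finset.dvd_sum fun p hp => ?_
  rw [X_dvd_iff, mon, ← coeff_zero_eq_constantCoeff_apply, coeff_monomial, if_neg]
  have := mem_sK.1 hp; omega

/-- generating series of partitions -/
noncomputable def PP (g : ℕ) (Q : ℝ) (K : ℕ) : PowerSeries ℂ := 1 + AA g Q K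

noncomputable def UU (g : ℕ) (Q : ℝ) (K : ℕ) : PowerSeries ℂ := th (PP g Q K) * (PP g Q K)⁻¹

lemma PP_inv (g : ℕ) (Q : ℝ) (K : ℕ) : PP g Q K * (PP g Q K)⁻¹ = 1 := by
  refine PowerSeries.mul_inv_cancel _ ?_
  rw [PP, map_add, X_dvd_iff.1 (X_dvd_AA g Q K)]; simp

lemma LD_PP (g : ℕ) (Q : ℝ) (K : ℕ) : LD (PP g Q K) (UU g Q K) := by
  rw [LD, UU]
  linear_combination (-th (PP g Q K)) * PP_inv g Q K

lemma coeff_UU_zero (g : ℕ) (Q : ℝ) (K : ℕ) : coeff 0 (UU g Q K) = 0 := by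
  rw [UU, th, mul_assoc]; simp

lemma coeff_UU (g : ℕ) (Q : ℝ) (K m : ℕ) (hm : 1 ≤ m) (hK : m ≤ K) :
    coeff m (UU g Q K) = ((Upoly g m Q : ℝ) : ℂ) := by
  rw [Upoly_eq g Q K m hm hK]
  set A := AA g Q K with hA
  have h1 : ∀ M ∈ Finset.Icc 1 m, (m : ℂ) * ((-1 : ℂ) ^ (M - 1) / M * coeff m (A ^ M)) =
      coeff m (th A * (-A) ^ (M - 1)) := by
    intro M hM
    have hM := (Finset.mem_Icc.1 hM).1
    have h2 := coeff_th (A ^ M) m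
    have h3 : th (A ^ M) = C (M : ℂ) * (th A * A ^ (M - 1)) := by
      rw [th, derivative_pow, th]; simp; ring
    rw [h3, coeff_C_mul] at h2
    have hM0 : (M : ℂ) ≠ 0 := by norm_cast; omega
    have h4 : th A * (-A) ^ (M - 1) = C ((-1 : ℂ) ^ (M - 1)) * (th A * A ^ (M - 1)) := by
      rw [neg_pow]; simp; ring
    rw [h4, coeff_C_mul]
    field_simp
    linear_combination -h2
  rw [Finset.mul_sum, Finset.sum_congr rfl h1, ← map_sum, ← Finset.mul_sum]
  have h5 : ∑ M ∈ Finset.Icc 1 m, (-A) ^ (M - 1) = ∑ i ∈ Finset.range m, (-A) ^ i := by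
    refine Finset.sum_bij' (fun M _ => M - 1) (fun i _ => i + 1) ?_ ?_ ?_ ?_ ?_
    · intro M hM; simp only [Finset.mem_Icc, Finset.mem_range] at *; omega
    · intro M hM; simp only [Finset.mem_Icc, Finset.mem_range] at *; omega
    · intro M hM; simp only [Finset.mem_Icc] at *; omega
    · intro M hM; omega
    · intro M hM; rfl
  have h6 : th (PP g Q K) = th A := by rw [PP, th, map_add, th]; simp [hA]
  have h7 := mul_neg_geom_sum (-A) m
  rw [h5, UU, h6]
  have h8 : th A * (PP g Q K)⁻¹ = th A * ∑ i ∈ Finset.range m, (-A) ^ i +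
      th A * (PP g Q K)⁻¹ * (-A) ^ m := by
    have h9 := PP_inv g Q K
    rw [PP] at h9 ⊢
    rw [← hA] at *
    linear_combination (-th A * (1 + A)⁻¹) * h7 + (th A * ∑ i ∈ Finset.range m, (-A) ^ i) * h9
  rw [h8, map_add, add_eq_left]
  have h10 : X ^ (m + 1) ∣ th A * (PP g Q K)⁻¹ * (-A) ^ m := by
    rw [pow_succ']
    refine mul_dvd_mul ?_ (pow_dvd_pow_of_dvd ((X_dvd_AA g Q K).neg_right) _)
    rw [th, mul_assoc]; exact Dvd.intro _ rfl
  exact (X_pow_dvd_iff.1 h10) m (by omega)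

lemma Hp_empty (g : ℕ) (Q : ℝ) (p : Nat.Partition 0) : Hp g Q p = 1 := by
  simp [Hp, pairing, boxes]

lemma coeff_PP (g : ℕ) (Q : ℝ) (K k : ℕ) (hk : k ≤ K) :
    coeff k (PP g Q K) = ∑ p : Nat.Partition k, ((Hp g Q p : ℝ) : ℂ) := by
  rw [PP, map_add]
  by_cases h0 : k = 0
  · subst h0
    simp [Hp_empty, X_dvd_iff.1 (X_dvd_AA g Q K)]
  · rw [coeff_one, if_neg h0, zero_add, AA, map_sum, sK, Finset.sum_sigma,
      Finset.sum_eq_single_of_mem k (Finset.mem_Icc.2 ⟨by omega, hk⟩)]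
    · refine Finset.sum_congr rfl fun p _ => ?_
      simp [mon]
    · intro j _ hj
      refine Finset.sum_eq_zero fun p _ => ?_
      rw [mon, coeff_monomial, if_neg hj.symm]
end P8b

section P8c
open PowerSeries

namespace PSH
variable {q : ℝ} {Z : Type} [CommGroup Z] (P : PSH q Z) (n : ℕ)

/-- cuspidals of degree at most `n` -/
def CC : Type := {ρ : P.B // ρ ∈ P.upto n ∧ P.Cusp ρ}

noncomputable instance instFintypeCC : Fintype (P.CC n) := by
  classical
  exact Fintype.ofInjective (fun c : P.CC n => (⟨c.1, c.2.1⟩ : {x // x ∈ P.upto n})) (by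
    intro a b h
    simp only [Subtype.mk.injEq] at h
    exact Subtype.ext h)

noncomputable instance instDecEqCC : DecidableEq (P.CC n) := Classical.decEq _

variable {P n}

def kap (c : P.CC n) : P.B := c.1

lemma kap_cusp (c : P.CC n) : P.Cusp (kap c) := c.2.2

lemma kap_inj : Function.Injective (kap : P.CC n → P.B) := fun _ _ h => Subtype.ext h

lemma kap_deg (c : P.CC n) : P.deg (kap c) ≠ 0 := (P.deg_pos c.2.2.1).ne'

lemma exists_kap {b : P.B} (hb : P.deg b ≤ n) : ∀ σ ∈ P.supp b, ∃ c : P.CC n, kap c = σ := by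
  intro σ hσ
  refine ⟨⟨σ, ?_, P.supp_cusp hσ⟩, rfl⟩
  rw [P.mem_upto]
  refine le_trans ?_ hb
  rw [P.deg_supp b]
  exact Multiset.single_le_sum (fun x _ => Nat.zero_le x) _ (Multiset.mem_map_of_mem _ hσ)

/-- the multiset attached to a multiplicity function -/
noncomputable def ms (k : P.CC n → ℕ) : Multiset P.B := ∑ c, Multiset.replicate (k c) (kap c)

open scoped Classical in
lemma count_ms (k : P.CC n → ℕ) (c : P.CC n) : (ms k).count (kap c) = k c := by
  rw [ms, Multiset.count_sum', Finset.sum_eq_single_of_mem c (Finset.mem_univ c)]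
  · simp
  · intro d _ hd
    rw [Multiset.count_replicate, if_neg]
    exact fun h => hd (kap_inj h)

lemma ms_inj {k l : P.CC n → ℕ} (h : ms k = ms l) : k = l := by
  classical
  funext c
  rw [← count_ms k c, h, count_ms]

lemma ms_cusp (k : P.CC n → ℕ) : ∀ σ ∈ ms k, P.Cusp σ := by
  intro σ hσ
  rw [ms, Multiset.mem_sum] at hσ
  obtain ⟨c, -, h⟩ := hσ
  rw [Multiset.eq_of_mem_replicate h]; exact kap_cusp c

lemma ms_map_prod (k : P.CC n → ℕ) (f : P.B → ℂ) : ((ms k).map f).prod = ∏ c, f (kap c) ^ k c := by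
  have h := map_sum (Multiset.mapAddMonoidHom f) (fun c => Multiset.replicate (k c) (kap c)) Finset.univ
  simp only [Multiset.coe_mapAddMonoidHom] at h
  rw [ms, h, Multiset.prod_sum]
  simp

lemma ms_map_sum (k : P.CC n → ℕ) (f : P.B → ℕ) : ((ms k).map f).sum = ∑ c, k c * f (kap c) := by
  have h := map_sum (Multiset.mapAddMonoidHom f) (fun c => Multiset.replicate (k c) (kap c)) Finset.univ
  simp only [Multiset.coe_mapAddMonoidHom] at h
  rw [ms, h, ← Multiset.coe_sumAddMonoidHom, map_sum]
  simp

lemma exists_ms {b : P.B} (hb : P.deg b ≤ n) : ∃ k : P.CC n → ℕ, P.supp b = ms k := by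
  classical
  refine ⟨fun c => (P.supp b).count (kap c), ?_⟩
  ext σ
  by_cases h : ∃ c : P.CC n, kap c = σ
  · obtain ⟨c, rfl⟩ := h
    rw [count_ms]
  · rw [Multiset.count_eq_zero.2 fun h' => h (exists_kap hb σ h'), eq_comm, Multiset.count_eq_zero]
    intro h'
    rw [ms, Multiset.mem_sum] at h'
    obtain ⟨c, -, h2⟩ := h'
    exact h ⟨c, (Multiset.eq_of_mem_replicate h2).symm⟩

/-- generating series of generics -/
noncomputable def GS (P : PSH q Z) (n : ℕ) (z : Z) : PowerSeries ℂ :=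
  ∏ c : P.CC n, sb (P.deg (kap c)) (kap_deg c) (P.om (kap c) z) (PowerSeries.mk fun _ => 1)

lemma filt_le {k : P.CC n → ℕ} {m : ℕ} (hs : ∑ c, k c * P.deg (kap c) = m) (c : P.CC n) : k c ≤ m := by
  have h1 := Finset.single_le_sum (f := fun c => k c * P.deg (kap c)) (fun i _ => Nat.zero_le _)
      (Finset.mem_univ c)
  have h2 : k c * 1 ≤ k c * P.deg (kap c) := Nat.mul_le_mul_left _ (Nat.pos_of_ne_zero (kap_deg c))
  omega

lemma coeff_GS (z : Z) (m : ℕ) (hm : m ≤ n) : coeff m (GS P n z) = P.genSum z m := by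
  classical
  rw [GS, coeff_prod_sb, genSum]
  refine Finset.sum_of_injOn (fun k => P.gen (ms k)) ?_ ?_ ?_ ?_
  · intro k _ l _ h
    have := congrArg P.supp h
    simp only [P.gen_supp (ms_cusp _)] at this
    exact ms_inj this
  · intro k hk
    simp only [Finset.coe_filter, Set.mem_setOf_eq] at hk
    rw [Finset.mem_coe, P.mem_lev, P.deg_supp, P.gen_supp (ms_cusp _), ms_map_sum, hk.2]
  · intro b hb hb2
    rw [P.mem_lev] at hb
    by_cases h0 : P.c b = 0
    · simp [h0]
    · exfalso
      have h1 : P.c b = 1 := by have := P.c_le b; omega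
      obtain ⟨k, hk⟩ := exists_ms (n := n) (b := b) (by omega)
      have hs : ∑ c, k c * P.deg (kap c) = m := by
        rw [← ms_map_sum, ← hk, ← P.deg_supp, hb]
      refine hb2 ⟨k, ?_, ?_⟩
      · simp only [Finset.coe_filter, Set.mem_setOf_eq, Fintype.mem_piFinset, Finset.mem_range]
        exact ⟨fun c => Nat.lt_succ_of_le (filt_le hs c), hs⟩
      · simp only [← hk]
        exact (P.eq_gen h1).symm
  · intro k _
    rw [P.gen_c (ms_cusp k), P.om_supp (P.gen (ms k)), P.gen_supp (ms_cusp k), ms_map_prod]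
    simp

/-- power sums over cuspidals of degree `d` -/
noncomputable def SS (P : PSH q Z) (n d : ℕ) (z : Z) : ℂ :=
  ∑ c : P.CC n, if P.deg (kap c) = d then P.om (kap c) z else 0

lemma coeff_log (z : Z) (k : ℕ) (hk : 1 ≤ k) (U : ℕ → PowerSeries ℂ) :
    coeff k (∑ c : P.CC n, C (P.deg (kap c) : ℂ) * sb (P.deg (kap c)) (kap_deg c) (P.om (kap c) z)
      (U (P.deg (kap c)))) =
    ∑ d ∈ k.divisors, d * SS P n d (z ^ (k / d)) * coeff (k / d) (U d) := by
  rw [map_sum]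
  simp only [SS, Finset.mul_sum, Finset.sum_mul]
  rw [Finset.sum_comm]
  refine Finset.sum_congr rfl fun c _ => ?_
  rw [coeff_C_mul, coeff_sb]
  by_cases h : P.deg (kap c) ∣ k
  · rw [if_pos h, Finset.sum_eq_single_of_mem (P.deg (kap c)) (Nat.mem_divisors.2 ⟨h, by omega⟩)]
    · simp; ring
    · intro d _ hd
      rw [if_neg hd.symm]; simp
  · rw [if_neg h, mul_zero, Finset.sum_eq_zero]
    intro d hd
    rw [if_neg, mul_zero, zero_mul]
    rintro rfl
    exact h (Nat.dvd_of_mem_divisors hd)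

/-- `X/(1-X)` -/
noncomputable def UO : PowerSeries ℂ := PowerSeries.mk fun k => if k = 0 then 0 else 1

lemma LD_one : LD (PowerSeries.mk fun _ => (1 : ℂ)) UO := by
  rw [LD]
  ext k
  rw [coeff_th, PowerSeries.coeff_mul, Finset.Nat.sum_antidiagonal_eq_sum_range_succ_mk,
    Finset.sum_range_succ]
  simp only [coeff_mk, UO]
  rw [Finset.sum_congr rfl (g := fun _ => (1 : ℂ))]
  · simp
  · intro i hi
    rw [Finset.mem_range] at hi
    rw [if_neg (by omega), mul_one]

lemma LD_GS (z : Z) : LD (GS P n z) (∑ c : P.CC n, C (P.deg (kap c) : ℂ) *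
    sb (P.deg (kap c)) (kap_deg c) (P.om (kap c) z) UO) :=
  LD.prod _ _ _ fun c _ => LD_one.sb _ (kap_deg c) _

/-- power sums -/
lemma coeff_LD {W K : PowerSeries ℂ} (h : LD W K) (n : ℕ) (h0 : coeff 0 W = 1)
    (hz : ∀ i, 1 ≤ i → i < n → coeff i W = 0 ∨ coeff (n - i) K = 0) (hK : coeff 0 K = 0)  :
    n * coeff n W = coeff n K := by
  rw [← coeff_th, h, PowerSeries.coeff_mul, Finset.sum_eq_single (0, n)]
  · simp [h0]
  · rintro ⟨a, b⟩ hab hne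
    rw [Finset.HasAntidiagonal.mem_antidiagonal] at hab
    dsimp only at hab ⊢
    by_cases hb : b = 0
    · rw [hb, hK, mul_zero]
    · have ha : a ≠ 0 := by rintro rfl; apply hne; simp at hab; rw [hab]
      rcases hz a (by omega) (by omega) with h1 | h1
      · rw [h1, zero_mul]
      · rw [show b = n - a by omega, h1, mul_zero]
  · simp

lemma coeff_zero_sb_sum (U : P.CC n → PowerSeries ℂ) (hU : ∀ c, coeff 0 (U c) = 0) (z : Z) :
    coeff 0 (∑ c : P.CC n, C (P.deg (kap c) : ℂ) *
    sb (P.deg (kap c)) (kap_deg c) (P.om (kap c) z) (U c)) = 0 := by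
  rw [map_sum]
  refine Finset.sum_eq_zero fun c _ => ?_
  rw [coeff_C_mul, coeff_sb]; simp [hU]

lemma SS_sum {z : Z} (hz : z ≠ 1) (k : ℕ) (h1 : 1 ≤ k) (hk : k ≤ n) :
    ∑ d ∈ k.divisors, (d : ℂ) * SS P n d (z ^ (k / d)) = 0 := by
  have h := coeff_LD (LD_GS (P := P) (n := n) z) k
    (by rw [coeff_GS _ _ (Nat.zero_le _), genSum_zero])
    (fun i hi hik => Or.inl (by rw [coeff_GS _ _ (by omega), genSum_of_ne hz _ hi]))
    (coeff_zero_sb_sum _ (by simp [UO]) z)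
  rw [coeff_GS _ _ hk, genSum_of_ne hz _ h1, mul_zero, coeff_log z k h1 (fun _ => UO)] at h
  rw [h]
  refine Finset.sum_congr rfl fun d hd => ?_
  have : k / d ≠ 0 := by
    have := Nat.div_pos (Nat.divisor_le hd) (Nat.pos_of_mem_divisors hd)
    omega
  simp [UO]
  intro h3
  rw [Nat.mem_divisors] at hd
  have := Nat.le_of_dvd (by omega) hd.1
  have := Nat.pos_of_dvd_of_pos hd.1 (by omega)
  omega

lemma SS_one (hn : 1 ≤ n) : SS P n 1 1 = q - 1 := by
  have h := coeff_LD (LD_GS (P := P) (n := n) 1) 1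
    (by rw [coeff_GS _ _ (Nat.zero_le _), genSum_zero])
    (fun i hi hik => by omega)
    (coeff_zero_sb_sum _ (by simp [UO]) 1)
  rw [coeff_GS _ _ hn, genSum_one_one, coeff_log 1 1 le_rfl (fun _ => UO)] at h
  simp [UO] at h
  exact h.symm

lemma SS_zero (d : ℕ) : 1 ≤ d → d ≤ n → ∀ z : Z, (∀ k, 1 ≤ k → k ≤ d → z ^ k ≠ 1) →
    SS P n d z = 0 := by
  induction d using Nat.strong_induction_on with
  | _ d ih =>
  intro h1 hd z hz
  have h := SS_sum (P := P) (n := n) (z := z) (by simpa using hz 1 le_rfl h1) d h1 hd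
  rw [Finset.sum_eq_single_of_mem d (Nat.mem_divisors_self d (by omega))] at h
  · rw [Nat.div_self (by omega), pow_one] at h
    rcases mul_eq_zero.1 h with h | h
    · norm_cast at h; omega
    · exact h
  · intro e he hne
    have hdv := Nat.dvd_of_mem_divisors he
    have he0 := Nat.pos_of_mem_divisors he
    have hle := Nat.divisor_le he
    rw [ih e (by omega) he0 (by omega), mul_zero]
    intro k hk hke
    rw [← pow_mul]
    refine hz _ ?_ ?_
    · exact Nat.mul_pos (Nat.div_pos hle he0) hk
    · calc d / e * k ≤ d / e * e := Nat.mul_le_mul_left _ hke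
        _ = d := Nat.div_mul_cancel hdv

lemma sum_moebius (m : ℕ) (hm : m ≠ 0) :
    ∑ e ∈ m.divisors, ((ArithmeticFunction.moebius e : ℤ) : ℂ) = if m = 1 then 1 else 0 := by
  have h := congrArg (fun f => f m) ArithmeticFunction.moebius_mul_coe_zeta
  simp only [ArithmeticFunction.mul_zeta_apply, ArithmeticFunction.coe_mul_zeta_apply,
    ArithmeticFunction.one_apply] at h
  have h2 := congrArg (fun x : ℤ => (x : ℂ)) h
  push_cast at h2
  exact h2

lemma SS_moebius {z : Z} (hz : orderOf z = n) (hn : 1 ≤ n) (e : ℕ) : e ∣ n →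
    e * SS P n e (z ^ (n / e)) = (q - 1) * ((ArithmeticFunction.moebius e : ℤ) : ℂ) := by
  induction e using Nat.strong_induction_on with
  | _ m ih =>
  intro hm
  have hm0 : 0 < m := Nat.pos_of_dvd_of_pos hm hn
  have hmn : m ≤ n := Nat.le_of_dvd hn hm
  by_cases h1 : m = 1
  · subst h1
    rw [Nat.div_one, ← hz, pow_orderOf_eq_one, hz, SS_one hn]; simp
  · have hne : z ^ (n / m) ≠ 1 := by
      refine pow_ne_one_of_lt_orderOf (Nat.div_pos hmn hm0).ne' ?_
      rw [hz]
      exact Nat.div_lt_self hn (by omega)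
    have h2 := SS_sum (P := P) (n := n) hne m hm0 hmn
    have h3 := sum_moebius m (by omega)
    rw [if_neg h1] at h3
    rw [← Nat.cons_self_properDivisors hm0.ne', Finset.sum_cons] at h2 h3
    have h4 : ∑ d ∈ m.properDivisors, (d : ℂ) * SS P n d ((z ^ (n / m)) ^ (m / d)) =
        (q - 1) * ∑ d ∈ m.properDivisors, ((ArithmeticFunction.moebius d : ℤ) : ℂ) := by
      rw [Finset.mul_sum]
      refine Finset.sum_congr rfl fun d hd => ?_
      rw [Nat.mem_properDivisors] at hd
      have h5 : n / m * (m / d) = n / d := by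
        rw [Nat.div_mul_div_comm hm hd.1, mul_comm n m, Nat.mul_div_mul_left _ _ hm0]
      rw [← ih d hd.2 (hd.1.trans hm), ← pow_mul, h5]
    rw [h4, Nat.div_self hm0, pow_one] at h2
    linear_combination h2 - (q - 1 : ℂ) * h3

/-- generating series of irreducibles -/
noncomputable def WS (P : PSH q Z) (n : ℕ) (g : ℕ) (z : Z) : PowerSeries ℂ :=
  ∏ c : P.CC n, sb (P.deg (kap c)) (kap_deg c) (P.om (kap c) z) (PP g (q ^ P.deg (kap c)) n)

lemma LD_WS (g : ℕ) (z : Z) : LD (WS P n g z) (∑ c : P.CC n, C (P.deg (kap c) : ℂ) *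
    sb (P.deg (kap c)) (kap_deg c) (P.om (kap c) z) (UU g (q ^ P.deg (kap c)) n)) :=
  LD.prod _ _ _ fun c _ => (LD_PP _ _ _).sb _ (kap_deg c) _

lemma coeff_WS (g : ℕ) {z : Z} (hz : orderOf z = n) (hn : 1 ≤ n) :
    n * coeff n (WS P n g z) = (q - 1) * ∑ d ∈ n.divisors,
      ((ArithmeticFunction.moebius d : ℤ) : ℂ) * ((Upoly g (n / d) (q ^ d) : ℝ) : ℂ) := by
  have h := coeff_LD (LD_WS (P := P) (n := n) g z) n
    (by
      rw [WS, coeff_zero_eq_constantCoeff_apply, map_prod]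
      refine Finset.prod_eq_one fun c _ => ?_
      rw [← coeff_zero_eq_constantCoeff_apply, coeff_sb, if_pos (Nat.dvd_zero _)]
      simp [PP, X_dvd_iff.1 (X_dvd_AA g _ n)])
    (fun i hi hik => Or.inr (by
      rw [coeff_log z (n - i) (by omega) (fun d => UU g (q ^ d) n)]
      refine Finset.sum_eq_zero fun d hd => ?_
      have hle := Nat.divisor_le hd
      have hd0 := Nat.pos_of_mem_divisors hd
      rw [SS_zero d hd0 (by omega), mul_zero, zero_mul]
      intro k hk hkd
      rw [← pow_mul]
      have h3 : (n - i) / d * k ≤ n - i := by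
        calc (n - i) / d * k ≤ (n - i) / d * d := Nat.mul_le_mul_left _ hkd
          _ = n - i := Nat.div_mul_cancel (Nat.dvd_of_mem_divisors hd)
      have h4 := Nat.mul_pos (Nat.div_pos hle hd0) hk
      exact pow_ne_one_of_lt_orderOf h4.ne' (by omega)))
    (coeff_zero_sb_sum _ (fun c => coeff_UU_zero _ _ _) z)
  rw [h, coeff_log z n hn (fun d => UU g (q ^ d) n), Finset.mul_sum]
  refine Finset.sum_congr rfl fun d hd => ?_
  have hle := Nat.divisor_le hd
  have hd0 := Nat.pos_of_mem_divisors hd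
  rw [SS_moebius hz hn d (Nat.dvd_of_mem_divisors hd), coeff_UU _ _ _ _ (Nat.div_pos hle hd0)
    (Nat.div_le_self _ _), mul_assoc]

lemma zpow_sum' {ι : Type} (s : Finset ι) (f : ι → ℤ) {x : ℝ} (hx : x ≠ 0) :
    x ^ (∑ i ∈ s, f i) = ∏ i ∈ s, x ^ f i := by
  classical
  induction s using Finset.induction_on with
  | empty => simp
  | insert a s ha ih => rw [Finset.sum_insert ha, Finset.prod_insert ha, zpow_add₀ hx, ih]

/-- sequences attached to partitions -/
def gam (k : P.CC n → ℕ) (p : ∀ c, Nat.Partition (k c)) : P.CC n → Fin n → ℕ :=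
  fun c i => bet (p c) n i

lemma gam_mono (k : P.CC n → ℕ) (p : ∀ c, Nat.Partition (k c)) (c : P.CC n) :
    StrictMono (gam k p c) := fun _ _ h => bet_strictMono (p c) n h

/-- irreducible attached to a partition valued function -/
noncomputable def irp (k : P.CC n → ℕ) (p : ∀ c, Nat.Partition (k c)) : P.B :=
  irr n kap_cusp kap_inj (gam k p) (gam_mono k p)

lemma irp_supp (k : P.CC n → ℕ) (p : ∀ c, Nat.Partition (k c)) (hk : ∀ c, k c ≤ n) :
    P.supp (irp k p) = ms k := by
  rw [irp, irr_supp, ms]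
  refine Finset.sum_congr rfl fun c _ => ?_
  simp only [gam]
  rw [bet_sum (p c) (hk c), Nat.add_sub_cancel]

lemma le_of_strictMono {N : ℕ} (γ : Fin N → ℕ) (h : StrictMono γ) :
    ∑ j : Fin N, (j : ℕ) ≤ ∑ j, γ j := by
  have key : ∀ (j : ℕ) (hj : j < N), j ≤ γ ⟨j, hj⟩ := by
    intro j
    induction j with
    | zero => simp
    | succ j ih =>
      intro hj
      have h1 := ih (by omega)
      have h2 : γ ⟨j, by omega⟩ < γ ⟨j + 1, hj⟩ := h (by simp)
      omega
  exact Finset.sum_le_sum fun j _ => key j j.2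

lemma irp_value (g : ℕ) (z : Z) (k : P.CC n → ℕ) (p : ∀ c, Nat.Partition (k c))
    (hk : ∀ c, k c ≤ n) (hs : ∑ c, k c * P.deg (kap c) = n) :
    ∏ c, (P.om (kap c) z ^ k c * ((Hp g (q ^ P.deg (kap c)) (p c) : ℝ) : ℂ)) =
      (q : ℂ) ^ (-(((g : ℤ) - 1) * n)) *
        (P.om (irp k p) z * (P.delta (irp k p) : ℂ) ^ (-(2 * (g : ℤ) - 2))) := by
  rw [P.om_supp, irp_supp k p hk, ms_map_prod, irp, irr_delta, Finset.prod_mul_distrib]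
  have hq0 : (q : ℝ) ≠ 0 := by have := P.hq; positivity
  have h1 : ∏ c, Hp g (q ^ P.deg (kap c)) (p c) = q ^ (-(((g : ℤ) - 1) * n)) *
      (∏ c, Dnum (q ^ P.deg (kap c)) (gam k p c)) ^ (-(2 * (g : ℤ) - 2)) := by
    rw [← Finset.prod_zpow]
    have h2 : q ^ (-(((g : ℤ) - 1) * (n : ℤ))) =
        ∏ c : P.CC n, (q ^ P.deg (kap c)) ^ (-(((g : ℤ) - 1) * (k c : ℤ))) := by
      have hs2 : (n : ℤ) = ∑ c : P.CC n, (k c : ℤ) * (P.deg (kap c) : ℤ) := by exact_mod_cast hs.symm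
      have : (-(((g : ℤ) - 1) * (n : ℤ))) =
          ∑ c : P.CC n, (P.deg (kap c) : ℤ) * (-(((g : ℤ) - 1) * (k c : ℤ))) := by
        refine (congrArg (fun x => -(((g : ℤ) - 1) * x)) hs2).trans ?_
        rw [Finset.mul_sum, ← Finset.sum_neg_distrib]
        exact Finset.sum_congr rfl fun c _ => by ring
      rw [this, zpow_sum' _ _ hq0]
      refine Finset.prod_congr rfl fun c _ => ?_
      rw [zpow_mul, zpow_natCast]
    rw [h2, ← Finset.prod_mul_distrib]
    refine Finset.prod_congr rfl fun c _ => ?_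
    exact Hp_eq (p c) g (hk c) _ (one_lt_pow₀ P.hq (kap_deg c))
  have h3 := congrArg (fun x : ℝ => (x : ℂ)) h1
  push_cast at h3 ⊢
  rw [h3]
  ring

lemma irr_sum (g : ℕ) (z : Z) :
    coeff n (WS P n g z) = (q : ℂ) ^ (-(((g : ℤ) - 1) * n)) *
      ∑ b ∈ P.lev n, P.om b z * (P.delta b : ℂ) ^ (-(2 * (g : ℤ) - 2)) := by
  classical
  rw [WS, coeff_prod_sb]
  set K := (Fintype.piFinset fun _ : P.CC n => Finset.range (n + 1)).filter
    (fun k => ∑ c, k c * P.deg (kap c) = n) with hK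
  have hKm : ∀ k : P.CC n → ℕ, k ∈ K ↔ ∑ c, k c * P.deg (kap c) = n := by
    intro k
    simp only [hK, Finset.mem_filter, Fintype.mem_piFinset, Finset.mem_range]
    exact ⟨fun h => h.2, fun h => ⟨fun c => Nat.lt_succ_of_le (filt_le h c), h⟩⟩
  have h1 : ∀ k ∈ K, ∏ c : P.CC n, (P.om (kap c) z ^ k c * coeff (k c) (PP g (q ^ P.deg (kap c)) n)) =
      ∑ p : (∀ c, Nat.Partition (k c)),
        ∏ c, (P.om (kap c) z ^ k c * ((Hp g (q ^ P.deg (kap c)) (p c) : ℝ) : ℂ)) := by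
    intro k hk
    rw [← Fintype.prod_sum (fun c (r : Nat.Partition (k c)) =>
      P.om (kap c) z ^ k c * ((Hp g (q ^ P.deg (kap c)) r : ℝ) : ℂ))]
    refine Finset.prod_congr rfl fun c _ => ?_
    rw [coeff_PP _ _ _ _ (filt_le ((hKm k).1 hk) c), Finset.mul_sum]
  rw [Finset.sum_congr rfl h1, Finset.sum_sigma', Finset.mul_sum]
  refine Finset.sum_bij (fun x _ => irp x.1 x.2) ?_ ?_ ?_ ?_
  · rintro ⟨k, p⟩ hx
    have hs := (hKm k).1 (Finset.mem_sigma.1 hx).1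
    rw [P.mem_lev, P.deg_supp, irp_supp k p (filt_le hs), ms_map_sum, hs]
  · rintro ⟨k, p⟩ hx ⟨l, r⟩ hy h
    have hs := (hKm k).1 (Finset.mem_sigma.1 hx).1
    have ht := (hKm l).1 (Finset.mem_sigma.1 hy).1
    have h2 : k = l := by
      apply ms_inj
      rw [← irp_supp k p (filt_le hs), ← irp_supp l r (filt_le ht)]
      exact congrArg P.supp h
    subst h2
    have h3 := irr_inj n kap_cusp kap_inj _ _ _ _ h
    have h4 : p = r := by
      funext c
      exact bet_inj (filt_le hs c) (congrFun h3 c)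
    rw [h4]
  · intro b hb
    rw [P.mem_lev] at hb
    have hcard : Multiset.card (P.supp b) ≤ n := by
      rw [← hb, P.deg_supp b]
      have h3 : Multiset.card ((P.supp b).map P.deg) • 1 ≤ ((P.supp b).map P.deg).sum :=
        Multiset.card_nsmul_le_sum fun x hx => by
          obtain ⟨p, hp, rfl⟩ := Multiset.mem_map.1 hx
          exact P.deg_pos (P.supp_cusp hp).1
      simpa using h3
    obtain ⟨γ, hγ, rfl⟩ := irr_surj n kap_cusp kap_inj b (exists_kap hb.le) hcard
    have h5 : ∀ c, ∃ p : Nat.Partition (∑ j, γ c j - ∑ j : Fin n, (j : ℕ)),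
        γ c = fun i : Fin n => bet p n i := fun c =>
      bet_surj (γ c) (hγ c) (Nat.sub_add_cancel (le_of_strictMono _ (hγ c))).symm
    choose p hp using h5
    refine ⟨⟨fun c => ∑ j, γ c j - ∑ j : Fin n, (j : ℕ), p⟩, ?_, ?_⟩
    · rw [Finset.mem_sigma]
      refine ⟨?_, Finset.mem_univ _⟩
      rw [hKm, ← ms_map_sum, ms, ← irr_supp n kap_cusp kap_inj γ hγ, ← P.deg_supp, hb]
    · have : gam _ p = γ := by
        funext c
        rw [hp c]; rfl
      unfold irp
      congr 1
  · rintro ⟨k, p⟩ hx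
    have hs := (hKm k).1 (Finset.mem_sigma.1 hx).1
    exact irp_value g z k p (filt_le hs) hs

/-- the main output of the combinatorial part -/
theorem main_sum (g : ℕ) {z : Z} (hz : orderOf z = n) (hn : 1 ≤ n) :
    ∑ b ∈ P.lev n, P.om b z * (P.delta b : ℂ) ^ (-(2 * (g : ℤ) - 2)) =
      (q : ℂ) ^ (((g : ℤ) - 1) * n) * ((q - 1) / n * ∑ d ∈ n.divisors,
      ((ArithmeticFunction.moebius d : ℤ) : ℂ) * ((Upoly g (n / d) (q ^ d) : ℝ) : ℂ)) := by
  have h1 := coeff_WS (P := P) g hz hn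
  rw [irr_sum] at h1
  have hq0 : (q : ℂ) ≠ 0 := by
    have h := P.hq
    have : q ≠ 0 := by positivity
    exact_mod_cast this
  have hn0 : (n : ℂ) ≠ 0 := by norm_cast; omega
  rw [zpow_neg] at h1
  have h2 := zpow_ne_zero (((g : ℤ) - 1) * n) hq0
  field_simp at h1 ⊢
  linear_combination h1

end PSH
end P8c

section P2a
/-- isomorphism invariant functions on endomorphisms of finite vector spaces -/
structure CF (F : Type) [Field F] where
  toFun : ∀ (V : Type) [AddCommGroup V] [Module F V] [Finite V], (V →ₗ[F] V) → ℂ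
  inv : ∀ {V W : Type} [AddCommGroup V] [Module F V] [Finite V] [AddCommGroup W] [Module F W]
    [Finite W] (e : V ≃ₗ[F] W) (x : V →ₗ[F] V) (y : W →ₗ[F] W),
    (∀ v, e (x v) = y (e v)) → toFun W y = toFun V x

section LA
variable {F : Type} [Field F]

instance instFiniteHom (V W : Type) [AddCommGroup V] [Module F V] [Finite V]
    [AddCommGroup W] [Module F W] [Finite W] : Finite (V →ₗ[F] W) :=
  Finite.of_injective (fun f => (f : V → W)) DFunLike.coe_injective

instance instFiniteQuot (V : Type) [AddCommGroup V] [Module F V] [Finite V]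
    (U : Submodule F V) : Finite (V ⧸ U) := Finite.of_surjective U.mkQ U.mkQ_surjective

noncomputable instance instFintypeHom (V W : Type) [AddCommGroup V] [Module F V] [Finite V]
    [AddCommGroup W] [Module F W] [Finite W] : Fintype (V →ₗ[F] W) := Fintype.ofFinite _

noncomputable instance instFintypeSub (V : Type) [AddCommGroup V] [Module F V] [Finite V] :
    Fintype (Submodule F V) := Fintype.ofFinite _

variable {V W X Y : Type} [AddCommGroup V] [Module F V] [Finite V] [AddCommGroup W] [Module F W]
  [Finite W] [AddCommGroup X] [Module F X] [Finite X] [AddCommGroup Y] [Module F Y] [Finite Y]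

/-- block upper triangular endomorphism -/
def blk (x : V →ₗ[F] V) (h : W →ₗ[F] V) (y : W →ₗ[F] W) : (V × W) →ₗ[F] (V × W) :=
  (x.coprod h).prod (y ∘ₗ LinearMap.snd F V W)

@[simp] lemma blk_apply (x : V →ₗ[F] V) (h : W →ₗ[F] V) (y : W →ₗ[F] W) (v : V × W) :
    blk x h y v = (x v.1 + h v.2, y v.2) := rfl

/-- coproduct -/
noncomputable def Dl (f : CF F) (x : V →ₗ[F] V) (y : W →ₗ[F] W) : ℂ :=
  (Fintype.card (W →ₗ[F] V) : ℂ)⁻¹ * ∑ h : W →ₗ[F] V, f.toFun (V × W) (blk x h y)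

open scoped Classical in
/-- the term of the Hall product -/
noncomputable def tm (a b : CF F) (x : V →ₗ[F] V) (U : Submodule F V) : ℂ :=
  if h : U ≤ U.comap x then a.toFun U (x.restrict h) * b.toFun (V ⧸ U) (U.mapQ U x h) else 0

/-- Hall product -/
noncomputable def hall (a b : CF F) (x : V →ₗ[F] V) : ℂ := ∑ U : Submodule F V, tm a b x U

lemma tm_eq (a b : CF F) (x : V →ₗ[F] V) (U : Submodule F V) (i : X →ₗ[F] V) (p : V →ₗ[F] Y)
    (xa : X →ₗ[F] X) (xc : Y →ₗ[F] Y) (hi : Function.Injective i) (hp : Function.Surjective p)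
    (hU : LinearMap.range i = U) (hU' : LinearMap.ker p = U) (h1 : ∀ v, x (i v) = i (xa v))
    (h2 : ∀ v, p (x v) = xc (p v)) : tm a b x U = a.toFun X xa * b.toFun Y xc := by
  subst hU
  have hs : LinearMap.range i ≤ (LinearMap.range i).comap x := by
    rintro _ ⟨v, rfl⟩
    exact ⟨xa v, (h1 v).symm⟩
  rw [tm, dif_pos hs]
  congr 1
  · refine a.inv (LinearEquiv.ofInjective i hi) _ _ fun v => ?_
    apply Subtype.ext
    simp [h1]
  · refine (b.inv ((Submodule.quotEquivOfEq _ _ hU'.symm).trans (p.quotKerEquivOfSurjective hp)) _ _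
      fun v => ?_).symm
    obtain ⟨v, rfl⟩ := Submodule.Quotient.mk_surjective _ v
    simp [h2]

lemma tm_ne (a b : CF F) (x : V →ₗ[F] V) (U : Submodule F V) (h : ¬ U ≤ U.comap x) :
    tm a b x U = 0 := by
  rw [tm, dif_neg h]

lemma stable_map (e : V ≃ₗ[F] W) (x : V →ₗ[F] V) (y : W →ₗ[F] W) (h : ∀ v, e (x v) = y (e v))
    (U : Submodule F V) : U.map (e : V →ₗ[F] W) ≤ (U.map (e : V →ₗ[F] W)).comap y ↔ U ≤ U.comap x := by
  constructor
  · intro hs v hv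
    have : y (e v) ∈ U.map (e : V →ₗ[F] W) := hs ⟨v, hv, rfl⟩
    rw [← h] at this
    obtain ⟨w, hw, hh⟩ := this
    have := e.injective hh
    rw [this] at hw
    exact hw
  · rintro hs _ ⟨v, hv, rfl⟩
    exact ⟨x v, hs hv, h v⟩

lemma tm_conj (a b : CF F) (e : V ≃ₗ[F] W) (x : V →ₗ[F] V) (y : W →ₗ[F] W)
    (h : ∀ v, e (x v) = y (e v)) (U : Submodule F V) :
    tm a b y (U.map (e : V →ₗ[F] W)) = tm a b x U := by
  by_cases hs : U ≤ U.comap x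
  · conv_rhs => rw [tm, dif_pos hs]
    refine tm_eq a b y _ ((e : V →ₗ[F] W) ∘ₗ U.subtype) (U.mkQ ∘ₗ (e.symm : W →ₗ[F] V)) _ _ ?_ ?_ ?_ ?_ ?_ ?_
    · exact e.injective.comp Subtype.val_injective
    · exact (U.mkQ_surjective).comp e.symm.surjective
    · rw [LinearMap.range_comp, Submodule.range_subtype]
    · rw [LinearMap.ker_comp, Submodule.ker_mkQ]
      ext v
      simp
    · intro v; simp [h]
    · intro v
      have : e.symm (y v) = x (e.symm v) := by
        apply e.injective; rw [h]; simp
      simp [this]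
  · rw [tm_ne _ _ _ _ hs, tm_ne]
    rwa [stable_map e x y h]

lemma sum_sub_map {A : Type} [AddCommMonoid A] (e : V ≃ₗ[F] W) (f : Submodule F W → A) :
    ∑ U : Submodule F V, f (U.map (e : V →ₗ[F] W)) = ∑ U, f U :=
  Fintype.sum_equiv (Submodule.orderIsoMapComap e).toEquiv _ _ fun _ => rfl

lemma hall_conj (a b : CF F) (e : V ≃ₗ[F] W) (x : V →ₗ[F] V) (y : W →ₗ[F] W)
    (h : ∀ v, e (x v) = y (e v)) : hall a b y = hall a b x := by
  rw [hall, ← sum_sub_map e, hall]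
  exact Finset.sum_congr rfl fun U _ => tm_conj a b e x y h U

/-- the Hall product as an invariant function -/
noncomputable def CF.mul (a b : CF F) : CF F where
  toFun V _ _ _ x := hall a b x
  inv e x y h := hall_conj a b e x y h

/-- unipotent automorphism -/
def uS (S : W →ₗ[F] V) : (V × W) ≃ₗ[F] (V × W) :=
  LinearEquiv.ofLinear (blk LinearMap.id S LinearMap.id) (blk LinearMap.id (-S) LinearMap.id)
    (by ext v <;> simp) (by ext v <;> simp)

@[simp] lemma uS_apply (S : W →ₗ[F] V) (v : V × W) : uS S v = (v.1 + S v.2, v.2) := rfl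

/-- average over a surjective homomorphism -/
lemma avg_surj {A B : Type} [AddCommGroup A] [AddCommGroup B] [Fintype A] [Fintype B]
    (φ : A →+ B) (hφ : Function.Surjective φ) (f : B → ℂ) :
    (Fintype.card A : ℂ)⁻¹ * ∑ x, f (φ x) = (Fintype.card B : ℂ)⁻¹ * ∑ y, f y := by
  classical
  have hfib : ∀ y : B, (Finset.univ.filter fun x => φ x = y).card = (Finset.univ.filter fun x => φ x = 0).card := by
    intro y
    obtain ⟨x0, rfl⟩ := hφ y
    refine Finset.card_bij (fun x _ => x - x0) ?_ ?_ ?_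
    · intro x hx; simp at hx ⊢; simp [hx]
    · intro x _ x' _ h; simpa using h
    · intro x hx
      simp at hx
      exact ⟨x + x0, by simp [hx], by simp⟩
  have h1 : ∑ x, f (φ x) = (Finset.univ.filter fun x => φ x = 0).card * ∑ y, f y := by
    rw [← Finset.sum_fiberwise_of_maps_to (g := φ) (t := Finset.univ) (fun x _ => Finset.mem_univ _),
      Finset.mul_sum]
    refine Finset.sum_congr rfl fun y _ => ?_
    rw [Finset.sum_congr rfl (g := fun _ => f y), Finset.sum_const, hfib y, nsmul_eq_mul]
    intro x hx; rw [(Finset.mem_filter.1 hx).2]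
  have h2 : Fintype.card A = (Finset.univ.filter fun x => φ x = 0).card * Fintype.card B := by
    rw [← Finset.card_univ, Finset.card_eq_sum_card_fiberwise (f := φ) (t := Finset.univ)
      (fun x _ => Finset.mem_univ _), Finset.sum_congr rfl (fun y _ => hfib y)]
    simp [mul_comm]
  have hA : (Fintype.card A : ℂ) ≠ 0 := by exact_mod_cast Fintype.card_ne_zero
  have hB : (Fintype.card B : ℂ) ≠ 0 := by exact_mod_cast Fintype.card_ne_zero
  rw [h1]
  rw [h2] at hA ⊢
  push_cast at hA ⊢
  have h3 := left_ne_zero_of_mul hA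
  field_simp

noncomputable instance instFintypeCM (U0 : Submodule F V) (U1 : Submodule F W) :
    Fintype (Submodule.compatibleMaps U1 U0) := Fintype.ofFinite _

lemma mem_cm {U0 : Submodule F V} {U1 : Submodule F W} {S : W →ₗ[F] V} :
    S ∈ Submodule.compatibleMaps U1 U0 ↔ ∀ w ∈ U1, S w ∈ U0 := Iff.rfl

lemma mem_map_uS {U0 : Submodule F V} {U1 : Submodule F W} {S : W →ₗ[F] V} {v : V × W} :
    v ∈ (U0.prod U1).map (uS S : (V × W) →ₗ[F] (V × W)) ↔ v.1 - S v.2 ∈ U0 ∧ v.2 ∈ U1 := by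
  constructor
  · rintro ⟨w, hw, rfl⟩
    rw [SetLike.mem_coe, Submodule.mem_prod] at hw
    simpa using hw
  · intro h
    exact ⟨(v.1 - S v.2, v.2), by simpa using h, by simp⟩

lemma map_uS_eq_iff {U0 : Submodule F V} {U1 : Submodule F W} {S S' : W →ₗ[F] V} :
    (U0.prod U1).map (uS S : (V × W) →ₗ[F] (V × W)) =
      (U0.prod U1).map (uS S' : (V × W) →ₗ[F] (V × W)) ↔ S - S' ∈ Submodule.compatibleMaps U1 U0 := by
  rw [mem_cm]
  constructor
  · intro h w hw
    have h1 : ((S w, w) : V × W) ∈ (U0.prod U1).map (uS S : (V × W) →ₗ[F] (V × W)) := by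
      rw [mem_map_uS]; simpa using hw
    rw [h, mem_map_uS] at h1
    simpa using h1.1
  · intro h
    ext v
    rw [mem_map_uS, mem_map_uS]
    refine and_congr_left fun hv => ?_
    have := h _ hv
    rw [LinearMap.sub_apply] at this
    constructor
    · intro h2; have := U0.add_mem h2 this; simpa using this
    · intro h2; have := U0.sub_mem h2 this; simpa using this

lemma exists_uS (U : Submodule F (V × W)) : ∃ S : W →ₗ[F] V,
    ((U.comap (LinearMap.inl F V W)).prod (U.map (LinearMap.snd F V W))).map
      (uS S : (V × W) →ₗ[F] (V × W)) = U := by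
  set U1 := U.map (LinearMap.snd F V W)
  let s : U →ₗ[F] U1 := ((LinearMap.snd F V W) ∘ₗ U.subtype).codRestrict U1 fun u =>
    ⟨u.1, u.2, rfl⟩
  have hs : LinearMap.range s = ⊤ := by
    rw [LinearMap.range_eq_top]
    rintro ⟨_, u, hu, rfl⟩
    exact ⟨⟨u, hu⟩, rfl⟩
  obtain ⟨σ, hσ⟩ := s.exists_rightInverse_of_surjective hs
  obtain ⟨S, hS⟩ := LinearMap.exists_extend ((LinearMap.fst F V W) ∘ₗ U.subtype ∘ₗ σ)
  refine ⟨S, ?_⟩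
  have key : ∀ w ∈ U1, ((S w, w) : V × W) ∈ U := by
    intro w hw
    have h1 := LinearMap.congr_fun hS ⟨w, hw⟩
    have h2 := congrArg Subtype.val (LinearMap.congr_fun hσ ⟨w, hw⟩)
    simp [s] at h1 h2
    have h3 := (σ ⟨w, hw⟩).2
    have : (σ ⟨w, hw⟩ : V × W) = (S w, w) := Prod.ext h1.symm h2
    rwa [this] at h3
  ext v
  rw [mem_map_uS]
  constructor
  · rintro ⟨h1, h2⟩
    have h3 := U.add_mem h1 (key _ h2)
    simpa using h3
  · intro hv
    have h2 : v.2 ∈ U1 := ⟨v, hv, rfl⟩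
    refine ⟨?_, h2⟩
    have h3 := U.sub_mem hv (key _ h2)
    rw [Submodule.mem_comap]
    convert h3 using 1
    ext <;> simp

lemma comap_map_uS (U0 : Submodule F V) (U1 : Submodule F W) (S : W →ₗ[F] V) :
    ((U0.prod U1).map (uS S : (V × W) →ₗ[F] (V × W))).comap (LinearMap.inl F V W) = U0 := by
  ext v
  rw [Submodule.mem_comap, mem_map_uS]; simp

lemma snd_map_uS (U0 : Submodule F V) (U1 : Submodule F W) (S : W →ₗ[F] V) :
    ((U0.prod U1).map (uS S : (V × W) →ₗ[F] (V × W))).map (LinearMap.snd F V W) = U1 := by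
  ext w
  constructor
  · rintro ⟨v, hv, rfl⟩
    rw [SetLike.mem_coe, mem_map_uS] at hv
    exact hv.2
  · intro hw
    refine ⟨(S w, w), ?_, rfl⟩
    rw [SetLike.mem_coe, mem_map_uS]; simpa using hw

lemma sub_sum (G : Submodule F (V × W) → ℂ) :
    ∑ U, G U = ∑ U0 : Submodule F V, ∑ U1 : Submodule F W,
      (Fintype.card (Submodule.compatibleMaps U1 U0) : ℂ)⁻¹ *
        ∑ S : W →ₗ[F] V, G ((U0.prod U1).map (uS S : (V × W) →ₗ[F] (V × W))) := by
  classical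
  have h1 : ∀ (U0 : Submodule F V) (U1 : Submodule F W),
      (Fintype.card (Submodule.compatibleMaps U1 U0) : ℂ)⁻¹ *
        ∑ S : W →ₗ[F] V, G ((U0.prod U1).map (uS S : (V × W) →ₗ[F] (V × W))) =
      ∑ U ∈ Finset.univ.filter (fun U : Submodule F (V × W) =>
        (U.comap (LinearMap.inl F V W), U.map (LinearMap.snd F V W)) = (U0, U1)), G U := by
    intro U0 U1
    have hc : (Fintype.card (Submodule.compatibleMaps U1 U0) : ℂ) ≠ 0 := by
      exact_mod_cast Fintype.card_ne_zero
    rw [inv_mul_eq_iff_eq_mul₀ hc]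
    rw [← Finset.sum_fiberwise_of_maps_to
      (g := fun S : W →ₗ[F] V => (U0.prod U1).map (uS S : (V × W) →ₗ[F] (V × W)))
      (t := Finset.univ.filter (fun U : Submodule F (V × W) =>
        (U.comap (LinearMap.inl F V W), U.map (LinearMap.snd F V W)) = (U0, U1)))
      (fun S _ => by
        rw [Finset.mem_filter]
        exact ⟨Finset.mem_univ _, Prod.ext (comap_map_uS _ _ _) (snd_map_uS _ _ _)⟩), Finset.mul_sum]
    refine Finset.sum_congr rfl fun U hU => ?_
    rw [Finset.sum_congr rfl (g := fun _ => G U) (fun S hS => by rw [(Finset.mem_filter.1 hS).2]),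
      Finset.sum_const, nsmul_eq_mul]
    congr 2
    have hU2 := (Finset.mem_filter.1 hU).2
    rw [Prod.mk.injEq] at hU2
    obtain ⟨S0, hS0⟩ := exists_uS U
    rw [hU2.1, hU2.2] at hS0
    rw [← Finset.card_univ]
    symm
    refine Finset.card_bij (fun s _ => s.1 + S0) ?_ ?_ ?_
    · intro s _
      rw [Finset.mem_filter]
      refine ⟨Finset.mem_univ _, ?_⟩
      rw [← hS0, map_uS_eq_iff]
      simp
    · intro s _ s' _ h
      exact Subtype.ext (add_right_cancel h)
    · intro S hS
      have := (Finset.mem_filter.1 hS).2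
      rw [← hS0, map_uS_eq_iff] at this
      exact ⟨⟨_, this⟩, Finset.mem_univ _, by simp⟩
  simp only [h1]
  rw [← Fintype.sum_prod_type' (f := fun (U0 : Submodule F V) (U1 : Submodule F W) =>
    ∑ U ∈ Finset.univ.filter (fun U : Submodule F (V × W) =>
        (U.comap (LinearMap.inl F V W), U.map (LinearMap.snd F V W)) = (U0, U1)), G U)]
  rw [← Finset.sum_fiberwise_of_maps_to (g := fun U : Submodule F (V × W) =>
    (U.comap (LinearMap.inl F V W), U.map (LinearMap.snd F V W))) (t := Finset.univ)
    (fun _ _ => Finset.mem_univ _)]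

end LA
end P2a

section P2b
section LA2
variable {F : Type} [Field F]
variable {V W X Y : Type} [AddCommGroup V] [Module F V] [Finite V] [AddCommGroup W] [Module F W]
  [Finite W] [AddCommGroup X] [Module F X] [Finite X] [AddCommGroup Y] [Module F Y] [Finite Y]

open scoped Classical in
/-- term of the right hand side of the Hopf identity -/
noncomputable def tm2 (a b : CF F) (x : V →ₗ[F] V) (y : W →ₗ[F] W) (U0 : Submodule F V)
    (U1 : Submodule F W) : ℂ :=
  if h : U0 ≤ U0.comap x ∧ U1 ≤ U1.comap y then
    Dl a (x.restrict h.1) (y.restrict h.2) * Dl b (U0.mapQ U0 x h.1) (U1.mapQ U1 y h.2) else 0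

lemma tm_blk_uS (a b : CF F) (x : V →ₗ[F] V) (h : W →ₗ[F] V) (y : W →ₗ[F] W) (S : W →ₗ[F] V)
    (U : Submodule F (V × W)) :
    tm a b (blk x h y) (U.map (uS S : (V × W) →ₗ[F] (V × W))) =
      tm a b (blk x (h + (x ∘ₗ S - S ∘ₗ y)) y) U := by
  apply tm_conj
  intro v
  ext
  · simp; abel
  · simp

/-- restriction and quotient of compatible maps -/
noncomputable def cmMap (U0 : Submodule F V) (U1 : Submodule F W) :
    Submodule.compatibleMaps U1 U0 →+ ((U1 →ₗ[F] U0) × ((W ⧸ U1) →ₗ[F] (V ⧸ U0))) where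
  toFun S := (S.1.restrict S.2, U1.mapQ U0 S.1 S.2)
  map_zero' := by
    ext v
    · simp
    · simp
  map_add' S T := by
    ext v
    · simp; rfl
    · simp; rfl

lemma cmMap_surj (U0 : Submodule F V) (U1 : Submodule F W) : Function.Surjective (cmMap U0 U1) := by
  rintro ⟨r, s⟩
  obtain ⟨r', hr⟩ := LinearMap.exists_extend (U0.subtype ∘ₗ r)
  obtain ⟨σ, hσ⟩ := U0.mkQ.exists_rightInverse_of_surjective (LinearMap.range_eq_top.2 U0.mkQ_surjective)
  -- choose the extension so that it vanishes on the quotient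
  obtain ⟨π, hπ⟩ := LinearMap.exists_extend (LinearMap.id : U1 →ₗ[F] U1)
  let S : W →ₗ[F] V := U0.subtype ∘ₗ r ∘ₗ π + σ ∘ₗ s ∘ₗ U1.mkQ
  have hS1 : ∀ w : U1, S w = r w := by
    intro w
    have h1 : π w = w := LinearMap.congr_fun hπ w
    have h2 : U1.mkQ (w : W) = 0 := (Submodule.Quotient.mk_eq_zero U1).2 w.2
    simp only [S, LinearMap.add_apply, LinearMap.comp_apply, h1, h2, map_zero, add_zero, Submodule.subtype_apply]
  have hS : S ∈ Submodule.compatibleMaps U1 U0 := by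
    rw [mem_cm]
    intro w hw
    rw [hS1 ⟨w, hw⟩]
    exact (r _).2
  refine ⟨⟨S, hS⟩, Prod.ext ?_ ?_⟩
  · apply LinearMap.ext
    intro w
    exact Subtype.ext (hS1 w)
  · apply Submodule.linearMap_qext
    ext w
    have h3 : U0.mkQ (σ (s (U1.mkQ w))) = s (U1.mkQ w) := LinearMap.congr_fun hσ _
    have h4 : U0.mkQ (r (π w) : V) = 0 := (Submodule.Quotient.mk_eq_zero U0).2 (r (π w)).2
    change U0.mkQ (S w) = s (U1.mkQ w)
    simp only [S, LinearMap.add_apply, LinearMap.comp_apply, map_add, h3, Submodule.subtype_apply, h4, zero_add]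

lemma tm_prod (a b : CF F) (x : V →ₗ[F] V) (y : W →ₗ[F] W) (U0 : Submodule F V)
    (U1 : Submodule F W) (h0 : U0 ≤ U0.comap x) (h1 : U1 ≤ U1.comap y)
    (S : Submodule.compatibleMaps U1 U0) :
    tm a b (blk x S.1 y) (U0.prod U1) =
      a.toFun (U0 × U1) (blk (x.restrict h0) (cmMap U0 U1 S).1 (y.restrict h1)) *
      b.toFun ((V ⧸ U0) × (W ⧸ U1)) (blk (U0.mapQ U0 x h0) (cmMap U0 U1 S).2 (U1.mapQ U1 y h1)) := by
  apply tm_eq a b _ _ (LinearMap.prodMap U0.subtype U1.subtype) (LinearMap.prodMap U0.mkQ U1.mkQ)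
  · exact Function.Injective.prodMap Subtype.val_injective Subtype.val_injective
  · exact Function.Surjective.prodMap U0.mkQ_surjective U1.mkQ_surjective
  · rw [LinearMap.range_prodMap]; simp
  · rw [LinearMap.ker_prodMap]; simp
  · intro v; simp [cmMap]; rfl
  · intro v; simp [cmMap]; rfl

lemma stable_prod (x : V →ₗ[F] V) (h : W →ₗ[F] V) (y : W →ₗ[F] W) (U0 : Submodule F V)
    (U1 : Submodule F W) (hs : U0.prod U1 ≤ (U0.prod U1).comap (blk x h y)) :
    (U0 ≤ U0.comap x ∧ U1 ≤ U1.comap y) ∧ h ∈ Submodule.compatibleMaps U1 U0 := by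
  refine ⟨⟨fun v hv => ?_, fun w hw => ?_⟩, ?_⟩
  · have := @hs (v, 0) ⟨hv, U1.zero_mem⟩
    simpa using this.1
  · have := @hs (0, w) ⟨U0.zero_mem, hw⟩
    simpa using this.2
  · rw [mem_cm]
    intro w hw
    have := @hs (0, w) ⟨U0.zero_mem, hw⟩
    simpa using this.1

lemma avg_tm_prod (a b : CF F) (x : V →ₗ[F] V) (y : W →ₗ[F] W) (U0 : Submodule F V)
    (U1 : Submodule F W) :
    (Fintype.card (Submodule.compatibleMaps U1 U0) : ℂ)⁻¹ *
      ∑ h : W →ₗ[F] V, tm a b (blk x h y) (U0.prod U1) = tm2 a b x y U0 U1 := by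
  classical
  by_cases hs : U0 ≤ U0.comap x ∧ U1 ≤ U1.comap y
  · rw [tm2, dif_pos hs]
    have h1 : ∑ h : W →ₗ[F] V, tm a b (blk x h y) (U0.prod U1) =
        ∑ S : Submodule.compatibleMaps U1 U0, tm a b (blk x S.1 y) (U0.prod U1) := by
      rw [← Finset.sum_subset (Finset.subset_univ
        (Finset.univ.filter fun h : W →ₗ[F] V => h ∈ Submodule.compatibleMaps U1 U0))]
      · exact Finset.sum_subtype _ (by simp) _
      · intro h _ hh
        apply tm_ne
        intro h3
        exact hh (by simpa using (stable_prod x h y U0 U1 h3).2)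
    rw [h1, Finset.sum_congr rfl fun S _ => tm_prod a b x y U0 U1 hs.1 hs.2 S]
    have h2 := avg_surj (cmMap U0 U1) (cmMap_surj U0 U1) (fun p =>
      a.toFun (U0 × U1) (blk (x.restrict hs.1) p.1 (y.restrict hs.2)) *
      b.toFun ((V ⧸ U0) × (W ⧸ U1)) (blk (U0.mapQ U0 x hs.1) p.2 (U1.mapQ U1 y hs.2)))
    rw [h2, Fintype.card_prod, Fintype.sum_prod_type, Dl, Dl]
    simp only [← Finset.mul_sum, ← Finset.sum_mul]
    push_cast
    rw [mul_inv]
    ring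
  · rw [tm2, dif_neg hs, Finset.sum_eq_zero, mul_zero]
    intro h _
    apply tm_ne
    exact fun h3 => hs (stable_prod x h y U0 U1 h3).1

/-- Hopf identity -/
lemma Dl_mul (a b : CF F) (x : V →ₗ[F] V) (y : W →ₗ[F] W) :
    Dl (a.mul b) x y = ∑ U0 : Submodule F V, ∑ U1 : Submodule F W, tm2 a b x y U0 U1 := by
  have h0 : ∀ h : W →ₗ[F] V, (a.mul b).toFun (V × W) (blk x h y) =
      ∑ U : Submodule F (V × W), tm a b (blk x h y) U := fun _ => rfl
  rw [Dl]
  simp only [h0, sub_sum, tm_blk_uS]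
  rw [Finset.sum_comm, Finset.mul_sum]
  refine Finset.sum_congr rfl fun U0 _ => ?_
  rw [Finset.sum_comm, Finset.mul_sum]
  refine Finset.sum_congr rfl fun U1 _ => ?_
  rw [← avg_tm_prod, ← Finset.mul_sum, Finset.sum_comm]
  have h1 : ∀ S : W →ₗ[F] V, ∑ h : W →ₗ[F] V,
      tm a b (blk x (h + (x ∘ₗ S - S ∘ₗ y)) y) (U0.prod U1) =
      ∑ h : W →ₗ[F] V, tm a b (blk x h y) (U0.prod U1) := fun S =>
    Fintype.sum_equiv (Equiv.addRight (x ∘ₗ S - S ∘ₗ y)) _ _ fun h => rfl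
  rw [Finset.sum_congr rfl fun S _ => h1 S, Finset.sum_const, Finset.card_univ, nsmul_eq_mul]
  have hc : (Fintype.card (W →ₗ[F] V) : ℂ) ≠ 0 := by exact_mod_cast Fintype.card_ne_zero
  field_simp

end LA2
end P2b

section P2c
section LA3
variable {F : Type} [Field F] [Fintype F]

/-- the general linear group -/
abbrev GL' (F : Type) [Field F] (n : ℕ) : Type := (Module.End F (Fin n → F))ˣ

noncomputable instance instFintypeGL' (n : ℕ) : Fintype (GL' F n) :=
  haveI : Finite (Module.End F (Fin n → F)) := instFiniteHom _ _
  Fintype.ofFinite _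

variable {V W X Y : Type} [AddCommGroup V] [Module F V] [Finite V] [AddCommGroup W] [Module F W]
  [Finite W] [AddCommGroup X] [Module F X] [Finite X] [AddCommGroup Y] [Module F Y] [Finite Y]

/-- unit from an equivalence -/
def unitOf {n : ℕ} (t : (Fin n → F) ≃ₗ[F] (Fin n → F)) : GL' F n :=
  ⟨(t : (Fin n → F) →ₗ[F] (Fin n → F)), (t.symm : (Fin n → F) →ₗ[F] (Fin n → F)),
    LinearMap.ext fun v => t.apply_symm_apply v, LinearMap.ext fun v => t.symm_apply_apply v⟩

/-- `u` is a matrix of `x` in some basis -/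
def Rel (n : ℕ) (x : V →ₗ[F] V) (u : GL' F n) : Prop :=
  ∃ e : V ≃ₗ[F] (Fin n → F), ∀ v, e (x v) = u.1 (e v)

open scoped Classical in
/-- extension of a class function -/
noncomputable def extFun (n : ℕ) (f : GL' F n → ℂ) (x : V →ₗ[F] V) : ℂ :=
  if h : ∃ u : GL' F n, Rel n x u then f h.choose else 0

lemma rel_conj {n : ℕ} {x : V →ₗ[F] V} {u w : GL' F n} (hu : Rel n x u) (hw : Rel n x w) :
    ∃ y : GL' F n, w = y * u * y⁻¹ := by
  obtain ⟨e, he⟩ := hu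
  obtain ⟨e', he'⟩ := hw
  let t : (Fin n → F) ≃ₗ[F] (Fin n → F) := e.symm.trans e'
  refine ⟨unitOf t, ?_⟩
  · rw [eq_mul_inv_iff_mul_eq]
    apply Units.ext
    apply LinearMap.ext
    intro v
    have h1 : v = e (e.symm v) := by simp
    simp only [Units.val_mul, Module.End.mul_apply]
    change w.1 (t v) = t (u.1 v)
    rw [h1, ← he]
    simp [t, he']

lemma rel_iso {n : ℕ} (e : V ≃ₗ[F] W) {x : V →ₗ[F] V} {y : W →ₗ[F] W}
    (h : ∀ v, e (x v) = y (e v)) {u : GL' F n} : Rel n y u ↔ Rel n x u := by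
  constructor
  · rintro ⟨e', he'⟩
    exact ⟨e.trans e', fun v => by simp [h, he']⟩
  · rintro ⟨e', he'⟩
    refine ⟨e.symm.trans e', fun v => ?_⟩
    have : e.symm (y v) = x (e.symm v) := by
      apply e.injective; rw [h]; simp
    simp [this, he']

lemma extFun_eq {n : ℕ} (f : GL' F n → ℂ) (hf : ∀ x y, f (y * x * y⁻¹) = f x) {x : V →ₗ[F] V}
    {u : GL' F n} (hu : Rel n x u) : extFun n f x = f u := by
  have h : ∃ u : GL' F n, Rel n x u := ⟨u, hu⟩
  rw [extFun, dif_pos h]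
  obtain ⟨y, hy⟩ := rel_conj hu h.choose_spec
  rw [hy, hf]

/-- extension of a class function -/
noncomputable def ext (n : ℕ) (f : GL' F n → ℂ) (hf : ∀ x y, f (y * x * y⁻¹) = f x) : CF F where
  toFun V _ _ _ x := extFun n f x
  inv e x y h := by
    by_cases hx : ∃ u : GL' F n, Rel n x u
    · obtain ⟨u, hu⟩ := hx
      rw [extFun_eq f hf hu, extFun_eq f hf ((rel_iso e h).2 hu)]
    · rw [extFun, extFun, dif_neg hx, dif_neg]
      rintro ⟨u, hu⟩
      exact hx ⟨u, (rel_iso e h).1 hu⟩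

lemma ext_eq {n : ℕ} (f : GL' F n → ℂ) (hf : ∀ x y, f (y * x * y⁻¹) = f x) {x : V →ₗ[F] V}
    {u : GL' F n} (hu : Rel n x u) : (ext n f hf).toFun V x = f u := extFun_eq f hf hu

lemma ext_val {n : ℕ} (f : GL' F n → ℂ) (hf : ∀ x y, f (y * x * y⁻¹) = f x) (u : GL' F n) :
    (ext n f hf).toFun (Fin n → F) u.1 = f u :=
  ext_eq f hf ⟨LinearEquiv.refl F _, fun v => rfl⟩

lemma ext_ne {n : ℕ} (f : GL' F n → ℂ) (hf : ∀ x y, f (y * x * y⁻¹) = f x) {x : V →ₗ[F] V}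
    (h : (ext n f hf).toFun V x ≠ 0) :
    Module.finrank F V = n ∧ Function.Injective x := by
  have h2 : ∃ u : GL' F n, Rel n x u := by
    by_contra h3
    exact h (dif_neg h3)
  obtain ⟨u, e, he⟩ := h2
  refine ⟨by rw [e.finrank_eq]; simp, ?_⟩
  intro v w hvw
  apply e.injective
  have h4 : u.1 (e v) = u.1 (e w) := by rw [← he, ← he, hvw]
  have h5 := congrArg u.2 h4
  have h6 : ∀ z, u.2 (u.1 z) = z := fun z => by
    rw [← Module.End.mul_apply, u.inv_val]; rfl
  rwa [h6, h6] at h5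

lemma exists_rel {n : ℕ} (x : V →ₗ[F] V) (hV : Module.finrank F V = n)
    (hx : Function.Injective x) : ∃ u : GL' F n, Rel n x u := by
  have hfd : Module.Finite F V := Module.Finite.of_finite
  have h1 : Module.finrank F V = Module.finrank F (Fin n → F) := by simp [hV]
  obtain ⟨e⟩ := FiniteDimensional.nonempty_linearEquiv_of_finrank_eq h1
  let x' : V ≃ₗ[F] V := LinearEquiv.ofInjectiveEndo x hx
  let t := e.symm.trans (x'.trans e)
  refine ⟨unitOf t, e, ?_⟩
  · intro v
    change _ = t (e v)
    simp [t, x']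

lemma inj_unit {n : ℕ} (x : (Fin n → F) →ₗ[F] (Fin n → F)) (hx : Function.Injective x) :
    ∃ u : GL' F n, u.1 = x := by
  let x' : (Fin n → F) ≃ₗ[F] (Fin n → F) := LinearEquiv.ofInjectiveEndo x hx
  refine ⟨unitOf x', ?_⟩
  · ext v : 1
    rfl

/-- sums over endomorphisms of functions supported on automorphisms -/
lemma sum_end {n : ℕ} (g : ((Fin n → F) →ₗ[F] (Fin n → F)) → ℂ)
    (hg : ∀ x, g x ≠ 0 → Function.Injective x) : ∑ x, g x = ∑ u : GL' F n, g u.1 := by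
  classical
  symm
  rw [← Finset.sum_image (s := Finset.univ) (g := fun u : GL' F n => u.1) (f := g)
    (fun u _ w _ h => Units.ext h)]
  apply Finset.sum_subset (Finset.subset_univ _)
  intro x _ hx
  by_contra h
  obtain ⟨u, hu⟩ := inj_unit x (hg x h)
  exact hx (Finset.mem_image.2 ⟨u, Finset.mem_univ _, hu⟩)

end LA3
end P2c

section P2d
section LA4
variable {F : Type} [Field F] [Fintype F]

variable {V W X Y : Type} [AddCommGroup V] [Module F V] [Finite V] [AddCommGroup W] [Module F W]
  [Finite W] [AddCommGroup X] [Module F X] [Finite X] [AddCommGroup Y] [Module F Y] [Finite Y]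

/-- the first summand -/
abbrev U00 (F : Type) [Field F] (V W : Type) [AddCommGroup V] [Module F V]
    [AddCommGroup W] [Module F W] : Submodule F (V × W) := LinearMap.range (LinearMap.inl F V W)

lemma mem_U00 {v : V × W} : v ∈ U00 F V W ↔ v.2 = 0 := by
  constructor
  · rintro ⟨w, rfl⟩; rfl
  · intro h
    exact ⟨v.1, by ext <;> simp [h]⟩

lemma exists_aut (U : Submodule F (V × W)) (hU : Module.finrank F U = Module.finrank F V) :
    ∃ e : (V × W) ≃ₗ[F] (V × W), (U00 F V W).map (e : (V × W) →ₗ[F] (V × W)) = U := by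
  have hV : Module.Finite F V := Module.Finite.of_finite
  have hW : Module.Finite F W := Module.Finite.of_finite
  obtain ⟨U', hU'⟩ := Submodule.exists_isCompl U
  have h1 := Submodule.finrank_add_eq_of_isCompl hU'
  rw [Module.finrank_prod, hU] at h1
  have h2 : Module.finrank F U' = Module.finrank F W := by omega
  obtain ⟨e1⟩ := FiniteDimensional.nonempty_linearEquiv_of_finrank_eq hU.symm
  obtain ⟨e2⟩ := FiniteDimensional.nonempty_linearEquiv_of_finrank_eq h2.symm
  refine ⟨(LinearEquiv.prodCongr e1 e2).trans (Submodule.prodEquivOfIsCompl U U' hU'), ?_⟩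
  ext v
  constructor
  · rintro ⟨w, ⟨w, rfl⟩, rfl⟩
    simp
  · intro hv
    refine ⟨(e1.symm ⟨v, hv⟩, 0), ⟨_, rfl⟩, ?_⟩
    simp

lemma blk_inj {x : V →ₗ[F] V} {h : W →ₗ[F] V} {y : W →ₗ[F] W} :
    Function.Injective (blk x h y) ↔ Function.Injective x ∧ Function.Injective y := by
  have hV : Module.Finite F V := Module.Finite.of_finite
  have hW : Module.Finite F W := Module.Finite.of_finite
  constructor
  · intro hi
    constructor
    · intro v w hvw
      have : blk x h y (v, 0) = blk x h y (w, 0) := by simp [hvw]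
      simpa using hi this
    · rw [LinearMap.injective_iff_surjective]
      rw [LinearMap.injective_iff_surjective] at hi
      intro w
      obtain ⟨v, hv⟩ := hi (0, w)
      exact ⟨v.2, congrArg Prod.snd hv⟩
  · rintro ⟨hx, hy⟩ v w hvw
    simp only [blk_apply, Prod.mk.injEq] at hvw
    have h2 := hy hvw.2
    rw [h2] at hvw
    have h1 := hx (add_right_cancel hvw.1)
    exact Prod.ext h1 h2

lemma stable_blk (z : (V × W) →ₗ[F] (V × W)) (hz : U00 F V W ≤ (U00 F V W).comap z) :
    ∃ x h y, z = blk x h y := by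
  refine ⟨LinearMap.fst F V W ∘ₗ z ∘ₗ LinearMap.inl F V W, LinearMap.fst F V W ∘ₗ z ∘ₗ LinearMap.inr F V W,
    LinearMap.snd F V W ∘ₗ z ∘ₗ LinearMap.inr F V W, ?_⟩
  apply LinearMap.ext
  rintro ⟨v, w⟩
  have h1 : ((v, w) : V × W) = (v, 0) + (0, w) := by simp
  have h2 : (z (v, 0)).2 = 0 := mem_U00.1 (@hz (v, 0) (mem_U00.2 rfl))
  rw [h1, map_add]
  ext <;> simp [h2]

lemma sum_blk (g : ((V × W) →ₗ[F] (V × W)) → ℂ)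
    (hg : ∀ z, g z ≠ 0 → U00 F V W ≤ (U00 F V W).comap z) :
    ∑ z, g z = ∑ x : V →ₗ[F] V, ∑ y : W →ₗ[F] W, ∑ h : W →ₗ[F] V, g (blk x h y) := by
  classical
  rw [← Fintype.sum_prod_type', ← Fintype.sum_prod_type'
    (f := fun (p : (V →ₗ[F] V) × (W →ₗ[F] W)) h => g (blk p.1 h p.2))]
  symm
  rw [← Finset.sum_image (s := Finset.univ)
    (g := fun p : ((V →ₗ[F] V) × (W →ₗ[F] W)) × (W →ₗ[F] V) => blk p.1.1 p.2 p.1.2) (f := g)]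
  · apply Finset.sum_subset (Finset.subset_univ _)
    intro z _ hz
    by_contra h0
    obtain ⟨x, h, y, rfl⟩ := stable_blk z (hg z h0)
    exact hz (Finset.mem_image.2 ⟨((x, y), h), Finset.mem_univ _, rfl⟩)
  · rintro ⟨⟨x, y⟩, h⟩ _ ⟨⟨x', y'⟩, h'⟩ _ he
    have h1 : ∀ v, x v = x' v := fun v => by
      have := congrArg Prod.fst (LinearMap.congr_fun he (v, 0)); simpa using this
    have h2 : ∀ v, h v = h' v := fun v => by
      have := congrArg Prod.fst (LinearMap.congr_fun he (0, v)); simpa using this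
    have h3 : ∀ v, y v = y' v := fun v => by
      have := congrArg Prod.snd (LinearMap.congr_fun he (0, v)); simpa using this
    rw [LinearMap.ext h1, LinearMap.ext h2, LinearMap.ext h3]

open scoped Classical in
/-- number of automorphisms -/
noncomputable def autN (F : Type) [Field F] (V : Type) [AddCommGroup V] [Module F V] [Finite V] : ℂ :=
  ∑ x : V →ₗ[F] V, if Function.Injective x then 1 else 0

open scoped Classical in
/-- number of subspaces -/
noncomputable def grN (F : Type) [Field F] (V : Type) [AddCommGroup V] [Module F V] [Finite V]
    (m : ℕ) : ℂ :=
  ∑ U : Submodule F V, if Module.finrank F U = m then 1 else 0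

/-- conjugation of endomorphisms -/
lemma sum_conj (e : V ≃ₗ[F] W) (g : (W →ₗ[F] W) → ℂ) : ∑ x : V →ₗ[F] V, g (e.conj x) = ∑ y, g y :=
  Fintype.sum_equiv e.conj.toEquiv _ _ fun x => rfl

lemma sum_compl (e : V ≃ₗ[F] W) (g : (V →ₗ[F] W) → ℂ) :
    ∑ x : V →ₗ[F] V, g ((e : V →ₗ[F] W) ∘ₗ x) = ∑ y, g y :=
  Fintype.sum_equiv
    ({ toFun := fun x => (e : V →ₗ[F] W) ∘ₗ x
       invFun := fun x => (e.symm : W →ₗ[F] V) ∘ₗ x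
       left_inv := fun x => by ext v; simp
       right_inv := fun x => by ext v; simp } : (V →ₗ[F] V) ≃ (V →ₗ[F] W)) _ _ fun x => rfl

lemma autN_iso (e : V ≃ₗ[F] W) : autN F V = autN F W := by
  classical
  rw [autN, autN, ← sum_conj e]
  refine Finset.sum_congr rfl fun x _ => ?_
  have : Function.Injective (e.conj x) ↔ Function.Injective x := by
    rw [LinearEquiv.conj_apply]
    simp [LinearMap.coe_comp, Function.Injective.of_comp_iff e.injective]
  simp only [this]

lemma autN_GL (n : ℕ) : autN F (Fin n → F) = (Fintype.card (GL' F n) : ℂ) := by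
  classical
  rw [autN, sum_end]
  · rw [Finset.sum_congr rfl (g := fun _ => (1 : ℂ))]
    · simp
    · intro u _
      rw [if_pos]
      intro v w h
      have h5 := congrArg u.2 h
      have h6 : ∀ z, u.2 (u.1 z) = z := fun z => by
        rw [← Module.End.mul_apply, u.inv_val]; rfl
      rwa [h6, h6] at h5
  · intro x hx
    by_contra h
    exact hx (if_neg h)

lemma grN_mul : grN F (V × W) (Module.finrank F V) *
    (autN F V * autN F W * Fintype.card (W →ₗ[F] V)) = autN F (V × W) := by
  classical
  have hV : Module.Finite F V := Module.Finite.of_finite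
  have hW : Module.Finite F W := Module.Finite.of_finite
  have hfr : Module.finrank F (U00 F V W) = Module.finrank F V :=
    (LinearEquiv.ofInjective (LinearMap.inl F V W) LinearMap.inl_injective).finrank_eq.symm
  have hst : autN F V * autN F W * Fintype.card (W →ₗ[F] V) =
      ∑ z : (V × W) →ₗ[F] (V × W), if Function.Injective z ∧ (U00 F V W).map z = U00 F V W then 1 else 0 := by
    rw [sum_blk]
    · have h1 : ∀ (x : V →ₗ[F] V) (y : W →ₗ[F] W) (h : W →ₗ[F] V),
          (Function.Injective (blk x h y) ∧ (U00 F V W).map (blk x h y) = U00 F V W) ↔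
          (Function.Injective x ∧ Function.Injective y) := by
        intro x y h
        rw [blk_inj]
        constructor
        · exact fun h => h.1
        · intro hi
          refine ⟨hi, ?_⟩
          apply Submodule.eq_of_le_of_finrank_eq
          · rintro _ ⟨v, hv, rfl⟩
            rw [SetLike.mem_coe, mem_U00] at hv
            rw [mem_U00]; simp [hv]
          · exact ((U00 F V W).equivMapOfInjective _ (blk_inj.2 hi)).finrank_eq.symm
      simp only [h1, Finset.sum_const, Finset.card_univ, nsmul_eq_mul]
      rw [autN, autN, Finset.sum_mul_sum, Finset.sum_mul]
      refine Finset.sum_congr rfl fun x _ => ?_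
      rw [Finset.sum_mul]
      refine Finset.sum_congr rfl fun y _ => ?_
      by_cases hx : Function.Injective x <;> by_cases hy : Function.Injective y <;> simp [hx, hy]
    · intro z hz
      have h2 : (U00 F V W).map z = U00 F V W := by
        by_contra h
        exact hz (if_neg fun h3 => h h3.2)
      exact Submodule.map_le_iff_le_comap.1 h2.le
  rw [hst, grN, Finset.sum_mul, autN]
  have hf : ∀ U : Submodule F (V × W), (if Module.finrank F U = Module.finrank F V then (1:ℂ) else 0) *
      (∑ z : (V × W) →ₗ[F] (V × W), if Function.Injective z ∧ (U00 F V W).map z = U00 F V W then 1 else 0) =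
      ∑ z : (V × W) →ₗ[F] (V × W), if Function.Injective z ∧ (U00 F V W).map z = U then 1 else 0 := by
    intro U
    by_cases hU : Module.finrank F U = Module.finrank F V
    · rw [if_pos hU, one_mul]
      obtain ⟨e, he⟩ := exists_aut U hU
      symm
      rw [← sum_compl e]
      refine Finset.sum_congr rfl fun z _ => ?_
      have h3 : (Function.Injective ((e : (V × W) →ₗ[F] (V × W)) ∘ₗ z)) ↔ Function.Injective z := by
        rw [LinearMap.coe_comp]
        exact e.injective.of_comp_iff _
      have h4 : (U00 F V W).map ((e : (V × W) →ₗ[F] (V × W)) ∘ₗ z) = U ↔ (U00 F V W).map z = U00 F V W := by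
        rw [Submodule.map_comp, ← he]
        exact (Submodule.map_injective_of_injective e.injective).eq_iff
      simp only [h3, h4]
    · rw [if_neg hU, zero_mul]
      symm
      apply Finset.sum_eq_zero
      intro z _
      rw [if_neg]
      rintro ⟨h5, h6⟩
      apply hU
      rw [← h6, ← hfr]
      exact ((U00 F V W).equivMapOfInjective _ h5).finrank_eq.symm
  rw [Finset.sum_congr rfl fun U _ => hf U, Finset.sum_comm]
  refine Finset.sum_congr rfl fun z _ => ?_
  by_cases hz : Function.Injective z
  · simp [hz]
  · simp [hz]

/-- Frobenius reciprocity -/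
lemma reciprocity (a b φ : CF F)
    (ha : ∀ (X : Type) [AddCommGroup X] [Module F X] [Finite X] (x : X →ₗ[F] X),
      a.toFun X x ≠ 0 → Module.finrank F X = Module.finrank F V) :
    ∑ z : (V × W) →ₗ[F] (V × W), hall a b z * φ.toFun (V × W) z =
      grN F (V × W) (Module.finrank F V) * ∑ x : V →ₗ[F] V, ∑ y : W →ₗ[F] W, ∑ h : W →ₗ[F] V,
        a.toFun V x * b.toFun W y * φ.toFun (V × W) (blk x h y) := by
  classical
  have h0 : ∑ x : V →ₗ[F] V, ∑ y : W →ₗ[F] W, ∑ h : W →ₗ[F] V,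
        a.toFun V x * b.toFun W y * φ.toFun (V × W) (blk x h y) =
      ∑ z : (V × W) →ₗ[F] (V × W), tm a b z (U00 F V W) * φ.toFun (V × W) z := by
    rw [sum_blk]
    · refine Finset.sum_congr rfl fun x _ => Finset.sum_congr rfl fun y _ =>
        Finset.sum_congr rfl fun h _ => ?_
      congr 1
      symm
      apply tm_eq a b _ _ (LinearMap.inl F V W) (LinearMap.snd F V W)
      · exact LinearMap.inl_injective
      · exact LinearMap.snd_surjective
      · rfl
      · exact LinearMap.ker_snd F V W
      · intro v; simp
      · intro v; simp
    · intro z hz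
      by_contra h
      exact hz (by rw [tm_ne _ _ _ _ h, zero_mul])
  rw [h0]
  simp only [hall, Finset.sum_mul]
  rw [Finset.sum_comm, grN, Finset.sum_mul]
  refine Finset.sum_congr rfl fun U _ => ?_
  by_cases hU : Module.finrank F U = Module.finrank F V
  · rw [if_pos hU, one_mul]
    obtain ⟨e, he⟩ := exists_aut U hU
    rw [← sum_conj e]
    refine Finset.sum_congr rfl fun z _ => ?_
    rw [← he, tm_conj a b e z _ (fun v => by simp), φ.inv e z _ (fun v => by simp)]
  · rw [if_neg hU, zero_mul]
    apply Finset.sum_eq_zero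
    intro z _
    rw [tm]
    split_ifs with h
    · have : a.toFun U (z.restrict h) = 0 := by
        by_contra h3
        exact hU (ha _ _ h3)
      rw [this]; simp
    · simp

end LA4
end P2d

section P2e
section LA5
variable (F : Type) [Field F] [Fintype F]

/-- chosen irreducible representations -/
noncomputable def DD (n : ℕ) : IrrData (GL' F n) := (exists_irrData _).some

/-- the basis of irreducible characters -/
structure BB where
  n : ℕ
  i : Fin (DD F n).num

variable {F}

lemma BB.mk_inj {n : ℕ} {i j : Fin (DD F n).num} (h : (⟨n, i⟩ : BB F) = ⟨n, j⟩) : i = j := by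
  cases h; rfl

/-- basis elements of degree `n` -/
noncomputable def lev (n : ℕ) : Finset (BB F) :=
  Finset.univ.map ⟨fun i => ⟨n, i⟩, fun _ _ h => BB.mk_inj h⟩

lemma mem_lev (n : ℕ) (b : BB F) : b ∈ lev n ↔ b.n = n := by
  rw [lev, Finset.mem_map]
  constructor
  · rintro ⟨i, _, rfl⟩; rfl
  · rintro rfl
    exact ⟨b.i, Finset.mem_univ _, rfl⟩

lemma sum_lev {A : Type} [AddCommMonoid A] (n : ℕ) (g : BB F → A) : ∑ b ∈ lev n, g b = ∑ i, g ⟨n, i⟩ := by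
  rw [lev, Finset.sum_map]; rfl

open scoped Classical in
/-- basis elements of degree at most `D` -/
noncomputable def upto (D : ℕ) : Finset (BB F) := (Finset.range (D + 1)).biUnion lev

lemma mem_upto {D : ℕ} {b : BB F} : b ∈ upto D ↔ b.n ≤ D := by
  simp [upto, mem_lev]

lemma sum_upto {A : Type} [AddCommMonoid A] {n D : ℕ} (h : n ≤ D) (g : BB F → A)
    (hg : ∀ b : BB F, b.n ≠ n → g b = 0) : ∑ b ∈ upto D, g b = ∑ b ∈ lev n, g b := by
  symm
  apply Finset.sum_subset
  · intro b hb
    rw [mem_lev] at hb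
    rw [mem_upto, hb]; exact h
  · intro b _ hb
    rw [mem_lev] at hb
    exact hg b hb

variable {V W X Y : Type} [AddCommGroup V] [Module F V] [Finite V] [AddCommGroup W] [Module F W]
  [Finite W] [AddCommGroup X] [Module F X] [Finite X] [AddCommGroup Y] [Module F Y] [Finite Y]

/-- irreducible characters -/
noncomputable def ch (b : BB F) : CF F := ext b.n ((DD F b.n).chi b.i) ((DD F b.n).chi_conj b.i)

/-- dual irreducible characters -/
noncomputable def ch' (b : BB F) : CF F := ext b.n (fun u => (DD F b.n).chi b.i u⁻¹)
  (fun x y => by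
    rw [← (DD F b.n).chi_conj b.i x⁻¹ y, mul_inv_rev, mul_inv_rev, inv_inv, mul_assoc])

lemma ch_val (b : BB F) (u : GL' F b.n) : (ch b).toFun _ u.1 = (DD F b.n).chi b.i u := ext_val _ _ _
lemma ch'_val (b : BB F) (u : GL' F b.n) : (ch' b).toFun _ u.1 = (DD F b.n).chi b.i u⁻¹ := ext_val _ _ _

lemma ch_ne {b : BB F} {x : V →ₗ[F] V} (h : (ch b).toFun V x ≠ 0) :
    Module.finrank F V = b.n ∧ Function.Injective x := ext_ne _ _ h

lemma ch'_ne {b : BB F} {x : V →ₗ[F] V} (h : (ch' b).toFun V x ≠ 0) :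
    Module.finrank F V = b.n ∧ Function.Injective x := ext_ne _ _ h

lemma ch_zero {b : BB F} {x : V →ₗ[F] V} (h : Module.finrank F V ≠ b.n) : (ch b).toFun V x = 0 := by
  by_contra h2
  exact h (ch_ne h2).1

lemma ch_zero' {b : BB F} {x : V →ₗ[F] V} (h : ¬ Function.Injective x) : (ch b).toFun V x = 0 := by
  by_contra h2
  exact h (ch_ne h2).2

lemma ch'_inv (b : BB F) (x y : V →ₗ[F] V) (h : ∀ v, x (y v) = v) (h' : ∀ v, y (x v) = v) :
    (ch' b).toFun V x = (ch b).toFun V y := by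
  by_cases hV : Module.finrank F V = b.n
  · have hx : Function.Injective x := Function.LeftInverse.injective h'
    obtain ⟨u, hu⟩ := exists_rel x hV hx
    have hu2 : Rel b.n y u⁻¹ := by
      obtain ⟨e, he⟩ := hu
      refine ⟨e, fun v => ?_⟩
      have h1 : ∀ z, (u⁻¹).1 (u.1 z) = z := fun z => by
        rw [← Module.End.mul_apply, u.inv_mul]; rfl
      have h2 := he (y v)
      rw [h] at h2
      rw [h2, h1]
    rw [ch', ch, ext_eq _ _ hu, ext_eq _ _ hu2]
  · rw [ch_zero hV]
    by_contra h2
    exact hV (ch'_ne h2).1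

/-- coefficient extraction -/
noncomputable def co (b : BB F) (f : ((Fin b.n → F) →ₗ[F] (Fin b.n → F)) → ℂ) : ℂ :=
  (Fintype.card (GL' F b.n) : ℂ)⁻¹ * ∑ u : GL' F b.n, f u.1 * (DD F b.n).chi b.i u⁻¹

lemma co_sum {ι : Type} (s : Finset ι) (b : BB F)
    (f : ι → ((Fin b.n → F) →ₗ[F] (Fin b.n → F)) → ℂ) :
    co b (fun x => ∑ i ∈ s, f i x) = ∑ i ∈ s, co b (f i) := by
  simp only [co, Finset.sum_mul]
  rw [Finset.sum_comm, Finset.mul_sum]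

lemma co_mul (b : BB F) (r : ℂ)
    (f : ((Fin b.n → F) →ₗ[F] (Fin b.n → F)) → ℂ) :
    co b (fun x => r * f x) = r * co b f := by
  simp only [co, Finset.mul_sum]
  refine Finset.sum_congr rfl fun u _ => by ring

lemma co_mul' (b : BB F) (r : ℂ)
    (f : ((Fin b.n → F) →ₗ[F] (Fin b.n → F)) → ℂ) :
    co b (fun x => f x * r) = co b f * r := by
  simp only [mul_comm _ r, co_mul]

open scoped Classical in
lemma co_ch (a c : BB F) : co c (fun x => (ch a).toFun _ x) = if a = c then 1 else 0 := by
  by_cases h : a.n = c.n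
  · obtain ⟨n, i⟩ := a
    obtain ⟨m, j⟩ := c
    subst h
    have h1 : ∀ u : GL' F n, (ch ⟨n, i⟩).toFun _ u.1 = (DD F n).chi i u := fun u => ch_val ⟨n, i⟩ u
    simp only [co, h1]
    rw [(DD F n).ortho]
    by_cases hij : i = j
    · rw [if_pos hij, if_pos]; rw [hij]
    · rw [if_neg hij, if_neg]; exact fun hh => hij (BB.mk_inj hh)
  · rw [if_neg (fun hh => h (by rw [hh]))]
    rw [co, Finset.sum_eq_zero, mul_zero]
    intro u _
    rw [ch_zero, zero_mul]
    simpa using Ne.symm h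

lemma expand_CF (f : CF F) (x : V →ₗ[F] V) (hx : Function.Injective x) :
    f.toFun V x = ∑ a ∈ lev (Module.finrank F V), co a (fun u => f.toFun _ u) * (ch a).toFun V x := by
  obtain ⟨u, e, he⟩ := exists_rel x rfl hx
  rw [sum_lev, ← f.inv e x u.1 he]
  rw [(DD F (Module.finrank F V)).expand (fun u => f.toFun _ u.1) ?_ u]
  · refine Finset.sum_congr rfl fun i _ => ?_
    rw [← (ch _).inv e x u.1 he]
    have := ch_val ⟨_, i⟩ u
    rw [this]
    rfl
  · intro x y
    refine f.inv (LinearMap.GeneralLinearGroup.generalLinearEquiv F _ y) _ _ fun v => ?_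
    have : ∀ z, (y⁻¹).1 (y.1 z) = z := fun z => by
        rw [← Module.End.mul_apply, y.inv_mul]; rfl
    change y.1 (x.1 v) = y.1 (x.1 ((y⁻¹).1 (y.1 v)))
    rw [this]

/-- the coproduct as a function of the first argument -/
noncomputable def DlL (f : CF F) (y : W →ₗ[F] W) : CF F where
  toFun V _ _ _ x := Dl f x y
  inv {V V'} _ _ _ _ _ _ e x x' h := by
    rw [Dl, Dl]
    let E : (W →ₗ[F] V) ≃ (W →ₗ[F] V') :=
      { toFun := fun x => (e : V →ₗ[F] V') ∘ₗ x
        invFun := fun x => (e.symm : V' →ₗ[F] V) ∘ₗ x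
        left_inv := fun x => by ext v; simp
        right_inv := fun x => by ext v; simp }
    rw [Fintype.card_congr E]
    congr 1
    symm
    refine Fintype.sum_equiv E _ _ fun t => ?_
    symm
    refine f.inv (LinearEquiv.prodCongr e (LinearEquiv.refl F W)) _ _ fun v => ?_
    simp [E, h]

/-- the coproduct as a function of the second argument -/
noncomputable def DlR (f : CF F) (x : V →ₗ[F] V) : CF F where
  toFun W _ _ _ y := Dl f x y
  inv {W W'} _ _ _ _ _ _ e y y' h := by
    rw [Dl, Dl]
    let E : (W →ₗ[F] V) ≃ (W' →ₗ[F] V) :=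
      { toFun := fun x => x ∘ₗ (e.symm : W' →ₗ[F] W)
        invFun := fun x => x ∘ₗ (e : W →ₗ[F] W')
        left_inv := fun x => by ext v; simp
        right_inv := fun x => by ext v; simp }
    rw [Fintype.card_congr E]
    congr 1
    symm
    refine Fintype.sum_equiv E _ _ fun t => ?_
    symm
    refine f.inv (LinearEquiv.prodCongr (LinearEquiv.refl F V) e) _ _ fun v => ?_
    simp [E, h]

/-- structure constants -/
noncomputable def Nc (a b c : BB F) : ℂ := co a (fun u => co b (fun w => Dl (ch c) u w))

lemma Dl_ch_zero {c : BB F} {x : V →ₗ[F] V} {y : W →ₗ[F] W}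
    (h : ¬ (Module.finrank F V + Module.finrank F W = c.n ∧ Function.Injective x ∧
      Function.Injective y)) : Dl (ch c) x y = 0 := by
  have hV : Module.Finite F V := Module.Finite.of_finite
  have hW : Module.Finite F W := Module.Finite.of_finite
  rw [Dl, Finset.sum_eq_zero, mul_zero]
  intro t _
  by_contra h2
  obtain ⟨h3, h4⟩ := ch_ne h2
  rw [Module.finrank_prod] at h3
  exact h ⟨h3, blk_inj.1 h4⟩

lemma co_zero (b : BB F) : co b (fun _ => 0) = 0 := by simp [co]

lemma Nc_zero {a b c : BB F} (h : a.n + b.n ≠ c.n) : Nc a b c = 0 := by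
  rw [Nc]
  have : ∀ (u : (Fin a.n → F) →ₗ[F] (Fin a.n → F)) (w : (Fin b.n → F) →ₗ[F] (Fin b.n → F)),
      Dl (ch c) u w = 0 := fun u w => Dl_ch_zero (by simp [h])
  simp [this, co_zero]

lemma Dl_ch (c : BB F) (x : V →ₗ[F] V) (y : W →ₗ[F] W) {D : ℕ} (hD : c.n ≤ D) :
    Dl (ch c) x y = ∑ a ∈ upto D, ∑ b ∈ upto D, Nc a b c * ((ch a).toFun V x * (ch b).toFun W y) := by
  by_cases h : Module.finrank F V + Module.finrank F W = c.n ∧ Function.Injective x ∧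
      Function.Injective y
  · obtain ⟨h1, hx, hy⟩ := h
    have e1 := expand_CF (DlL (ch c) y) x hx
    have e2 : ∀ (X : Type) [AddCommGroup X] [Module F X] [Finite X] (u : X →ₗ[F] X),
      Dl (ch c) u y = _ := fun X _ _ _ u => expand_CF (DlR (ch c) u) y hy
    change Dl (ch c) x y = ∑ a ∈ lev (Module.finrank F V), co a (fun u => Dl (ch c) u y) * (ch a).toFun V x at e1
    rw [e1, sum_upto (n := Module.finrank F V) (by omega)]
    · refine Finset.sum_congr rfl fun a ha => ?_
      rw [sum_upto (n := Module.finrank F W) (by omega)]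
      · simp only [e2]
        rw [co_sum, Finset.sum_mul]
        refine Finset.sum_congr rfl fun b hb => ?_
        rw [co_mul', Nc]
        simp only [DlR]
        ring
      · intro b hb
        rw [ch_zero (b := b) hb.symm]; ring
    · intro a ha
      apply Finset.sum_eq_zero
      intro b _
      rw [ch_zero (b := a) ha.symm]; ring
  · rw [Dl_ch_zero h]
    symm
    apply Finset.sum_eq_zero
    intro a _
    apply Finset.sum_eq_zero
    intro b _
    by_contra h2
    apply h
    have h3 := ch_ne (left_ne_zero_of_mul (right_ne_zero_of_mul h2))
    have h4 := ch_ne (right_ne_zero_of_mul (right_ne_zero_of_mul h2))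
    refine ⟨?_, h3.2, h4.2⟩
    by_contra h5
    exact h2 (by rw [Nc_zero (by rw [← h3.1, ← h4.1]; exact h5), zero_mul])

lemma hall_ne {a b : BB F} {x : V →ₗ[F] V} (h : hall (ch a) (ch b) x ≠ 0) :
    Module.finrank F V = a.n + b.n ∧ Function.Injective x := by
  have hV : Module.Finite F V := Module.Finite.of_finite
  rw [hall] at h
  obtain ⟨U, _, hU⟩ := Finset.exists_ne_zero_of_sum_ne_zero h
  rw [tm] at hU
  split_ifs at hU with hs
  · obtain ⟨h1, h2⟩ := ch_ne (left_ne_zero_of_mul hU)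
    obtain ⟨h3, h4⟩ := ch_ne (right_ne_zero_of_mul hU)
    constructor
    · rw [← h1, ← h3, add_comm, Submodule.finrank_quotient_add_finrank]
    · rw [injective_iff_map_eq_zero]
      intro v hv
      have h5 : v ∈ U := by
        rw [← Submodule.Quotient.mk_eq_zero U]
        apply h4
        simp [hv]
      have h6 : (⟨v, h5⟩ : U) = 0 := by
        apply h2
        apply Subtype.ext
        simp [hv]
      exact congrArg Subtype.val h6
  · exact absurd rfl hU

end LA5
end P2e

section P2f
section LA6
variable {F : Type} [Field F] [Fintype F]
variable {V W X Y : Type} [AddCommGroup V] [Module F V] [Finite V] [AddCommGroup W] [Module F W]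
  [Finite W] [AddCommGroup X] [Module F X] [Finite X] [AddCommGroup Y] [Module F Y] [Finite Y]

lemma unit_inj {n : ℕ} (u : GL' F n) : Function.Injective u.1 := by
  intro v w h
  have h5 := congrArg u.2 h
  have h6 : ∀ z, u.2 (u.1 z) = z := fun z => by
    rw [← Module.End.mul_apply, u.inv_val]; rfl
  rwa [h6, h6] at h5

lemma gl_mul_inv {n : ℕ} (u : GL' F n) (v : Fin n → F) : u.1 ((u⁻¹).1 v) = v := by
  rw [← Module.End.mul_apply, u.mul_inv]; rfl

lemma gl_inv_mul {n : ℕ} (u : GL' F n) (v : Fin n → F) : (u⁻¹).1 (u.1 v) = v := by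
  rw [← Module.End.mul_apply, u.inv_mul]; rfl

lemma grN_GL (m n : ℕ) : grN F ((Fin m → F) × (Fin n → F)) m *
    (Fintype.card (GL' F m) * Fintype.card (GL' F n) *
      Fintype.card ((Fin n → F) →ₗ[F] (Fin m → F))) = Fintype.card (GL' F (m + n)) := by
  have h := grN_mul (F := F) (V := Fin m → F) (W := Fin n → F)
  have e : ((Fin m → F) × (Fin n → F)) ≃ₗ[F] (Fin (m + n) → F) :=
    LinearEquiv.ofFinrankEq _ _ (by simp [Module.finrank_prod])
  rw [Module.finrank_fin_fun, autN_GL, autN_GL, autN_iso e, autN_GL] at h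
  exact h

lemma sum_ch'_blk (c : BB F) {m n : ℕ} (u : GL' F m) (w : GL' F n) :
    ∑ h : (Fin n → F) →ₗ[F] (Fin m → F), (ch' c).toFun _ (blk (u⁻¹).1 h (w⁻¹).1) =
    ∑ h : (Fin n → F) →ₗ[F] (Fin m → F), (ch c).toFun _ (blk u.1 h w.1) := by
  let E : ((Fin n → F) →ₗ[F] (Fin m → F)) ≃ ((Fin n → F) →ₗ[F] (Fin m → F)) :=
    { toFun := fun h => -(u.1 ∘ₗ h ∘ₗ w.1)
      invFun := fun h => -((u⁻¹).1 ∘ₗ h ∘ₗ (w⁻¹).1)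
      left_inv := fun h => by
        apply LinearMap.ext; intro v
        simp only [LinearMap.neg_apply, LinearMap.comp_apply, map_neg, neg_neg, gl_inv_mul, gl_mul_inv]
      right_inv := fun h => by
        apply LinearMap.ext; intro v
        simp only [LinearMap.neg_apply, LinearMap.comp_apply, map_neg, neg_neg, gl_inv_mul, gl_mul_inv] }
  refine Fintype.sum_equiv E _ _ fun h => ?_
  apply ch'_inv
  · rintro ⟨v, t⟩
    simp only [blk_apply, E, Equiv.coe_fn_mk, map_add, gl_inv_mul, LinearMap.neg_apply, map_neg,
      LinearMap.comp_apply]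
    simp
  · rintro ⟨v, t⟩
    simp only [blk_apply, E, Equiv.coe_fn_mk, map_add, gl_mul_inv, LinearMap.neg_apply, map_neg,
      LinearMap.comp_apply]
    simp

lemma co_hall (a b c : BB F) : co c (fun x => hall (ch a) (ch b) x) = Nc a b c := by
  by_cases hn : a.n + b.n = c.n
  · have hG := IrrData.cardG_ne (G := GL' F c.n)
    have hGa := IrrData.cardG_ne (G := GL' F a.n)
    have hGb := IrrData.cardG_ne (G := GL' F b.n)
    have hH : (Fintype.card ((Fin b.n → F) →ₗ[F] (Fin a.n → F)) : ℂ) ≠ 0 := by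
      exact_mod_cast Fintype.card_ne_zero
    have h1 : ∑ u : GL' F c.n, hall (ch a) (ch b) u.1 * (DD F c.n).chi c.i u⁻¹ =
        ∑ x : (Fin c.n → F) →ₗ[F] (Fin c.n → F), hall (ch a) (ch b) x * (ch' c).toFun _ x := by
      rw [sum_end]
      · exact Finset.sum_congr rfl fun u _ => by rw [ch'_val]
      · intro x hx
        exact (hall_ne (left_ne_zero_of_mul hx)).2
    have e : (Fin c.n → F) ≃ₗ[F] ((Fin a.n → F) × (Fin b.n → F)) :=
      LinearEquiv.ofFinrankEq _ _ (by simp [Module.finrank_prod, hn])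
    have h2 : ∑ x : (Fin c.n → F) →ₗ[F] (Fin c.n → F), hall (ch a) (ch b) x * (ch' c).toFun _ x =
        ∑ z : ((Fin a.n → F) × (Fin b.n → F)) →ₗ[F] ((Fin a.n → F) × (Fin b.n → F)),
          hall (ch a) (ch b) z * (ch' c).toFun _ z := by
      rw [← sum_conj e]
      refine Finset.sum_congr rfl fun x _ => ?_
      rw [hall_conj (ch a) (ch b) e x _ (fun v => by simp), (ch' c).inv e x _ (fun v => by simp)]
    have h3 : ∑ x : (Fin a.n → F) →ₗ[F] (Fin a.n → F), ∑ y : (Fin b.n → F) →ₗ[F] (Fin b.n → F),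
        ∑ h : (Fin b.n → F) →ₗ[F] (Fin a.n → F), (ch a).toFun _ x * (ch b).toFun _ y *
          (ch' c).toFun ((Fin a.n → F) × (Fin b.n → F)) (blk x h y) =
        Fintype.card ((Fin b.n → F) →ₗ[F] (Fin a.n → F)) * ∑ u : GL' F a.n, (∑ w : GL' F b.n,
          Dl (ch c) u.1 w.1 * (DD F b.n).chi b.i w⁻¹) * (DD F a.n).chi a.i u⁻¹ := by
      rw [sum_end]
      · rw [Finset.mul_sum, ← Equiv.sum_comp (Equiv.inv (GL' F a.n))]
        refine Finset.sum_congr rfl fun u _ => ?_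
        rw [sum_end]
        · rw [Finset.sum_mul, Finset.mul_sum, ← Equiv.sum_comp (Equiv.inv (GL' F b.n))]
          refine Finset.sum_congr rfl fun w _ => ?_
          rw [← Finset.mul_sum]
          simp only [Equiv.inv_apply]
          rw [sum_ch'_blk, ch_val, ch_val, Dl]
          field_simp
        · intro y hy
          obtain ⟨h, _, hh⟩ := Finset.exists_ne_zero_of_sum_ne_zero hy
          exact (ch_ne (right_ne_zero_of_mul (left_ne_zero_of_mul hh))).2
      · intro x hx
        obtain ⟨y, _, hy⟩ := Finset.exists_ne_zero_of_sum_ne_zero hx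
        obtain ⟨h, _, hh⟩ := Finset.exists_ne_zero_of_sum_ne_zero hy
        exact (ch_ne (left_ne_zero_of_mul (left_ne_zero_of_mul hh))).2
    have h4 := grN_GL (F := F) a.n b.n
    rw [hn] at h4
    have h5 := reciprocity (F := F) (V := Fin a.n → F) (W := Fin b.n → F) (ch a) (ch b) (ch' c)
      (fun X _ _ _ x hx => by rw [(ch_ne hx).1]; simp)
    rw [h3, Module.finrank_fin_fun] at h5
    rw [co, h1, h2, h5, Nc, ← h4]
    simp only [co]
    rw [← h4] at hG
    have hGr := left_ne_zero_of_mul hG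
    simp only [mul_assoc, ← Finset.mul_sum]
    field_simp
  · rw [Nc_zero hn]
    rw [co, Finset.sum_eq_zero, mul_zero]
    intro u _
    have : hall (ch a) (ch b) u.1 = 0 := by
      by_contra h
      have := (hall_ne h).1
      rw [Module.finrank_fin_fun] at this
      exact hn this.symm
    rw [this, zero_mul]

lemma mul_ch (a b : BB F) (x : V →ₗ[F] V) {D : ℕ} (hD : a.n + b.n ≤ D) :
    hall (ch a) (ch b) x = ∑ e ∈ upto D, Nc a b e * (ch e).toFun V x := by
  by_cases h : Module.finrank F V = a.n + b.n ∧ Function.Injective x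
  · have e1 := expand_CF ((ch a).mul (ch b)) x h.2
    rw [sum_upto (n := Module.finrank F V) (by omega)]
    · refine e1.trans ?_
      refine Finset.sum_congr rfl fun e _ => ?_
      rw [← co_hall]
      rfl
    · intro e he
      rw [ch_zero (b := e) he.symm, mul_zero]
  · have h0 : hall (ch a) (ch b) x = 0 := by
      by_contra h2
      exact h (hall_ne h2)
    rw [h0]
    symm
    apply Finset.sum_eq_zero
    intro e _
    by_contra h2
    obtain ⟨h3, h4⟩ := ch_ne (right_ne_zero_of_mul h2)
    apply h
    refine ⟨?_, h4⟩
    by_contra h5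
    exact h2 (by rw [Nc_zero (by rw [← h3]; exact fun h => h5 h.symm), zero_mul])

lemma sum4_comm {ι κ : Type} (s : Finset ι) (t : Finset κ) (f : ι → κ → κ → κ → κ → ℂ) :
    ∑ u ∈ s, ∑ i ∈ t, ∑ j ∈ t, ∑ k ∈ t, ∑ l ∈ t, f u i j k l =
    ∑ i ∈ t, ∑ j ∈ t, ∑ k ∈ t, ∑ l ∈ t, ∑ u ∈ s, f u i j k l := by
  rw [Finset.sum_comm]
  refine Finset.sum_congr rfl fun i _ => ?_
  rw [Finset.sum_comm]
  refine Finset.sum_congr rfl fun j _ => ?_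
  rw [Finset.sum_comm]
  refine Finset.sum_congr rfl fun k _ => ?_
  rw [Finset.sum_comm]

lemma hopf_c (a b c d : BB F) {D : ℕ} (hD : a.n + b.n ≤ D) :
    ∑ e ∈ upto D, Nc a b e * Nc c d e =
    ∑ i ∈ upto D, ∑ j ∈ upto D, ∑ k ∈ upto D, ∑ l ∈ upto D,
      Nc i j a * Nc k l b * (Nc i k c * Nc j l d) := by
  classical
  have h1 : ∀ (x : (Fin c.n → F) →ₗ[F] (Fin c.n → F)) (y : (Fin d.n → F) →ₗ[F] (Fin d.n → F)),
      Dl ((ch a).mul (ch b)) x y = ∑ e ∈ upto D, Nc a b e * Dl (ch e) x y := by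
    intro x y
    rw [Dl]
    have : ∀ z : ((Fin c.n → F) × (Fin d.n → F)) →ₗ[F] ((Fin c.n → F) × (Fin d.n → F)),
        ((ch a).mul (ch b)).toFun _ z = ∑ e ∈ upto D, Nc a b e * (ch e).toFun _ z :=
      fun z => mul_ch a b z hD
    simp only [this]
    rw [Finset.sum_comm, Finset.mul_sum]
    refine Finset.sum_congr rfl fun e _ => ?_
    rw [← Finset.mul_sum, Dl]; ring
  have h2 : ∀ (x : (Fin c.n → F) →ₗ[F] (Fin c.n → F)) (y : (Fin d.n → F) →ₗ[F] (Fin d.n → F)),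
      Dl ((ch a).mul (ch b)) x y = ∑ i ∈ upto D, ∑ j ∈ upto D, ∑ k ∈ upto D, ∑ l ∈ upto D,
        (Nc i j a * Nc k l b) * (hall (ch i) (ch k) x * hall (ch j) (ch l) y) := by
    intro x y
    rw [Dl_mul]
    have h3 : ∀ U0 U1, tm2 (ch a) (ch b) x y U0 U1 =
        ∑ i ∈ upto D, ∑ j ∈ upto D, ∑ k ∈ upto D, ∑ l ∈ upto D,
          (Nc i j a * Nc k l b) * (tm (ch i) (ch k) x U0 * tm (ch j) (ch l) y U1) := by
      intro U0 U1
      by_cases hs : U0 ≤ U0.comap x ∧ U1 ≤ U1.comap y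
      · simp only [tm2, tm, dif_pos hs, dif_pos hs.1, dif_pos hs.2]
        rw [Dl_ch a _ _ (show a.n ≤ D by omega), Dl_ch b _ _ (show b.n ≤ D by omega)]
        rw [Finset.sum_mul]
        refine Finset.sum_congr rfl fun i _ => ?_
        rw [Finset.sum_mul]
        refine Finset.sum_congr rfl fun j _ => ?_
        rw [Finset.mul_sum]
        refine Finset.sum_congr rfl fun k _ => ?_
        rw [Finset.mul_sum]
        refine Finset.sum_congr rfl fun l _ => ?_
        ring
      · rw [tm2, dif_neg hs]
        symm
        refine Finset.sum_eq_zero fun i _ => Finset.sum_eq_zero fun j _ =>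
          Finset.sum_eq_zero fun k _ => Finset.sum_eq_zero fun l _ => ?_
        by_cases hx : U0 ≤ U0.comap x
        · rw [tm_ne _ _ y U1 (fun hy => hs ⟨hx, hy⟩)]; ring
        · rw [tm_ne _ _ x U0 hx]; ring
    simp only [h3, hall, Finset.sum_mul_sum]
    simp only [Finset.mul_sum]
    rw [Finset.sum_congr rfl fun U0 _ => sum4_comm _ _ _, sum4_comm]
  have h4 : co c (fun x => co d (fun y => Dl ((ch a).mul (ch b)) x y)) =
      co c (fun x => co d (fun y => Dl ((ch a).mul (ch b)) x y)) := rfl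
  conv_lhs at h4 => simp only [h1, co_sum, co_mul]
  conv_rhs at h4 => simp only [h2, co_sum, co_mul, co_mul', co_hall]
  exact h4

end LA6
end P2f

section P2g
section LA7
variable {F : Type} [Field F] [Fintype F]
variable {V W X Y : Type} [AddCommGroup V] [Module F V] [Finite V] [AddCommGroup W] [Module F W]
  [Finite W] [AddCommGroup X] [Module F X] [Finite X] [AddCommGroup Y] [Module F Y] [Finite Y]

lemma coassoc (f : CF F) (x : V →ₗ[F] V) (y : W →ₗ[F] W) (z : X →ₗ[F] X) :
    (Fintype.card (W →ₗ[F] V) : ℂ)⁻¹ * ∑ h : W →ₗ[F] V, Dl f (blk x h y) z =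
    (Fintype.card (X →ₗ[F] W) : ℂ)⁻¹ * ∑ h : X →ₗ[F] W, Dl f x (blk y h z) := by
  simp only [Dl]
  rw [← Finset.mul_sum, ← Finset.mul_sum]
  rw [Fintype.card_congr (LinearMap.prodEquiv F (M := X) (M₂ := V) (M₃ := W)).toEquiv.symm,
    Fintype.card_congr (LinearMap.coprodEquiv F (M := W) (M₂ := X) (M₃ := V)).toEquiv.symm,
    Fintype.card_prod, Fintype.card_prod]
  have h1 : ∀ h : W →ₗ[F] V, ∑ k : X →ₗ[F] (V × W), f.toFun ((V × W) × X) (blk (blk x h y) k z) =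
      ∑ s : X →ₗ[F] V, ∑ t : X →ₗ[F] W, f.toFun ((V × W) × X) (blk (blk x h y) (s.prod t) z) := by
    intro h
    rw [← Fintype.sum_prod_type']
    exact (Fintype.sum_equiv (LinearMap.prodEquiv F (M := X) (M₂ := V) (M₃ := W)).toEquiv _ _
      fun p => rfl).symm
  have h2 : ∀ t : X →ₗ[F] W, ∑ k : (W × X) →ₗ[F] V, f.toFun (V × (W × X)) (blk x k (blk y t z)) =
      ∑ h : W →ₗ[F] V, ∑ s : X →ₗ[F] V, f.toFun (V × (W × X)) (blk x (h.coprod s) (blk y t z)) := by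
    intro t
    rw [← Fintype.sum_prod_type']
    exact (Fintype.sum_equiv (LinearMap.coprodEquiv F (M := W) (M₂ := X) (M₃ := V)).toEquiv _ _
      fun p => rfl).symm
  have h3 : ∀ h s t, f.toFun ((V × W) × X) (blk (blk x h y) (s.prod t) z) =
      f.toFun (V × (W × X)) (blk x (h.coprod s) (blk y t z)) := by
    intro h s t
    refine (f.inv (LinearEquiv.prodAssoc F V W X) _ _ fun v => ?_).symm
    simp [add_assoc]
  simp only [h1, h2, h3]
  rw [Finset.sum_congr rfl fun h _ => Finset.sum_comm, Finset.sum_comm]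
  push_cast
  rw [mul_inv, mul_inv]
  ring

lemma assoc_c (a b c d : BB F) {D : ℕ} (hD : d.n ≤ D) :
    ∑ e ∈ upto D, Nc a b e * Nc e c d = ∑ e ∈ upto D, Nc b c e * Nc a e d := by
  classical
  have h1 : ∀ (x : (Fin a.n → F) →ₗ[F] (Fin a.n → F)) (y : (Fin b.n → F) →ₗ[F] (Fin b.n → F))
      (z : (Fin c.n → F) →ₗ[F] (Fin c.n → F)),
      (Fintype.card ((Fin b.n → F) →ₗ[F] (Fin a.n → F)) : ℂ)⁻¹ *
        ∑ h : (Fin b.n → F) →ₗ[F] (Fin a.n → F), Dl (ch d) (blk x h y) z =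
      ∑ e ∈ upto D, ∑ c' ∈ upto D, Nc e c' d * (Dl (ch e) x y * (ch c').toFun _ z) := by
    intro x y z
    simp only [Dl_ch d _ _ hD]
    rw [Finset.sum_comm, Finset.mul_sum]
    refine Finset.sum_congr rfl fun e _ => ?_
    rw [Finset.sum_comm, Finset.mul_sum]
    refine Finset.sum_congr rfl fun c' _ => ?_
    rw [← Finset.mul_sum, ← Finset.sum_mul, Dl]
    ring
  have h2 : ∀ (x : (Fin a.n → F) →ₗ[F] (Fin a.n → F)) (y : (Fin b.n → F) →ₗ[F] (Fin b.n → F))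
      (z : (Fin c.n → F) →ₗ[F] (Fin c.n → F)),
      (Fintype.card ((Fin c.n → F) →ₗ[F] (Fin b.n → F)) : ℂ)⁻¹ *
        ∑ h : (Fin c.n → F) →ₗ[F] (Fin b.n → F), Dl (ch d) x (blk y h z) =
      ∑ a' ∈ upto D, ∑ e ∈ upto D, Nc a' e d * ((ch a').toFun _ x * Dl (ch e) y z) := by
    intro x y z
    simp only [Dl_ch d _ _ hD]
    rw [Finset.sum_comm, Finset.mul_sum]
    refine Finset.sum_congr rfl fun a' _ => ?_
    rw [Finset.sum_comm, Finset.mul_sum]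
    refine Finset.sum_congr rfl fun e _ => ?_
    rw [← Finset.mul_sum, ← Finset.mul_sum, Dl]
    ring
  have h3 : co a (fun x => co b (fun y => co c (fun z =>
      ∑ e ∈ upto D, ∑ c' ∈ upto D, Nc e c' d * (Dl (ch e) x y * (ch c').toFun _ z)))) =
      co a (fun x => co b (fun y => co c (fun z =>
      ∑ a' ∈ upto D, ∑ e ∈ upto D, Nc a' e d * ((ch a').toFun _ x * Dl (ch e) y z)))) := by
    simp only [← h1, ← h2, coassoc]
  simp only [co_sum, co_mul, co_mul', co_ch] at h3
  by_cases hc : c.n ≤ D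
  · by_cases ha : a.n ≤ D
    · have e1 : ∑ e ∈ upto D, Nc a b e * Nc e c d = ∑ x ∈ upto D, ∑ x_1 ∈ upto D,
          Nc x x_1 d * (co a (fun u => co b (fun w => Dl (ch x) u w)) * if x_1 = c then 1 else 0) := by
        refine Finset.sum_congr rfl fun e _ => ?_
        rw [Finset.sum_eq_single c]
        · rw [if_pos rfl, Nc]; ring
        · intro b _ hb; rw [if_neg hb]; ring
        · intro h; exact absurd (mem_upto.2 hc) h
      rw [e1, h3, Finset.sum_comm]
      refine Finset.sum_congr rfl fun e _ => ?_
      rw [Finset.sum_eq_single a]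
      · rw [if_pos rfl, Nc, Nc]; ring
      · intro b _ hb; rw [if_neg hb]; ring
      · intro h; exact absurd (mem_upto.2 ha) h
    · rw [Finset.sum_eq_zero, Finset.sum_eq_zero]
      · intro e _; rw [Nc_zero (c := d) (by omega), mul_zero]
      · intro e _
        by_cases he : a.n + b.n = e.n
        · rw [Nc_zero (c := d) (by omega), mul_zero]
        · rw [Nc_zero he, zero_mul]
  · rw [Finset.sum_eq_zero, Finset.sum_eq_zero]
    · intro e _
      by_cases he : b.n + c.n = e.n
      · rw [Nc_zero (c := d) (by omega), mul_zero]
      · rw [Nc_zero he, zero_mul]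
    · intro e _; rw [Nc_zero (c := d) (by omega), mul_zero]

lemma Dl_left [Subsingleton V] (f : CF F) (x : V →ₗ[F] V) (y : W →ₗ[F] W) :
    Dl f x y = f.toFun W y := by
  have : Subsingleton (W →ₗ[F] V) := ⟨fun a b => LinearMap.ext fun v => Subsingleton.elim _ _⟩
  have h1 : ∀ h : W →ₗ[F] V, f.toFun (V × W) (blk x h y) = f.toFun W y := by
    intro h
    let e : (V × W) ≃ₗ[F] W := LinearEquiv.ofBijective (LinearMap.snd F V W)
      ⟨fun a b hab => Prod.ext (Subsingleton.elim _ _) hab, LinearMap.snd_surjective⟩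
    exact (f.inv e _ _ fun v => rfl).symm
  have hH : (Fintype.card (W →ₗ[F] V) : ℂ) ≠ 0 := by
    exact_mod_cast Fintype.card_ne_zero
  simp only [Dl, h1, Finset.sum_const, Finset.card_univ, nsmul_eq_mul]
  field_simp

lemma Dl_right [Subsingleton W] (f : CF F) (x : V →ₗ[F] V) (y : W →ₗ[F] W) :
    Dl f x y = f.toFun V x := by
  have h1 : ∀ h : W →ₗ[F] V, f.toFun (V × W) (blk x h y) = f.toFun V x := by
    intro h
    have h0 : h = 0 := LinearMap.ext fun v => by rw [Subsingleton.elim v 0]; simp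
    let e : (V × W) ≃ₗ[F] V := LinearEquiv.ofBijective (LinearMap.fst F V W)
      ⟨fun a b hab => Prod.ext hab (Subsingleton.elim _ _), LinearMap.fst_surjective⟩
    exact (f.inv e _ _ fun v => by
      subst h0
      change x v.1 + (0 : W →ₗ[F] V) v.2 = x v.1
      simp).symm
  have hH : (Fintype.card (W →ₗ[F] V) : ℂ) ≠ 0 := by
    exact_mod_cast Fintype.card_ne_zero
  simp only [Dl, h1, Finset.sum_const, Finset.card_univ, nsmul_eq_mul]
  field_simp

instance instSubsGL0 : Subsingleton (GL' F 0) :=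
  ⟨fun a b => Units.ext (LinearMap.ext fun v => Subsingleton.elim _ _)⟩

lemma card_GL0 : Fintype.card (GL' F 0) = 1 := Fintype.card_eq_one_iff.2 ⟨1, fun _ => Subsingleton.elim _ _⟩

lemma DD0_ortho (j k : Fin (DD F 0).num) : ((DD F 0).d j : ℂ) * (DD F 0).d k = if j = k then 1 else 0 := by
  rw [← (DD F 0).ortho j k, card_GL0]
  rw [Fintype.sum_subsingleton _ (1 : GL' F 0)]
  simp [(DD F 0).chi_one]

lemma DD0_num : (DD F 0).num = 1 := by
  have hd : ∀ j, ((DD F 0).d j : ℂ) ≠ 0 := fun j => by exact_mod_cast ((DD F 0).dpos j).ne'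
  have h1 : ∀ j k : Fin (DD F 0).num, j = k := by
    intro j k
    by_contra h
    have := DD0_ortho j k
    rw [if_neg h] at this
    exact mul_ne_zero (hd j) (hd k) this
  have h2 : (DD F 0).num ≠ 0 := by
    intro h0
    have h3 := (DD F 0).expand (fun _ => 1) (fun _ _ => rfl) 1
    have : IsEmpty (Fin (DD F 0).num) := by rw [h0]; infer_instance
    simp at h3
  have h4 : (DD F 0).num ≤ 1 := by
    rw [← Fintype.card_fin (DD F 0).num]
    exact Fintype.card_le_one_iff.2 h1
  omega

/-- the unit -/
noncomputable def oo : BB F := ⟨0, ⟨0, by rw [DD0_num]; exact one_pos⟩⟩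

lemma eq_oo (b : BB F) : b.n = 0 ↔ b = oo := by
  constructor
  · intro h
    obtain ⟨n, i⟩ := b
    subst h
    unfold oo
    congr 1
    apply Fin.ext
    have := i.2
    have h2 := DD0_num (F := F)
    simp only
    omega
  · rintro rfl; rfl

lemma DD0_d (j : Fin (DD F 0).num) : (DD F 0).d j = 1 := by
  have h := DD0_ortho j j
  rw [if_pos rfl] at h
  have h2 : (DD F 0).d j * (DD F 0).d j = 1 := by exact_mod_cast h
  exact Nat.eq_one_of_mul_eq_one_left h2

lemma d_oo : (DD F (oo : BB F).n).d (oo : BB F).i = 1 := DD0_d _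

lemma co_oo (r : ℂ) : co (oo : BB F) (fun _ => r) = r := by
  have hs : Subsingleton (GL' F (oo : BB F).n) := inferInstanceAs (Subsingleton (GL' F 0))
  rw [co, Fintype.sum_subsingleton _ (1 : GL' F (oo : BB F).n)]
  have : Fintype.card (GL' F (oo : BB F).n) = 1 := card_GL0
  rw [this, inv_one, (DD F _).chi_one, d_oo]; simp

open scoped Classical in
lemma Nc_left (a b : BB F) : Nc oo a b = if a = b then 1 else 0 := by
  have : Subsingleton (Fin (oo : BB F).n → F) := inferInstanceAs (Subsingleton (Fin 0 → F))
  rw [Nc]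
  simp only [Dl_left, co_ch, co_oo]
  simp only [eq_comm]

open scoped Classical in
lemma Nc_right (a b : BB F) : Nc a oo b = if a = b then 1 else 0 := by
  have : Subsingleton (Fin (oo : BB F).n → F) := inferInstanceAs (Subsingleton (Fin 0 → F))
  rw [Nc]
  simp only [Dl_right, co_ch, co_oo]
  simp only [eq_comm]

end LA7
end P2g

section P2h
section LA8
variable {F : Type} [Field F] [Fintype F]
variable {V W X Y : Type} [AddCommGroup V] [Module F V] [Finite V] [AddCommGroup W] [Module F W]
  [Finite W] [AddCommGroup X] [Module F X] [Finite X] [AddCommGroup Y] [Module F Y] [Finite Y]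

/-- the parabolic subgroup -/
def parab {k m n : ℕ} (e : ((Fin m → F) × (Fin n → F)) ≃ₗ[F] (Fin k → F)) :
    Subgroup (GL' F k × GL' F m × GL' F n) where
  carrier := {s | ∃ h : (Fin n → F) →ₗ[F] (Fin m → F), ∀ v, s.1.1 (e v) = e (blk s.2.1.1 h s.2.2.1 v)}
  mul_mem' := by
    rintro ⟨p, x, y⟩ ⟨p', x', y'⟩ ⟨h, hh⟩ ⟨h', hh'⟩
    refine ⟨x.1 ∘ₗ h' + h ∘ₗ y'.1, fun v => ?_⟩
    simp only [Prod.mk_mul_mk, Units.val_mul, Module.End.mul_apply] at *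
    rw [hh', hh]
    simp [add_assoc]
  one_mem' := ⟨0, fun v => by simp⟩
  inv_mem' := by
    rintro ⟨p, x, y⟩ ⟨h, hh⟩
    refine ⟨-((x⁻¹).1 ∘ₗ h ∘ₗ (y⁻¹).1), fun v => ?_⟩
    simp only [Prod.inv_mk] at *
    apply unit_inj p
    rw [gl_mul_inv, hh]
    congr 1
    simp only [blk_apply, map_add, gl_mul_inv, LinearMap.neg_apply, map_neg, LinearMap.comp_apply]
    simp

/-- dual representation -/
noncomputable def dualRep {G : Type} [Group G] {d : ℕ} (ρ : G →* Matrix (Fin d) (Fin d) ℂ) :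
    G →* Matrix (Fin d) (Fin d) ℂ where
  toFun x := (ρ x⁻¹).transpose
  map_one' := by simp
  map_mul' x y := by simp [Matrix.transpose_mul]

/-- tensor product of representations -/
noncomputable def tensRep {G : Type} [Group G] {m n : Type} [Fintype m] [Fintype n] [DecidableEq m]
    [DecidableEq n] (ρ : G →* Matrix m m ℂ) (σ : G →* Matrix n n ℂ) :
    G →* Matrix (m × n) (m × n) ℂ where
  toFun x := Matrix.kronecker (ρ x) (σ x)
  map_one' := by simp
  map_mul' x y := by simp [Matrix.mul_kronecker_mul]

lemma Nc_nat (a b c : BB F) : ∃ k : ℕ, Nc a b c = k := by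
  classical
  by_cases hn : a.n + b.n = c.n
  · have e : ((Fin a.n → F) × (Fin b.n → F)) ≃ₗ[F] (Fin c.n → F) :=
      LinearEquiv.ofFinrankEq _ _ (by simp [Module.finrank_prod, hn])
    letI : Fintype (parab e) := Fintype.ofFinite _
    let σ : parab e →* Matrix ((Fin _ × Fin _) × Fin _) ((Fin _ × Fin _) × Fin _) ℂ :=
      tensRep (tensRep (((DD F c.n).rep c.i).comp ((MonoidHom.fst _ _).comp (parab e).subtype))
        ((dualRep ((DD F a.n).rep a.i)).comp
          ((MonoidHom.fst _ _).comp ((MonoidHom.snd _ _).comp (parab e).subtype))))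
        ((dualRep ((DD F b.n).rep b.i)).comp
          ((MonoidHom.snd _ _).comp ((MonoidHom.snd _ _).comp (parab e).subtype)))
    have hσ : ∀ s, (σ s).trace = (DD F c.n).chi c.i s.1.1 * (DD F a.n).chi a.i (s.1.2.1)⁻¹ *
        (DD F b.n).chi b.i (s.1.2.2)⁻¹ := by
      intro s
      change (Matrix.kroneckerMap (fun x1 x2 => x1 * x2)
        (Matrix.kroneckerMap (fun x1 x2 => x1 * x2) _ _) _).trace = _
      rw [Matrix.trace_kronecker, Matrix.trace_kronecker]
      simp only [MonoidHom.comp_apply, dualRep, MonoidHom.coe_mk, OneHom.coe_mk,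
        Matrix.trace_transpose]
      rfl
    obtain ⟨k, hk⟩ := avg_trace_nat σ
    refine ⟨k, ?_⟩
    rw [← hk]
    -- parametrization of the parabolic subgroup
    have hp : ∀ (u : GL' F a.n) (w : GL' F b.n) (h : (Fin b.n → F) →ₗ[F] (Fin a.n → F)),
        ∃ p : GL' F c.n, ∀ v, p.1 (e v) = e (blk u.1 h w.1 v) := by
      intro u w h
      obtain ⟨p, hp⟩ := inj_unit (e.conj (blk u.1 h w.1)) (by
        rw [LinearEquiv.conj_apply]
        simp only [LinearMap.coe_comp, LinearEquiv.coe_coe]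
        exact (e.injective.comp (blk_inj.2 ⟨unit_inj u, unit_inj w⟩)).comp e.symm.injective)
      refine ⟨p, fun v => ?_⟩
      rw [hp]; simp
    choose P hP using hp
    let Φ : (GL' F a.n × GL' F b.n) × ((Fin b.n → F) →ₗ[F] (Fin a.n → F)) → parab e := fun t =>
      ⟨(P t.1.1 t.1.2 t.2, t.1.1, t.1.2), ⟨t.2, hP _ _ _⟩⟩
    have hΦ : Function.Bijective Φ := by
      constructor
      · rintro ⟨⟨u, w⟩, h⟩ ⟨⟨u', w'⟩, h'⟩ hh
        have h1 := congrArg (fun s => s.1.2.1) hh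
        have h2 := congrArg (fun s => s.1.2.2) hh
        have h3 := congrArg (fun s => s.1.1) hh
        simp only [Φ] at h1 h2 h3
        subst h1 h2
        have h4 : h = h' := by
          apply LinearMap.ext
          intro v
          have h5 := hP u w h (0, v)
          rw [h3, hP] at h5
          have h6 := congrArg Prod.fst (e.injective h5)
          simpa using h6.symm
        rw [h4]
      · rintro ⟨⟨p, u, w⟩, h, hh⟩
        refine ⟨((u, w), h), ?_⟩
        apply Subtype.ext
        simp only [Φ]
        congr 1
        apply Units.ext
        apply LinearMap.ext
        intro v
        have h1 := hP u w h (e.symm v)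
        rw [e.apply_symm_apply] at h1
        rw [h1, ← hh]
        simp
    have hc : Fintype.card (parab e) = Fintype.card (GL' F a.n) * Fintype.card (GL' F b.n) *
        Fintype.card ((Fin b.n → F) →ₗ[F] (Fin a.n → F)) := by
      rw [← Fintype.card_of_bijective hΦ, Fintype.card_prod, Fintype.card_prod]
    rw [hc]
    rw [← Fintype.sum_bijective Φ hΦ _ _ (fun t => rfl)]
    simp only [hσ]
    have hch : ∀ t, (DD F c.n).chi c.i (Φ t).1.1 =
        (ch c).toFun ((Fin a.n → F) × (Fin b.n → F)) (blk t.1.1.1 t.2 t.1.2.1) := by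
      intro t
      rw [← ch_val c]
      exact (ch c).inv e _ _ fun v => (hP _ _ _ v).symm
    simp only [hch]
    rw [Fintype.sum_prod_type, Fintype.sum_prod_type, Nc]
    simp only [co, Dl]
    push_cast
    rw [mul_inv, mul_inv, mul_assoc, mul_assoc]
    congr 1
    rw [Finset.mul_sum, Finset.mul_sum]
    refine Finset.sum_congr rfl fun u _ => ?_
    rw [Finset.mul_sum, Finset.mul_sum, Finset.mul_sum, Finset.sum_mul]
    refine Finset.sum_congr rfl fun w _ => ?_
    simp only [Φ]
    rw [← Finset.sum_mul, ← Finset.sum_mul]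
    ring
  · exact ⟨0, by rw [Nc_zero hn]; simp⟩

/-- structure constants as natural numbers -/
noncomputable def Nn (a b c : BB F) : ℕ := (Nc_nat a b c).choose
lemma Nn_spec (a b c : BB F) : (Nn a b c : ℂ) = Nc a b c := (Nc_nat a b c).choose_spec.symm

/-- the dimension -/
noncomputable def dm (b : BB F) : ℕ := (DD F b.n).d b.i

lemma ch_id (b : BB F) : (ch b).toFun V LinearMap.id = if Module.finrank F V = b.n then (dm b : ℂ) else 0 := by
  split_ifs with h
  · have hV : Module.Finite F V := Module.Finite.of_finite
    have e : V ≃ₗ[F] (Fin b.n → F) := LinearEquiv.ofFinrankEq _ _ (by simp [h])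
    have h1 : Rel b.n (LinearMap.id : V →ₗ[F] V) 1 := ⟨e, fun v => rfl⟩
    rw [ch, ext_eq _ _ h1, (DD F b.n).chi_one, dm]
  · exact ch_zero h

lemma card_hom (m n : ℕ) : Fintype.card ((Fin n → F) →ₗ[F] (Fin m → F)) = Fintype.card F ^ (m * n) := by
  rw [Module.card_eq_pow_finrank (K := F) (V := (Fin n → F) →ₗ[F] (Fin m → F))]
  rw [Module.finrank_linearMap]; simp [mul_comm]

lemma hall_id (a b : BB F) : hall (ch a) (ch b) (LinearMap.id : V →ₗ[F] V) =
    if Module.finrank F V = a.n + b.n then grN F V a.n * (dm a * dm b) else 0 := by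
  classical
  have hV : Module.Finite F V := Module.Finite.of_finite
  split_ifs with h
  · rw [hall, grN, Finset.sum_mul]
    refine Finset.sum_congr rfl fun U _ => ?_
    have hs : U ≤ U.comap (LinearMap.id : V →ₗ[F] V) := le_refl _
    rw [tm, dif_pos hs]
    have h1 : (LinearMap.id : V →ₗ[F] V).restrict hs = LinearMap.id := rfl
    have h2 : U.mapQ U LinearMap.id hs = LinearMap.id := by ext v; rfl
    rw [h1, h2, ch_id, ch_id]
    have h3 := Submodule.finrank_quotient_add_finrank U
    by_cases hU : Module.finrank F U = a.n
    · rw [if_pos hU, if_pos (by omega), if_pos hU]; ring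
    · rw [if_neg hU, if_neg hU]; ring
  · by_contra h2
    exact h (hall_ne h2).1

lemma add_choose_two' (m n : ℕ) : (m + n).choose 2 = m.choose 2 + n.choose 2 + m * n := by
  induction n with
  | zero => simp
  | succ k ih =>
    have h1 : (m + (k + 1)).choose 2 = (m + k).choose 1 + (m + k).choose 2 := Nat.choose_succ_succ _ _
    have h2 : (k + 1).choose 2 = k.choose 1 + k.choose 2 := Nat.choose_succ_succ _ _
    rw [h1, h2, ih, Nat.choose_one_right, Nat.choose_one_right]
    ring

lemma dm_mul (a b : BB F) {D : ℕ} (hD : a.n + b.n ≤ D) :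
    ∑ e ∈ upto D, Nc a b e * (dm e * ((Fintype.card (GL' F e.n) : ℂ)⁻¹ * (Fintype.card F : ℂ) ^ (e.n.choose 2))) =
    (dm a * ((Fintype.card (GL' F a.n) : ℂ)⁻¹ * (Fintype.card F : ℂ) ^ (a.n.choose 2))) *
    (dm b * ((Fintype.card (GL' F b.n) : ℂ)⁻¹ * (Fintype.card F : ℂ) ^ (b.n.choose 2))) := by
  have h1 := mul_ch a b (LinearMap.id : ((Fin a.n → F) × (Fin b.n → F)) →ₗ[F] _) hD
  have hf : Module.finrank F ((Fin a.n → F) × (Fin b.n → F)) = a.n + b.n := by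
    simp [Module.finrank_prod]
  rw [hall_id, if_pos hf] at h1
  have h2 : ∑ e ∈ upto D, Nc a b e * (dm e * ((Fintype.card (GL' F e.n) : ℂ)⁻¹ *
      (Fintype.card F : ℂ) ^ (e.n.choose 2))) =
      (∑ e ∈ upto D, Nc a b e * (ch e).toFun ((Fin a.n → F) × (Fin b.n → F)) LinearMap.id) *
      ((Fintype.card (GL' F (a.n + b.n)) : ℂ)⁻¹ * (Fintype.card F : ℂ) ^ ((a.n + b.n).choose 2)) := by
    rw [Finset.sum_mul]
    refine Finset.sum_congr rfl fun e _ => ?_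
    by_cases he : a.n + b.n = e.n
    · rw [ch_id, if_pos (by rw [hf, he]), he]; ring
    · rw [Nc_zero he]; ring
  rw [h2, ← h1, ← grN_GL a.n b.n, card_hom]
  have hq : (Fintype.card F : ℂ) ≠ 0 := by exact_mod_cast Fintype.card_ne_zero
  have hG := IrrData.cardG_ne (G := GL' F (a.n + b.n))
  rw [← grN_GL a.n b.n] at hG
  have hGr := left_ne_zero_of_mul hG
  have hGa := IrrData.cardG_ne (G := GL' F a.n)
  have hGb := IrrData.cardG_ne (G := GL' F b.n)
  rw [add_choose_two' a.n b.n]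
  push_cast
  field_simp
  ring

end LA8
end P2h

section P2i
section LA9
variable {F : Type} [Field F] [Fintype F]
variable {V W X Y : Type} [AddCommGroup V] [Module F V] [Finite V] [AddCommGroup W] [Module F W]
  [Finite W] [AddCommGroup X] [Module F X] [Finite X] [AddCommGroup Y] [Module F Y] [Finite Y]

/-- scalar matrices -/
noncomputable def scal (F : Type) [Field F] (n : ℕ) : Fˣ →* GL' F n :=
  Units.map (algebraMap F (Module.End F (Fin n → F))).toMonoidHom

lemma scal_apply (n : ℕ) (z : Fˣ) (v : Fin n → F) : (scal F n z).1 v = (z : F) • v := rfl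

lemma scal_central (n : ℕ) (z : Fˣ) (x : GL' F n) : x * scal F n z = scal F n z * x := by
  apply Units.ext
  apply LinearMap.ext
  intro v
  rw [Units.val_mul, Units.val_mul, Module.End.mul_apply, Module.End.mul_apply, scal_apply, scal_apply, map_smul]

/-- central character -/
noncomputable def omB (b : BB F) : Fˣ →* ℂ where
  toFun z := (DD F b.n).omega b.i (scal F b.n z)
  map_one' := by rw [map_one, (DD F b.n).omega_one]
  map_mul' z z' := by
    rw [map_mul, (DD F b.n).omega_mul]
    exact scal_central _ _

lemma ch_smul (b : BB F) (z : Fˣ) (x : V →ₗ[F] V) :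
    (ch b).toFun V ((z : F) • x) = omB b z * (ch b).toFun V x := by
  have hz : (z : F) ≠ 0 := z.ne_zero
  by_cases hx : Function.Injective x
  · by_cases hV : Module.finrank F V = b.n
    · obtain ⟨u, hu⟩ := exists_rel x hV hx
      have h2 : Rel b.n ((z : F) • x) (scal F b.n z * u) := by
        obtain ⟨e, he⟩ := hu
        refine ⟨e, fun v => ?_⟩
        rw [Units.val_mul, Module.End.mul_apply, scal_apply, LinearMap.smul_apply, map_smul, he]
      rw [ch, ext_eq _ _ hu, ext_eq _ _ h2, (DD F b.n).chi_central_mul _ _ (scal_central _ _)]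
      rfl
    · rw [ch_zero hV, ch_zero hV, mul_zero]
  · rw [ch_zero' hx, ch_zero', mul_zero]
    intro h
    apply hx
    intro v w hvw
    apply h
    simp [hvw]

lemma Dl_smul (b : BB F) (z : Fˣ) (x : V →ₗ[F] V) (y : W →ₗ[F] W) :
    Dl (ch b) ((z : F) • x) ((z : F) • y) = omB b z * Dl (ch b) x y := by
  rw [Dl, Dl, mul_left_comm]
  congr 1
  rw [Finset.mul_sum]
  symm
  refine Fintype.sum_equiv (LinearEquiv.smulOfUnit (R := F) (M := W →ₗ[F] V) z).toEquiv _ _ fun h => ?_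
  rw [← ch_smul]
  congr 1
  apply LinearMap.ext
  intro v
  change _ = blk ((z : F) • x) ((z : F) • h) ((z : F) • y) v
  simp

lemma co_smul (b : BB F) (z : Fˣ) (f : ((Fin b.n → F) →ₗ[F] (Fin b.n → F)) → ℂ) :
    co b (fun u => f ((z : F) • u)) = omB b z * co b f := by
  rw [co, co, mul_left_comm]
  congr 1
  rw [Finset.mul_sum]
  refine Fintype.sum_equiv (Equiv.mulLeft (scal F b.n z)) _ _ fun u => ?_
  have h1 : (u⁻¹ : GL' F b.n) = scal F b.n z * ((Equiv.mulLeft (scal F b.n z)) u)⁻¹ := by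
    rw [Equiv.coe_mulLeft, mul_inv_rev, ← scal_central, inv_mul_cancel_right]
  rw [h1, (DD F b.n).chi_central_mul _ _ (scal_central _ _)]
  have h2 : (((Equiv.mulLeft (scal F b.n z)) u : GL' F b.n)).1 = (z : F) • u.1 := by
    apply LinearMap.ext
    intro v
    rw [Equiv.coe_mulLeft, Units.val_mul, Module.End.mul_apply, scal_apply]; rfl
  rw [h2]
  change f _ * (omB b z * _) = _
  ring

lemma Nc_om (a b c : BB F) (z : Fˣ) (h : Nc a b c ≠ 0) : omB c z = omB a z * omB b z := by
  have h1 : omB c z * Nc a b c = omB a z * omB b z * Nc a b c := by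
    have e1 : omB c z * Nc a b c =
        co a (fun u => co b fun w => Dl (ch c) ((z : F) • u) ((z : F) • w)) := by
      simp only [Dl_smul, co_mul]; rfl
    rw [e1, co_smul a z (fun u => co b fun w => Dl (ch c) u ((z : F) • w)), mul_assoc]
    congr 1
    have e2 : ∀ u : (Fin a.n → F) →ₗ[F] (Fin a.n → F), (co b fun w => Dl (ch c) u ((z : F) • w)) = omB b z * co b (fun w => Dl (ch c) u w) :=
      fun u => co_smul b z (fun w => Dl (ch c) u w)
    simp only [e2, co_mul]; rfl
  exact mul_right_cancel₀ h h1

lemma omB_oo (z : Fˣ) : omB (oo : BB F) z = 1 := by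
  have : scal F (oo : BB F).n z = 1 := by
    apply Units.ext
    apply LinearMap.ext
    intro v
    funext i
    exact i.elim0
  change (DD F _).omega _ (scal F (oo : BB F).n z) = 1
  rw [this, (DD F _).omega_one]

end LA9
end P2i

section P4a
section Av
/-- average of a function on a finite set -/
noncomputable def av (V : Type) [Finite V] (g : V → ℂ) : ℂ :=
  letI := Fintype.ofFinite V
  (Fintype.card V : ℂ)⁻¹ * ∑ v, g v

lemma av_eq (V : Type) [Finite V] [I : Fintype V] (g : V → ℂ) :
    av V g = (Fintype.card V : ℂ)⁻¹ * ∑ v, g v := by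
  have : I = Fintype.ofFinite V := Subsingleton.elim _ _
  subst this
  rfl

lemma av_equiv {V W : Type} [Finite V] [Finite W] (e : V ≃ W) (g : V → ℂ) (g' : W → ℂ)
    (h : ∀ v, g v = g' (e v)) : av V g = av W g' := by
  letI := Fintype.ofFinite V
  letI := Fintype.ofFinite W
  rw [av_eq, av_eq, Fintype.card_congr e, Fintype.sum_equiv e g g' h]

lemma av_prod (V W : Type) [Finite V] [Finite W] (g : V × W → ℂ) :
    av (V × W) g = av V (fun v => av W fun w => g (v, w)) := by
  letI := Fintype.ofFinite V
  letI := Fintype.ofFinite W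
  simp only [av_eq]
  rw [Fintype.card_prod, Fintype.sum_prod_type, ← Finset.mul_sum, ← mul_assoc]
  push_cast
  rw [mul_inv]

lemma av_comm (V W : Type) [Finite V] [Finite W] (g : V → W → ℂ) :
    av V (fun v => av W fun w => g v w) = av W (fun w => av V fun v => g v w) := by
  rw [← av_prod V W (fun p => g p.1 p.2), ← av_prod W V (fun p => g p.2 p.1)]
  exact av_equiv (Equiv.prodComm _ _) _ _ fun v => rfl

lemma av_mul (V : Type) [Finite V] (r : ℂ) (g : V → ℂ) : av V (fun v => r * g v) = r * av V g := by
  letI := Fintype.ofFinite V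
  simp only [av_eq]
  rw [← Finset.mul_sum, mul_left_comm]

lemma av_sum (V : Type) [Finite V] {ι : Type} (s : Finset ι) (g : ι → V → ℂ) :
    av V (fun v => ∑ i ∈ s, g i v) = ∑ i ∈ s, av V (g i) := by
  letI := Fintype.ofFinite V
  simp only [av_eq]
  rw [Finset.sum_comm, Finset.mul_sum]

lemma av_const (V : Type) [Finite V] [Nonempty V] (r : ℂ) : av V (fun _ => r) = r := by
  letI := Fintype.ofFinite V
  rw [av_eq, Finset.sum_const, Finset.card_univ, nsmul_eq_mul, ← mul_assoc, inv_mul_cancel₀, one_mul]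
  exact_mod_cast Fintype.card_ne_zero

lemma av_unique (V : Type) [Finite V] [Subsingleton V] (v : V) (g : V → ℂ) : av V g = g v := by
  haveI : Nonempty V := ⟨v⟩
  rw [← av_const V (g v)]
  congr 1
  funext w
  rw [Subsingleton.elim w v]

lemma av_surj {A B : Type} [AddCommGroup A] [AddCommGroup B] [Finite A] [Finite B]
    (φ : A →+ B) (hφ : Function.Surjective φ) (f : B → ℂ) : av A (fun x => f (φ x)) = av B f := by
  letI := Fintype.ofFinite A
  letI := Fintype.ofFinite B
  rw [av_eq, av_eq, avg_surj φ hφ f]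
end Av

section Whit
variable {F : Type} [Field F] [Fintype F]
variable {V W X Y : Type} [AddCommGroup V] [Module F V] [Finite V] [AddCommGroup W] [Module F W]
  [Finite W] [AddCommGroup X] [Module F X] [Finite X] [AddCommGroup Y] [Module F Y] [Finite Y]

/-- adding one vector to the space -/
noncomputable def adj (x : V →ₗ[F] V) (v : V) : (V × F) →ₗ[F] (V × F) :=
  blk x (LinearMap.toSpanSingleton F V v) LinearMap.id

lemma adj_apply (x : V →ₗ[F] V) (v : V) (w : V × F) : adj x v w = (x w.1 + w.2 • v, w.2) := rfl

/-- Whittaker functional, built one vector at a time -/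
noncomputable def whit (ψ : AddChar F ℂ) (f : CF F) : (k : ℕ) → (V : Type) → [AddCommGroup V] →
    [Module F V] → [Finite V] → (V →ₗ[F] V) → (V →ₗ[F] F) → ℂ
  | 0, V, _, _, _, x, _ => f.toFun V x
  | k + 1, V, _, _, _, x, l => av V fun v => ψ (-(l v)) * whit ψ f k (V × F) (adj x v) (LinearMap.snd F V F)

variable (ψ : AddChar F ℂ)

lemma whit_zero (f : CF F) (x : V →ₗ[F] V) (l : V →ₗ[F] F) : whit ψ f 0 V x l = f.toFun V x := rfl
lemma whit_succ (f : CF F) (k : ℕ) (x : V →ₗ[F] V) (l : V →ₗ[F] F) : whit ψ f (k + 1) V x l =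
    av V fun v => ψ (-(l v)) * whit ψ f k (V × F) (adj x v) (LinearMap.snd F V F) := rfl

lemma whit_conj (f : CF F) (k : ℕ) : ∀ {V W : Type} [AddCommGroup V] [Module F V] [Finite V]
    [AddCommGroup W] [Module F W] [Finite W] (e : V ≃ₗ[F] W) (x : V →ₗ[F] V) (y : W →ₗ[F] W)
    (l : V →ₗ[F] F) (l' : W →ₗ[F] F), (∀ v, e (x v) = y (e v)) → (∀ v, l v = l' (e v)) →
    whit ψ f k V x l = whit ψ f k W y l' := by
  induction k with
  | zero => intro V W _ _ _ _ _ _ e x y l l' h _; exact (f.inv e x y h).symm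
  | succ k ih =>
    intro V W _ _ _ _ _ _ e x y l l' h hl
    rw [whit_succ, whit_succ]
    refine av_equiv e.toEquiv _ _ fun v => ?_
    rw [hl]
    congr 1
    refine ih (e.prodCongr (LinearEquiv.refl F F)) _ _ _ _ ?_ ?_
    · intro w
      simp [adj_apply, h]
    · intro w; simp

lemma whit_lin {ι : Type} (s : Finset ι) (f : CF F) (r : ι → ℂ) (φ : ι → CF F) (k n : ℕ)
    (h : ∀ (U : Type) [AddCommGroup U] [Module F U] [Finite U] (x : U →ₗ[F] U),
      Module.finrank F U = n → Function.Injective x → f.toFun U x = ∑ i ∈ s, r i * (φ i).toFun U x) :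
    ∀ (V : Type) [AddCommGroup V] [Module F V] [Finite V] (x : V →ₗ[F] V) (l : V →ₗ[F] F),
    Module.finrank F V + k = n → Function.Injective x →
    whit ψ f k V x l = ∑ i ∈ s, r i * whit ψ (φ i) k V x l := by
  induction k with
  | zero => intro V _ _ _ x l hV hx; exact h V x hV hx
  | succ k ih =>
    intro V _ _ _ x l hV hx
    have hVf : Module.Finite F V := Module.Finite.of_finite
    simp only [whit_succ]
    simp only [← av_mul]
    rw [← av_sum]
    congr 1
    funext v
    rw [ih (V × F) (adj x v) _ (by rw [Module.finrank_prod, Module.finrank_self]; omega)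
      (blk_inj.2 ⟨hx, Function.injective_id⟩), Finset.mul_sum]
    refine Finset.sum_congr rfl fun i _ => by ring

lemma whit_ne (f : CF F) (k n : ℕ)
    (h : ∀ (U : Type) [AddCommGroup U] [Module F U] [Finite U] (x : U →ₗ[F] U),
      Module.finrank F U ≠ n → f.toFun U x = 0) :
    ∀ (V : Type) [AddCommGroup V] [Module F V] [Finite V] (x : V →ₗ[F] V) (l : V →ₗ[F] F),
    Module.finrank F V + k ≠ n → whit ψ f k V x l = 0 := by
  induction k with
  | zero => intro V _ _ _ x l hV; exact h V x hV
  | succ k ih =>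
    intro V _ _ _ x l hV
    have hVf : Module.Finite F V := Module.Finite.of_finite
    rw [whit_succ]
    have : ∀ v, whit ψ f k (V × F) (adj x v) (LinearMap.snd F V F) = 0 := fun v =>
      ih (V × F) (adj x v) _ (by rw [Module.finrank_prod, Module.finrank_self]; omega)
    simp only [this, mul_zero]
    exact av_const V 0

open scoped Classical in
lemma sum_dual (hψ : ψ ≠ 1) (v : V) : ∑ l : V →ₗ[F] F, ψ (-(l v)) = if v = 0 then (Fintype.card (V →ₗ[F] F) : ℂ) else 0 := by
  split_ifs with h
  · subst h; simp
  · let χ : AddChar (V →ₗ[F] F) ℂ := ψ.compAddMonoidHom (-(LinearMap.applyₗ v).toAddMonoidHom)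
    have hχ : ∀ l, ψ (-(l v)) = χ l := fun l => rfl
    simp only [hχ]
    apply AddChar.sum_eq_zero_of_ne_one
    intro h1
    apply hψ
    obtain ⟨l, hl⟩ : ∃ l : V →ₗ[F] F, l v = 1 := by
      obtain ⟨l, hl⟩ := Module.Projective.exists_dual_ne_zero F h
      exact ⟨(l v)⁻¹ • l, by rw [LinearMap.smul_apply, smul_eq_mul, inv_mul_cancel₀ hl]⟩
    ext a
    have h2 : χ ((-a) • l) = 1 := by rw [h1]; rfl
    rw [← hχ] at h2
    simpa [hl] using h2

lemma card_dual : Nat.card (V →ₗ[F] F) = Nat.card V := by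
  have hV : Module.Finite F V := Module.Finite.of_finite
  obtain ⟨e⟩ := FiniteDimensional.nonempty_linearEquiv_of_finrank_eq
    (Subspace.dual_finrank_eq (K := F) (V := V))
  exact Nat.card_congr e.toEquiv

lemma whit_fourier (hψ : ψ ≠ 1) (f : CF F) (k : ℕ) (x : V →ₗ[F] V) :
    ∑ l : V →ₗ[F] F, whit ψ f (k + 1) V x l = whit ψ f k (V × F) (adj x 0) (LinearMap.snd F V F) := by
  classical
  simp only [whit_succ]
  rw [← av_sum]
  simp only [← Finset.sum_mul, sum_dual ψ hψ]
  letI := Fintype.ofFinite V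
  rw [av_eq, Finset.sum_eq_single 0]
  · have := card_dual (F := F) (V := V)
    rw [Nat.card_eq_fintype_card, Nat.card_eq_fintype_card] at this
    rw [if_pos rfl, ← mul_assoc, this, inv_mul_cancel₀, one_mul]
    exact_mod_cast Fintype.card_ne_zero
  · intro b _ hb; rw [if_neg hb, zero_mul]
  · simp
end Whit
end P4a

section P4b
section Whit2
variable {F : Type} [Field F] [Fintype F]
variable {V W X Y : Type} [AddCommGroup V] [Module F V] [Finite V] [AddCommGroup W] [Module F W]
  [Finite W] [AddCommGroup X] [Module F X] [Finite X] [AddCommGroup Y] [Module F Y] [Finite Y]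
variable (ψ : AddChar F ℂ)

lemma whit_Dl (f : CF F) (x : V →ₗ[F] V) (k : ℕ) : ∀ (U : Type) [AddCommGroup U] [Module F U]
    [Finite U] (y : U →ₗ[F] U) (l : U →ₗ[F] F),
    av (U →ₗ[F] V) (fun h => whit ψ f k (V × U) (blk x h y) (l ∘ₗ LinearMap.snd F V U)) =
      whit ψ (DlR f x) k U y l := by
  induction k with
  | zero =>
    intro U _ _ _ y l
    rw [whit_zero, av_eq]; rfl
  | succ k ih =>
    intro U _ _ _ y l
    rw [whit_succ]
    simp only [← ih, whit_succ, ← av_mul]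
    rw [av_comm, ← av_prod U ((U × F) →ₗ[F] V) (fun p => ψ (-(l p.1)) *
      whit ψ f k (V × (U × F)) (blk x p.2 (adj y p.1)) (LinearMap.snd F U F ∘ₗ LinearMap.snd F V (U × F))),
      ← av_prod (V × U) (U →ₗ[F] V) (fun p => ψ (-((l ∘ₗ LinearMap.snd F V U) p.1)) *
      whit ψ f k ((V × U) × F) (adj (blk x p.2 y) p.1) (LinearMap.snd F (V × U) F))]
    let E : (V × U) × (U →ₗ[F] V) ≃ U × ((U × F) →ₗ[F] V) :=
      { toFun := fun p => (p.1.2, p.2.coprod (LinearMap.toSpanSingleton F V p.1.1))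
        invFun := fun p => ((p.2 (0, 1), p.1), p.2 ∘ₗ LinearMap.inl F U F)
        left_inv := by
          rintro ⟨⟨v, u⟩, h⟩
          simp only [Prod.mk.injEq, and_true]
          refine ⟨by simp, ?_⟩
          ext w; simp
        right_inv := by
          rintro ⟨u, h⟩
          simp only [Prod.mk.injEq, true_and]
          ext w <;> simp }
    refine av_equiv E _ _ ?_
    rintro ⟨⟨v, u⟩, h⟩
    change _ = ψ (-(l u)) * _
    congr 1
    refine whit_conj ψ f k (LinearEquiv.prodAssoc F V U F) _ _ _ _ ?_ ?_
    · rintro ⟨⟨a, b⟩, c⟩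
      simp [E, adj_apply, add_assoc]
    · rintro ⟨⟨a, b⟩, c⟩
      simp

lemma covec_trans (hVW : Module.finrank F V = Module.finrank F W) (l : V →ₗ[F] F) (l' : W →ₗ[F] F)
    (hl : l ≠ 0) (hl' : l' ≠ 0) : ∃ e : V ≃ₗ[F] W, ∀ v, l v = l' (e v) := by
  have hV : Module.Finite F V := Module.Finite.of_finite
  have hW : Module.Finite F W := Module.Finite.of_finite
  have key : ∀ {U : Type} [AddCommGroup U] [Module F U] [Finite U] (m : U →ₗ[F] F), m ≠ 0 →
      ∃ e : U ≃ₗ[F] (LinearMap.ker m × F), ∀ v, m v = (e v).2 := by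
    intro U _ _ _ m hm
    obtain ⟨u0, hu0⟩ : ∃ u, m u ≠ 0 := by
      by_contra h
      push Not at h
      exact hm (LinearMap.ext h)
    obtain ⟨u, hu⟩ : ∃ u, m u = 1 := ⟨(m u0)⁻¹ • u0, by rw [map_smul, smul_eq_mul, inv_mul_cancel₀ hu0]⟩
    let P : U →ₗ[F] LinearMap.ker m := (LinearMap.id - m.smulRight u).codRestrict _ (by
      intro c; simp [hu])
    have hP : ∀ w, (P w : U) = w - m w • u := fun w => rfl
    refine ⟨LinearEquiv.ofLinear (P.prod m) ((LinearMap.ker m).subtype.coprod (LinearMap.toSpanSingleton F U u)) ?_ ?_, fun v => rfl⟩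
    · apply LinearMap.ext
      rintro ⟨⟨w, hw⟩, c⟩
      rw [LinearMap.mem_ker] at hw
      apply Prod.ext
      · apply Subtype.ext
        simp [hP, hw, hu]
      · simp [hw, hu]
    · apply LinearMap.ext
      intro w
      simp [hP]
  obtain ⟨e1, h1⟩ := key l hl
  obtain ⟨e2, h2⟩ := key l' hl'
  have hk : Module.finrank F (LinearMap.ker l) = Module.finrank F (LinearMap.ker l') := by
    have := e1.finrank_eq
    have := e2.finrank_eq
    rw [Module.finrank_prod, Module.finrank_self] at *
    omega
  obtain ⟨e3⟩ := FiniteDimensional.nonempty_linearEquiv_of_finrank_eq hk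
  refine ⟨e1.trans ((e3.prodCongr (LinearEquiv.refl F F)).trans e2.symm), fun v => ?_⟩
  rw [h1, h2]; simp

lemma whit_trans (f : CF F) (k : ℕ) (hVW : Module.finrank F V = Module.finrank F W) (l : V →ₗ[F] F)
    (l' : W →ₗ[F] F) (hl : l ≠ 0) (hl' : l' ≠ 0) :
    whit ψ f k V LinearMap.id l = whit ψ f k W LinearMap.id l' := by
  obtain ⟨e, he⟩ := covec_trans hVW l l' hl hl'
  exact whit_conj ψ f k e _ _ _ _ (fun v => rfl) he

/-- a covector, nonzero when possible -/
noncomputable def lst (F : Type) [Field F] (m : ℕ) : (Fin m → F) →ₗ[F] F :=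
  if h : 0 < m then LinearMap.proj ⟨0, h⟩ else 0

lemma lst_ne {m : ℕ} (h : 0 < m) : lst F m ≠ 0 := by
  intro h2
  have := LinearMap.congr_fun h2 (fun _ => 1)
  simp [lst, h] at this

/-- values at identity with nondegenerate functional -/
noncomputable def wa (f : CF F) (m k : ℕ) : ℂ := whit ψ f k (Fin m → F) LinearMap.id (lst F m)
/-- values at identity with zero functional -/
noncomputable def wb (f : CF F) (m k : ℕ) : ℂ := whit ψ f k (Fin m → F) LinearMap.id 0

lemma wa_step (hψ : ψ ≠ 1) (f : CF F) (m k : ℕ) :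
    wa ψ f (m + 1) k = wb ψ f m (k + 1) + ((Fintype.card F : ℂ) ^ m - 1) * wa ψ f m (k + 1) := by
  classical
  have h1 := whit_fourier ψ hψ f k (LinearMap.id : (Fin m → F) →ₗ[F] _)
  have h2 : (adj LinearMap.id 0 : ((Fin m → F) × F) →ₗ[F] _) = LinearMap.id := by
    apply LinearMap.ext; intro v; simp [adj_apply]
  rw [h2, whit_trans ψ f k (W := Fin (m + 1) → F) (by simp) _ (lst F (m + 1)) _ (lst_ne (by omega))] at h1
  · rw [wa, ← h1, ← Finset.add_sum_erase _ _ (Finset.mem_univ 0)]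
    congr 1
    have h3 : ∀ l ∈ Finset.univ.erase (0 : (Fin m → F) →ₗ[F] F),
        whit ψ f (k + 1) (Fin m → F) LinearMap.id l = wa ψ f m (k + 1) := by
      intro l hl
      have hl := Finset.ne_of_mem_erase hl
      refine whit_trans ψ f _ rfl _ _ hl (lst_ne ?_)
      by_contra h
      have : m = 0 := by omega
      subst this
      exact hl (Subsingleton.elim _ _)
    rw [Finset.sum_congr rfl h3, Finset.sum_const, Finset.card_erase_of_mem (Finset.mem_univ _),
      Finset.card_univ, nsmul_eq_mul]
    have h4 := card_dual (F := F) (V := Fin m → F)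
    rw [Nat.card_eq_fintype_card, Nat.card_eq_fintype_card] at h4
    rw [h4, Nat.cast_sub Fintype.card_pos]
    simp
  · intro h
    have := LinearMap.congr_fun h (0, 1)
    simp at this

/-- product of `q ^ i - 1` -/
noncomputable def dl (F : Type) [Fintype F] (n : ℕ) : ℂ := ∏ i ∈ Finset.range n, ((Fintype.card F : ℂ) ^ (i + 1) - 1)

lemma qpow_ne (i : ℕ) : (Fintype.card F : ℂ) ^ (i + 1) - 1 ≠ 0 := by
  have h : 1 < Fintype.card F := Fintype.one_lt_card
  have h2 : 1 < Fintype.card F ^ (i + 1) := Nat.one_lt_pow (by omega) h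
  intro h3
  have h4 : ((Fintype.card F ^ (i + 1) : ℕ) : ℂ) = ((1 : ℕ) : ℂ) := by
    push_cast
    exact sub_eq_zero.1 h3
  have := Nat.cast_injective h4
  omega

lemma dl_ne (n : ℕ) : dl F n ≠ 0 := Finset.prod_ne_zero_iff.2 fun i _ => qpow_ne i

lemma dl_succ (n : ℕ) : dl F (n + 1) = dl F n * ((Fintype.card F : ℂ) ^ (n + 1) - 1) := Finset.prod_range_succ _ _

lemma wb_sum_aux (hψ : ψ ≠ 1) (f : CF F) (n M : ℕ) (hM : M < n) :
    wa ψ f (M + 1) (n - (M + 1)) * (dl F M)⁻¹ = ∑ m ∈ Finset.range (M + 1), wb ψ f m (n - m) * (dl F m)⁻¹ := by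
  induction M with
  | zero =>
    rw [wa_step ψ hψ, show n - (0 + 1) + 1 = n - 0 by omega]
    simp
  | succ M ih =>
    rw [Finset.sum_range_succ, ← ih (by omega), wa_step ψ hψ,
      show n - (M + 1 + 1) + 1 = n - (M + 1) by omega, dl_succ]
    have := dl_ne (F := F) M
    have := qpow_ne (F := F) M
    field_simp
    ring

lemma wb_sum (hψ : ψ ≠ 1) (f : CF F) (n : ℕ) :
    (Fintype.card F : ℂ) ^ n * (f.toFun (Fin n → F) LinearMap.id * (dl F n)⁻¹) =
      ∑ m ∈ Finset.range (n + 1), wb ψ f m (n - m) * (dl F m)⁻¹ := by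
  rw [Finset.sum_range_succ]
  have h0 : wb ψ f n (n - n) = f.toFun (Fin n → F) LinearMap.id := by
    rw [Nat.sub_self]; rfl
  rw [h0]
  cases n with
  | zero => simp
  | succ M =>
    rw [← wb_sum_aux ψ hψ f (M + 1) M (by omega)]
    have h1 : wa ψ f (M + 1) (M + 1 - (M + 1)) = f.toFun (Fin (M + 1) → F) LinearMap.id := by
      rw [Nat.sub_self]; rfl
    rw [h1, dl_succ]
    have := dl_ne (F := F) M
    have := qpow_ne (F := F) M
    field_simp
    ring

/-- the Whittaker multiplicity -/
noncomputable def cc (b : BB F) : ℂ := wb ψ (ch b) 0 b.n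

lemma wb_ch (a : BB F) (m k : ℕ) {D : ℕ} (hD : a.n ≤ D) (hk : m + k = a.n) :
    wb ψ (ch a) m k = ∑ j ∈ upto D, ∑ i ∈ upto D, if j.n = m then Nc j i a * (cc ψ i * dm j) else 0 := by
  have h1 := whit_Dl ψ (ch a) (LinearMap.id : (Fin m → F) →ₗ[F] _) k (Fin 0 → F) LinearMap.id 0
  rw [av_unique _ 0] at h1
  have h2 : wb ψ (ch a) m k = whit ψ (DlR (ch a) (LinearMap.id : (Fin m → F) →ₗ[F] _)) k (Fin 0 → F) LinearMap.id 0 := by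
    rw [← h1, wb]
    refine whit_conj ψ _ k (LinearEquiv.prodUnique (R := F) (M := Fin m → F) (M₂ := Fin 0 → F)).symm _ _ _ _ ?_ ?_
    · intro v
      apply Prod.ext
      · simp
      · exact Subsingleton.elim _ _
    · intro v; simp
  rw [h2, whit_lin ψ (upto D ×ˢ upto D) _ (fun p => Nc p.1 p.2 a * (ch p.1).toFun (Fin m → F) LinearMap.id)
    (fun p => ch p.2) k k ?_ _ _ _ (by simp) Function.injective_id, Finset.sum_product]
  · refine Finset.sum_congr rfl fun j _ => Finset.sum_congr rfl fun i _ => ?_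
    split_ifs with hj
    · by_cases hi : i.n = k
      · simp only [ch_id]
        rw [if_pos (by simp [hj]), cc, wb, hi]; ring
      · rw [Nc_zero (show j.n + i.n ≠ a.n by omega)]; ring
    · simp only [ch_id]
      rw [if_neg (by simpa using Ne.symm hj)]; ring
  · intro U _ _ _ x _ _
    change Dl (ch a) _ x = _
    rw [Dl_ch a _ x hD, Finset.sum_product]
    refine Finset.sum_congr rfl fun j _ => Finset.sum_congr rfl fun i _ => ?_
    ring

theorem P5_c (hψ : ψ ≠ 1) (a : BB F) {D : ℕ} (hD : a.n ≤ D) :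
    (Fintype.card F : ℂ) ^ a.n * (dm a * (dl F a.n)⁻¹) =
      ∑ i ∈ upto D, ∑ j ∈ upto D, Nc j i a * (cc ψ i * (dm j * (dl F j.n)⁻¹)) := by
  have h1 := wb_sum ψ hψ (ch a) a.n
  rw [ch_id, if_pos (by simp)] at h1
  rw [h1]
  have h2 : ∀ m ∈ Finset.range (a.n + 1), wb ψ (ch a) m (a.n - m) * (dl F m)⁻¹ =
      ∑ j ∈ upto D, ∑ i ∈ upto D, if j.n = m then Nc j i a * (cc ψ i * (dm j * (dl F m)⁻¹)) else 0 := by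
    intro m hm
    rw [Finset.mem_range] at hm
    rw [wb_ch ψ a m _ hD (by omega), Finset.sum_mul]
    refine Finset.sum_congr rfl fun j _ => ?_
    rw [Finset.sum_mul]
    refine Finset.sum_congr rfl fun i _ => ?_
    split_ifs <;> ring
  rw [Finset.sum_congr rfl h2, Finset.sum_comm, Finset.sum_comm (s := upto D) (t := upto D)]
  refine Finset.sum_congr rfl fun j _ => ?_
  rw [Finset.sum_comm]
  refine Finset.sum_congr rfl fun i _ => ?_
  rw [Finset.sum_ite_eq]
  split_ifs with h
  · rfl
  · rw [Nc_zero, zero_mul]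
    rw [Finset.mem_range] at h; omega
end Whit2
end P4b

section P4c
section GGsec
variable {F : Type} [Field F] [Fintype F]
variable {V W X Y : Type} [AddCommGroup V] [Module F V] [Finite V] [AddCommGroup W] [Module F W]
  [Finite W] [AddCommGroup X] [Module F X] [Finite X] [AddCommGroup Y] [Module F Y] [Finite Y]
variable (ψ : AddChar F ℂ)

/-- the two models of the general linear group -/
noncomputable def glEquiv (F : Type) [Field F] (n : ℕ) : GL (Fin n) F ≃* GL' F n :=
  Units.mapEquiv (Matrix.toLinAlgEquiv' (R := F) (n := Fin n)).toMulEquiv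

lemma glEquiv_val (n : ℕ) (x : GL (Fin n) F) : (glEquiv F n x).1 = Matrix.toLin' x.1 := rfl

lemma choose_succ_two (n : ℕ) : (n + 1).choose 2 = n.choose 2 + n := by
  rw [Nat.choose_succ_succ' n 1, Nat.choose_one_right, add_comm]

lemma card_GL' (n : ℕ) : (Fintype.card (GL' F n) : ℂ) = (Fintype.card F : ℂ) ^ (n.choose 2) * dl F n := by
  classical
  have h1 : Fintype.card (GL' F n) = ∏ i : Fin n, (Fintype.card F ^ n - Fintype.card F ^ (i : ℕ)) := by
    rw [← Nat.card_eq_fintype_card, ← Nat.card_congr (glEquiv F n).toEquiv]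
    have := Matrix.card_GL_field (𝔽 := F) n
    simpa using this
  rw [h1, Fin.prod_univ_eq_prod_range (fun i => Fintype.card F ^ n - Fintype.card F ^ i) n]
  push_cast
  have h2 : ∀ i ∈ Finset.range n, ((Fintype.card F ^ n - Fintype.card F ^ i : ℕ) : ℂ) =
      (Fintype.card F : ℂ) ^ i * ((Fintype.card F : ℂ) ^ (n - 1 - i + 1) - 1) := by
    intro i hi
    rw [Finset.mem_range] at hi
    rw [Nat.cast_sub (Nat.pow_le_pow_right Fintype.card_pos (by omega)), mul_sub, ← pow_add]
    rw [show i + (n - 1 - i + 1) = n by omega]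
    push_cast
    ring
  rw [Finset.prod_congr rfl h2, Finset.prod_mul_distrib,
    Finset.prod_range_reflect (fun j => (Fintype.card F : ℂ) ^ (j + 1) - 1) n, dl]
  congr 1
  rw [Finset.prod_pow_eq_pow_sum]
  congr 1
  rw [Finset.sum_range_id, Nat.choose_two_right]

lemma dl_eq (n : ℕ) : (dl F n)⁻¹ = (Fintype.card (GL' F n) : ℂ)⁻¹ * (Fintype.card F : ℂ) ^ (n.choose 2) := by
  have hq : (Fintype.card F : ℂ) ≠ 0 := by exact_mod_cast Fintype.card_ne_zero
  have := dl_ne (F := F) n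
  rw [card_GL']
  field_simp

open scoped Classical in
/-- the indicator function of a scalar -/
noncomputable def f0 (n : ℕ) (z : Fˣ) : CF F where
  toFun V _ _ _ x := if Module.finrank F V = n ∧ ∀ v, (z : F) • x v = v then 1 else 0
  inv {V W} _ _ _ _ _ _ e x y h := by
    have : (Module.finrank F W = n ∧ ∀ v, (z : F) • y v = v) ↔
        (Module.finrank F V = n ∧ ∀ v, (z : F) • x v = v) := by
      rw [e.finrank_eq]
      refine and_congr Iff.rfl ⟨fun h2 v => e.injective ?_, fun h2 v => ?_⟩
      · rw [map_smul, h, h2]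
      · obtain ⟨w, rfl⟩ := e.surjective v
        rw [← h, ← map_smul, h2]
    simp only [this]

lemma f0_expand (n : ℕ) (z : Fˣ) (x : V →ₗ[F] V) (hV : Module.finrank F V = n) (hx : Function.Injective x) :
    (f0 n z).toFun V x = ∑ b ∈ lev n, ((Fintype.card (GL' F n) : ℂ)⁻¹ * (dm b * omB b z)) * (ch b).toFun V x := by
  classical
  obtain ⟨u, hu⟩ := exists_rel x hV hx
  have h1 : ∀ b ∈ lev n, ((Fintype.card (GL' F n) : ℂ)⁻¹ * (dm b * omB b z)) * (ch b).toFun V x =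
      (Fintype.card (GL' F n) : ℂ)⁻¹ * (dm b * (ch b).toFun V ((z : F) • x)) := by
    intro b _
    rw [ch_smul]; ring
  rw [Finset.sum_congr rfl h1, ← Finset.mul_sum, sum_lev]
  have h2 : Rel n ((z : F) • x) (scal F n z * u) := by
    obtain ⟨e, he⟩ := hu
    refine ⟨e, fun v => ?_⟩
    rw [Units.val_mul, Module.End.mul_apply, scal_apply, LinearMap.smul_apply, map_smul, he]
  have h3 : ∀ i, (dm (⟨n, i⟩ : BB F) : ℂ) * (ch ⟨n, i⟩).toFun V ((z : F) • x) =
      (DD F n).d i * ((DD F n).rep i (scal F n z * u)).trace := by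
    intro i
    rw [ch, ext_eq _ _ h2]; rfl
  simp only [h3]
  rw [(DD F n).reg]
  have h4 : (∀ v, (z : F) • x v = v) ↔ scal F n z * u = 1 := by
    obtain ⟨e, he⟩ := h2
    constructor
    · intro h
      apply Units.ext
      apply LinearMap.ext
      intro v
      obtain ⟨w, rfl⟩ := e.surjective v
      rw [← he]
      exact congrArg e (h w)
    · intro h v
      apply e.injective
      have := he v
      rw [h] at this
      exact this
  have hG := IrrData.cardG_ne (G := GL' F n)
  change (if _ then _ else _) = _
  by_cases h5 : scal F n z * u = 1
  · rw [if_pos ⟨hV, h4.2 h5⟩, if_pos h5, inv_mul_cancel₀ hG]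
  · rw [if_neg (fun h => h5 (h4.1 h.2)), if_neg h5, mul_zero]

lemma cc_gg (n : ℕ) (z : Fˣ) : ∑ b ∈ lev n, cc ψ b * omB b z * (dm b * (Fintype.card (GL' F n) : ℂ)⁻¹) =
    whit ψ (f0 n z) n (Fin 0 → F) LinearMap.id 0 := by
  rw [whit_lin ψ (lev n) _ (fun b => ((Fintype.card (GL' F n) : ℂ)⁻¹ * (dm b * omB b z))) (fun b => ch b) n n
    (fun U _ _ _ x hU hx => f0_expand n z x hU hx) _ _ _ (by simp) Function.injective_id]
  refine Finset.sum_congr rfl fun b hb => ?_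
  rw [mem_lev] at hb
  rw [cc, wb, hb]
  ring

open scoped Classical in
lemma whit_f0_ne (n : ℕ) (z : Fˣ) (hz : z ≠ 1) (k : ℕ) : ∀ (V : Type) [AddCommGroup V] [Module F V]
    [Finite V] (x : V →ₗ[F] V) (l : V →ₗ[F] F) (m : V →ₗ[F] F), m ≠ 0 → (∀ v, m (x v) = m v) →
    whit ψ (f0 n z) k V x l = 0 := by
  induction k with
  | zero =>
    intro V _ _ _ x l m hm h
    rw [whit_zero]
    change (if _ then _ else _) = _
    rw [if_neg]
    rintro ⟨_, h2⟩
    apply hm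
    ext v
    have h3 := congrArg m (h2 v)
    rw [map_smul, h, smul_eq_mul] at h3
    by_contra h4
    have h5 : (m v) ≠ 0 := h4
    apply hz
    apply Units.ext
    exact mul_right_cancel₀ h5 (by rw [h3]; simp)
  | succ k ih =>
    intro V _ _ _ x l m hm h
    rw [whit_succ]
    have : ∀ v, whit ψ (f0 n z) k (V × F) (adj x v) (LinearMap.snd F V F) = 0 := fun v =>
      ih (V × F) (adj x v) _ (LinearMap.snd F V F) (fun h => by
        have := LinearMap.congr_fun h (0, 1)
        simp at this) (fun w => rfl)
    simp only [this, mul_zero]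
    exact av_const V 0

open scoped Classical in
lemma whit_f0_one (n : ℕ) (k : ℕ) : ∀ (V : Type) [AddCommGroup V] [Module F V]
    [Finite V] (x : V →ₗ[F] V) (l : V →ₗ[F] F), Module.finrank F V + k = n →
    (Fintype.card F : ℂ) ^ (n.choose 2) * whit ψ (f0 n 1) k V x l =
      if x = LinearMap.id then (Fintype.card F : ℂ) ^ ((Module.finrank F V).choose 2) else 0 := by
  have hq : (Fintype.card F : ℂ) ≠ 0 := by exact_mod_cast Fintype.card_ne_zero
  induction k with
  | zero =>
    intro V _ _ _ x l hV
    rw [whit_zero]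
    change _ * (if _ then _ else _) = _
    have : (∀ v, ((1 : Fˣ) : F) • x v = v) ↔ x = LinearMap.id := by
      rw [LinearMap.ext_iff]
      simp
    simp only [add_zero] at hV
    have h2 : (∀ v, x v = v) ↔ x = LinearMap.id := by
      rw [LinearMap.ext_iff]; simp
    simp [hV, h2]
  | succ k ih =>
    intro V _ _ _ x l hV
    have hVf : Module.Finite F V := Module.Finite.of_finite
    have hf : Module.finrank F (V × F) = Module.finrank F V + 1 := by
      rw [Module.finrank_prod, Module.finrank_self]
    rw [whit_succ, ← av_mul]
    have h1 : ∀ v, (Fintype.card F : ℂ) ^ (n.choose 2) * (ψ (-(l v)) *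
        whit ψ (f0 n 1) k (V × F) (adj x v) (LinearMap.snd F V F)) =
        if v = 0 then (if x = LinearMap.id then (Fintype.card F : ℂ) ^ ((Module.finrank F V + 1).choose 2) else 0) else 0 := by
      intro v
      rw [mul_left_comm, ih (V × F) _ _ (by omega), hf]
      have : adj x v = LinearMap.id ↔ v = 0 ∧ x = LinearMap.id := by
        constructor
        · intro h
          have h2 := LinearMap.congr_fun h (0, 1)
          simp [adj_apply] at h2
          refine ⟨h2, ?_⟩
          ext w
          have h3 := LinearMap.congr_fun h (w, 0)
          simpa [adj_apply] using h3
        · rintro ⟨rfl, rfl⟩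
          apply LinearMap.ext; intro v; simp [adj_apply]
      by_cases hv : v = 0
      · subst hv
        simp [this]
      · simp [this, hv]
    simp only [h1]
    letI := Fintype.ofFinite V
    rw [av_eq, Finset.sum_ite_eq']
    simp only [Finset.mem_univ, if_true]
    split_ifs with hx
    · rw [choose_succ_two, Module.card_eq_pow_finrank (K := F) (V := V), pow_add]
      push_cast
      field_simp
    · simp

open scoped Classical in
theorem GG_c (n : ℕ) (hn : 1 ≤ n) (z : Fˣ) :
    ∑ b ∈ lev n, cc ψ b * omB b z * (dm b * (dl F b.n)⁻¹) = if z = 1 then 1 else 0 := by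
  have h1 := cc_gg ψ n z
  have h2 : ∑ b ∈ lev n, cc ψ b * omB b z * (dm b * (dl F b.n)⁻¹) =
      (Fintype.card F : ℂ) ^ (n.choose 2) * whit ψ (f0 n z) n (Fin 0 → F) LinearMap.id 0 := by
    rw [← h1, Finset.mul_sum]
    refine Finset.sum_congr rfl fun b hb => ?_
    rw [mem_lev] at hb
    rw [hb, dl_eq]; ring
  rw [h2]
  split_ifs with hz
  · rw [hz, whit_f0_one ψ n n _ _ _ (by simp), if_pos rfl]; simp
  · obtain ⟨k, rfl⟩ : ∃ k, n = k + 1 := ⟨n - 1, by omega⟩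
    rw [whit_succ]
    have : ∀ v, whit ψ (f0 (k + 1) z) k ((Fin 0 → F) × F) (adj LinearMap.id v) (LinearMap.snd F (Fin 0 → F) F) = 0 := fun v =>
      whit_f0_ne ψ (k + 1) z hz k _ _ _ (LinearMap.snd F (Fin 0 → F) F) (fun h => by
        have := LinearMap.congr_fun h (0, 1)
        simp at this) (fun w => rfl)
    simp only [this, mul_zero]
    rw [av_const, mul_zero]

lemma cc_oo : cc ψ (oo : BB F) = 1 := by
  rw [cc]
  change (ch (oo : BB F)).toFun (Fin 0 → F) LinearMap.id = 1
  rw [ch_id, if_pos (by rw [(eq_oo (oo : BB F)).2 rfl]; simp), dm, d_oo]; simp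
end GGsec
end P4c

section P4d
section Unip
variable {F : Type} [Field F] [Fintype F]
variable {V W X Y : Type} [AddCommGroup V] [Module F V] [Finite V] [AddCommGroup W] [Module F W]
  [Finite W] [AddCommGroup X] [Module F X] [Finite X] [AddCommGroup Y] [Module F Y] [Finite Y]
variable (ψ : AddChar F ℂ)

/-- strictly upper part -/
def ut {k : ℕ} (N : Matrix (Fin k) (Fin k) F) : Matrix (Fin k) (Fin k) F :=
  Matrix.of fun i j => if i < j then N i j else 0

lemma ut_apply {k : ℕ} (N : Matrix (Fin k) (Fin k) F) (i j : Fin k) : ut N i j = if i < j then N i j else 0 := rfl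

/-- sum of superdiagonal entries -/
def sup {k : ℕ} (N : Matrix (Fin k) (Fin k) F) : F := ∑ i, ∑ j, if i.1 + 1 = j.1 then N i j else 0

instance instFiniteMat (k : ℕ) : Finite (Matrix (Fin k) (Fin k) F) := inferInstanceAs (Finite (Fin k → Fin k → F))

lemma ut_mulVec_zero {k : ℕ} (N : Matrix (Fin (k + 1)) (Fin (k + 1)) F) (c : Fin (k + 1) → F) :
    (ut N).mulVec c 0 = ∑ j : Fin k, N 0 j.succ * c j.succ := by
  rw [Matrix.mulVec, dotProduct, Fin.sum_univ_succ]
  simp [ut_apply]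

lemma ut_mulVec_succ {k : ℕ} (N : Matrix (Fin (k + 1)) (Fin (k + 1)) F) (c : Fin (k + 1) → F) (i : Fin k) :
    (ut N).mulVec c i.succ = (ut (N.submatrix Fin.succ Fin.succ)).mulVec (fun j => c j.succ) i := by
  rw [Matrix.mulVec, dotProduct, Fin.sum_univ_succ, Matrix.mulVec, dotProduct]
  simp [ut_apply]

lemma sup_succ {k : ℕ} (N : Matrix (Fin (k + 1)) (Fin (k + 1)) F) :
    sup N = (∑ j : Fin k, if j.1 = 0 then N 0 j.succ else 0) + sup (N.submatrix Fin.succ Fin.succ) := by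
  rw [sup, Fin.sum_univ_succ, sup]
  congr 1
  · rw [Fin.sum_univ_succ]; simp
  · refine Finset.sum_congr rfl fun i _ => ?_
    rw [Fin.sum_univ_succ]; simp

lemma whit_mat (f : CF F) (k : ℕ) : ∀ (V : Type) [AddCommGroup V] [Module F V] [Finite V]
    (x : V →ₗ[F] V) (l : V →ₗ[F] F), whit ψ f k V x l =
    av ((Fin k → V) × Matrix (Fin k) (Fin k) F) (fun p =>
      ψ (-((∑ j : Fin k, if j.1 = 0 then l (p.1 j) else 0) + sup p.2)) *
        f.toFun (V × (Fin k → F)) (blk x (Fintype.linearCombination F p.1) (Matrix.toLin' (1 + ut p.2)))) := by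
  induction k with
  | zero =>
    intro V _ _ _ x l
    rw [whit_zero, av_unique _ (0, 0)]
    simp only [sup, Finset.univ_eq_empty, Finset.sum_empty, add_zero, neg_zero, AddChar.map_zero_eq_one, one_mul]
    refine f.inv (LinearEquiv.prodUnique (R := F) (M := V) (M₂ := Fin 0 → F)) _ _ ?_
    intro v
    simp [Fintype.linearCombination_apply]
  | succ k ih =>
    intro V _ _ _ x l
    rw [whit_succ]
    simp only [ih, ← av_mul]
    rw [← av_prod V ((Fin k → V × F) × Matrix (Fin k) (Fin k) F) (fun p => ψ (-(l p.1)) *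
      (ψ (-((∑ j : Fin k, if j.1 = 0 then (LinearMap.snd F V F) (p.2.1 j) else 0) + sup p.2.2)) *
        f.toFun ((V × F) × (Fin k → F)) (blk (adj x p.1) (Fintype.linearCombination F p.2.1)
          (Matrix.toLin' (1 + ut p.2.2)))))]
    let φ : (Fin (k + 1) → V) × Matrix (Fin (k + 1)) (Fin (k + 1)) F →+
        V × ((Fin k → V × F) × Matrix (Fin k) (Fin k) F) :=
      { toFun := fun p => (p.1 0, (fun j => (p.1 j.succ, p.2 0 j.succ)), p.2.submatrix Fin.succ Fin.succ)
        map_zero' := rfl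
        map_add' := fun p p' => rfl }
    have hφ : Function.Surjective φ := by
      rintro ⟨v, h, N⟩
      refine ⟨(Fin.cons v (fun j => (h j).1), Matrix.of fun i j => Fin.cases (motive := fun _ => F)
        (Fin.cases (motive := fun _ => F) 0 (fun j => (h j).2) j)
        (fun i => Fin.cases (motive := fun _ => F) 0 (fun j => N i j) j) i), ?_⟩
      rfl
    rw [← av_surj φ hφ]
    congr 1
    funext p
    obtain ⟨h, N⟩ := p
    change ψ (-(l (h 0))) * (ψ (-((∑ j : Fin k, if j.1 = 0 then N 0 j.succ else 0) +
      sup (N.submatrix Fin.succ Fin.succ))) * f.toFun ((V × F) × (Fin k → F)) (blk (adj x (h 0))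
        (Fintype.linearCombination F (fun j => (h j.succ, N 0 j.succ)))
          (Matrix.toLin' (1 + ut (N.submatrix Fin.succ Fin.succ))))) = _
    rw [← mul_assoc, ← AddChar.map_add_eq_mul]
    congr 1
    · congr 1
      rw [sup_succ, Fin.sum_univ_succ]
      simp
      ring
    · let e : (V × (Fin (k + 1) → F)) ≃ₗ[F] ((V × F) × (Fin k → F)) :=
        { toFun := fun p => ((p.1, p.2 0), fun j => p.2 j.succ)
          invFun := fun p => (p.1.1, Fin.cons p.1.2 p.2)
          map_add' := fun p p' => rfl
          map_smul' := fun r p => rfl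
          left_inv := fun p => by
            apply Prod.ext
            · rfl
            · funext j
              refine Fin.cases ?_ (fun j => ?_) j <;> rfl
          right_inv := fun p => rfl }
      refine f.inv e _ _ ?_
      rintro ⟨v, c⟩
      have h1 : e (v, c) = ((v, c 0), fun j => c j.succ) := rfl
      rw [h1, blk_apply, blk_apply]
      have h2 : ∀ w c', e (w, c') = ((w, c' 0), fun j => c' j.succ) := fun w c' => rfl
      rw [h2]
      simp only [Matrix.toLin'_apply, Matrix.add_mulVec, Matrix.one_mulVec, Pi.add_apply, ut_mulVec_zero,
        ut_mulVec_succ, adj_apply, Fintype.linearCombination_apply]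
      apply Prod.ext
      · apply Prod.ext
        · simp only [Prod.fst_add, Prod.fst_sum, Prod.smul_fst]
          rw [Fin.sum_univ_succ, add_assoc]
        · simp only [Prod.snd_add, Prod.snd_sum, Prod.smul_snd, smul_eq_mul]
          congr 1
          exact Finset.sum_congr rfl fun j _ => mul_comm _ _
      · rfl

lemma cc_mat (b : BB F) : cc ψ b = av (Matrix (Fin b.n) (Fin b.n) F) (fun N =>
    ψ (-sup N) * (ch b).toFun (Fin b.n → F) (Matrix.toLin' (1 + ut N))) := by
  rw [cc, wb, whit_mat, av_prod, av_unique (Fin b.n → Fin 0 → F) 0]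
  congr 1
  funext N
  congr 1
  · simp
  · refine (ch b).inv (LinearEquiv.uniqueProd (R := F) (M := Fin b.n → F) (M₂ := Fin 0 → F)).symm _ _ ?_
    intro v
    apply Prod.ext
    · exact Subsingleton.elim _ _
    · simp

/-- upper unitriangular matrices -/
def isU {n : ℕ} (u : Matrix (Fin n) (Fin n) F) : Prop := (∀ i j, j < i → u i j = 0) ∧ ∀ i, u i i = 1

lemma isU_one {n : ℕ} : isU (1 : Matrix (Fin n) (Fin n) F) :=
  ⟨fun i j h => Matrix.one_apply_ne h.ne', fun i => Matrix.one_apply_eq i⟩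

lemma isU_mul {n : ℕ} {u w : Matrix (Fin n) (Fin n) F} (hu : isU u) (hw : isU w) : isU (u * w) := by
  constructor
  · intro i j h
    rw [Matrix.mul_apply]
    refine Finset.sum_eq_zero fun k _ => ?_
    by_cases hk : k < i
    · rw [hu.1 _ _ hk, zero_mul]
    · rw [hw.1 _ _ (lt_of_lt_of_le h (not_lt.1 hk)), mul_zero]
  · intro i
    rw [Matrix.mul_apply, Finset.sum_eq_single i]
    · rw [hu.2, hw.2, one_mul]
    · intro k _ hk
      rcases lt_or_gt_of_ne hk with h | h
      · rw [hu.1 _ _ h, zero_mul]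
      · rw [hw.1 _ _ h, mul_zero]
    · simp

lemma isU_det {n : ℕ} {u : Matrix (Fin n) (Fin n) F} (hu : isU u) : u.det = 1 := by
  rw [Matrix.det_of_upperTriangular (fun i j h => hu.1 i j h)]
  exact Finset.prod_eq_one fun i _ => hu.2 i

lemma sup_mul {n : ℕ} {u w : Matrix (Fin n) (Fin n) F} (hu : isU u) (hw : isU w) :
    sup (u * w) = sup u + sup w := by
  simp only [sup, ← Finset.sum_add_distrib]
  refine Finset.sum_congr rfl fun i _ => Finset.sum_congr rfl fun j _ => ?_
  split_ifs with h
  · have hij : i ≠ j := fun hh => by rw [hh] at h; omega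
    rw [Matrix.mul_apply, Finset.sum_eq_add i j hij]
    · rw [hu.2, hw.2]; ring
    · intro k _ ⟨hk1, hk2⟩
      by_cases h3 : k < i
      · rw [hu.1 _ _ h3, zero_mul]
      · rw [hw.1 _ _ ?_, mul_zero]
        have h1 : k.1 ≠ i.1 := fun h => hk1 (Fin.ext h)
        have h2 : k.1 ≠ j.1 := fun h => hk2 (Fin.ext h)
        rw [Fin.lt_def] at *
        omega
    · simp
    · simp
  · simp

instance instFiniteGL (n : ℕ) : Finite (GL (Fin n) F) := inferInstanceAs (Finite (Matrix (Fin n) (Fin n) F)ˣ)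

/-- the group of upper unitriangular matrices -/
def UG (F : Type) [Field F] [Fintype F] (n : ℕ) : Subgroup (GL (Fin n) F) where
  carrier := {u | isU u.1}
  mul_mem' := fun hu hw => isU_mul hu hw
  one_mem' := isU_one
  inv_mem' := by
    intro u hu
    let S : Submonoid (GL (Fin n) F) :=
      { carrier := {u | isU u.1}
        mul_mem' := fun hu hw => isU_mul hu hw
        one_mem' := isU_one }
    have h1 : u ^ (orderOf u - 1) = u⁻¹ := by
      rw [eq_inv_iff_mul_eq_one, ← pow_succ, Nat.sub_add_cancel (orderOf_pos u), pow_orderOf_eq_one]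
    rw [← h1]
    exact S.pow_mem (x := u) hu _

noncomputable instance instFintypeUG (n : ℕ) : Fintype (UG F n) := Fintype.ofFinite _

lemma av_unip (n : ℕ) (g : Matrix (Fin n) (Fin n) F → ℂ) :
    av (Matrix (Fin n) (Fin n) F) (fun N => g (1 + ut N)) = av (UG F n) (fun u => g u.1.1) := by
  let S : AddSubgroup (Matrix (Fin n) (Fin n) F) :=
    { carrier := {M | ∀ i j, j ≤ i → M i j = 0}
      add_mem' := fun {a b} ha hb i j h => by rw [Matrix.add_apply, ha i j h, hb i j h, add_zero]
      zero_mem' := fun i j h => rfl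
      neg_mem' := fun {a} ha i j h => by rw [Matrix.neg_apply, ha i j h, neg_zero] }
  let φ : Matrix (Fin n) (Fin n) F →+ S :=
    { toFun := fun N => ⟨ut N, fun i j h => if_neg (not_lt.2 h)⟩
      map_zero' := by
        apply Subtype.ext
        ext i j; simp [ut_apply]
      map_add' := fun a b => by
        apply Subtype.ext
        ext i j
        simp only [ut_apply, Matrix.add_apply, AddSubgroup.coe_add]
        split_ifs <;> simp }
  have hφ : Function.Surjective φ := by
    rintro ⟨M, hM⟩
    refine ⟨M, ?_⟩
    apply Subtype.ext
    ext i j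
    change (if i < j then M i j else 0) = M i j
    split_ifs with h
    · rfl
    · exact (hM i j (not_lt.1 h)).symm
  refine (av_surj φ hφ (fun M : S => g (1 + M.1))).trans ?_
  have hU : ∀ M : S, isU (1 + M.1) := fun M => by
    constructor
    · intro i j h
      rw [Matrix.add_apply, M.2 i j h.le, Matrix.one_apply_ne h.ne', add_zero]
    · intro i
      rw [Matrix.add_apply, M.2 i i le_rfl, Matrix.one_apply_eq, add_zero]
  have hdet : ∀ M : S, IsUnit (1 + M.1).det := fun M => by rw [isU_det (hU M)]; exact isUnit_one
  let E : S ≃ UG F n :=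
    { toFun := fun M => ⟨Matrix.nonsingInvUnit (1 + M.1) (hdet M), hU M⟩
      invFun := fun u => ⟨u.1.1 - 1, fun i j h => by
        have hu : isU u.1.1 := u.2
        rw [Matrix.sub_apply]
        rcases h.lt_or_eq with h | h
        · rw [hu.1 _ _ h, Matrix.one_apply_ne h.ne', sub_zero]
        · rw [h, hu.2, Matrix.one_apply_eq, sub_self]⟩
      left_inv := fun M => by
        apply Subtype.ext
        change (1 + M.1) - 1 = M.1
        abel
      right_inv := fun u => by
        apply Subtype.ext
        apply Units.ext
        change 1 + (u.1.1 - 1) = u.1.1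
        abel }
  exact av_equiv E _ _ fun M => rfl

lemma sup_ut {n : ℕ} (N : Matrix (Fin n) (Fin n) F) : sup (1 + ut N) = sup N := by
  refine Finset.sum_congr rfl fun i _ => Finset.sum_congr rfl fun j _ => ?_
  split_ifs with h
  · have : i < j := by rw [Fin.lt_def]; omega
    rw [Matrix.add_apply, ut_apply, if_pos this, Matrix.one_apply_ne this.ne, zero_add]
  · rfl

lemma cc_UG (b : BB F) : cc ψ b = av (UG F b.n) (fun u => ψ (-sup u.1.1) *
    (DD F b.n).chi b.i (glEquiv F b.n u.1)) := by
  rw [cc_mat]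
  simp only [← ch_val, glEquiv_val]
  rw [← av_unip b.n (fun M => ψ (-sup M) * (ch b).toFun (Fin b.n → F) (Matrix.toLin' M))]
  simp only [sup_ut]
end Unip
end P4d

section P4e
section Bru
variable {F : Type} [Field F] [Fintype F]

lemma rowop {n : ℕ} (i : Fin n) (c : Fin n → F) (hc : ∀ a, ¬ a < i → c a = 0) :
    ∃ u : Matrix (Fin n) (Fin n) F, isU u ∧
      ∀ (M : Matrix (Fin n) (Fin n) F) a j, (u * M) a j = M a j - c a * M i j := by
  refine ⟨1 - Matrix.of fun a b => if b = i then c a else 0, ⟨?_, ?_⟩, ?_⟩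
  · intro a b h
    rw [Matrix.sub_apply, Matrix.one_apply_ne h.ne', Matrix.of_apply]
    split_ifs with hb
    · rw [hc a (by rw [← hb]; exact not_lt.2 h.le), sub_zero]
    · rw [sub_zero]
  · intro a
    rw [Matrix.sub_apply, Matrix.one_apply_eq, Matrix.of_apply]
    split_ifs with hb
    · rw [hc a (by rw [← hb]; exact lt_irrefl _), sub_zero]
    · rw [sub_zero]
  · intro M a j
    rw [sub_mul, one_mul, Matrix.sub_apply, Matrix.mul_apply]
    simp

lemma colop {n : ℕ} (k : Fin n) (d : Fin n → F) (hd : ∀ b, ¬ k < b → d b = 0) :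
    ∃ u : Matrix (Fin n) (Fin n) F, isU u ∧
      ∀ (M : Matrix (Fin n) (Fin n) F) a j, (M * u) a j = M a j - M a k * d j := by
  refine ⟨1 - Matrix.of fun a b => if a = k then d b else 0, ⟨?_, ?_⟩, ?_⟩
  · intro a b h
    rw [Matrix.sub_apply, Matrix.one_apply_ne h.ne', Matrix.of_apply]
    split_ifs with hb
    · rw [hd b (by rw [← hb]; exact not_lt.2 h.le), sub_zero]
    · rw [sub_zero]
  · intro a
    rw [Matrix.sub_apply, Matrix.one_apply_eq, Matrix.of_apply]
    split_ifs with hb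
    · rw [hd a (by rw [← hb]; exact lt_irrefl _), sub_zero]
    · rw [sub_zero]
  · intro M a j
    rw [mul_sub, mul_one, Matrix.sub_apply, Matrix.mul_apply]
    simp

lemma bruhat_aux {n : ℕ} (g : Matrix (Fin n) (Fin n) F) (hg : g.det ≠ 0) (k : ℕ) (hk : k ≤ n) :
    ∃ u w : Matrix (Fin n) (Fin n) F, isU u ∧ isU w ∧ ∃ r : Fin n → Fin n, ∀ j : Fin n, j.1 < k →
      (∀ i, i ≠ r j → (u * g * w) i j = 0) ∧ (u * g * w) (r j) j ≠ 0 ∧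
      ∀ l, l ≠ j → (u * g * w) (r j) l = 0 := by
  induction k with
  | zero => exact ⟨1, 1, isU_one, isU_one, id, fun j hj => absurd hj (by omega)⟩
  | succ k ih =>
    obtain ⟨u, w, hu, hw, r, hr⟩ := ih (by omega)
    set M := u * g * w with hM
    have hdet : M.det ≠ 0 := by
      rw [hM, Matrix.det_mul, Matrix.det_mul, isU_det hu, isU_det hw]; simpa using hg
    let K : Fin n := ⟨k, by omega⟩
    have hex : ∃ i, M i K ≠ 0 := by
      by_contra h
      push Not at h
      exact hdet (Matrix.det_eq_zero_of_column_eq_zero K h)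
    classical
    obtain ⟨i, hi, hmax⟩ : ∃ i, M i K ≠ 0 ∧ ∀ a, i < a → M a K = 0 := by
      have hne : (Finset.univ.filter fun i => M i K ≠ 0).Nonempty := by
        obtain ⟨i, hi⟩ := hex
        exact ⟨i, by simpa using hi⟩
      refine ⟨_, (Finset.mem_filter.1 (Finset.max'_mem _ hne)).2, fun a ha => ?_⟩
      by_contra h
      exact absurd (Finset.le_max' _ a (by simpa using h)) (not_le.2 ha)
    have hir : ∀ j : Fin n, j.1 < k → i ≠ r j := by
      intro j hj h
      apply hi
      rw [h]
      refine (hr j hj).2.2 K fun h => ?_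
      rw [← h] at hj
      exact lt_irrefl _ hj
    have hij : ∀ j : Fin n, j.1 < k → M i j = 0 := fun j hj => (hr j hj).1 i (hir j hj)
    obtain ⟨u', hu', hu2⟩ := rowop i (fun a => if a < i then M a K / M i K else 0)
      (fun a h => if_neg h)
    obtain ⟨w', hw', hw2⟩ := colop K (fun b => if K < b then M i b / M i K else 0)
      (fun a h => if_neg h)
    have hform : ∀ a b, ((u' * u) * g * (w * w')) a b = (M a b - (if a < i then M a K / M i K else 0) * M i b) -
        (M a K - (if a < i then M a K / M i K else 0) * M i K) * (if K < b then M i b / M i K else 0) := by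
      intro a b
      have : (u' * u) * g * (w * w') = (u' * M) * w' := by rw [hM]; noncomm_ring
      rw [this, hw2, hu2, hu2]
    -- the cleared column
    have hcol : ∀ a, a ≠ i → M a K - (if a < i then M a K / M i K else 0) * M i K = 0 := by
      intro a ha
      split_ifs with h
      · field_simp; ring
      · rw [hmax a (lt_of_le_of_ne (not_lt.1 h) ha.symm)]; ring
    have hrowi : ∀ b, ((u' * u) * g * (w * w')) i b = M i b - M i K * (if K < b then M i b / M i K else 0) := by
      intro b; rw [hform, if_neg (lt_irrefl i)]; ring
    have hother : ∀ a b, a ≠ i → ((u' * u) * g * (w * w')) a b =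
        M a b - (if a < i then M a K / M i K else 0) * M i b := by
      intro a b ha; rw [hform, hcol a ha]; ring
    refine ⟨u' * u, w * w', isU_mul hu' hu, isU_mul hw hw', fun j => if j = K then i else r j, fun j hj => ?_⟩
    by_cases hjK : j = K
    · subst hjK
      simp only [if_true]
      refine ⟨fun a ha => ?_, ?_, fun l hl => ?_⟩
      · rw [hother a _ ha]; exact hcol a ha
      · rw [hrowi, if_neg (lt_irrefl _), mul_zero, sub_zero]; exact hi
      · rw [hrowi]
        split_ifs with h
        · field_simp; ring
        · rw [hij l ?_]; · ring
          have h1 : l ≤ K := not_lt.1 h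
          have h2 : l < K := lt_of_le_of_ne h1 hl
          exact h2
    · have hjk : j.1 < k := by
        have : j.1 ≠ k := fun h => hjK (Fin.ext h)
        omega
      have hjK' : ¬ K < j := by
        intro h
        have : k < j.1 := h
        omega
      simp only [if_neg hjK]
      obtain ⟨h1, h2, h3⟩ := hr j hjk
      have hc0 : (if r j < i then M (r j) K / M i K else 0) = 0 := by
        rw [h3 K (fun h => hjK h.symm)]; simp
      have hrow : ∀ b, ((u' * u) * g * (w * w')) (r j) b = M (r j) b := by
        intro b
        rw [hother _ _ (hir j hjk).symm, hc0]; ring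
      refine ⟨fun a ha => ?_, ?_, fun l hl => ?_⟩
      · by_cases hai : a = i
        · rw [hai, hrowi, hij j hjk, if_neg hjK']; ring
        · rw [hother _ _ hai, hij j hjk, h1 a ha]; ring
      · rw [hrow]; exact h2
      · rw [hrow]; exact h3 l hl

/-- monomial matrix -/
def mono {n : ℕ} (σ : Equiv.Perm (Fin n)) (t : Fin n → F) : Matrix (Fin n) (Fin n) F :=
  Matrix.of fun i j => if i = σ j then t j else 0

lemma bruhat {n : ℕ} (g : Matrix (Fin n) (Fin n) F) (hg : g.det ≠ 0) :
    ∃ u w : Matrix (Fin n) (Fin n) F, isU u ∧ isU w ∧ ∃ (σ : Equiv.Perm (Fin n)) (t : Fin n → F),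
      (∀ j, t j ≠ 0) ∧ u * g * w = mono σ t := by
  obtain ⟨u, w, hu, hw, r, hr⟩ := bruhat_aux g hg n le_rfl
  have hinj : Function.Injective r := by
    intro j l h
    by_contra hne
    have h1 := (hr j j.2).2.2 l (fun h => hne h.symm)
    rw [h] at h1
    exact (hr l l.2).2.1 h1
  refine ⟨u, w, hu, hw, Equiv.ofBijective r (Finite.injective_iff_bijective.1 hinj),
    fun j => (u * g * w) (r j) j, fun j => (hr j j.2).2.1, ?_⟩
  ext i j
  rw [mono, Matrix.of_apply]
  split_ifs with h
  · rw [h]; rfl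
  · exact (hr j j.2).1 i h

/-- elementary -/
def elem {n : ℕ} (a b : Fin n) (x : F) : Matrix (Fin n) (Fin n) F := 1 + Matrix.single a b x

lemma isU_elem {n : ℕ} {a b : Fin n} (h : a < b) (x : F) : isU (elem a b x) := by
  constructor
  · intro i j hij
    rw [elem, Matrix.add_apply, Matrix.one_apply_ne hij.ne', zero_add, Matrix.single_apply_of_ne]
    rintro ⟨rfl, rfl⟩
    exact lt_asymm h hij
  · intro i
    rw [elem, Matrix.add_apply, Matrix.one_apply_eq, Matrix.single_apply_of_ne, add_zero]
    rintro ⟨rfl, rfl⟩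
    exact lt_irrefl _ h

lemma sup_elem {n : ℕ} (a b : Fin n) (x : F) : sup (elem a b x) = if a.1 + 1 = b.1 then x else 0 := by
  rw [sup, Finset.sum_eq_single a, Finset.sum_eq_single b]
  · split_ifs with h
    · rw [elem, Matrix.add_apply, Matrix.one_apply_ne (fun h' => by rw [h'] at h; omega), zero_add,
        Matrix.single_apply_same]
    · rfl
  · intro j _ hj
    split_ifs with h
    · rw [elem, Matrix.add_apply, Matrix.one_apply_ne (fun h' => by rw [h'] at h; omega), zero_add,
        Matrix.single_apply_of_ne]
      rintro ⟨-, h⟩; exact hj h.symm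
    · rfl
  · simp
  · intro i _ hi
    refine Finset.sum_eq_zero fun j _ => ?_
    split_ifs with h
    · rw [elem, Matrix.add_apply, Matrix.one_apply_ne (fun h' => by rw [h'] at h; omega), zero_add,
        Matrix.single_apply_of_ne]
      rintro ⟨h, -⟩; exact hi h.symm
    · rfl
  · simp

lemma mono_elem {n : ℕ} (σ : Equiv.Perm (Fin n)) (t : Fin n → F) (ht : ∀ j, t j ≠ 0) (a b : Fin n) (x : F) :
    mono σ t * elem a b x = elem (σ a) (σ b) (x * (t a / t b)) * mono σ t := by
  rw [elem, elem, mul_add, add_mul, mul_one, one_mul]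
  congr 1
  ext i j
  rw [Matrix.mul_apply, Matrix.mul_apply, Finset.sum_eq_single a, Finset.sum_eq_single (σ b)]
  · simp only [mono, Matrix.of_apply, Matrix.single_apply]
    have := ht b
    by_cases h1 : i = σ a
    · by_cases h2 : b = j
      · subst h2
        simp [h1]
        field_simp
      · simp [h1, h2]
    · have h1' : ¬ σ a = i := fun h => h1 h.symm
      simp [h1, h1']
  · intro c _ hc
    rw [Matrix.single_apply_of_ne, zero_mul]
    rintro ⟨-, h⟩; exact hc h.symm
  · simp
  · intro c _ hc
    rw [Matrix.single_apply_of_ne, mul_zero]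
    rintro ⟨h, -⟩; exact hc h.symm
  · simp

/-- relevance condition -/
def Relv {n : ℕ} (σ : Equiv.Perm (Fin n)) (t : Fin n → F) : Prop :=
  ∀ a b : Fin n, a < b → σ a < σ b → (a.1 + 1 = b.1 ↔ (σ a).1 + 1 = (σ b).1) ∧ (a.1 + 1 = b.1 → t a = t b)

lemma relv {X : Type} [AddCommGroup X] [Module ℂ X] {n : ℕ} (ψ : AddChar F ℂ) (hψ : ψ ≠ 1)
    (φ : Matrix (Fin n) (Fin n) F → X)
    (h1 : ∀ u M, isU u → φ (u * M) = ψ (sup u) • φ M) (h2 : ∀ u M, isU u → φ (M * u) = ψ (sup u) • φ M)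
    (σ : Equiv.Perm (Fin n)) (t : Fin n → F) (ht : ∀ j, t j ≠ 0) (hne : φ (mono σ t) ≠ 0) : Relv σ t := by
  intro a b hab hσ
  have key : ∀ x : F, ψ (if a.1 + 1 = b.1 then x else 0) =
      ψ (if (σ a).1 + 1 = (σ b).1 then x * (t a / t b) else 0) := by
    intro x
    have := congrArg φ (mono_elem σ t ht a b x)
    rw [h2 _ _ (isU_elem hab x), h1 _ _ (isU_elem hσ _), sup_elem, sup_elem] at this
    exact smul_left_injective ℂ hne this
  have key2 : (if a.1 + 1 = b.1 then (1:F) else 0) = (if (σ a).1 + 1 = (σ b).1 then (t a / t b) else 0) := by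
    by_contra hc
    apply hψ
    have hd := sub_ne_zero.2 hc
    ext y
    set α : F := (if a.1 + 1 = b.1 then (1:F) else 0) with hα
    set β : F := (if (σ a).1 + 1 = (σ b).1 then (t a / t b) else 0) with hβ
    have h3 := key (y / (α - β))
    have e1 : (if a.1 + 1 = b.1 then y / (α - β) else 0) = y / (α - β) * α := by rw [hα]; split_ifs <;> simp
    have e2 : (if (σ a).1 + 1 = (σ b).1 then y / (α - β) * (t a / t b) else 0) = y / (α - β) * β := by
      rw [hβ]; split_ifs <;> simp
    rw [e1, e2] at h3
    have h4 : y = y / (α - β) * α - y / (α - β) * β := by field_simp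
    rw [h4, AddChar.map_sub_eq_div, h3, div_self, AddChar.one_apply]
    exact (ψ.val_isUnit _).ne_zero
  have htt : t a / t b ≠ 0 := div_ne_zero (ht a) (ht b)
  split_ifs at key2 with h3 h4 h4
  · refine ⟨by simp [h3, h4], fun _ => ?_⟩
    rw [eq_div_iff (ht b), one_mul] at key2
    exact key2.symm
  · exact absurd key2 one_ne_zero
  · exact absurd key2.symm htt
  · exact ⟨by simp [h3, h4], fun h => absurd h h3⟩

/-- the anti-involution -/
def tau {n : ℕ} (M : Matrix (Fin n) (Fin n) F) : Matrix (Fin n) (Fin n) F :=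
  Matrix.of fun i j => M j.rev i.rev

lemma tau_apply {n : ℕ} (M : Matrix (Fin n) (Fin n) F) (i j : Fin n) : tau M i j = M j.rev i.rev := rfl

lemma tau_mul {n : ℕ} (M N : Matrix (Fin n) (Fin n) F) : tau (M * N) = tau N * tau M := by
  ext i j
  rw [tau_apply, Matrix.mul_apply, Matrix.mul_apply]
  refine Fintype.sum_equiv Fin.revPerm _ _ fun k => ?_
  simp [tau_apply, mul_comm]

lemma tau_tau {n : ℕ} (M : Matrix (Fin n) (Fin n) F) : tau (tau M) = M := by
  ext i j; simp [tau_apply]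

lemma tau_one {n : ℕ} : tau (1 : Matrix (Fin n) (Fin n) F) = 1 := by
  ext i j
  simp [tau_apply, Matrix.one_apply, eq_comm]

lemma isU_tau {n : ℕ} {u : Matrix (Fin n) (Fin n) F} (hu : isU u) : isU (tau u) :=
  ⟨fun i j h => hu.1 _ _ (Fin.rev_lt_rev.2 h), fun i => hu.2 _⟩

lemma sup_tau {n : ℕ} (u : Matrix (Fin n) (Fin n) F) : sup (tau u) = sup u := by
  rw [sup, sup, Finset.sum_comm]
  refine Fintype.sum_equiv Fin.revPerm _ _ fun j => ?_
  refine Fintype.sum_equiv Fin.revPerm _ _ fun i => ?_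
  simp only [Fin.revPerm_apply, tau_apply, Fin.val_rev]
  congr 1
  simp only [eq_iff_iff]
  omega

lemma mono_chain {n : ℕ} (s : Fin n → ℕ) (t : Fin n → F)
    (h : ∀ a b : Fin n, a.1 + 1 = b.1 → s a ≤ s b ∧ (s a = s b → t a = t b)) :
    ∀ a b : Fin n, a ≤ b → s a ≤ s b ∧ (s a = s b → t a = t b) := by
  have : ∀ m : ℕ, ∀ a b : Fin n, a.1 + m = b.1 → s a ≤ s b ∧ (s a = s b → t a = t b) := by
    intro m
    induction m with
    | zero => intro a b hab; have : a = b := Fin.ext hab; subst this; exact ⟨le_rfl, fun _ => rfl⟩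
    | succ m ih =>
      intro a b hab
      have hb := b.2
      obtain ⟨h1, h2⟩ := ih a ⟨a.1 + m, by omega⟩ rfl
      obtain ⟨h3, h4⟩ := h ⟨a.1 + m, by omega⟩ b (by simp only []; omega)
      refine ⟨h1.trans h3, fun he => ?_⟩
      rw [h2 (by omega), h4 (by omega)]
  intro a b hab
  exact this (b.1 - a.1) a b (by have : a.1 ≤ b.1 := hab; omega)

lemma tau_mono {n : ℕ} (σ : Equiv.Perm (Fin n)) (t : Fin n → F) (h : Relv σ t) : tau (mono σ t) = mono σ t := by
  let θ : Equiv.Perm (Fin n) := σ.trans Fin.revPerm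
  have hθ : ∀ j, (θ j).1 + (σ j).1 + 1 = n := fun j => by
    change ((σ j).rev).1 + (σ j).1 + 1 = n
    rw [Fin.val_rev]; have := (σ j).2; omega
  let s : Fin n → ℕ := fun j => (θ j).1 + j.1
  have hs : ∀ a b : Fin n, a ≤ b → s a ≤ s b ∧ (s a = s b → t a = t b) := by
    apply mono_chain
    intro a b hab
    have h1 := hθ a
    have h2 := hθ b
    have hlt : a < b := by rw [Fin.lt_def]; omega
    have hne : (σ a).1 ≠ (σ b).1 := fun hh => hlt.ne (σ.injective (Fin.ext hh))
    change (θ a).1 + a.1 ≤ (θ b).1 + b.1 ∧ ((θ a).1 + a.1 = (θ b).1 + b.1 → t a = t b)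
    by_cases h3 : σ a < σ b
    · obtain ⟨h4, h5⟩ := h a b hlt h3
      have h6 := h4.1 hab
      exact ⟨by omega, fun _ => h5 hab⟩
    · have : ¬ (σ a).1 < (σ b).1 := h3
      exact ⟨by omega, fun _ => by omega⟩
  have hs' : Monotone (s ∘ θ.symm) := by
    intro a b hab
    refine (mono_chain (s ∘ θ.symm) (fun _ => (0:F)) ?_ a b hab).1
    intro a b hab
    refine ⟨?_, fun _ => rfl⟩
    change (θ (θ.symm a)).1 + (θ.symm a).1 ≤ (θ (θ.symm b)).1 + (θ.symm b).1
    rw [Equiv.apply_symm_apply, Equiv.apply_symm_apply]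
    have h1 := hθ (θ.symm a)
    have h2 := hθ (θ.symm b)
    rw [Equiv.apply_symm_apply] at h1 h2
    by_cases h3 : θ.symm b < θ.symm a
    · obtain ⟨h4, -⟩ := h _ _ h3 (by rw [Fin.lt_def]; omega)
      have := h4.2 (by omega)
      omega
    · have : ¬ (θ.symm b).1 < (θ.symm a).1 := h3
      omega
  have hid : s ∘ (Equiv.refl (Fin n)) = s ∘ θ.symm :=
    Tuple.unique_monotone (fun a b hab => (hs a b hab).1) hs'
  have hinv : ∀ j, θ (θ j) = j := by
    intro j
    have := congrFun hid (θ j)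
    change (θ (θ j)).1 + (θ j).1 = (θ (θ.symm (θ j))).1 + (θ.symm (θ j)).1 at this
    rw [Equiv.symm_apply_apply] at this
    exact Fin.ext (by omega)
  have ht : ∀ j, t (θ j) = t j := by
    intro j
    have he : s (θ j) = s j := by
      change (θ (θ j)).1 + (θ j).1 = (θ j).1 + j.1
      rw [hinv]; omega
    rcases le_total (θ j) j with hle | hle
    · exact (hs _ _ hle).2 he
    · exact ((hs _ _ hle).2 he.symm).symm
  have hr : ∀ i j, i = σ j ↔ i.rev = θ j := by
    intro i j
    change i = σ j ↔ i.rev = (σ j).rev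
    rw [Fin.rev_inj]
  ext i j
  rw [tau_apply, mono, Matrix.of_apply, Matrix.of_apply]
  have e : (j.rev = σ i.rev) ↔ (i = σ j) := by
    rw [hr, hr, Fin.rev_rev]
    constructor
    · intro h; rw [h, hinv]
    · intro h; rw [h, hinv]
  by_cases h3 : i = σ j
  · rw [if_pos h3, if_pos (e.2 h3), (hr _ _).1 h3, ht]
  · rw [if_neg h3, if_neg (fun h => h3 (e.1 h))]

lemma gelfand {X : Type} [AddCommGroup X] [Module ℂ X] {n : ℕ} (ψ : AddChar F ℂ) (hψ : ψ ≠ 1)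
    (φ : Matrix (Fin n) (Fin n) F → X)
    (h1 : ∀ u M, isU u → φ (u * M) = ψ (sup u) • φ M) (h2 : ∀ u M, isU u → φ (M * u) = ψ (sup u) • φ M)
    (M : Matrix (Fin n) (Fin n) F) (hM : M.det ≠ 0) : φ (tau M) = φ M := by
  obtain ⟨u, w, hu, hw, σ, t, ht, he⟩ := bruhat M hM
  have e1 : φ (mono σ t) = (ψ (sup w) * ψ (sup u)) • φ M := by
    rw [← he, h2 _ _ hw, h1 _ _ hu, smul_smul]
  have e2 : φ (tau (mono σ t)) = (ψ (sup w) * ψ (sup u)) • φ (tau M) := by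
    rw [← he, tau_mul, tau_mul, h1 _ _ (isU_tau hw), h2 _ _ (isU_tau hu), smul_smul, sup_tau, sup_tau]
  have hne : ψ (sup w) * ψ (sup u) ≠ 0 :=
    mul_ne_zero (ψ.val_isUnit _).ne_zero (ψ.val_isUnit _).ne_zero
  apply smul_right_injective X hne
  simp only []
  rw [← e1, ← e2]
  by_cases h0 : φ (mono σ t) = 0
  · have h0' : φ (tau (mono σ t)) = 0 := by
      by_contra h3
      -- apply the argument to the composite
      have hr := relv ψ hψ (fun N => φ (tau N))
        (fun u N hu => by simp only [tau_mul]; rw [h2 _ _ (isU_tau hu), sup_tau])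
        (fun u N hu => by simp only [tau_mul]; rw [h1 _ _ (isU_tau hu), sup_tau]) σ t ht h3
      rw [tau_mono σ t hr] at h3
      exact h3 h0
    rw [h0, h0']
  · rw [tau_mono σ t (relv ψ hψ φ h1 h2 σ t ht h0)]
end Bru
end P4e

section P4f
section Gel
variable {F : Type} [Field F] [Fintype F]

/-- tau on GL -/
def tauG {n : ℕ} (g : GL (Fin n) F) : GL (Fin n) F where
  val := tau g.1
  inv := tau g.2
  val_inv := by rw [← tau_mul, g.inv_val, tau_one]
  inv_val := by rw [← tau_mul, g.val_inv, tau_one]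

lemma tauG_val {n : ℕ} (g : GL (Fin n) F) : (tauG g).1 = tau g.1 := rfl

lemma tauG_mul {n : ℕ} (g h : GL (Fin n) F) : tauG (g * h) = tauG h * tauG g :=
  Units.ext (tau_mul _ _)

lemma tauG_tauG {n : ℕ} (g : GL (Fin n) F) : tauG (tauG g) = g := Units.ext (tau_tau _)

/-- tau on U -/
def tauU {n : ℕ} : UG F n ≃ UG F n where
  toFun u := ⟨tauG u.1, isU_tau u.2⟩
  invFun u := ⟨tauG u.1, isU_tau u.2⟩
  left_inv u := Subtype.ext (tauG_tauG _)
  right_inv u := Subtype.ext (tauG_tauG _)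

lemma trace_cube {d : ℕ} (E : Matrix (Fin d) (Fin d) ℂ) (hE : E * E = E)
    (h : ∀ X Y, E * X * E * Y * E = E * Y * E * X * E) : E.trace ^ 3 = E.trace := by
  have key : ∀ i j l, E i i * E j j * E l l = E i j * E l i * E j l := by
    intro i j l
    have := congrFun (congrFun (h (Matrix.single i j 1) (Matrix.single j l 1)) i) l
    have e1 : ∀ (A : Matrix (Fin d) (Fin d) ℂ) (a b c e : Fin d), (A * Matrix.single a b (1:ℂ)) c e = if b = e then A c a else 0 := by
      intro A a b c e
      rw [Matrix.mul_apply, Finset.sum_eq_single a]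
      · simp [Matrix.single_apply]
      · intro x _ hx
        rw [Matrix.single_apply_of_ne, mul_zero]
        rintro ⟨h, -⟩; exact hx h.symm
      · simp
    have e2 : ∀ (A B : Matrix (Fin d) (Fin d) ℂ) (a b c e : Fin d), (A * Matrix.single a b (1:ℂ) * B) c e = A c a * B b e := by
      intro A B a b c e
      rw [Matrix.mul_apply]
      simp only [e1]
      simp
    rw [e2, e2, e2, e2] at this
    exact this
  have h3 : E.trace = (E * E * E).trace := by rw [hE, hE]
  have hR : (E * E * E).trace = ∑ l, ∑ j, ∑ i, E l i * E i j * E j l := by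
    simp only [Matrix.trace, Matrix.diag_apply, Matrix.mul_apply, Finset.sum_mul]
  have hT : E.trace = ∑ l, E l l := rfl
  have hL : E.trace ^ 3 = ∑ l, ∑ j, ∑ i, E i i * E j j * E l l := by
    rw [pow_three', hT, Finset.mul_sum]
    refine Finset.sum_congr rfl fun l _ => ?_
    rw [Finset.mul_sum, Finset.sum_mul]
    refine Finset.sum_congr rfl fun j _ => ?_
    rw [Finset.sum_mul, Finset.sum_mul]
  rw [hL, h3, hR]
  exact Finset.sum_congr rfl fun l _ => Finset.sum_congr rfl fun j _ => Finset.sum_congr rfl fun i _ => by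
    rw [key]; ring

lemma mult_one {n d : ℕ} (ρ : GL (Fin n) F →* Matrix (Fin d) (Fin d) ℂ) (ψ : AddChar F ℂ) (hψ : ψ ≠ 1)
    (hs : ∀ X : Matrix (Fin d) (Fin d) ℂ, X ∈ Submodule.span ℂ (Set.range ρ)) :
    ∃ k : ℕ, k ≤ 1 ∧ av (UG F n) (fun u => ψ (-sup u.1.1) * (ρ u.1).trace) = k := by
  classical
  let σ : UG F n →* Matrix (Fin d) (Fin d) ℂ :=
    { toFun := fun u => ψ (-sup u.1.1) • ρ u.1
      map_one' := by
        have : sup ((1 : UG F n).1.1) = 0 := by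
          have h := sup_mul (isU_one (F := F) (n := n)) (isU_one (F := F) (n := n))
          rw [mul_one] at h
          have h2 := left_eq_add.1 h
          exact h2
        rw [this, neg_zero, AddChar.map_zero_eq_one, one_smul]
        exact map_one ρ
      map_mul' := fun u w => by
        have : sup ((u * w).1.1) = sup u.1.1 + sup w.1.1 := sup_mul u.2 w.2
        rw [this, neg_add, AddChar.map_add_eq_mul, Subgroup.coe_mul, map_mul, smul_mul_smul_comm] }
  have hσ : ∀ u : UG F n, σ u = ψ (-sup u.1.1) • ρ u.1 := fun u => rfl
  obtain ⟨k, hk⟩ := avg_trace_nat σ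
  have hG : (Fintype.card (UG F n) : ℂ) ≠ 0 := IrrData.cardG_ne
  set E : Matrix (Fin d) (Fin d) ℂ := (Fintype.card (UG F n) : ℂ)⁻¹ • ∑ u, σ u with hE
  have htr : E.trace = k := by
    rw [← hk, hE, Matrix.trace_smul, Matrix.trace_sum, smul_eq_mul]
  have hav : av (UG F n) (fun u => ψ (-sup u.1.1) * (ρ u.1).trace) = k := by
    rw [av_eq, ← hk]
    congr 1
    refine Finset.sum_congr rfl fun u _ => ?_
    rw [hσ, Matrix.trace_smul, smul_eq_mul]
  have hl : ∀ u, σ u * E = E := by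
    intro u
    rw [hE, mul_smul_comm, Finset.mul_sum]
    congr 1
    simp only [← map_mul]
    exact Fintype.sum_equiv (Equiv.mulLeft u) _ _ fun x => rfl
  have hr : ∀ u, E * σ u = E := by
    intro u
    rw [hE, smul_mul_assoc, Finset.sum_mul]
    congr 1
    simp only [← map_mul]
    exact Fintype.sum_equiv (Equiv.mulRight u) _ _ fun x => rfl
  have hEE : E * E = E := by
    conv_lhs => enter [1]; rw [hE]
    rw [smul_mul_assoc, Finset.sum_mul, Finset.sum_congr rfl fun u _ => hl u, Finset.sum_const, Finset.card_univ,
      ← Nat.cast_smul_eq_nsmul ℂ, smul_smul, inv_mul_cancel₀ hG, one_smul]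
  have hψi : ∀ x : F, ψ x * ψ (-x) = 1 := fun x => by
    rw [← AddChar.map_add_eq_mul, add_neg_cancel, AddChar.map_zero_eq_one]
  have hl' : ∀ u : UG F n, ρ u.1 * E = ψ (sup u.1.1) • E := by
    intro u
    conv_rhs => rw [← hl u]
    rw [hσ, smul_mul_assoc, smul_smul, hψi, one_smul]
  have hr' : ∀ u : UG F n, E * ρ u.1 = ψ (sup u.1.1) • E := by
    intro u
    conv_rhs => rw [← hr u]
    rw [hσ, mul_smul_comm, smul_smul, hψi, one_smul]
  let pt : Matrix (Fin n) (Fin n) F → Matrix (Fin d) (Fin d) ℂ := fun M =>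
    if h : IsUnit M then ρ h.unit else 0
  have pt1 : ∀ g : GL (Fin n) F, pt g.1 = ρ g := by
    intro g
    have : IsUnit g.1 := g.isUnit
    simp only [pt, dif_pos this]
    congr 1
    exact Units.ext rfl
  have pt2 : ∀ (g : GL (Fin n) F) M, pt (g.1 * M) = ρ g * pt M := by
    intro g M
    by_cases h : IsUnit M
    · obtain ⟨m, rfl⟩ := h
      have : g.1 * m.1 = (g * m).1 := rfl
      rw [this, pt1, pt1, map_mul]
    · have h' : ¬ IsUnit (g.1 * M) := fun h' => h ((Units.isUnit_units_mul g M).1 h')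
      simp only [pt, dif_neg h, dif_neg h', mul_zero]
  have pt3 : ∀ (g : GL (Fin n) F) M, pt (M * g.1) = pt M * ρ g := by
    intro g M
    by_cases h : IsUnit M
    · obtain ⟨m, rfl⟩ := h
      have : m.1 * g.1 = (m * g).1 := rfl
      rw [this, pt1, pt1, map_mul]
    · have h' : ¬ IsUnit (M * g.1) := fun h' => h ((Units.isUnit_mul_units M g).1 h')
      simp only [pt, dif_neg h, dif_neg h', zero_mul]
  have hUG : ∀ u : Matrix (Fin n) (Fin n) F, isU u → ∃ v : UG F n, v.1.1 = u := by
    intro u hu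
    exact ⟨⟨Matrix.nonsingInvUnit u (by rw [isU_det hu]; exact isUnit_one), hu⟩, rfl⟩
  have hφ : ∀ g : GL (Fin n) F, E * ρ (tauG g) * E = E * ρ g * E := by
    intro g
    have := gelfand ψ hψ (fun M => E * pt M * E) ?_ ?_ g.1 ?_
    · simpa only [← tauG_val, pt1] using this
    · intro u M hu
      obtain ⟨v, rfl⟩ := hUG u hu
      simp only [pt2]
      rw [← mul_assoc, hr', smul_mul_assoc, smul_mul_assoc]
    · intro u M hu
      obtain ⟨v, rfl⟩ := hUG u hu
      simp only [pt3]
      rw [← mul_assoc, mul_assoc, hl', mul_smul_comm]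
    · exact ((Matrix.isUnit_iff_isUnit_det g.1).1 g.isUnit).ne_zero
  have hexp : ∀ A B : Matrix (Fin d) (Fin d) ℂ, A * E * B = (Fintype.card (UG F n) : ℂ)⁻¹ • ∑ u : UG F n,
      ψ (-sup u.1.1) • (A * ρ u.1 * B) := by
    intro A B
    rw [hE, mul_smul_comm, smul_mul_assoc, Finset.mul_sum, Finset.sum_mul]
    congr 1
    refine Finset.sum_congr rfl fun u _ => ?_
    rw [hσ, mul_smul_comm, smul_mul_assoc]
  have hcomm : ∀ g h : GL (Fin n) F, E * ρ g * E * ρ h * E = E * ρ h * E * ρ g * E := by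
    have step : ∀ g h : GL (Fin n) F, E * ρ g * E * ρ h * E = E * ρ (tauG h) * E * ρ (tauG g) * E := by
      intro g h
      rw [mul_assoc _ (ρ h) E, mul_assoc _ (ρ (tauG g)) E, hexp, hexp]
      congr 1
      refine Fintype.sum_equiv tauU _ _ fun u => ?_
      have e1 : (tauU u).1 = tauG u.1 := rfl
      rw [e1, tauG_val, sup_tau]
      congr 1
      have e2 : E * ρ (tauG h) * ρ (tauG u.1) * (ρ (tauG g) * E) = E * ρ (tauG (g * u.1 * h)) * E := by
        rw [tauG_mul, tauG_mul, map_mul, map_mul]; noncomm_ring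
      rw [e2, hφ, map_mul, map_mul]
      noncomm_ring
    intro g h
    rw [step]
    have e3 : ∀ A B : Matrix (Fin d) (Fin d) ℂ, E * A * E * B * E = (E * A * E) * (E * B * E) := by
      intro A B
      have : (E * A * E) * (E * B * E) = E * A * (E * E) * B * E := by noncomm_ring
      rw [this, hEE]
    rw [e3, e3, hφ, hφ]
  have hall : ∀ X Y, E * X * E * Y * E = E * Y * E * X * E := by
    intro X Y
    have hX := hs X
    have hY := hs Y
    induction hX using Submodule.span_induction with
    | mem x hx =>
      obtain ⟨g, rfl⟩ := hx
      induction hY using Submodule.span_induction with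
      | mem y hy => obtain ⟨h, rfl⟩ := hy; exact hcomm g h
      | zero => simp
      | add a b _ _ ha hb => simp only [mul_add, add_mul, ha, hb]
      | smul r a _ ha => simp only [mul_smul_comm, smul_mul_assoc, ha]
    | zero => simp
    | add a b _ _ ha hb => simp only [mul_add, add_mul, ha, hb]
    | smul r a _ ha => simp only [mul_smul_comm, smul_mul_assoc, ha]
  have hc := trace_cube E hEE hall
  rw [htr] at hc
  refine ⟨k, ?_, hav⟩
  have hc' : k ^ 3 = k := by exact_mod_cast hc
  by_contra h2
  have h2' : 2 ≤ k := by omega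
  have : k < k ^ 3 := by nlinarith [Nat.mul_le_mul h2' h2', pow_succ k 2]
  omega

lemma cc_nat (ψ : AddChar F ℂ) (hψ : ψ ≠ 1) (b : BB F) : ∃ k : ℕ, k ≤ 1 ∧ cc ψ b = k := by
  rw [cc_UG]
  refine mult_one (((DD F b.n).rep b.i).comp (glEquiv F b.n).toMonoidHom) ψ hψ ?_
  intro X
  obtain ⟨a, ha⟩ := (DD F b.n).surj (Function.update (fun _ => 0) b.i X)
  have := ha b.i
  rw [Function.update_self] at this
  rw [← this]
  refine Submodule.sum_mem _ fun x _ => Submodule.smul_mem _ _ (Submodule.subset_span ⟨(glEquiv F b.n).symm x, ?_⟩)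
  simp
end Gel
end P4f

section P9
section Fin9
variable {F : Type} [Field F] [Fintype F]

/-- normalized dimension -/
noncomputable def dR (b : BB F) : ℝ :=
  dm b * ((Fintype.card (GL' F b.n) : ℝ)⁻¹ * (Fintype.card F : ℝ) ^ (b.n.choose 2))

lemma dR_c (b : BB F) : ((dR b : ℝ) : ℂ) =
    dm b * ((Fintype.card (GL' F b.n) : ℂ)⁻¹ * (Fintype.card F : ℂ) ^ (b.n.choose 2)) := by
  rw [dR]; push_cast; rfl

lemma dR_dl (b : BB F) : ((dR b : ℝ) : ℂ) = dm b * (dl F b.n)⁻¹ := by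
  rw [dR_c, dl_eq]

lemma dR_pos (b : BB F) : 0 < dR b := by
  have h1 : 0 < dm b := (DD F b.n).dpos b.i
  have h2 : 0 < Fintype.card (GL' F b.n) := Fintype.card_pos
  have h3 : 0 < Fintype.card F := Fintype.card_pos
  rw [dR]
  positivity

lemma sum4_rev {κ : Type} (t : Finset κ) (f : κ → κ → κ → κ → ℕ) :
    ∑ i ∈ t, ∑ j ∈ t, ∑ k ∈ t, ∑ l ∈ t, f i j k l = ∑ l ∈ t, ∑ k ∈ t, ∑ j ∈ t, ∑ i ∈ t, f i j k l := by
  have h3 : ∀ h : κ → κ → κ → ℕ, ∑ j ∈ t, ∑ k ∈ t, ∑ l ∈ t, h j k l = ∑ l ∈ t, ∑ k ∈ t, ∑ j ∈ t, h j k l := by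
    intro h
    rw [Finset.sum_congr rfl fun j _ => Finset.sum_comm, Finset.sum_comm]
    exact Finset.sum_congr rfl fun l _ => Finset.sum_comm
  rw [Finset.sum_congr rfl fun i _ => h3 (f i), Finset.sum_comm]
  refine Finset.sum_congr rfl fun l _ => ?_
  rw [Finset.sum_comm]
  refine Finset.sum_congr rfl fun k _ => ?_
  rw [Finset.sum_comm]

/-- the Whittaker multiplicity -/
noncomputable def cn (ψ : AddChar F ℂ) (hψ : ψ ≠ 1) (b : BB F) : ℕ := (cc_nat ψ hψ b).choose

lemma cn_le (ψ : AddChar F ℂ) (hψ : ψ ≠ 1) (b : BB F) : cn ψ hψ b ≤ 1 := (cc_nat ψ hψ b).choose_spec.1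

lemma cn_spec (ψ : AddChar F ℂ) (hψ : ψ ≠ 1) (b : BB F) : cc ψ b = cn ψ hψ b := (cc_nat ψ hψ b).choose_spec.2

open scoped Classical in
/-- the Hopf algebra of the general linear groups -/
noncomputable def pshGL (F : Type) [Field F] [Fintype F] (ψ : AddChar F ℂ) (hψ : ψ ≠ 1) :
    PSH (Fintype.card F : ℝ) Fˣ where
  B := BB F
  deg b := b.n
  lev := lev
  mem_lev := mem_lev
  o := oo
  deg_eq_zero := eq_oo
  N a b c := Nn b a c
  N_deg a b c h := by
    by_contra hn
    apply h
    have := Nc_zero (a := b) (b := a) (c := c) (by omega)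
    rw [← Nn_spec] at this
    exact_mod_cast this
  N_o_left a b := by
    have := Nc_right a b
    rw [← Nn_spec] at this
    split_ifs at this ⊢ <;> exact_mod_cast this
  N_o_right a b := by
    have := Nc_left a b
    rw [← Nn_spec] at this
    split_ifs at this ⊢ <;> exact_mod_cast this
  assoc a b c d D hD := by
    have := assoc_c c b a d hD
    simp only [← Nn_spec, upto] at this
    symm
    exact_mod_cast this
  hopf a b c d D hD := by
    have := hopf_c b a d c (D := D) (by omega)
    simp only [← Nn_spec, upto] at this
    rw [sum4_rev]
    have h2 : ∀ i j k l : BB F, Nn j i a * Nn l k b * (Nn k i c * Nn l j d) =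
      Nn l k b * Nn j i a * (Nn l j d * Nn k i c) := fun i j k l => by ring
    simp only [h2]
    exact_mod_cast this
  delta := dR
  delta_pos := dR_pos
  delta_o := by
    have h1 : Fintype.card (GL' F (oo : BB F).n) = 1 := card_GL0
    have h2 : dm (oo : BB F) = 1 := d_oo
    have h3 : (oo : BB F).n = 0 := rfl
    rw [dR, h1, h2, h3]
    simp
  delta_mul a b D hD := by
    have := dm_mul b a (D := D) (by omega)
    simp only [← dR_c, ← Nn_spec, upto] at this
    rw [mul_comm (dR a)]
    exact_mod_cast this
  c := cn ψ hψ
  c_le := cn_le ψ hψ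
  c_o := by
    have := cn_spec ψ hψ oo
    rw [cc_oo] at this
    exact_mod_cast this.symm
  P5 a D hD := by
    have := P5_c ψ hψ a hD
    simp only [← dR_dl, ← Nn_spec, upto, cn_spec ψ hψ] at this
    exact_mod_cast this
  om := omB
  om_o := omB_oo
  om_mul a b d h z := by
    have h2 : Nc b a d ≠ 0 := by
      rw [← Nn_spec]; exact_mod_cast h
    rw [Nc_om b a d z h2, mul_comm]
  GG_one n hn := by
    have := GG_c ψ n hn (1 : Fˣ)
    simp only [← dR_dl, cn_spec ψ hψ] at this
    rw [if_pos trivial] at this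
    exact this
  GG n hn z hz := by
    have := GG_c ψ n hn z
    simp only [← dR_dl, cn_spec ψ hψ] at this
    rw [if_neg hz] at this
    exact this
  hq := by exact_mod_cast Fintype.one_lt_card

lemma exists_psi (F : Type) [Field F] [Fintype F] : ∃ ψ : AddChar F ℂ, ψ ≠ 1 := by
  have h : (0 : F) ≠ 1 := zero_ne_one
  obtain ⟨ψ, hψ⟩ := AddChar.exists_apply_ne_zero.2 (one_ne_zero (α := F))
  refine ⟨ψ, fun h => hψ ?_⟩
  rw [h]; rfl

lemma count_transport (g n : ℕ) (z : Fˣ) :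
    Nat.card {p : (Fin g → GL (Fin n) F) × (Fin g → GL (Fin n) F) //
        (↑((List.ofFn fun i => p.1 i * p.2 i * (p.1 i)⁻¹ * (p.2 i)⁻¹).prod) :
          Matrix (Fin n) (Fin n) F) = (z : F) • (1 : Matrix (Fin n) (Fin n) F)} =
    Nat.card {p : (Fin g → GL' F n) × (Fin g → GL' F n) //
        (List.ofFn fun i => p.1 i * p.2 i * (p.1 i)⁻¹ * (p.2 i)⁻¹).prod = scal F n z} := by
  let e : (Fin g → GL (Fin n) F) ≃ (Fin g → GL' F n) := Equiv.piCongrRight fun _ => (glEquiv F n).toEquiv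
  refine Nat.card_congr (Equiv.subtypeEquiv (Equiv.prodCongr e e) fun p => ?_)
  have h1 : (List.ofFn fun i => (Equiv.prodCongr e e p).1 i * (Equiv.prodCongr e e p).2 i *
      ((Equiv.prodCongr e e p).1 i)⁻¹ * ((Equiv.prodCongr e e p).2 i)⁻¹).prod =
      glEquiv F n (List.ofFn fun i => p.1 i * p.2 i * (p.1 i)⁻¹ * (p.2 i)⁻¹).prod := by
    rw [map_list_prod, List.map_ofFn]
    congr 2
    funext i
    change glEquiv F n (p.1 i) * glEquiv F n (p.2 i) * (glEquiv F n (p.1 i))⁻¹ * (glEquiv F n (p.2 i))⁻¹ = _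
    simp
  rw [h1]
  have h2 : (scal F n z).1 = Matrix.toLin' ((z : F) • (1 : Matrix (Fin n) (Fin n) F)) := by
    rw [map_smul, Matrix.toLin'_one]
    rfl
  rw [Units.ext_iff, glEquiv_val, h2]
  exact (Matrix.toLin'.injective.eq_iff).symm

lemma main_c (g n : ℕ) (hn : 1 ≤ n) (z : Fˣ) (hz : orderOf z = n) :
    (Nat.card {p : (Fin g → GL' F n) × (Fin g → GL' F n) //
        (List.ofFn fun i => p.1 i * p.2 i * (p.1 i)⁻¹ * (p.2 i)⁻¹).prod = scal F n z} : ℂ) =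
    ((Fintype.card F : ℂ) - 1) * (Fintype.card (GL' F n) : ℂ)
          * (Fintype.card F : ℂ) ^ (((g : ℤ) - 1) * (n : ℤ) ^ 2)
          * (1 / (n : ℂ))
          * ∑ d ∈ n.divisors,
              ((ArithmeticFunction.moebius d : ℤ) : ℂ)
                * ((Upoly g (n / d) ((Fintype.card F : ℝ) ^ d) : ℝ) : ℂ) := by
  obtain ⟨ψ, hψ⟩ := exists_psi F
  have hm := PSH.main_sum (P := pshGL F ψ hψ) g (z := z⁻¹) (n := n) (by rw [orderOf_inv, hz]) hn
  have hq : (Fintype.card F : ℂ) ≠ 0 := by exact_mod_cast Fintype.card_ne_zero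
  have hG : (Fintype.card (GL' F n) : ℂ) ≠ 0 := IrrData.cardG_ne
  rw [(DD F n).frobenius g (scal F n z)]
  have e1 : ∑ i, ((Fintype.card (GL' F n) : ℂ) / ((DD F n).d i : ℂ)) ^ (2 * (g : ℤ) - 2) *
      (DD F n).omega i (scal F n z)⁻¹ = (Fintype.card F : ℂ) ^ (((n.choose 2 : ℕ) : ℤ) * (2 * (g : ℤ) - 2)) *
        ∑ b ∈ (lev n : Finset (BB F)), omB b z⁻¹ * ((dR b : ℝ) : ℂ) ^ (-(2 * (g : ℤ) - 2)) := by
    rw [sum_lev, Finset.mul_sum]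
    refine Finset.sum_congr rfl fun i _ => ?_
    have h1 : omB (⟨n, i⟩ : BB F) z⁻¹ = (DD F n).omega i (scal F n z)⁻¹ := by
      rw [← map_inv]; rfl
    have h2 : ((dR (⟨n, i⟩ : BB F) : ℝ) : ℂ) = (DD F n).d i * ((Fintype.card (GL' F n) : ℂ)⁻¹ *
      (Fintype.card F : ℂ) ^ (n.choose 2)) := dR_c _
    have hd : ((DD F n).d i : ℂ) ≠ 0 := by exact_mod_cast ((DD F n).dpos i).ne'
    rw [h1, h2, zpow_neg, ← inv_zpow, zpow_mul, zpow_natCast, mul_left_comm, ← mul_zpow, mul_comm]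
    congr 2
    field_simp
  rw [e1]
  have hm' : ∑ b ∈ (lev n : Finset (BB F)), omB b z⁻¹ * ((dR b : ℝ) : ℂ) ^ (-(2 * (g : ℤ) - 2)) = _ := hm
  rw [hm']
  have hch : (((n.choose 2 : ℕ) : ℤ)) * 2 = (n : ℤ) * ((n : ℤ) - 1) := by
    have := Nat.choose_two_right n
    have h2 : n.choose 2 * 2 = n * (n - 1) := by
      rw [this]; exact Nat.div_mul_cancel (Nat.even_mul_pred_self n).two_dvd
    zify [hn] at h2
    exact h2
  have hexp : ((g : ℤ) - 1) * (n : ℤ) ^ 2 = ((n.choose 2 : ℕ) : ℤ) * (2 * (g : ℤ) - 2) + ((g : ℤ) - 1) * n := by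
    linear_combination (-((g : ℤ) - 1)) * hch
  rw [hexp, zpow_add₀ hq]
  push_cast
  ring
end Fin9
end P9

/-- For every finite field `F_q` and `ζ ∈ F_q^×` of multiplicative
order exactly `n`, the number `N_n(q)` of `2g`-tuples in `GL(n,F_q)^{2g}` with
`[A₁,B₁]⋯[A_g,B_g] = ζ·Iₙ` satisfies
`N_n(q) = (q−1)·|GL(n,F_q)|·q^{(g−1)n²}·(1/n)·Σ_{d∣n} μ(d)·U_{n/d}(q^d)`. -/
theorem statement11 (g n : ℕ) (hn : 1 ≤ n) (F : Type) [Field F] [Fintype F]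
    (ζ : F) (hζ : orderOf ζ = n) :
    (Nat.card {p : (Fin g → GL (Fin n) F) × (Fin g → GL (Fin n) F) //
        (↑((List.ofFn fun i => p.1 i * p.2 i * (p.1 i)⁻¹ * (p.2 i)⁻¹).prod) :
          Matrix (Fin n) (Fin n) F) = ζ • (1 : Matrix (Fin n) (Fin n) F)} : ℝ)
      = ((Fintype.card F : ℝ) - 1) * (Nat.card (GL (Fin n) F) : ℝ)
          * (Fintype.card F : ℝ) ^ (((g : ℤ) - 1) * (n : ℤ) ^ 2)
          * (1 / (n : ℝ))
          * ∑ d ∈ n.divisors,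
              ((ArithmeticFunction.moebius d : ℤ) : ℝ)
                * Upoly g (n / d) ((Fintype.card F : ℝ) ^ d) := by
  have hF : Finite F := inferInstance
  have hζ0 : ζ ≠ 0 := by
    rintro rfl
    have h1 := pow_orderOf_eq_one (0 : F)
    rw [hζ, zero_pow (by omega)] at h1
    exact zero_ne_one h1
  have hz : orderOf (Units.mk0 ζ hζ0) = n := by
    rw [← orderOf_units]; exact hζ
  have h1 := count_transport (F := F) g n (Units.mk0 ζ hζ0)
  rw [Units.val_mk0] at h1
  rw [h1]
  have h2 := main_c g n hn (Units.mk0 ζ hζ0) hz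
  have h3 : Nat.card (GL (Fin n) F) = Fintype.card (GL' F n) := by
    rw [← Nat.card_eq_fintype_card]
    exact Nat.card_congr (glEquiv F n).toEquiv
  rw [h3]
  apply Complex.ofReal_injective
  rw [Complex.ofReal_natCast, h2]
  simp only [Complex.ofReal_mul, Complex.ofReal_sub, Complex.ofReal_one, Complex.ofReal_natCast,
    Complex.ofReal_zpow, Complex.ofReal_div, Complex.ofReal_sum, Complex.ofReal_intCast]

end Statement11
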